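/- Let (a_n)_{n≥1} be a sequence of rational numbers and suppose that f(t) = ∑_{n≥1} a_n t^{n-1} ∈ ℚ[[t]] is algebraic over ℚ(t). Then the following three assertions are equivalent: (a) every power series y ∈ ℚ[[t]] satisfying y'(t) = f(t)·y(t) is algebraic over ℚ(t); (b) for all but finitely many primes p, a_{np} − a_n ∈ p ℤ_(p) for all n ≥ 1; (c) for all but finitely many primes p, a_{np} − a_n ∈ n p ℤ_(p) for all n ≥ 1 (the Gauss property). -/

import Mathlib

open PowerSeries

/-- A formal power series `g ∈ ℚ[[t]]` is algebraic over `ℚ(t)` if there exists a nonzero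
polynomial `P ∈ ℚ[x][y]` with `P(t, g(t)) = 0`. -/
def IsAlgebraicPS (g : PowerSeries ℚ) : Prop :=
  ∃ P : Polynomial (Polynomial ℚ), P ≠ 0 ∧
    Polynomial.eval₂ Polynomial.coeToPowerSeries.ringHom g P = 0

/-- `x ∈ ℤ_(p)`, the localization of `ℤ` at the prime `(p)`: the (reduced) denominator of the
rational number `x` is not divisible by `p`. -/
def MemZp (p : ℕ) (x : ℚ) : Prop := ¬ p ∣ x.den

/-- `x ∈ p ℤ_(p)`. -/
def MemPZp (p : ℕ) (x : ℚ) : Prop := ∃ y : ℚ, MemZp p y ∧ x = p * y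

/-- `x ∈ n p ℤ_(p)`. -/
def MemNPZp (n p : ℕ) (x : ℚ) : Prop := ∃ y : ℚ, MemZp p y ∧ x = n * p * y

section Dwork

variable {p : ℕ} [Fact p.Prime]

theorem PadicInt.natCast_dvd_prime_pow {k : ℕ} (hk : 1 ≤ k) :
    (k : ℤ_[p]) ∣ (p : ℤ_[p]) ^ (k - 1) := by
  have hp : p.Prime := Fact.out
  obtain ⟨v, k', hk', rfl⟩ := Nat.exists_eq_pow_mul_and_not_dvd (by omega : k ≠ 0) p hp.ne_one
  have hu : IsUnit ((k' : ℕ) : ℤ_[p]) := by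
    rw [PadicInt.isUnit_iff, PadicInt.norm_def]
    push_cast
    rw [Padic.norm_natCast_eq_one_iff]
    exact (Nat.Prime.coprime_iff_not_dvd hp).2 hk'
  have hv : v ≤ p ^ v * k' - 1 := by
    have h1 : v < p ^ v := Nat.lt_pow_self hp.one_lt
    have h2 : 0 < k' := Nat.pos_of_ne_zero (by rintro rfl; simp at hk')
    have h3 : p ^ v ≤ p ^ v * k' := Nat.le_mul_of_pos_right _ h2
    omega
  push_cast
  exact (hu.mul_right_dvd).2 (pow_dvd_pow _ hv)

theorem PadicInt.toZMod_eq_zero_iff (x : ℤ_[p]) : PadicInt.toZMod x = 0 ↔ (p : ℤ_[p]) ∣ x := by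
  rw [← RingHom.mem_ker, PadicInt.ker_toZMod, PadicInt.maximalIdeal_eq_span_p,
    Ideal.mem_span_singleton]

theorem PowerSeries.exists_eq_C_mul_of_dvd_coeff {R : Type*} [CommRing R] {c : R} {F : R⟦X⟧}
    (h : ∀ n, c ∣ coeff n F) : ∃ V : R⟦X⟧, F = C c * V := by
  choose g hg using h
  exact ⟨mk g, by ext n; simp [hg]⟩

theorem PowerSeries.map_toZMod_eq_zero_iff (F : ℤ_[p]⟦X⟧) :
    PowerSeries.map PadicInt.toZMod F = 0 ↔ ∃ V : ℤ_[p]⟦X⟧, F = C (p : ℤ_[p]) * V := by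
  constructor
  · intro h
    refine exists_eq_C_mul_of_dvd_coeff fun n => ?_
    rw [← PadicInt.toZMod_eq_zero_iff, ← PowerSeries.coeff_map, h, map_zero]
  · rintro ⟨V, rfl⟩
    rw [map_mul, map_C, map_natCast, CharP.cast_eq_zero, map_zero, zero_mul]

theorem PowerSeries.pow_prime_eq_expand_add (Y : ℤ_[p]⟦X⟧) :
    ∃ V : ℤ_[p]⟦X⟧, Y ^ p = expand p (Fact.out : p.Prime).ne_zero Y + C (p : ℤ_[p]) * V := by
  have h : PowerSeries.map PadicInt.toZMod
      (Y ^ p - expand p (Fact.out : p.Prime).ne_zero Y) = 0 := by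
    rw [map_sub, map_pow, map_expand, sub_eq_zero]
    have h2 := MvPowerSeries.map_frobenius_expand (p := p) (hp := (Fact.out : p.Prime).ne_zero)
      (f := (PowerSeries.map PadicInt.toZMod Y : (ZMod p)⟦X⟧))
    rw [ZMod.frobenius_zmod, MvPowerSeries.map_id] at h2
    exact h2.symm
  obtain ⟨V, hV⟩ := (map_toZMod_eq_zero_iff _).1 h
  exact ⟨V, by rw [← hV]; ring⟩

theorem PowerSeries.X_mul_derivative_expand {R : Type*} [CommRing R] (p : ℕ) (hp : p ≠ 0)
    (Y : R⟦X⟧) : X * derivative R (expand p hp Y) =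
      C (p : R) * expand p hp (X * derivative R Y) := by
  have key : ∀ (Z : R⟦X⟧) (n : ℕ), coeff n (X * derivative R Z) = n * coeff n Z := by
    intro Z n
    cases n with
    | zero => simp
    | succ n => rw [coeff_succ_X_mul, coeff_derivative]; push_cast; ring
  ext n
  rw [key, coeff_C_mul]
  by_cases h : p ∣ n
  · obtain ⟨m, rfl⟩ := h
    rw [coeff_expand_mul, coeff_expand_mul, key]
    push_cast; ring
  · rw [coeff_expand_of_not_dvd _ _ _ h, coeff_expand_of_not_dvd _ _ _ h]; simp

/-- **Dwork's lemma** for logarithmic derivatives. -/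
theorem PadicInt.dvd_coeff_sub_of_logDeriv {Y F : ℤ_[p]⟦X⟧} (h0 : constantCoeff Y = 1)
    (h : X * derivative ℤ_[p] Y = F * Y) (n : ℕ) :
    ((n * p : ℕ) : ℤ_[p]) ∣ coeff (n * p) F - coeff n F := by
  have hp : p.Prime := Fact.out
  have hpz : (p : ℤ_[p]) ≠ 0 := by exact_mod_cast hp.ne_zero
  obtain ⟨V₀, hV₀⟩ := pow_prime_eq_expand_add Y
  set E := expand p hp.ne_zero Y with hE
  have hE0 : constantCoeff E = 1 := by rw [hE, constantCoeff_expand, h0]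
  obtain ⟨W, hW⟩ : ∃ W, E * W = 1 :=
    IsUnit.exists_right_inv (by rw [isUnit_iff_constantCoeff, hE0]; exact isUnit_one)
  have hV0c : constantCoeff V₀ = 0 := by
    have := congrArg constantCoeff hV₀
    simp only [map_pow, map_add, map_mul, h0, hE0, one_pow, constantCoeff_C] at this
    have h2 : (p : ℤ_[p]) * constantCoeff V₀ = 0 := by linear_combination -this
    exact (mul_eq_zero.1 h2).resolve_left hpz
  set V := V₀ * W with hV
  have hVc : constantCoeff V = 0 := by simp [hV, hV0c]
  have hCp : (C (p : ℤ_[p]) : ℤ_[p]⟦X⟧) ≠ 0 := by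
    rw [Ne, ← map_zero (C (R := ℤ_[p])), C_injective.eq_iff]; exact hpz
  have hE1 : E ≠ 0 := by
    intro h; rw [h] at hE0; simp at hE0
  set Fs := expand p hp.ne_zero F with hFs
  have hEd : X * derivative ℤ_[p] E = C (p : ℤ_[p]) * Fs * E := by
    rw [hE, X_mul_derivative_expand, h, map_mul]; ring
  have hCn : ∀ m : ℕ, (C (m : ℤ_[p]) : ℤ_[p]⟦X⟧) = (m : ℤ_[p]⟦X⟧) := fun m => by simp
  have hYp : Y ^ p = E * (1 + C (p : ℤ_[p]) * V) := by
    rw [hV₀, hV]; linear_combination (-(C (p : ℤ_[p]) * V₀)) * hW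
  have hYd : X * derivative ℤ_[p] (Y ^ p) = C (p : ℤ_[p]) * F * Y ^ p := by
    rw [derivative_pow, hCn]
    have : Y ^ p = Y ^ (p - 1) * Y := by rw [← pow_succ, Nat.sub_add_cancel hp.one_le]
    rw [this]; linear_combination (p * Y ^ (p - 1)) * h
  have hVd : X * derivative ℤ_[p] V = (F - Fs) * (1 + C (p : ℤ_[p]) * V) := by
    rw [hYp] at hYd
    simp only [Derivation.leibniz, map_add, smul_eq_mul, derivative_C, derivative_one] at hYd
    apply mul_left_cancel₀ (mul_ne_zero hCp hE1)
    linear_combination hYd - (1 + C (p : ℤ_[p]) * V) * hEd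
  choose! c hc using fun (k : ℕ) (hk : 1 ≤ k) => PadicInt.natCast_dvd_prime_pow (p := p) hk
  set K := n * p + 1 with hK
  set L : ℤ_[p]⟦X⟧ := ∑ k ∈ Finset.range K, (-1) ^ k * C (c (k + 1)) * V ^ (k + 1) with hL
  have hLd : X * derivative ℤ_[p] L =
      X * derivative ℤ_[p] V * ∑ k ∈ Finset.range K, (-(C (p : ℤ_[p]) * V)) ^ k := by
    rw [hL, map_sum, Finset.mul_sum, Finset.mul_sum]
    refine Finset.sum_congr rfl fun k _ => ?_
    have e1 : ((-1 : ℤ_[p]⟦X⟧) ^ k) = C ((-1) ^ k) := by simp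
    have h1 := hc (k + 1) (by omega)
    rw [Nat.add_sub_cancel] at h1
    have h3 : (C (p : ℤ_[p]) : ℤ_[p]⟦X⟧) ^ k = ((k + 1 : ℕ) : ℤ_[p]⟦X⟧) * C (c (k + 1)) := by
      rw [← map_pow, h1, map_mul, hCn]
    have h4 : (-(C (p : ℤ_[p]) * V)) ^ k =
        C ((-1) ^ k) * (((k + 1 : ℕ) : ℤ_[p]⟦X⟧) * C (c (k + 1)) * V ^ k) := by
      rw [neg_pow, mul_pow, h3, e1]
    rw [h4, e1, Derivation.leibniz, Derivation.leibniz, derivative_C, derivative_C, derivative_pow]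
    simp only [smul_eq_mul, Nat.add_sub_cancel]
    ring
  have hgeom : (1 + C (p : ℤ_[p]) * V) * ∑ k ∈ Finset.range K, (-(C (p : ℤ_[p]) * V)) ^ k =
      1 - (-(C (p : ℤ_[p]) * V)) ^ K := by
    rw [← mul_neg_geom_sum]; ring
  have hfin : X * derivative ℤ_[p] L = (F - Fs) * (1 - (-(C (p : ℤ_[p]) * V)) ^ K) := by
    rw [hLd, hVd, mul_assoc, hgeom]
  obtain ⟨U, hU⟩ : X ∣ V := X_dvd_iff.2 hVc
  have hXK : (-(C (p : ℤ_[p]) * V)) ^ K = X ^ K * (-(C (p : ℤ_[p]) * U)) ^ K := by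
    rw [hU, ← mul_pow]; congr 1; ring
  have hco := congrArg (coeff (n * p)) hfin
  have key : coeff (n * p) (X * derivative ℤ_[p] L) = ((n * p : ℕ) : ℤ_[p]) * coeff (n * p) L := by
    rcases Nat.eq_zero_or_pos (n * p) with h | h
    · rw [h]; simp
    · obtain ⟨m, hm⟩ := Nat.exists_eq_succ_of_ne_zero h.ne'
      rw [hm, Nat.succ_eq_add_one, coeff_succ_X_mul, coeff_derivative]; push_cast; ring
  have h2 : (F - Fs) * (1 - (-(C (p : ℤ_[p]) * V)) ^ K) =
      (F - Fs) - X ^ K * ((F - Fs) * (-(C (p : ℤ_[p]) * U)) ^ K) := by rw [hXK]; ring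
  rw [key, h2, map_sub, coeff_X_pow_mul', if_neg (by omega), sub_zero, map_sub, hFs,
    mul_comm n p, coeff_expand_mul] at hco
  rw [mul_comm n p]
  exact ⟨_, hco.symm⟩

end Dwork

section Curvature

/-- The rank one connection `h ↦ h' + f h` on power series. -/
noncomputable def PowerSeries.conn {R : Type*} [CommRing R] (f h : R⟦X⟧) : R⟦X⟧ :=
  derivative R h + f * h

theorem PowerSeries.map_conn {R S : Type*} [CommRing R] [CommRing S] (φ : R →+* S) (f h : R⟦X⟧) :
    PowerSeries.map φ (conn f h) = conn (PowerSeries.map φ f) (PowerSeries.map φ h) := by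
  simp only [conn, map_add, map_mul]
  congr 1
  ext n
  simp [coeff_derivative]

theorem PowerSeries.map_conn_iterate {R S : Type*} [CommRing R] [CommRing S] (φ : R →+* S)
    (f h : R⟦X⟧) (m : ℕ) : PowerSeries.map φ ((conn f)^[m] h) =
      (conn (PowerSeries.map φ f))^[m] (PowerSeries.map φ h) := by
  induction m with
  | zero => rfl
  | succ m ih => rw [Function.iterate_succ_apply', Function.iterate_succ_apply', map_conn, ih]

theorem PowerSeries.conn_iterate_C_mul {R : Type*} [CommRing R] (f h : R⟦X⟧) (c : R) (m : ℕ) :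
    (conn f)^[m] (C c * h) = C c * (conn f)^[m] h := by
  induction m with
  | zero => rfl
  | succ m ih =>
    rw [Function.iterate_succ_apply', Function.iterate_succ_apply', ih]
    simp only [conn, Derivation.leibniz, derivative_C, smul_eq_mul]
    ring

theorem PowerSeries.X_pow_dvd_derivative {R : Type*} [CommRing R] {n : ℕ} {g : R⟦X⟧}
    (h : X ^ (n + 1) ∣ g) : X ^ n ∣ derivative R g := by
  rw [X_pow_dvd_iff] at h ⊢
  intro m hm
  rw [coeff_derivative, h (m + 1) (by omega), zero_mul]

theorem PowerSeries.conn_iterate_mul_sub {R : Type*} [CommRing R] {f u : R⟦X⟧} {K : ℕ}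
    (hu : X ^ K ∣ derivative R u - f * u) (h : R⟦X⟧) (m : ℕ) (hm : m ≤ K) :
    X ^ (K - m) ∣ (derivative R)^[m] (h * u) - (conn f)^[m] h * u := by
  induction m with
  | zero => simp
  | succ m ih =>
    have h1 := ih (by omega)
    rw [show K - m = (K - (m + 1)) + 1 by omega] at h1
    have h2 := X_pow_dvd_derivative h1
    rw [Function.iterate_succ_apply', Function.iterate_succ_apply']
    have h3 : X ^ (K - (m + 1)) ∣ (conn f)^[m] h * (derivative R u - f * u) :=
      Dvd.dvd.mul_left ((pow_dvd_pow _ (by omega)).trans hu) _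
    have := dvd_add h2 h3
    convert this using 1
    simp only [conn, map_sub, Derivation.leibniz, smul_eq_mul]
    ring

variable {p : ℕ} [Fact p.Prime]

theorem PowerSeries.iterate_derivative_prime (h : (ZMod p)⟦X⟧) :
    (derivative (ZMod p))^[p] h = 0 := by
  ext n
  rw [coeff_iterate_derivative, map_zero]
  have : ((n + 1).ascFactorial p : ZMod p) = 0 := by
    rw [ZMod.natCast_eq_zero_iff]
    exact (Nat.dvd_factorial (Fact.out : p.Prime).pos le_rfl).trans (Nat.factorial_dvd_ascFactorial
      _ _)
  simp [this]

/-- Approximate solutions modulo `p` of `θ u = F u` under the supercongruence modulo `p`. -/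
theorem PadicInt.exists_approx_solution {F : ℤ_[p]⟦X⟧} (hF0 : constantCoeff F = 0)
    (hF : ∀ n, 1 ≤ n → (p : ℤ_[p]) ∣ coeff (n * p) F - coeff n F) (K : ℕ) :
    ∃ u : ℤ_[p]⟦X⟧, constantCoeff u = 1 ∧
      X ^ (K + 1) ∣ PowerSeries.map PadicInt.toZMod (X * derivative ℤ_[p] u - F * u) := by
  have hp : p.Prime := Fact.out
  induction K with
  | zero =>
    refine ⟨1, by simp, ?_⟩
    rw [zero_add, pow_one, X_dvd_iff, ← coeff_zero_eq_constantCoeff_apply, coeff_map,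
      coeff_zero_eq_constantCoeff_apply]
    simp [hF0]
  | succ K ih =>
    obtain ⟨u, hu0, hu⟩ := ih
    set r := coeff (K + 1) (X * derivative ℤ_[p] u - F * u) with hr
    have step : ∀ s : ℤ_[p], PadicInt.toZMod (r + ((K : ℤ_[p]) + 1) * s) = 0 →
        ∃ u : ℤ_[p]⟦X⟧, constantCoeff u = 1 ∧ X ^ (K + 1 + 1) ∣
          PowerSeries.map PadicInt.toZMod (X * derivative ℤ_[p] u - F * u) := by
      intro s hs
      refine ⟨u + C s * X ^ (K + 1), by simp [hu0], ?_⟩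
      obtain ⟨F', hF'⟩ := X_dvd_iff.2 hF0
      have e : X * derivative ℤ_[p] (u + C s * X ^ (K + 1)) - F * (u + C s * X ^ (K + 1)) =
          (X * derivative ℤ_[p] u - F * u) + (C (((K : ℤ_[p]) + 1) * s) * X ^ (K + 1)
            - X ^ (K + 2) * (F' * C s)) := by
        rw [map_add, Derivation.leibniz, derivative_C, derivative_pow, derivative_X, hF']
        simp only [smul_eq_mul, Nat.add_sub_cancel, map_mul, map_add, map_one, map_natCast]
        push_cast
        ring
      rw [e, X_pow_dvd_iff]
      rw [X_pow_dvd_iff] at hu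
      intro m hm
      rw [coeff_map, map_add, map_sub (coeff m) (C _ * _), coeff_C_mul, coeff_X_pow,
        coeff_X_pow_mul', if_neg (show ¬ K + 2 ≤ m by omega), sub_zero]
      rcases Nat.lt_succ_iff_lt_or_eq.1 hm with hm | rfl
      · rw [if_neg (by omega), mul_zero, add_zero, ← coeff_map]
        exact hu m hm
      · rw [if_pos rfl, mul_one]
        exact hs
    by_cases hK : p ∣ K + 1
    · refine step 0 ?_
      rw [mul_zero, add_zero]
      obtain ⟨n, hn⟩ := hK
      have hn1 : 1 ≤ n := Nat.pos_of_ne_zero (by rintro rfl; simp at hn)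
      obtain ⟨W, hW⟩ : ∃ W, u * W = 1 :=
        IsUnit.exists_right_inv (by rw [isUnit_iff_constantCoeff, hu0]; exact isUnit_one)
      have hW0 : constantCoeff W = 1 := by
        have := congrArg constantCoeff hW
        rwa [map_mul, hu0, one_mul, map_one] at this
      set Fu := X * derivative ℤ_[p] u * W with hFu
      have hD := PadicInt.dvd_coeff_sub_of_logDeriv (Y := u) (F := Fu) hu0
        (by rw [hFu]; linear_combination (-(X * derivative ℤ_[p] u)) * hW) n
      have hD' : (p : ℤ_[p]) ∣ coeff (n * p) Fu - coeff n Fu :=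
        (by push_cast; exact Dvd.intro_left _ rfl : (p : ℤ_[p]) ∣ ((n * p : ℕ) : ℤ_[p])).trans hD
      have hdiff : Fu - F = (X * derivative ℤ_[p] u - F * u) * W := by
        rw [hFu]; linear_combination (F) * hW
      obtain ⟨E, hE⟩ := hu
      have hmd : PowerSeries.map PadicInt.toZMod (Fu - F) =
          X ^ (K + 1) * (E * PowerSeries.map PadicInt.toZMod W) := by
        rw [hdiff, map_mul, hE]; ring
      have hr1 : PadicInt.toZMod r = constantCoeff E := by
        rw [hr, ← coeff_map, hE, coeff_X_pow_mul', if_pos le_rfl, Nat.sub_self,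
          coeff_zero_eq_constantCoeff_apply]
      have hr2 : PadicInt.toZMod (coeff (K + 1) (Fu - F)) = constantCoeff E := by
        rw [← coeff_map, hmd, coeff_X_pow_mul', if_pos le_rfl, Nat.sub_self,
          coeff_zero_eq_constantCoeff_apply, map_mul]
        have : constantCoeff (PowerSeries.map PadicInt.toZMod W : (ZMod p)⟦X⟧) = 1 := by
          rw [← coeff_zero_eq_constantCoeff_apply, coeff_map, coeff_zero_eq_constantCoeff_apply,
            hW0, map_one]
        rw [this, mul_one]
      have hr3 : PadicInt.toZMod (coeff n (Fu - F)) = 0 := by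
        rw [← coeff_map, hmd, coeff_X_pow_mul', if_neg]
        have : 2 * n ≤ p * n := Nat.mul_le_mul_right _ hp.two_le
        omega
      have h4 := (PadicInt.toZMod_eq_zero_iff _).2 hD'
      have h5 := (PadicInt.toZMod_eq_zero_iff _).2 (hF n hn1)
      rw [mul_comm n p, ← hn, map_sub, sub_eq_zero] at h4 h5
      rw [map_sub, map_sub, sub_eq_zero] at hr3
      rw [hr1, ← hr2, map_sub, map_sub, h4, h5, hr3, sub_self]
    · have hu2 : IsUnit (((K + 1 : ℕ)) : ℤ_[p]) := by
        rw [PadicInt.isUnit_iff, PadicInt.norm_def]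
        push_cast
        have := (Padic.norm_natCast_eq_one_iff (p := p) (n := K + 1)).2
          ((Nat.Prime.coprime_iff_not_dvd hp).2 hK)
        exact_mod_cast this
      obtain ⟨v, hv⟩ := hu2.exists_right_inv
      refine step (-(v * r)) ?_
      push_cast at hv
      have : r + ((K : ℤ_[p]) + 1) * -(v * r) = 0 := by linear_combination (-r) * hv
      rw [this, map_zero]

/-- Vanishing of the `p`-curvature. -/
theorem PadicInt.conn_iterate_prime_dvd {f : ℤ_[p]⟦X⟧}
    (hf : ∀ n, 1 ≤ n → (p : ℤ_[p]) ∣ coeff (n * p) (X * f) - coeff n (X * f)) (h : ℤ_[p]⟦X⟧) :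
    ∃ V, (conn f)^[p] h = C (p : ℤ_[p]) * V := by
  rw [← map_toZMod_eq_zero_iff, map_conn_iterate]
  set fb := PowerSeries.map PadicInt.toZMod f with hfb
  set hb := PowerSeries.map PadicInt.toZMod h with hhb
  ext n
  obtain ⟨u, hu0, hu⟩ := PadicInt.exists_approx_solution (F := X * f) (by simp) hf (p + n + 1)
  set ub := PowerSeries.map PadicInt.toZMod u with hub
  have hu1 : X ^ (p + n + 1) ∣ derivative (ZMod p) ub - fb * ub := by
    have e : PowerSeries.map PadicInt.toZMod (X * derivative ℤ_[p] u - X * f * u) =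
        X * (derivative (ZMod p) ub - fb * ub) := by
      have : PowerSeries.map PadicInt.toZMod (derivative ℤ_[p] u) = derivative (ZMod p) ub := by
        ext n; simp [hub, coeff_derivative]
      rw [map_sub, map_mul, map_mul, map_mul, this, map_X]; ring
    rw [e, pow_succ', mul_dvd_mul_iff_left X_ne_zero] at hu
    exact hu
  have h1 := conn_iterate_mul_sub hu1 hb p (by omega)
  rw [iterate_derivative_prime, zero_sub, dvd_neg] at h1
  have hunit : IsUnit ub := by
    rw [isUnit_iff_constantCoeff, ← coeff_zero_eq_constantCoeff_apply, hub, coeff_map,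
      coeff_zero_eq_constantCoeff_apply, hu0, map_one]
    exact isUnit_one
  rw [hunit.dvd_mul_right, X_pow_dvd_iff] at h1
  rw [h1 n (by omega), map_zero]

theorem PadicInt.conn_iterate_dvd {f : ℤ_[p]⟦X⟧}
    (hf : ∀ n, 1 ≤ n → (p : ℤ_[p]) ∣ coeff (n * p) (X * f) - coeff n (X * f)) (m : ℕ) :
    ∃ V, (conn f)^[m] 1 = C ((p : ℤ_[p]) ^ (m / p)) * V := by
  have aux : ∀ (k : ℕ) (h : ℤ_[p]⟦X⟧), ∃ V, (conn f)^[p * k] h = C ((p : ℤ_[p]) ^ k) * V := by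
    intro k
    induction k with
    | zero => intro h; exact ⟨h, by simp⟩
    | succ k ih =>
      intro h
      obtain ⟨V, hV⟩ := PadicInt.conn_iterate_prime_dvd hf h
      obtain ⟨U, hU⟩ := ih V
      refine ⟨U, ?_⟩
      rw [mul_add, mul_one, Function.iterate_add_apply, hV, conn_iterate_C_mul, hU,
        ← mul_assoc, ← map_mul, pow_succ']
  obtain ⟨V, hV⟩ := aux (m / p) ((conn f)^[m % p] 1)
  refine ⟨V, ?_⟩
  rw [← hV, ← Function.iterate_add_apply, Nat.div_add_mod]

end Curvature

section FixedPoint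

/-- A subring of power series containing all simple roots of polynomials over it, formulated
through closure under division by `X` and under contractive fixed points. -/
structure Subring.IsFixClosed {F : Type*} [Field F] (S : Subring F⟦X⟧) : Prop where
  C_mem : ∀ c : F, C c ∈ S
  X_mem : X ∈ S
  of_X_mul : ∀ g : F⟦X⟧, X * g ∈ S → g ∈ S
  fix : ∀ (e : S) (E : Polynomial S) (z : F⟦X⟧), z = (e : F⟦X⟧) + X * Polynomial.aeval z E → z ∈ S

theorem Subring.IsFixClosed.mem_of_root {F : Type*} [Field F] {S : Subring F⟦X⟧}
    (hS : S.IsFixClosed) (Q : Polynomial S) (w : F⟦X⟧) (hw : Polynomial.aeval w Q = 0)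
    (hw' : Polynomial.aeval w (Polynomial.derivative Q) ≠ 0) : w ∈ S := by
  have hpow : ∀ (n : ℕ) (g : F⟦X⟧), X ^ n * g ∈ S → g ∈ S := by
    intro n
    induction n with
    | zero => intro g hg; simpa using hg
    | succ n ih => intro g hg; exact ih g (hS.of_X_mul _ (by rwa [← mul_assoc, ← pow_succ']))
  obtain ⟨e, v', hv', hv'0⟩ : ∃ (e : ℕ) (v : F⟦X⟧),
      Polynomial.aeval w (Polynomial.derivative Q) = X ^ e * v ∧ constantCoeff v ≠ 0 := by
    refine ⟨(Polynomial.aeval w (Polynomial.derivative Q)).order.toNat, divXPowOrder _,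
      (X_pow_order_mul_divXPowOrder).symm, ?_⟩
    rw [constantCoeff_divXPowOrder]
    exact coeff_order hw'
  set u₀ : F⟦X⟧ := ((trunc (e + 1) w : Polynomial F) : F⟦X⟧) with hu₀
  have hu₀S : u₀ ∈ S := by
    have : ∀ P : Polynomial F, (P : F⟦X⟧) ∈ S := by
      intro P
      induction P using Polynomial.induction_on' with
      | add p q hp hq => rw [Polynomial.coe_add]; exact S.add_mem hp hq
      | monomial n a =>
        rw [← Polynomial.C_mul_X_pow_eq_monomial, Polynomial.coe_mul, Polynomial.coe_C,
          Polynomial.coe_pow, Polynomial.coe_X]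
        exact S.mul_mem (hS.C_mem a) (S.pow_mem hS.X_mem n)
    exact this _
  obtain ⟨z, hz⟩ : ∃ z, w - u₀ = X ^ (e + 1) * z := by
    change X ^ (e + 1) ∣ w - u₀
    rw [X_pow_dvd_iff]
    intro m hm
    rw [map_sub, hu₀, Polynomial.coeff_coe, coeff_trunc, if_pos hm, sub_self]
  set u : S := ⟨u₀, hu₀S⟩ with hu
  set T := Polynomial.taylor u Q with hT
  set T2 := T.divX.divX with hT2
  have hTd : T = T2 * Polynomial.X ^ 2 + Polynomial.C (T.coeff 1) * Polynomial.X
      + Polynomial.C (T.coeff 0) := by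
    conv_lhs => rw [← Polynomial.divX_mul_X_add T, ← Polynomial.divX_mul_X_add T.divX]
    rw [Polynomial.coeff_divX]; ring
  have hTw : Polynomial.aeval (X ^ (e + 1) * z) T = 0 := by
    rw [hT, Polynomial.taylor_apply, Polynomial.aeval_comp]
    simp only [map_add, Polynomial.aeval_X, Polynomial.aeval_C]
    rw [← hz]
    have : w - u₀ + (algebraMap S F⟦X⟧) u = w := by
      change w - u₀ + u₀ = w
      ring
    rw [this, hw]
  have hT1 : T.coeff 1 = (Polynomial.derivative Q).eval u := by
    rw [hT, Polynomial.taylor_coeff_one]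
  -- the derivative at `u` has the same order as at `w`
  obtain ⟨v, hv, hv0⟩ : ∃ v : F⟦X⟧, (T.coeff 1 : F⟦X⟧) = X ^ e * v ∧ constantCoeff v ≠ 0 := by
    have h1 : w - u₀ ∣ Polynomial.aeval w (Polynomial.derivative Q) -
        Polynomial.aeval u₀ (Polynomial.derivative Q) := by
      rw [Polynomial.aeval_def, Polynomial.aeval_def, Polynomial.eval₂_eq_eval_map,
        Polynomial.eval₂_eq_eval_map]
      exact Polynomial.sub_dvd_eval_sub _ _ _
    obtain ⟨k, hk⟩ := h1
    have h2 : (T.coeff 1 : F⟦X⟧) = Polynomial.aeval u₀ (Polynomial.derivative Q) := by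
      rw [hT1]
      exact (Polynomial.aeval_algebraMap_apply F⟦X⟧ u (Polynomial.derivative Q)).symm
    refine ⟨v' - X * (z * k), ?_, by simpa using hv'0⟩
    rw [h2]
    rw [hz] at hk
    linear_combination hv' - hk
  have hvS : v ∈ S := hpow e v (by rw [← hv]; exact (T.coeff 1).2)
  obtain ⟨v₁, hv₁⟩ : X ∣ v - C (constantCoeff v) := by rw [X_dvd_iff]; simp
  have hv₁S : v₁ ∈ S := hS.of_X_mul _ (by rw [← hv₁]; exact S.sub_mem hvS (hS.C_mem _))
  set Xe : S := ⟨X ^ (e + 1), S.pow_mem hS.X_mem _⟩ with hXe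
  set E2 : Polynomial S := T2.comp (Polynomial.C Xe * Polynomial.X) with hE2
  have hE2z : Polynomial.aeval z E2 = Polynomial.aeval (X ^ (e + 1) * z) T2 := by
    rw [hE2, Polynomial.aeval_comp]
    simp only [map_mul, Polynomial.aeval_C, Polynomial.aeval_X]
    rfl
  have hmain : (T.coeff 0 : F⟦X⟧) = X ^ (2 * e + 1) * -(v * z + X * z ^ 2 *
      Polynomial.aeval z E2) := by
    have h := hTw
    rw [hTd] at h
    simp only [map_add, map_mul, map_pow, Polynomial.aeval_X, Polynomial.aeval_C] at h
    rw [← hE2z] at h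
    have h1 : (algebraMap S F⟦X⟧) (T.coeff 1) = X ^ e * v := hv
    have h0 : (algebraMap S F⟦X⟧) (T.coeff 0) = (T.coeff 0 : F⟦X⟧) := rfl
    rw [h1, h0] at h
    linear_combination h
  set q := -(v * z + X * z ^ 2 * Polynomial.aeval z E2) with hq
  have hqS : q ∈ S := hpow (2 * e + 1) q (by rw [← hmain]; exact (T.coeff 0).2)
  set c := constantCoeff v with hc
  have hcc : (C c⁻¹ : F⟦X⟧) * C c = 1 := by rw [← map_mul, inv_mul_cancel₀ hv0, map_one]
  set cS : S := ⟨C c⁻¹, hS.C_mem _⟩ with hcS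
  set E : Polynomial S := -(Polynomial.C cS) * (Polynomial.C ⟨v₁, hv₁S⟩ * Polynomial.X +
    Polynomial.X ^ 2 * E2) with hE
  have hzS : z ∈ S := by
    refine hS.fix (-(cS * ⟨q, hqS⟩)) E z ?_
    rw [hE]
    simp only [map_add, map_mul, map_neg, map_pow, Polynomial.aeval_X, Polynomial.aeval_C]
    have h1 : (algebraMap S F⟦X⟧) cS = C c⁻¹ := rfl
    have h2 : (algebraMap S F⟦X⟧) ⟨v₁, hv₁S⟩ = v₁ := rfl
    have h3 : ((-(cS * ⟨q, hqS⟩) : S) : F⟦X⟧) = -(C c⁻¹ * q) := rfl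
    rw [h1, h2, h3, hq]
    linear_combination (-z) * hcc - (C c⁻¹ * z) * hv₁
  have : w = u₀ + X ^ (e + 1) * z := by rw [← hz]; ring
  rw [this]
  exact S.add_mem hu₀S (S.mul_mem (S.pow_mem hS.X_mem _) hzS)

end FixedPoint

section Eisenstein

/-- The first `M` coefficients of `F` have denominators dividing `c * B ^ m`. -/
def PowerSeries.DenBound (c B : ℕ) (M : ℕ) (F : ℚ⟦X⟧) : Prop :=
  ∀ m < M, ∃ z : ℤ, (c : ℚ) * (B : ℚ) ^ m * coeff m F = z

namespace PowerSeries.DenBound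

variable {c c' B B' M : ℕ} {F G : ℚ⟦X⟧}

theorem zero : DenBound c B M 0 := fun _ _ => ⟨0, by simp⟩

theorem mono (h : DenBound c B M F) (hc : c ∣ c') (hB : B ∣ B') : DenBound c' B' M F := by
  intro m hm
  obtain ⟨z, hz⟩ := h m hm
  obtain ⟨d, rfl⟩ := hc
  obtain ⟨e, rfl⟩ := hB
  refine ⟨d * e ^ m * z, ?_⟩
  push_cast
  rw [← hz]; ring

theorem add (h : DenBound c B M F) (h' : DenBound c B M G) : DenBound c B M (F + G) := by
  intro m hm
  obtain ⟨z, hz⟩ := h m hm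
  obtain ⟨z', hz'⟩ := h' m hm
  refine ⟨z + z', ?_⟩
  rw [map_add]; push_cast; rw [← hz, ← hz']; ring

theorem neg (h : DenBound c B M F) : DenBound c B M (-F) := by
  intro m hm
  obtain ⟨z, hz⟩ := h m hm
  refine ⟨-z, ?_⟩
  rw [map_neg]; push_cast; rw [← hz]; ring

theorem mul (h : DenBound c B M F) (h' : DenBound c' B M G) : DenBound (c * c') B M (F * G) := by
  intro m hm
  have : ∀ x : ℕ × ℕ, x ∈ Finset.HasAntidiagonal.antidiagonal m → ∃ z : ℤ,
      ((c * c' : ℕ) : ℚ) * (B : ℚ) ^ m * (coeff x.1 F * coeff x.2 G) = z := by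
    rintro ⟨i, j⟩ hij
    rw [Finset.HasAntidiagonal.mem_antidiagonal] at hij
    dsimp only at hij ⊢
    obtain ⟨z, hz⟩ := h i (by omega)
    obtain ⟨z', hz'⟩ := h' j (by omega)
    refine ⟨z * z', ?_⟩
    push_cast; rw [← hz, ← hz', ← hij]; ring
  choose! z hz using this
  refine ⟨∑ x ∈ Finset.HasAntidiagonal.antidiagonal m, z x, ?_⟩
  rw [coeff_mul, Finset.mul_sum]
  push_cast
  exact Finset.sum_congr rfl fun x hx => by rw [← hz x hx]; push_cast; ring

theorem C_int (z : ℤ) : DenBound c B M (C (z : ℚ)) := by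
  intro m _
  rw [coeff_C]
  split_ifs
  · exact ⟨c * B ^ m * z, by push_cast; ring⟩
  · exact ⟨0, by simp⟩

theorem one : DenBound c B M 1 := by simpa using C_int (c := c) (B := B) (M := M) 1

theorem pow (h : DenBound c B M F) (i : ℕ) : DenBound (c ^ i) B M (F ^ i) := by
  induction i with
  | zero => simpa using one
  | succ i ih => rw [pow_succ, pow_succ]; exact ih.mul h

theorem sum {ι : Type*} (s : Finset ι) (G : ι → ℚ⟦X⟧) (h : ∀ i ∈ s, DenBound c B M (G i)) :
    DenBound c B M (∑ i ∈ s, G i) :=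
  Finset.sum_induction _ _ (fun _ _ => add) zero h

end PowerSeries.DenBound

/-- The ring of power series with Eisenstein denominators. -/
def PowerSeries.eisensteinSubring : Subring ℚ⟦X⟧ where
  carrier := {F | ∃ A : ℕ, 0 < A ∧ ∀ M, DenBound A A M F}
  zero_mem' := ⟨1, one_pos, fun _ => DenBound.zero⟩
  one_mem' := ⟨1, one_pos, fun _ => DenBound.one⟩
  add_mem' := by
    rintro F G ⟨A, hA, h⟩ ⟨A', hA', h'⟩
    exact ⟨A * A', by positivity, fun M => ((h M).mono ⟨A', rfl⟩ ⟨A', rfl⟩).add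
      ((h' M).mono ⟨A, mul_comm _ _⟩ ⟨A, mul_comm _ _⟩)⟩
  neg_mem' := by
    rintro F ⟨A, hA, h⟩
    exact ⟨A, hA, fun M => (h M).neg⟩
  mul_mem' := by
    rintro F G ⟨A, hA, h⟩ ⟨A', hA', h'⟩
    exact ⟨A * A', by positivity, fun M => ((h M).mono dvd_rfl ⟨A', rfl⟩).mul
      ((h' M).mono dvd_rfl ⟨A, mul_comm _ _⟩)⟩

theorem PowerSeries.mem_eisensteinSubring {F : ℚ⟦X⟧} :
    F ∈ eisensteinSubring ↔ ∃ A : ℕ, 0 < A ∧ ∀ M, DenBound A A M F := Iff.rfl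

theorem PowerSeries.eisensteinSubring_fix_aux {c A J M : ℕ} {e z : ℚ⟦X⟧} {E : ℕ → ℚ⟦X⟧}
    (hc : c = A ^ (J + 1)) (he : ∀ M, DenBound A A M e)
    (hE : ∀ i M, DenBound A A M (E i)) (hz : z = e + X * ∑ i ∈ Finset.range (J + 1), E i * z ^ i) :
    DenBound A c M z := by
  induction M with
  | zero => intro m hm; omega
  | succ M ih =>
    have hAc : A ∣ c := by rw [hc]; exact dvd_pow_self _ (by omega)
    have h1 : DenBound c c M (∑ i ∈ Finset.range (J + 1), E i * z ^ i) := by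
      refine DenBound.sum _ _ fun i hi => ?_
      refine (((hE i M).mono dvd_rfl hAc).mul (ih.pow i)).mono ?_ dvd_rfl
      rw [hc, ← pow_succ']
      exact pow_dvd_pow _ (Finset.mem_range.1 hi)
    intro m hm
    obtain ⟨z1, hz1⟩ := ((he (M + 1)).mono dvd_rfl hAc) m hm
    cases m with
    | zero =>
      refine ⟨z1, ?_⟩
      rw [← hz1, hz]; simp
    | succ m =>
      obtain ⟨z2, hz2⟩ := h1 m (by omega)
      refine ⟨z1 + A * z2, ?_⟩
      rw [hz, map_add, coeff_succ_X_mul]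
      push_cast
      rw [← hz1, ← hz2]
      ring

theorem PowerSeries.eisensteinSubring_isFixClosed : eisensteinSubring.IsFixClosed where
  C_mem q := ⟨q.den, q.den_pos, fun M m _ => by
    rw [coeff_C]
    split_ifs with h
    · refine ⟨q.num, ?_⟩
      rw [h, pow_zero, mul_one, mul_comm]; exact Rat.mul_den_eq_num q
    · exact ⟨0, by simp⟩⟩
  X_mem := ⟨1, one_pos, fun M m _ => by
    rw [coeff_X]
    split_ifs with h
    · exact ⟨1, by simp⟩
    · exact ⟨0, by simp⟩⟩
  of_X_mul := by
    rintro g ⟨A, hA, h⟩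
    refine ⟨A * A, by positivity, fun M m hm => ?_⟩
    obtain ⟨z, hz⟩ := h (M + 1) (m + 1) (by omega)
    rw [coeff_succ_X_mul] at hz
    refine ⟨A ^ m * z, ?_⟩
    push_cast
    rw [← hz]; ring
  fix := by
    intro e E z hz
    obtain ⟨A₀, hA₀, he⟩ := e.2
    have : ∀ i, ∃ A : ℕ, 0 < A ∧ ∀ M, DenBound A A M (E.coeff i) := fun i => (E.coeff i).2
    choose A hA hE using this
    set J := E.natDegree
    set D := A₀ * ∏ i ∈ Finset.range (J + 1), A i with hD
    have hDpos : 0 < D := Nat.mul_pos hA₀ (Finset.prod_pos fun i _ => hA i)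
    have he' : ∀ M, DenBound D D M (e : ℚ⟦X⟧) := fun M => (he M).mono ⟨_, rfl⟩ ⟨_, rfl⟩
    have hE' : ∀ i M, DenBound D D M (E.coeff i : ℚ⟦X⟧) := by
      intro i M
      by_cases hi : i ∈ Finset.range (J + 1)
      · have : A i ∣ D := (Finset.dvd_prod_of_mem A hi).trans (Dvd.intro_left _ rfl)
        exact (hE i M).mono this this
      · rw [Polynomial.coeff_eq_zero_of_natDegree_lt (by simpa using hi)]
        exact DenBound.zero
    have hz' : z = (e : ℚ⟦X⟧) + X * ∑ i ∈ Finset.range (J + 1), (E.coeff i : ℚ⟦X⟧) * z ^ i := by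
      conv_lhs => rw [hz, Polynomial.aeval_eq_sum_range]
      rfl
    have key : z ∈ eisensteinSubring := by
      refine mem_eisensteinSubring.2 ⟨D ^ (J + 1), by positivity, fun M => ?_⟩
      exact (eisensteinSubring_fix_aux rfl he' hE' hz').mono (dvd_pow_self _ (by omega)) dvd_rfl
    exact key

end Eisenstein

section Growth

/-- Truncated weighted `ℓ¹` norm of a rational power series. -/
noncomputable def PowerSeries.psum (r : ℝ) (M : ℕ) (F : ℚ⟦X⟧) : ℝ :=
  ∑ m ∈ Finset.range M, |((coeff m F : ℚ) : ℝ)| * r ^ m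

namespace PowerSeries

variable {r : ℝ} {M : ℕ} {F G : ℚ⟦X⟧}

theorem psum_nonneg (hr : 0 ≤ r) : 0 ≤ psum r M F :=
  Finset.sum_nonneg fun _ _ => by positivity

theorem psum_mono_r {s : ℝ} (hr : 0 ≤ r) (h : r ≤ s) : psum r M F ≤ psum s M F :=
  Finset.sum_le_sum fun _ _ => by gcongr

theorem psum_add (hr : 0 ≤ r) : psum r M (F + G) ≤ psum r M F + psum r M G := by
  rw [psum, psum, psum, ← Finset.sum_add_distrib]
  refine Finset.sum_le_sum fun m _ => ?_
  rw [map_add, ← add_mul]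
  push_cast
  gcongr
  exact abs_add_le _ _

theorem psum_neg : psum r M (-F) = psum r M F := by simp [psum]

theorem psum_sum (hr : 0 ≤ r) {ι : Type*} (s : Finset ι) (G : ι → ℚ⟦X⟧) :
    psum r M (∑ i ∈ s, G i) ≤ ∑ i ∈ s, psum r M (G i) := by
  classical
  induction s using Finset.induction_on with
  | empty => simp [psum]
  | insert a s ha ih =>
    rw [Finset.sum_insert ha, Finset.sum_insert ha]
    exact (psum_add hr).trans (by gcongr)

theorem psum_mul (hr : 0 ≤ r) : psum r M (F * G) ≤ psum r M F * psum r M G := by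
  have h1 : psum r M (F * G) ≤ ∑ m ∈ Finset.range M, ∑ x ∈ Finset.HasAntidiagonal.antidiagonal m,
      (|((coeff x.1 F : ℚ) : ℝ)| * r ^ x.1) * (|((coeff x.2 G : ℚ) : ℝ)| * r ^ x.2) := by
    refine Finset.sum_le_sum fun m _ => ?_
    rw [coeff_mul]
    push_cast
    calc _ ≤ (∑ x ∈ Finset.HasAntidiagonal.antidiagonal m,
             |((coeff x.1 F : ℚ) : ℝ) * ((coeff x.2 G : ℚ) : ℝ)|)
          * r ^ m := by gcongr; exact Finset.abs_sum_le_sum_abs _ _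
      _ = _ := by
        rw [Finset.sum_mul]
        refine Finset.sum_congr rfl fun x hx => ?_
        rw [← Finset.HasAntidiagonal.mem_antidiagonal.1 hx, abs_mul, pow_add]; ring
  refine h1.trans ?_
  rw [psum, psum, Finset.sum_mul_sum, ← Finset.sum_product']
  set s := (Finset.range M ×ˢ Finset.range M).filter fun x : ℕ × ℕ => x.1 + x.2 < M with hs
  refine le_trans (le_of_eq ?_) (Finset.sum_le_sum_of_subset_of_nonneg
    (Finset.filter_subset (fun x : ℕ × ℕ => x.1 + x.2 < M) _) fun _ _ _ => by positivity)
  rw [← Finset.sum_fiberwise_of_maps_to (t := Finset.range M) (g := fun x : ℕ × ℕ => x.1 + x.2)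
    (fun x hx => by simpa using (Finset.mem_filter.1 hx).2)]
  refine Finset.sum_congr rfl fun m hm => Finset.sum_congr ?_ fun _ _ => rfl
  ext x
  simp only [Finset.HasAntidiagonal.mem_antidiagonal, Finset.mem_filter, Finset.mem_product,
    Finset.mem_range] at *
  omega

theorem psum_X_mul : psum r (M + 1) (X * F) = r * psum r M F := by
  rw [psum, psum, Finset.sum_range_succ', Finset.mul_sum]
  simp only [coeff_succ_X_mul, coeff_zero_X_mul]
  simp only [Rat.cast_zero, abs_zero, zero_mul, add_zero]
  exact Finset.sum_congr rfl fun _ _ => by ring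

theorem psum_succ_le (hr : 0 ≤ r) : psum r M F ≤ psum r (M + 1) F := by
  rw [psum, psum, Finset.sum_range_succ]
  have : 0 ≤ |((coeff M F : ℚ) : ℝ)| * r ^ M := by positivity
  linarith

theorem psum_C_le (q : ℚ) : psum r M (C q) ≤ |(q : ℝ)| := by
  cases M with
  | zero => simp [psum]
  | succ M =>
    rw [psum, Finset.sum_range_succ']
    simp

theorem psum_pow (hr : 0 ≤ r) (i : ℕ) : psum r M (F ^ i) ≤ psum r M F ^ i := by
  induction i with
  | zero => simpa using psum_C_le (M := M) 1
  | succ i ih =>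
    rw [pow_succ, pow_succ]
    exact (psum_mul hr).trans (by gcongr; exact psum_nonneg hr)

/-- The ring of rational power series with positive radius of convergence. -/
def growthSubring : Subring ℚ⟦X⟧ where
  carrier := {F | ∃ r : ℝ, 0 < r ∧ ∃ A, ∀ M, psum r M F ≤ A}
  zero_mem' := ⟨1, one_pos, 0, by simp [psum]⟩
  one_mem' := ⟨1, one_pos, 1, fun M => by simpa using psum_C_le (M := M) (r := 1) 1⟩
  add_mem' := by
    rintro F G ⟨r, hr, A, h⟩ ⟨r', hr', A', h'⟩
    refine ⟨min r r', by positivity, A + A', fun M => (psum_add (by positivity)).trans ?_⟩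
    exact add_le_add ((psum_mono_r (by positivity) (min_le_left _ _)).trans (h M))
      ((psum_mono_r (by positivity) (min_le_right _ _)).trans (h' M))
  neg_mem' := by
    rintro F ⟨r, hr, A, h⟩
    exact ⟨r, hr, A, fun M => by rw [psum_neg]; exact h M⟩
  mul_mem' := by
    rintro F G ⟨r, hr, A, h⟩ ⟨r', hr', A', h'⟩
    refine ⟨min r r', by positivity, A * A', fun M => (psum_mul (by positivity)).trans ?_⟩
    exact mul_le_mul ((psum_mono_r (by positivity) (min_le_left _ _)).trans (h M))
      ((psum_mono_r (by positivity) (min_le_right _ _)).trans (h' M)) (psum_nonneg (by positivity))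
      ((psum_nonneg hr.le).trans (h 0))

theorem mem_growthSubring : F ∈ growthSubring ↔ ∃ r : ℝ, 0 < r ∧ ∃ A, ∀ M, psum r M F ≤ A :=
  Iff.rfl

theorem growthSubring_fix_aux {J : ℕ} {a r : ℝ} {e z : ℚ⟦X⟧} {E : ℕ → ℚ⟦X⟧} {b : ℕ → ℝ}
    (hr : 0 ≤ r) (he : ∀ M, psum r M e ≤ a) (hE : ∀ i M, psum r M (E i) ≤ b i)
    (hra : r * ∑ i ∈ Finset.range (J + 1), b i * (a + 1) ^ i ≤ 1)
    (hz : z = e + X * ∑ i ∈ Finset.range (J + 1), E i * z ^ i) (M : ℕ) :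
    psum r M z ≤ a + 1 := by
  induction M with
  | zero =>
    have := (psum_nonneg (F := e) (M := 0) hr).trans (he 0)
    simp only [psum, Finset.range_zero, Finset.sum_empty]
    linarith
  | succ M ih =>
    rw [hz]
    refine (psum_add hr).trans (add_le_add (he _) ?_)
    rw [psum_X_mul]
    refine le_trans ?_ hra
    gcongr
    refine (psum_sum hr _ _).trans (Finset.sum_le_sum fun i _ => (psum_mul hr).trans ?_)
    have h0 : 0 ≤ psum r M z := psum_nonneg hr
    exact mul_le_mul (hE i M) ((psum_pow hr i).trans (by gcongr)) (psum_nonneg hr)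
      ((psum_nonneg hr).trans (hE i M))

theorem growthSubring_isFixClosed : growthSubring.IsFixClosed where
  C_mem q := ⟨1, one_pos, _, fun _ => psum_C_le q⟩
  X_mem := ⟨1, one_pos, 1, fun M => by
    refine (psum_succ_le zero_le_one).trans ?_
    rw [← mul_one X, psum_X_mul, one_mul]
    simpa using psum_C_le (M := M) (r := 1) 1⟩
  of_X_mul := by
    rintro g ⟨r, hr, A, h⟩
    refine ⟨r, hr, r⁻¹ * A, fun M => ?_⟩
    have := h (M + 1)
    rw [psum_X_mul] at this
    rwa [le_inv_mul_iff₀ hr]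
  fix := by
    intro e E z hz
    obtain ⟨r₀, hr₀, a, he⟩ := e.2
    have : ∀ i, ∃ r : ℝ, 0 < r ∧ ∃ A, ∀ M, psum r M (E.coeff i) ≤ A := fun i => (E.coeff i).2
    choose ρ hρ b hE using this
    set J := E.natDegree
    have ha : 0 ≤ a := (psum_nonneg hr₀.le).trans (he 0)
    have hb : ∀ i, 0 ≤ b i := fun i => (psum_nonneg (hρ i).le).trans (hE i 0)
    set Q := ∑ i ∈ Finset.range (J + 1), b i * (a + 1) ^ i with hQ
    have hQ0 : 0 ≤ Q := Finset.sum_nonneg fun i _ => mul_nonneg (hb i) (by positivity)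
    obtain ⟨r₁, hr₁, hr₁'⟩ : ∃ r : ℝ, 0 < r ∧ ∀ i ∈ Finset.range (J + 1), r ≤ ρ i := by
      refine ⟨(Finset.range (J + 1)).inf' Finset.nonempty_range_add_one ρ, ?_,
        fun i hi => Finset.inf'_le _ hi⟩
      exact (Finset.lt_inf'_iff _).2 fun i _ => hρ i
    set r := min (min r₀ r₁) (Q + 1)⁻¹
    have hr0 : 0 < r := by positivity
    have hz' : z = (e : ℚ⟦X⟧) + X * ∑ i ∈ Finset.range (J + 1), (E.coeff i : ℚ⟦X⟧) * z ^ i := by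
      conv_lhs => rw [hz, Polynomial.aeval_eq_sum_range]
      rfl
    have key : z ∈ growthSubring := by
      refine mem_growthSubring.2 ⟨r, hr0, a + 1, growthSubring_fix_aux (b := b) hr0.le
        (fun M => (psum_mono_r hr0.le ((min_le_left _ _).trans (min_le_left _ _))).trans (he M))
        (fun i M => ?_) ?_ hz'⟩
      · by_cases hi : i ∈ Finset.range (J + 1)
        · exact (psum_mono_r hr0.le ((min_le_left _ _).trans
            ((min_le_right _ _).trans (hr₁' i hi)))).trans (hE i M)
        · rw [Polynomial.coeff_eq_zero_of_natDegree_lt (by simpa using hi)]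
          simpa [psum] using hb i
      · calc r * Q ≤ (Q + 1)⁻¹ * Q := by gcongr; exact min_le_right _ _
          _ ≤ 1 := by
            rw [inv_mul_le_iff₀ (by positivity)]; linarith
    exact key

/-- A solution of `y' = f y` has positive radius of convergence if `f` has. -/
theorem mem_growthSubring_of_derivative {f y : ℚ⟦X⟧} (hf : f ∈ growthSubring)
    (h : derivative ℚ y = f * y) : y ∈ growthSubring := by
  obtain ⟨r₀, hr₀, A, hA⟩ := hf
  have hA0 : 0 ≤ A := (psum_nonneg hr₀.le).trans (hA 0)
  set r := min r₀ (2 * (A + 1))⁻¹ with hr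
  have hr0 : 0 < r := by positivity
  have hrA : r * A ≤ 1 / 2 := by
    calc r * A ≤ (2 * (A + 1))⁻¹ * A := by gcongr; exact min_le_right _ _
      _ ≤ _ := by
        rw [inv_mul_le_iff₀ (by positivity)]; linarith
  set y₀ := |((coeff 0 y : ℚ) : ℝ)|
  refine ⟨r, hr0, 2 * y₀, fun M => ?_⟩
  induction M with
  | zero => simp [psum, y₀]
  | succ M ih =>
    have h1 : psum r (M + 1) y ≤ y₀ + r * psum r M (f * y) := by
      rw [psum, Finset.sum_range_succ', psum, Finset.mul_sum, add_comm]
      simp only [pow_zero, mul_one]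
      refine add_le_add le_rfl (Finset.sum_le_sum fun m _ => ?_)
      rw [← h, coeff_derivative, pow_succ]
      push_cast
      rw [abs_mul]
      have : (1 : ℝ) ≤ |(m : ℝ) + 1| := by
        rw [abs_of_nonneg (by positivity)]; linarith [Nat.cast_nonneg (α := ℝ) m]
      calc _ = |((coeff (m + 1) y : ℚ) : ℝ)| * 1 * (r * r ^ m) := by ring
        _ ≤ |((coeff (m + 1) y : ℚ) : ℝ)| * |(m : ℝ) + 1| * (r * r ^ m) := by gcongr
        _ = _ := by ring
    have h2 : psum r M (f * y) ≤ A * (2 * y₀) := (psum_mul hr0.le).trans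
      (mul_le_mul ((psum_mono_r hr0.le (min_le_left _ _)).trans (hA M)) ih
        (psum_nonneg hr0.le) hA0)
    have h3 : 0 ≤ y₀ := abs_nonneg _
    calc _ ≤ y₀ + r * (A * (2 * y₀)) := h1.trans (by gcongr)
      _ = y₀ + (r * A) * (2 * y₀) := by ring
      _ ≤ y₀ + 1 / 2 * (2 * y₀) := by gcongr
      _ = _ := by ring

end PowerSeries
end Growth

theorem PowerSeries.exists_annihilator {g : ℚ⟦X⟧} (hg : IsAlgebraicPS g) :
    ∃ P : Polynomial (Polynomial ℚ), Polynomial.eval₂ Polynomial.coeToPowerSeries.ringHom g P = 0 ∧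
      Polynomial.eval₂ Polynomial.coeToPowerSeries.ringHom g (Polynomial.derivative P) ≠ 0 := by
  classical
  have h : ∃ n, ∃ P : Polynomial (Polynomial ℚ), P ≠ 0 ∧ P.natDegree = n ∧
      Polynomial.eval₂ Polynomial.coeToPowerSeries.ringHom g P = 0 := by
    obtain ⟨P, h0, h⟩ := hg
    exact ⟨_, P, h0, rfl, h⟩
  obtain ⟨P, h0, hn, hP⟩ := Nat.find_spec h
  have hdeg : P.natDegree ≠ 0 := by
    intro h1
    rw [Polynomial.eq_C_of_natDegree_eq_zero h1, Polynomial.eval₂_C] at hP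
    have : P.coeff 0 = 0 := by simpa using hP
    apply h0
    rw [Polynomial.eq_C_of_natDegree_eq_zero h1, this, map_zero]
  refine ⟨P, hP, fun hd => Nat.find_min h (m := (Polynomial.derivative P).natDegree) ?_
    ⟨_, ?_, rfl, hd⟩⟩
  · rw [← hn]
    exact Polynomial.natDegree_derivative_lt hdeg
  · intro h2
    exact hdeg (Polynomial.derivative_eq_zero.1 h2)

theorem Subring.IsFixClosed.mem_of_isAlgebraicPS {S : Subring ℚ⟦X⟧} (hS : S.IsFixClosed)
    {g : ℚ⟦X⟧} (hg : IsAlgebraicPS g) : g ∈ S := by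
  obtain ⟨P, hP, hP'⟩ := exists_annihilator hg
  have hpoly : ∀ q : Polynomial ℚ, (q : ℚ⟦X⟧) ∈ S := by
    intro q
    induction q using Polynomial.induction_on' with
    | add p q hp hq => rw [Polynomial.coe_add]; exact S.add_mem hp hq
    | monomial n a =>
      rw [Polynomial.coe_monomial, monomial_eq_C_mul_X_pow]
      exact S.mul_mem (hS.C_mem a) (S.pow_mem hS.X_mem n)
  let φ : Polynomial ℚ →+* S :=
    (Polynomial.coeToPowerSeries.ringHom (R := ℚ)).codRestrict S hpoly
  have hφ : (algebraMap S ℚ⟦X⟧).comp φ = Polynomial.coeToPowerSeries.ringHom := rfl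
  refine hS.mem_of_root (P.map φ) g ?_ ?_
  · rw [Polynomial.aeval_def, Polynomial.eval₂_map, hφ, hP]
  · rw [Polynomial.derivative_map, Polynomial.aeval_def, Polynomial.eval₂_map, hφ]
    exact hP'

section Padic

variable {p : ℕ} [Fact p.Prime]

theorem PadicInt.coe_ringHom_apply (z : ℤ_[p]) : PadicInt.Coe.ringHom z = (z : ℚ_[p]) := rfl

theorem memZp_iff_norm_le_one {q : ℚ} : MemZp p q ↔ ‖(q : ℚ_[p])‖ ≤ 1 := by
  refine ⟨Padic.norm_rat_le_one, fun h hp => ?_⟩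
  have hq : (q : ℚ_[p]) * (q.den : ℚ_[p]) = (q.num : ℚ_[p]) := by
    exact_mod_cast congrArg (fun x : ℚ => (x : ℚ_[p])) (Rat.mul_den_eq_num q)
  have hden : ‖((q.den : ℤ) : ℚ_[p])‖ < 1 :=
    Padic.norm_intCast_lt_one_iff.2 (by exact_mod_cast hp)
  have hnum : ‖((q.num : ℤ) : ℚ_[p])‖ < 1 := by
    rw [← hq, norm_mul]
    calc _ ≤ 1 * ‖(q.den : ℚ_[p])‖ := by gcongr
      _ < 1 := by rw [one_mul]; exact_mod_cast hden
  have h1 := Int.natCast_dvd.1 (Padic.norm_intCast_lt_one_iff.1 hnum)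
  exact (Fact.out : p.Prime).one_lt.ne' (Nat.dvd_one.1 (q.reduced ▸ Nat.dvd_gcd h1 hp))

theorem MemZp.exists_padicInt {q : ℚ} (h : MemZp p q) : ∃ z : ℤ_[p], (z : ℚ_[p]) = q :=
  ⟨⟨q, memZp_iff_norm_le_one.1 h⟩, rfl⟩

theorem memZp_of_eq {q : ℚ} (z : ℤ_[p]) (h : (z : ℚ_[p]) = q) : MemZp p q :=
  memZp_iff_norm_le_one.2 (h ▸ z.2)

/-- A power series whose coefficients are `p`-integral lifts to `ℤ_[p]`. -/
theorem PowerSeries.exists_padicInt_lift {F : ℚ⟦X⟧} (h : ∀ n, MemZp p (coeff n F)) :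
    ∃ G : ℤ_[p]⟦X⟧, map PadicInt.Coe.ringHom G = map (algebraMap ℚ ℚ_[p]) F := by
  choose z hz using fun n => (h n).exists_padicInt
  refine ⟨PowerSeries.mk z, ?_⟩
  ext n
  simpa [PadicInt.coe_ringHom_apply] using hz n

theorem PowerSeries.map_padicInt_injective :
    Function.Injective (map (PadicInt.Coe.ringHom (p := p))) :=
  map_injective _ Subtype.val_injective

theorem PowerSeries.DenBound.memZp {p : ℕ} (hp : p.Prime) {A : ℕ} {F : ℚ⟦X⟧}
    (h : ∀ M, DenBound A A M F)
    (hA : 0 < A) (hpA : A < p) (n : ℕ) : MemZp p (coeff n F) := by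
  obtain ⟨z, hz⟩ := h (n + 1) n (by omega)
  intro hd
  have h2 : ((coeff n F).den : ℤ) ∣ A ^ (n + 1) := by
    have h3 : ((A ^ (n + 1) : ℤ) : ℚ) * coeff n F = z := by push_cast; rw [← hz]; ring
    have h4 : (A ^ (n + 1) : ℤ) * (coeff n F).num = z * (coeff n F).den := by
      have := congrArg (· * ((coeff n F).den : ℚ)) h3
      simp only [mul_assoc, Rat.mul_den_eq_num] at this
      exact_mod_cast this
    refine IsCoprime.dvd_of_dvd_mul_right (z := (coeff n F).num) ?_ ⟨z, by rw [h4]; ring⟩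
    rw [Int.isCoprime_iff_gcd_eq_one, Int.gcd_comm]
    exact (coeff n F).reduced
  have h5 : p ∣ A ^ (n + 1) := hd.trans (by exact_mod_cast h2)
  exact absurd (Nat.le_of_dvd hA (hp.dvd_of_dvd_pow h5)) (by omega)

end Padic

section Solution

/-- Coefficients of the normalised solution of `y' = f y`. -/
noncomputable def PowerSeries.solCoeff (f : ℚ⟦X⟧) : ℕ → ℚ
  | 0 => 1
  | n + 1 => (∑ i : Fin (n + 1), coeff (n - i) f * solCoeff f i) / (n + 1)

theorem PowerSeries.exists_solution (f : ℚ⟦X⟧) :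
    ∃ y : ℚ⟦X⟧, constantCoeff y = 1 ∧ derivative ℚ y = f * y := by
  refine ⟨PowerSeries.mk (solCoeff f), by simp [solCoeff], ?_⟩
  ext n
  rw [coeff_derivative, coeff_mk, solCoeff, div_mul_cancel₀ _ (by positivity), coeff_mul,
    Finset.Nat.sum_antidiagonal_eq_sum_range_succ_mk, Fin.sum_univ_eq_sum_range
      (fun i => coeff (n - i) f * solCoeff f i), ← Finset.sum_range_reflect]
  refine Finset.sum_congr rfl fun i hi => ?_
  have := Finset.mem_range.1 hi
  rw [coeff_mk]
  dsimp only
  rw [show n - (n + 1 - 1 - i) = i by omega, show n + 1 - 1 - i = n - i by omega]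

/-- If the solutions of `y' = f y` are algebraic then `f` has the Gauss property. -/
theorem gauss_of_algebraic {a : ℕ → ℚ} {f : ℚ⟦X⟧} (hf : f = PowerSeries.mk fun k => a (k + 1))
    (halg : IsAlgebraicPS f) (h : ∀ y : ℚ⟦X⟧, derivative ℚ y = f * y → IsAlgebraicPS y) :
    ∃ B : ℕ, ∀ p : ℕ, p.Prime → B ≤ p →
        ∀ n : ℕ, 1 ≤ n → MemNPZp n p (a (n * p) - a n) := by
  obtain ⟨y, hy0, hy⟩ := exists_solution f
  obtain ⟨A, hA, hAf⟩ := eisensteinSubring_isFixClosed.mem_of_isAlgebraicPS halg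
  obtain ⟨A', hA', hAy⟩ := eisensteinSubring_isFixClosed.mem_of_isAlgebraicPS (h y hy)
  refine ⟨A + A' + 1, fun p hp hpB n hn => ?_⟩
  have : Fact p.Prime := ⟨hp⟩
  obtain ⟨F, hF⟩ := exists_padicInt_lift fun n => DenBound.memZp hp hAf hA (by omega) n
  obtain ⟨Y, hY⟩ := exists_padicInt_lift fun n => DenBound.memZp hp hAy hA' (by omega) n
  have hc : ∀ m, ((coeff m F : ℤ_[p]) : ℚ_[p]) = (coeff m f : ℚ) := fun m => by
    simpa [PadicInt.coe_ringHom_apply] using congrArg (coeff m) hF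
  have ha : ∀ m, 1 ≤ m → ((coeff m (X * F) : ℤ_[p]) : ℚ_[p]) = (a m : ℚ) := by
    intro m hm
    obtain ⟨m, rfl⟩ := Nat.exists_eq_add_of_le' hm
    rw [coeff_succ_X_mul, hc, hf, coeff_mk]
  have h0 : constantCoeff Y = 1 := by
    have := congrArg (coeff 0) hY
    rw [coeff_map, coeff_map, coeff_zero_eq_constantCoeff_apply,
      coeff_zero_eq_constantCoeff_apply, hy0, map_one] at this
    exact Subtype.val_injective (by simpa [PadicInt.coe_ringHom_apply] using this)
  have hd : X * derivative ℤ_[p] Y = X * F * Y := by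
    rw [mul_assoc]
    congr 1
    apply map_padicInt_injective
    rw [map_mul, hF, hY, ← map_mul, ← hy]
    ext m
    have := congrArg (coeff (m + 1)) hY
    simp only [coeff_map] at this
    simp [coeff_derivative, this]
  obtain ⟨z, hz⟩ := PadicInt.dvd_coeff_sub_of_logDeriv h0 hd n
  have h1 := congrArg PadicInt.Coe.ringHom hz
  have hn0 : (n : ℚ) ≠ 0 := by positivity
  have hp0 : (p : ℚ) ≠ 0 := by exact_mod_cast hp.ne_zero
  have hnp : (n * p : ℚ) ≠ 0 := mul_ne_zero hn0 hp0
  refine ⟨(a (n * p) - a n) / (n * p), memZp_of_eq z ?_, by field_simp⟩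
  rw [map_sub, map_mul (PadicInt.Coe.ringHom (p := p)) (_ : ℤ_[p]) z, map_natCast,
    PadicInt.coe_ringHom_apply, PadicInt.coe_ringHom_apply,
    PadicInt.coe_ringHom_apply, ha _ (Nat.mul_pos hn hp.pos), ha _ hn] at h1
  have hnp' : ((n * p : ℚ) : ℚ_[p]) ≠ 0 := by exact_mod_cast hnp
  rw [Rat.cast_div, eq_div_iff hnp', Rat.cast_sub, h1]
  push_cast
  ring

end Solution

section AlgebraicData

theorem Polynomial.exists_clear_denominators {A B : Type*} [CommRing A] [IsDomain A] [CommRing B]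
    (φ : A →+* B) (h : ∀ b, ∃ a, a ≠ 0 ∧ ∃ a', φ a * b = φ a') (q : Polynomial B) :
    ∃ a : A, a ≠ 0 ∧ ∃ q' : Polynomial A, C (φ a) * q = q'.map φ := by
  induction q using Polynomial.induction_on' with
  | add p q hp hq =>
    obtain ⟨a, ha, p', hp'⟩ := hp
    obtain ⟨b, hb, q', hq'⟩ := hq
    refine ⟨a * b, mul_ne_zero ha hb, C b * p' + C a * q', ?_⟩
    rw [Polynomial.map_add, Polynomial.map_mul, Polynomial.map_mul, ← hp', ← hq']
    simp only [map_mul, Polynomial.map_C]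
    ring
  | monomial n b =>
    obtain ⟨a, ha, a', h⟩ := h b
    exact ⟨a, ha, monomial n a', by rw [C_mul_monomial, h, map_monomial]⟩

theorem Polynomial.exists_clear_denominators_rat (q : Polynomial (Polynomial ℚ)) :
    ∃ a : Polynomial ℤ, a ≠ 0 ∧ ∃ q' : Polynomial (Polynomial ℤ),
      C (a.map (Int.castRingHom ℚ)) * q = q'.map (mapRingHom (Int.castRingHom ℚ)) := by
  refine exists_clear_denominators (mapRingHom (Int.castRingHom ℚ)) (fun b => ?_) q
  obtain ⟨a, ha, b', hb⟩ := exists_clear_denominators (Int.castRingHom ℚ) (fun x => by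
    refine ⟨x.den, by exact_mod_cast x.den_ne_zero, x.num, ?_⟩
    simp [mul_comm]) b
  refine ⟨C a, by simpa using ha, b', ?_⟩
  simpa using hb

/-- The canonical embedding of integral polynomials in rational power series. -/
noncomputable abbrev intPolyToPS : Polynomial ℤ →+* ℚ⟦X⟧ := algebraMap (Polynomial ℤ) ℚ⟦X⟧

theorem intPolyToPS_eq : intPolyToPS = (Polynomial.coeToPowerSeries.ringHom).comp
    (Polynomial.mapRingHom (Int.castRingHom ℚ)) := by
  ext
  · simp [intPolyToPS]
  · simp [intPolyToPS, PowerSeries.algebraMap_apply']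

theorem intPolyToPS_injective : Function.Injective intPolyToPS := by
  rw [intPolyToPS_eq]
  exact (Polynomial.coe_injective ℚ).comp (Polynomial.map_injective _ Int.cast_injective)

theorem IsAlgebraicPS.exists_isIntegral {f : ℚ⟦X⟧} (hf : IsAlgebraicPS f) :
    ∃ a : Polynomial ℤ, a ≠ 0 ∧ IsIntegral (Polynomial ℤ) (intPolyToPS a * f) := by
  obtain ⟨P, hP, h⟩ := hf
  obtain ⟨c, hc, Q, hQ⟩ := Polynomial.exists_clear_denominators_rat P
  have hQ0 : Q ≠ 0 := by
    rintro rfl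
    rw [Polynomial.map_zero, mul_eq_zero, Polynomial.C_eq_zero, ← Polynomial.coe_mapRingHom,
      map_eq_zero_iff _ (Polynomial.map_injective _ Int.cast_injective)] at hQ
    exact hQ.elim hc hP
  have : IsAlgebraic (Polynomial ℤ) f := by
    refine ⟨Q, hQ0, ?_⟩
    have h1 := congrArg (Polynomial.eval₂ Polynomial.coeToPowerSeries.ringHom f) hQ
    rw [Polynomial.eval₂_mul, h, mul_zero, Polynomial.eval₂_map, ← intPolyToPS_eq] at h1
    exact h1.symm
  obtain ⟨a, ha, h⟩ := this.exists_integral_multiple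
  exact ⟨a, ha, by rwa [Algebra.smul_def] at h⟩

theorem Polynomial.Monic.exists_bezout {A : Type*} [CommRing A] [IsDomain A] [CharZero A]
    [IsIntegrallyClosed A] {P : Polynomial A} (hm : P.Monic) (hi : Irreducible P) :
    ∃ (U V : Polynomial A) (d : A), d ≠ 0 ∧ U * P + V * derivative P = C d := by
  set K := FractionRing A
  have : CharZero K := charZero_of_injective_algebraMap (IsFractionRing.injective A K)
  have hK : ∀ x : K, ∃ a : A, a ≠ 0 ∧ ∃ a', algebraMap A K a * x = algebraMap A K a' := by
    intro x
    obtain ⟨⟨a', s⟩, h⟩ := IsLocalization.surj (nonZeroDivisors A) x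
    exact ⟨s, nonZeroDivisors.ne_zero s.2, a', by rw [mul_comm]; exact h⟩
  have hirr := (Polynomial.Monic.irreducible_iff_irreducible_map_fraction_map (K := K) hm).1 hi
  obtain ⟨u, v, huv⟩ := hirr.separable
  obtain ⟨a, ha, u', hu⟩ := exists_clear_denominators _ hK u
  obtain ⟨b, hb, v', hv⟩ := exists_clear_denominators _ hK v
  refine ⟨C b * u', C a * v', a * b, mul_ne_zero ha hb, ?_⟩
  apply Polynomial.map_injective _ (IsFractionRing.injective A K)
  have := congrArg (fun x => C (algebraMap A K a) * C (algebraMap A K b) * x) huv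
  simp only [Polynomial.map_add, Polynomial.map_mul, map_C, map_mul, ← hu, ← hv,
    ← derivative_map] at this ⊢
  linear_combination this

end AlgebraicData

section Recursion

open Polynomial in
/-- The derivative in the base variable of a bivariate polynomial. -/
noncomputable def Polynomial.baseDeriv (S : ℤ[X][X]) : ℤ[X][X] :=
  S.sum fun i c => monomial i (derivative c)

open Polynomial in
theorem Polynomial.baseDeriv_add (S T : ℤ[X][X]) :
    baseDeriv (S + T) = baseDeriv S + baseDeriv T :=
  sum_add_index _ _ _ (by simp) (by simp)

open Polynomial in
theorem Polynomial.baseDeriv_monomial (n : ℕ) (c : ℤ[X]) :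
    baseDeriv (monomial n c) = monomial n (derivative c) :=
  sum_monomial_index _ _ (by simp)

open Polynomial in
/-- The derivation `P_w ∂_t - P_t ∂_w`, tangent to the curve `P = 0`. -/
noncomputable def Polynomial.tangentDeriv (P S : ℤ[X][X]) : ℤ[X][X] :=
  derivative P * baseDeriv S - baseDeriv P * derivative S

open Polynomial in
/-- The numerators of the iterates of the connection `∂_t + w / a` on the curve `P = 0`. -/
noncomputable def connNum (a : ℤ[X]) (P : ℤ[X][X]) : ℕ → ℤ[X][X]
  | 0 => 1
  | m + 1 => Polynomial.C a * derivative P * tangentDeriv P (connNum a P m)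
      - (m : ℤ[X][X]) * (Polynomial.C (derivative a) * derivative P ^ 2 + 2 * Polynomial.C a *
      tangentDeriv P (derivative P))
        * connNum a P m + Polynomial.X * derivative P ^ 2 * connNum a P m

theorem Derivation.apply_eval₂ {R B : Type*} [CommRing R] [CommRing B] [Algebra R B]
    (δ : Derivation R B B)
    (φ : Polynomial ℤ →+* B) (hφ : ∀ q, δ (φ q) = φ (Polynomial.derivative q)) (w : B)
    (S : Polynomial (Polynomial ℤ)) :
    δ (S.eval₂ φ w) = S.baseDeriv.eval₂ φ w + (Polynomial.derivative S).eval₂ φ w * δ w := by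
  induction S using Polynomial.induction_on' with
  | add S T hS hT =>
    simp only [Polynomial.eval₂_add, map_add, Polynomial.baseDeriv_add, hS, hT]; ring
  | monomial n c =>
    rw [Polynomial.baseDeriv_monomial, Polynomial.derivative_monomial]
    simp only [Polynomial.eval₂_monomial, Derivation.leibniz, Derivation.leibniz_pow, hφ,
      smul_eq_mul, nsmul_eq_mul, map_mul]
    rw [_root_.map_natCast φ n]
    ring

theorem connNum_eval₂ {R B : Type*} [CommRing R] [CommRing B] [Algebra R B]
    (δ : Derivation R B B) (φ : Polynomial ℤ →+* B)
    (hφ : ∀ q, δ (φ q) = φ (Polynomial.derivative q)) {a : Polynomial ℤ}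
    {P : Polynomial (Polynomial ℤ)} {w f : B} (hP : P.eval₂ φ w = 0) (hf : φ a * f = w) (m : ℕ) :
    (φ a * (Polynomial.derivative P).eval₂ φ w ^ 2) ^ m * (fun h => δ h + f * h)^[m] 1 =
      (connNum a P m).eval₂ φ w := by
  have htan : ∀ S : Polynomial (Polynomial ℤ), (Polynomial.tangentDeriv P S).eval₂ φ w =
      (Polynomial.derivative P).eval₂ φ w * δ (S.eval₂ φ w) := by
    intro S
    have h1 := δ.apply_eval₂ φ hφ w P
    rw [hP, map_zero] at h1
    rw [Polynomial.tangentDeriv, δ.apply_eval₂ φ hφ w S, Polynomial.eval₂_sub,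
      Polynomial.eval₂_mul, Polynomial.eval₂_mul]
    linear_combination (Polynomial.derivative S).eval₂ φ w * h1
  induction m with
  | zero => simp [connNum]
  | succ m ih =>
    rw [Function.iterate_succ_apply', connNum]
    simp only [Polynomial.eval₂_add, Polynomial.eval₂_sub, Polynomial.eval₂_mul, htan,
      Polynomial.eval₂_C, Polynomial.eval₂_pow, Polynomial.eval₂_X, Polynomial.eval₂_natCast,
      Polynomial.eval₂_ofNat, ← ih]
    set p := (Polynomial.derivative P).eval₂ φ w
    set G := (fun h => δ h + f * h)^[m] 1
    cases m with
    | zero =>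
      simp only [← hf, zero_add, pow_zero, pow_one, one_mul,
        Nat.cast_zero, zero_mul, sub_zero]
      ring
    | succ m =>
      simp only [Derivation.leibniz, Derivation.leibniz_pow, hφ, smul_eq_mul, nsmul_eq_mul,
        ← hf, Nat.add_sub_cancel]
      push_cast
      ring

end Recursion

section Transfer

theorem intPoly_isTorsionFree : Module.IsTorsionFree (Polynomial ℤ) ℚ⟦X⟧ := by
  rw [Module.isTorsionFree_iff_algebraMap_injective]
  exact intPolyToPS_injective

theorem PowerSeries.eq_zero_of_eval₂_eq_zero_of_degree_lt {w : ℚ⟦X⟧}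
    (hw : IsIntegral (Polynomial ℤ) w) {S : Polynomial (Polynomial ℚ)}
    (hdeg : S.degree < (minpoly (Polynomial ℤ) w).degree)
    (h : S.eval₂ Polynomial.coeToPowerSeries.ringHom w = 0) : S = 0 := by
  have := intPoly_isTorsionFree
  obtain ⟨c, hc, Q, hQ⟩ := Polynomial.exists_clear_denominators_rat S
  have hinj := Polynomial.map_injective (Int.castRingHom ℚ) Int.cast_injective
  have hc' : c.map (Int.castRingHom ℚ) ≠ 0 := by
    rwa [Ne, Polynomial.map_eq_zero_iff Int.cast_injective]
  have h1 : Polynomial.aeval w Q = 0 := by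
    have h1 := congrArg (Polynomial.eval₂ Polynomial.coeToPowerSeries.ringHom w) hQ
    rw [Polynomial.eval₂_mul, h, mul_zero, Polynomial.eval₂_map, ← intPolyToPS_eq] at h1
    exact h1.symm
  have h2 : Q.degree = S.degree := by
    rw [← Polynomial.degree_map_eq_of_injective
      (f := Polynomial.mapRingHom (Int.castRingHom ℚ)) hinj, ← hQ, Polynomial.degree_C_mul hc']
  have h3 : Q = 0 := by
    refine Polynomial.eq_zero_of_dvd_of_degree_lt (minpoly.isIntegrallyClosed_dvd hw h1) ?_
    rwa [h2]
  rw [h3, Polynomial.map_zero, mul_eq_zero, Polynomial.C_eq_zero] at hQ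
  exact hQ.resolve_left hc'

theorem PowerSeries.linearIndependent_X_pow_mul_pow {w : ℚ⟦X⟧}
    (hw : IsIntegral (Polynomial ℤ) w) (J : ℕ) :
    LinearIndependent ℚ (fun x : Fin (J + 1) × Fin (minpoly (Polynomial ℤ) w).natDegree =>
      (X : ℚ⟦X⟧) ^ (x.1 : ℕ) * w ^ (x.2 : ℕ)) := by
  rw [Fintype.linearIndependent_iff]
  intro g hg
  set S : Polynomial (Polynomial ℚ) :=
    ∑ x, Polynomial.monomial (x.2 : ℕ) (Polynomial.monomial (x.1 : ℕ) (g x)) with hS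
  have h0 : S = 0 := by
    refine eq_zero_of_eval₂_eq_zero_of_degree_lt hw ?_ ?_
    · have hm : minpoly (Polynomial ℤ) w ≠ 0 := minpoly.ne_zero hw
      rw [hS]
      refine (Polynomial.degree_sum_le _ _).trans_lt ((Finset.sup_lt_iff ?_).2 fun x _ => ?_)
      · exact bot_lt_iff_ne_bot.2 (by simpa using hm)
      · rw [Polynomial.degree_eq_natDegree hm]
        exact (Polynomial.degree_monomial_le _ _).trans_lt (by exact_mod_cast x.2.2)
    · rw [hS, Polynomial.eval₂_finsetSum, ← hg]
      refine Finset.sum_congr rfl fun x _ => ?_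
      rw [Polynomial.eval₂_monomial, Polynomial.coeToPowerSeries.ringHom_apply,
        Polynomial.coe_monomial, monomial_eq_C_mul_X_pow, smul_eq_C_mul, mul_assoc]
  intro y
  have := congrArg (fun T => (Polynomial.coeff T y.2).coeff y.1) h0
  simp only [hS, Polynomial.finsetSum_coeff, Polynomial.coeff_zero] at this
  rw [Finset.sum_eq_single y] at this
  · simpa using this
  · intro x _ hxy
    rw [Polynomial.coeff_monomial]
    split_ifs with h
    · rw [Polynomial.coeff_monomial, if_neg]
      intro h'
      exact hxy (Prod.ext (Fin.ext h') (Fin.ext h))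
    · simp
  · simp

theorem PowerSeries.exists_dual_coeff {ι : Type*} [Finite ι] [DecidableEq ι] {v : ι → ℚ⟦X⟧}
    (hv : LinearIndependent ℚ v) :
    ∃ c : ι → ℕ →₀ ℚ, ∀ x y, ((c x).sum fun n q => q * coeff n (v y)) = if x = y then 1 else 0 := by
  have h1 : LinearIndependent ℚ (fun (x : ι) (n : ℕ) => coeff n (v x)) := by
    let e : ℚ⟦X⟧ →ₗ[ℚ] (ℕ → ℚ) := LinearMap.pi fun n => coeff n
    have he : LinearMap.ker e = ⊥ := by
      rw [LinearMap.ker_eq_bot']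
      intro m hm
      ext n
      exact congrFun hm n
    exact hv.map' e he
  have h2 := span_flip_eq_top_iff_linearIndependent.2 h1
  have h3 : ∀ x : ι, ∃ c : ℕ →₀ ℚ, (c.sum fun n q => q • (flip (fun (x : ι) (n : ℕ) =>
      coeff n (v x)) n)) = Pi.single x (1 : ℚ) := fun x =>
    Finsupp.mem_span_range_iff_exists_finsupp.1 (h2 ▸ Submodule.mem_top)
  choose c hc using h3
  refine ⟨c, fun x y => ?_⟩
  have := congrFun (hc x) y
  rw [Finsupp.sum, Finset.sum_apply, Pi.single_apply] at this
  simp only [eq_comm (a := y)] at this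
  exact this

end Transfer

section BivariateDegree

open Polynomial Polynomial.Bivariate in
theorem Polynomial.Bivariate.coeff_coeff_swap {R : Type*} [CommRing R] (S : R[X][Y]) (i j : ℕ) :
    ((swap S).coeff j).coeff i = (S.coeff i).coeff j := by
  induction S using Polynomial.induction_on' with
  | add S T hS hT => simp only [map_add, coeff_add, hS, hT]
  | monomial n q =>
    induction q using Polynomial.induction_on' with
    | add q r hq hr => simp only [map_add, coeff_add, hq, hr]
    | monomial m r =>
      rw [swap_monomial_monomial, coeff_monomial, coeff_monomial]
      split_ifs <;> simp_all [coeff_monomial]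

open Polynomial Polynomial.Bivariate in
theorem Polynomial.Bivariate.natDegree_swap_le {R : Type*} [CommRing R] {S : R[X][Y]} {J : ℕ} :
    (swap S).natDegree ≤ J ↔ ∀ i, (S.coeff i).natDegree ≤ J := by
  constructor
  · intro h i
    rw [natDegree_le_iff_coeff_eq_zero]
    intro j hj
    rw [← coeff_coeff_swap, coeff_eq_zero_of_natDegree_lt (h.trans_lt hj), coeff_zero]
  · intro h
    rw [natDegree_le_iff_coeff_eq_zero]
    intro j hj
    ext i
    rw [coeff_coeff_swap, coeff_eq_zero_of_natDegree_lt ((h i).trans_lt hj), coeff_zero]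

open Polynomial Polynomial.Bivariate in
theorem Polynomial.Bivariate.natDegree_coeff_le_of_dvd {R : Type*} [CommRing R] [IsDomain R]
    {G P : R[X][Y]} (hP : P ≠ 0) (h : G ∣ P) {J : ℕ} (hJ : ∀ i, (P.coeff i).natDegree ≤ J)
    (i : ℕ) : (G.coeff i).natDegree ≤ J := by
  have h1 : swap G ∣ swap P := by
    obtain ⟨T, rfl⟩ := h
    exact ⟨swap T, map_mul swap G T⟩
  exact natDegree_swap_le.1 ((natDegree_le_of_dvd h1 ((map_ne_zero_iff swap (swap (R :=
    R)).injective).2 hP)).trans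
    (natDegree_swap_le.2 hJ)) i

end BivariateDegree

section TransferModP

open PowerSeries in
theorem PowerSeries.eval₂_eq_sum_coeff {R : Type*} [CommRing R] (G : Polynomial (Polynomial R))
    (W : R⟦X⟧) {d J : ℕ} (hd : G.natDegree < d) (hJ : ∀ i, (G.coeff i).natDegree ≤ J) :
    G.eval₂ Polynomial.coeToPowerSeries.ringHom W =
      ∑ x : Fin (J + 1) × Fin d, C ((G.coeff x.2).coeff x.1) * (X ^ (x.1 : ℕ) * W ^ (x.2 : ℕ)) := by
  rw [Polynomial.eval₂_eq_sum_range' _ hd, Fintype.sum_prod_type_right,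
    ← Fin.sum_univ_eq_sum_range (fun i => Polynomial.coeToPowerSeries.ringHom (G.coeff i) * W ^ i)]
  refine Finset.sum_congr rfl fun i _ => ?_
  conv_lhs => rw [(G.coeff i).as_sum_range' (J + 1) (Nat.lt_succ_of_le (hJ i))]
  rw [map_sum, Finset.sum_mul, ← Fin.sum_univ_eq_sum_range
    (fun j => Polynomial.coeToPowerSeries.ringHom
      (Polynomial.monomial j ((G.coeff i).coeff j)) * W ^ (i : ℕ))]
  refine Finset.sum_congr rfl fun j _ => ?_
  rw [Polynomial.coeToPowerSeries.ringHom_apply, Polynomial.coe_monomial,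
    monomial_eq_C_mul_X_pow, mul_assoc]

theorem memZp_of_den_lt {p : ℕ} {q : ℚ} (h : q.den < p) : MemZp p q := fun hd =>
  absurd (Nat.le_of_dvd q.pos hd) (not_le.2 h)

/-- For all but finitely many primes `p`, the reduction modulo `p` of the minimal polynomial of `w`
is the minimal polynomial of the reduction of `w`. -/
theorem PowerSeries.exists_forall_eq_zero_of_eval₂_toZMod {w : ℚ⟦X⟧}
    (hw : IsIntegral (Polynomial ℤ) w) :
    ∃ B : ℕ, ∀ (p : ℕ) [Fact p.Prime], B ≤ p → ∀ W : ℤ_[p]⟦X⟧,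
      map PadicInt.Coe.ringHom W = map (algebraMap ℚ ℚ_[p]) w →
      ∀ S : Polynomial (Polynomial (ZMod p)),
        S.degree < (minpoly (Polynomial ℤ) w).natDegree →
        S.eval₂ Polynomial.coeToPowerSeries.ringHom (map PadicInt.toZMod W) = 0 → S = 0 := by
  have := intPoly_isTorsionFree
  set P := minpoly (Polynomial ℤ) w with hPdef
  have hPm : P.Monic := minpoly.monic hw
  set δ := P.natDegree with hδ
  set J := (Polynomial.Bivariate.swap P).natDegree with hJ
  have hJ' : ∀ i, (P.coeff i).natDegree ≤ J := Polynomial.Bivariate.natDegree_swap_le.1 le_rfl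
  obtain ⟨c, hc⟩ := exists_dual_coeff (linearIndependent_X_pow_mul_pow hw J)
  refine ⟨1 + ∑ x, ∑ n ∈ (c x).support, (c x n).den, fun p _ hp W hW S hS hS0 => ?_⟩
  have hden : ∀ x n, MemZp p (c x n) := by
    intro x n
    by_cases hn : n ∈ (c x).support
    · apply memZp_of_den_lt
      have h1 : (c x n).den ≤ ∑ n ∈ (c x).support, (c x n).den :=
        Finset.single_le_sum (f := fun n => (c x n).den) (fun _ _ => Nat.zero_le _) hn
      have h2 : ∑ n ∈ (c x).support, (c x n).den ≤ ∑ x, ∑ n ∈ (c x).support, (c x n).den :=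
        Finset.single_le_sum (f := fun x => ∑ n ∈ (c x).support, (c x n).den)
          (fun _ _ => Nat.zero_le _) (Finset.mem_univ x)
      omega
    · rw [Finsupp.notMem_support_iff.1 hn]
      apply memZp_of_den_lt
      simpa using (Fact.out : p.Prime).one_lt
  choose z hz using fun x n => (hden x n).exists_padicInt
  set Wb := map PadicInt.toZMod W with hWb
  have hcoe : ∀ (n i j : ℕ), ((coeff n ((X : ℤ_[p]⟦X⟧) ^ i * W ^ j) : ℤ_[p]) : ℚ_[p]) =
      algebraMap ℚ ℚ_[p] (coeff n ((X : ℚ⟦X⟧) ^ i * w ^ j)) := by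
    intro n i j
    have h1 : map PadicInt.Coe.ringHom ((X : ℤ_[p]⟦X⟧) ^ i * W ^ j) =
        map (algebraMap ℚ ℚ_[p]) ((X : ℚ⟦X⟧) ^ i * w ^ j) := by
      simp only [map_mul, map_pow, hW, map_X]
    have h2 := congrArg (coeff n) h1
    rwa [coeff_map, coeff_map] at h2
  have hred : ∀ (n i j : ℕ), PadicInt.toZMod (coeff n ((X : ℤ_[p]⟦X⟧) ^ i * W ^ j) : ℤ_[p]) =
      coeff n ((X : (ZMod p)⟦X⟧) ^ i * Wb ^ j) := by
    intro n i j
    have h1 : map PadicInt.toZMod ((X : ℤ_[p]⟦X⟧) ^ i * W ^ j) = X ^ i * Wb ^ j := by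
      simp only [map_mul, map_pow, map_X, hWb]
    rw [← h1, coeff_map]
  have hdual : ∀ x y : Fin (J + 1) × Fin δ, (∑ n ∈ (c x).support, PadicInt.toZMod (z x n) *
      coeff n ((X : (ZMod p)⟦X⟧) ^ (y.1 : ℕ) * Wb ^ (y.2 : ℕ))) = if x = y then 1 else 0 := by
    intro x y
    have h1 : (∑ n ∈ (c x).support, z x n *
        coeff n ((X : ℤ_[p]⟦X⟧) ^ (y.1 : ℕ) * W ^ (y.2 : ℕ))) = if x = y then 1 else 0 := by
      apply Subtype.val_injective
      change PadicInt.Coe.ringHom _ = PadicInt.Coe.ringHom _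
      rw [map_sum]
      have h2 := congrArg (algebraMap ℚ ℚ_[p]) (hc x y)
      rw [Finsupp.sum, map_sum] at h2
      convert h2 using 1
      · refine Finset.sum_congr rfl fun n _ => ?_
        rw [map_mul PadicInt.Coe.ringHom, map_mul (algebraMap ℚ ℚ_[p]),
          PadicInt.coe_ringHom_apply, PadicInt.coe_ringHom_apply, hz, hcoe]
        rfl
      · split_ifs <;> simp
    have h3 := congrArg PadicInt.toZMod h1
    rw [map_sum] at h3
    convert h3 using 1
    · refine Finset.sum_congr rfl fun n _ => ?_
      rw [map_mul PadicInt.toZMod, hred]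
    · split_ifs <;> simp
  set Pb := P.map (Polynomial.mapRingHom (Int.castRingHom (ZMod p))) with hPb
  have hPbm : Pb.Monic := hPm.map _
  have hev : ∀ Q : Polynomial (Polynomial ℤ), Polynomial.eval₂ intPolyToPS w Q = 0 →
      (Q.map (Polynomial.mapRingHom (Int.castRingHom (ZMod p)))).eval₂
        Polynomial.coeToPowerSeries.ringHom Wb = 0 := by
    intro Q hQ
    have h1 : Q.eval₂ (Polynomial.coeToPowerSeries.ringHom.comp
        (Polynomial.mapRingHom (Int.castRingHom ℤ_[p]))) W = 0 := by
      apply map_padicInt_injective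
      rw [Polynomial.hom_eval₂, map_zero, hW]
      have h2 := congrArg (map (algebraMap ℚ ℚ_[p])) hQ
      rw [Polynomial.hom_eval₂, map_zero] at h2
      convert h2 using 2
      rw [intPolyToPS_eq]
      apply Polynomial.ringHom_ext'
      · exact RingHom.ext_int _ _
      · simp
    have h3 := congrArg (map PadicInt.toZMod) h1
    rw [Polynomial.hom_eval₂, map_zero] at h3
    rw [Polynomial.eval₂_map]
    convert h3 using 2
    apply Polynomial.ringHom_ext'
    · exact RingHom.ext_int _ _
    · simp
  have hPb0 : Pb.eval₂ Polynomial.coeToPowerSeries.ringHom Wb = 0 := hev P (minpoly.aeval _ _)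
  have hJb : ∀ i, (Pb.coeff i).natDegree ≤ J := fun i => by
    rw [hPb, Polynomial.coeff_map, Polynomial.coe_mapRingHom]
    exact Polynomial.natDegree_map_le.trans (hJ' i)
  have halg : (algebraMap (Polynomial (ZMod p)) (ZMod p)⟦X⟧) =
      Polynomial.coeToPowerSeries.ringHom := by
    apply Polynomial.ringHom_ext'
    · exact Subsingleton.elim _ _
    · simp [PowerSeries.algebraMap_apply']
  have htf : Module.IsTorsionFree (Polynomial (ZMod p)) (ZMod p)⟦X⟧ := by
    rw [Module.isTorsionFree_iff_algebraMap_injective, halg]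
    exact Polynomial.coe_injective (ZMod p)
  have hI : IsIntegral (Polynomial (ZMod p)) Wb := ⟨Pb, hPbm, by rw [halg]; exact hPb0⟩
  set G := minpoly (Polynomial (ZMod p)) Wb with hG
  have hGm : G.Monic := minpoly.monic hI
  have hGP : G ∣ Pb := minpoly.isIntegrallyClosed_dvd hI (by
    rw [Polynomial.aeval_def, halg]; exact hPb0)
  have hGS : G ∣ S := minpoly.isIntegrallyClosed_dvd hI (by
    rw [Polynomial.aeval_def, halg]; exact hS0)
  have hG0 : G.eval₂ Polynomial.coeToPowerSeries.ringHom Wb = 0 := by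
    rw [← halg]; exact minpoly.aeval _ _
  by_cases hlt : G.natDegree < δ
  · exfalso
    rw [eval₂_eq_sum_coeff G Wb hlt (Polynomial.Bivariate.natDegree_coeff_le_of_dvd hPbm.ne_zero
      hGP hJb)] at hG0
    set x₀ : Fin (J + 1) × Fin δ := (0, ⟨G.natDegree, hlt⟩) with hx₀
    have h1 : ∑ y : Fin (J + 1) × Fin δ, (G.coeff y.2).coeff y.1 * (∑ n ∈ (c x₀).support,
        PadicInt.toZMod (z x₀ n) *
      coeff n ((X : (ZMod p)⟦X⟧) ^ (y.1 : ℕ) * Wb ^ (y.2 : ℕ))) = 0 := by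
      simp only [Finset.mul_sum]
      rw [Finset.sum_comm]
      refine Finset.sum_eq_zero fun n _ => ?_
      have h2 := congrArg (fun F => PadicInt.toZMod (z x₀ n) * coeff n F) hG0
      simp only [map_sum, coeff_C_mul, Finset.mul_sum, map_zero, mul_zero] at h2
      rw [← h2]
      exact Finset.sum_congr rfl fun y _ => by ring
    simp only [hdual, mul_ite, mul_one, mul_zero, Finset.sum_ite_eq, Finset.mem_univ, if_true] at h1
    simp [hx₀, hGm.coeff_natDegree] at h1
  · refine Polynomial.eq_zero_of_dvd_of_degree_lt hGS (hS.trans_le ?_)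
    rw [Polynomial.degree_eq_natDegree hGm.ne_zero]
    exact_mod_cast not_lt.1 hlt

theorem C_C_pow_dvd_of_eval₂ {p : ℕ} [Fact p.Prime] {W : ℤ_[p]⟦X⟧} {δ : ℕ}
    (hW : ∀ S : Polynomial (Polynomial (ZMod p)), S.degree < δ →
      S.eval₂ Polynomial.coeToPowerSeries.ringHom (map PadicInt.toZMod W) = 0 → S = 0)
    (k : ℕ) (S : Polynomial (Polynomial ℤ)) (hS : S.degree < δ) (V : ℤ_[p]⟦X⟧)
    (h : S.eval₂ (Polynomial.coeToPowerSeries.ringHom.comp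
        (Polynomial.mapRingHom (Int.castRingHom ℤ_[p]))) W = C ((p : ℤ_[p]) ^ k) * V) :
    Polynomial.C (Polynomial.C ((p : ℤ) ^ k)) ∣ S := by
  induction k generalizing S V with
  | zero => simp
  | succ k ih =>
    set φ := (Polynomial.coeToPowerSeries.ringHom (R := ℤ_[p])).comp
        (Polynomial.mapRingHom (Int.castRingHom ℤ_[p])) with hφ
    have h1 : S.map (Polynomial.mapRingHom (Int.castRingHom (ZMod p))) = 0 := by
      refine hW _ (Polynomial.degree_map_le.trans_lt hS) ?_
      rw [Polynomial.eval₂_map]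
      have h3 := congrArg (map PadicInt.toZMod) h
      rw [Polynomial.hom_eval₂, map_mul, map_C, map_pow, _root_.map_natCast, CharP.cast_eq_zero,
        zero_pow (by omega), map_zero, zero_mul] at h3
      convert h3 using 2
      apply Polynomial.ringHom_ext'
      · exact RingHom.ext_int _ _
      · simp [hφ]
    have h2 : Polynomial.C (Polynomial.C (p : ℤ)) ∣ S := by
      rw [Polynomial.C_dvd_iff_dvd_coeff]
      intro i
      rw [Polynomial.C_dvd_iff_dvd_coeff]
      intro j
      have := congrArg (fun T => (Polynomial.coeff T i).coeff j) h1
      simp only [Polynomial.coeff_map, Polynomial.coe_mapRingHom, Polynomial.coeff_zero] at this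
      exact (ZMod.intCast_zmod_eq_zero_iff_dvd _ _).1 this
    obtain ⟨S', rfl⟩ := h2
    have hp0 : (p : ℤ) ≠ 0 := by exact_mod_cast (Fact.out : p.Prime).ne_zero
    have hp1 : Polynomial.C (p : ℤ) ≠ 0 := by simpa using hp0
    rw [Polynomial.degree_C_mul hp1] at hS
    have hφp : φ (Polynomial.C (p : ℤ)) = C (p : ℤ_[p]) := by simp [hφ]
    rw [Polynomial.eval₂_mul, Polynomial.eval₂_C, hφp, pow_succ', map_mul, mul_assoc] at h
    have hne : (C (p : ℤ_[p]) : ℤ_[p]⟦X⟧) ≠ 0 := by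
      rw [Ne, map_eq_zero_iff _ C_injective]
      exact_mod_cast (Fact.out : p.Prime).ne_zero
    obtain ⟨T, hT⟩ := ih S' hS V (mul_left_cancel₀ hne h)
    exact ⟨T, by rw [hT, pow_succ', map_mul, map_mul]; ring⟩

end TransferModP

section BidegreeGrowth

open Polynomial

/-- Both partial degrees of `S` are at most `k`. -/
def Polynomial.BidegreeLE (k : ℕ) (S : ℤ[X][X]) : Prop :=
  S.natDegree ≤ k ∧ ∀ i, (S.coeff i).natDegree ≤ k

namespace Polynomial.BidegreeLE

variable {k l : ℕ} {S T : ℤ[X][X]}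

theorem mono (h : BidegreeLE k S) (hkl : k ≤ l) : BidegreeLE l S :=
  ⟨h.1.trans hkl, fun i => (h.2 i).trans hkl⟩

theorem add (hS : BidegreeLE k S) (hT : BidegreeLE k T) : BidegreeLE k (S + T) :=
  ⟨(natDegree_add_le _ _).trans (max_le hS.1 hT.1), fun i => by
    rw [coeff_add]; exact (natDegree_add_le _ _).trans (max_le (hS.2 i) (hT.2 i))⟩

theorem neg (hS : BidegreeLE k S) : BidegreeLE k (-S) :=
  ⟨by rw [natDegree_neg]; exact hS.1, fun i => by rw [coeff_neg, natDegree_neg]; exact hS.2 i⟩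

theorem sub (hS : BidegreeLE k S) (hT : BidegreeLE k T) : BidegreeLE k (S - T) := by
  rw [sub_eq_add_neg]; exact hS.add hT.neg

theorem mul (hS : BidegreeLE k S) (hT : BidegreeLE l T) : BidegreeLE (k + l) (S * T) :=
  ⟨natDegree_mul_le.trans (add_le_add hS.1 hT.1), fun i => by
    rw [coeff_mul]
    exact natDegree_sum_le_of_forall_le _ _ fun x _ =>
      natDegree_mul_le.trans (add_le_add (hS.2 _) (hT.2 _))⟩

theorem natCast (n : ℕ) : BidegreeLE 0 (n : ℤ[X][X]) :=
  ⟨by simp, fun i => by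
    rw [coeff_natCast_ite]
    split_ifs
    · simp
    · simp⟩

theorem derivative (hS : BidegreeLE k S) : BidegreeLE k (derivative S) :=
  ⟨(natDegree_derivative_le _).trans ((Nat.sub_le _ _).trans hS.1), fun i => by
    rw [coeff_derivative]
    refine natDegree_mul_le.trans ?_
    have : ((i : ℤ[X]) + 1).natDegree = 0 := by
      rw [← Nat.cast_succ]; exact natDegree_natCast _
    rw [this]
    exact hS.2 _⟩

theorem coeff_baseDeriv (S : ℤ[X][X]) (i : ℕ) :
    (baseDeriv S).coeff i = Polynomial.derivative (S.coeff i) := by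
  induction S using Polynomial.induction_on' with
  | add S T hS hT => rw [baseDeriv_add, coeff_add, coeff_add, hS, hT, map_add]
  | monomial n c =>
    rw [baseDeriv_monomial, coeff_monomial, coeff_monomial]
    split_ifs <;> simp

theorem baseDeriv (hS : BidegreeLE k S) : BidegreeLE k (baseDeriv S) :=
  ⟨by
    rw [natDegree_le_iff_coeff_eq_zero]
    intro j hj
    rw [coeff_baseDeriv, coeff_eq_zero_of_natDegree_lt (hS.1.trans_lt hj), map_zero], fun i => by
    rw [coeff_baseDeriv]
    exact (natDegree_derivative_le _).trans ((Nat.sub_le _ _).trans (hS.2 i))⟩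

theorem exists_bidegreeLE (S : ℤ[X][X]) : ∃ k, BidegreeLE k S :=
  ⟨max S.natDegree (Bivariate.swap S).natDegree, le_max_left _ _, fun i =>
    (Bivariate.natDegree_swap_le.1 le_rfl i).trans (le_max_right _ _)⟩

end Polynomial.BidegreeLE

theorem exists_bidegreeLE_connNum (a : ℤ[X]) (P : ℤ[X][X]) :
    ∃ k : ℕ, ∀ m, BidegreeLE (k * m) (connNum a P m) := by
  obtain ⟨k₁, h₁⟩ := BidegreeLE.exists_bidegreeLE P
  obtain ⟨k₂, h₂⟩ := BidegreeLE.exists_bidegreeLE (C a)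
  obtain ⟨k₃, h₃⟩ := BidegreeLE.exists_bidegreeLE (C (derivative a))
  obtain ⟨k₄, h₄⟩ := BidegreeLE.exists_bidegreeLE (X : ℤ[X][X])
  set k := k₁ + k₂ + k₃ + k₄
  replace h₁ : BidegreeLE k P := h₁.mono (by omega)
  replace h₂ : BidegreeLE k (C a) := h₂.mono (by omega)
  replace h₃ : BidegreeLE k (C (derivative a)) := h₃.mono (by omega)
  replace h₄ : BidegreeLE k (X : ℤ[X][X]) := h₄.mono (by omega)
  have htan : ∀ {l : ℕ} {S : ℤ[X][X]}, BidegreeLE l S →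
      BidegreeLE (k + l) (tangentDeriv P S) := fun h =>
    (h₁.derivative.mul h.baseDeriv).sub (h₁.baseDeriv.mul h.derivative)
  have hP2 : BidegreeLE (k + k) (derivative P ^ 2) := by
    rw [sq]; exact h₁.derivative.mul h₁.derivative
  have h2 : BidegreeLE 0 (2 : ℤ[X][X]) := by exact_mod_cast BidegreeLE.natCast 2
  refine ⟨3 * k, fun m => ?_⟩
  induction m with
  | zero => simpa [connNum] using BidegreeLE.natCast 1
  | succ m ih =>
    rw [connNum]
    have h5 : BidegreeLE (3 * k) (Polynomial.C (derivative a) * derivative P ^ 2 +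
        2 * Polynomial.C a * tangentDeriv P (derivative P)) :=
      ((h₃.mul hP2).mono (by omega)).add
        (((h2.mul h₂).mul (htan h₁.derivative)).mono (by omega))
    have e : 3 * k * (m + 1) = 3 * k + 3 * k * m := by ring
    rw [e]
    exact ((((h₂.mul h₁.derivative).mul (htan ih)).mono (by omega)).sub
      ((((BidegreeLE.natCast m).mul h5).mul ih).mono (by omega))).add
      (((h₄.mul hP2).mul ih).mono (by omega))

end BidegreeGrowth

section Divisibility

theorem exists_dvd_connNum_modByMonic {a : ℕ → ℚ} {f : ℚ⟦X⟧}
    (hf : f = PowerSeries.mk fun k => a (k + 1)) (halg : IsAlgebraicPS f)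
    (hb : ∃ B : ℕ, ∀ p : ℕ, p.Prime → B ≤ p → ∀ n : ℕ, 1 ≤ n → MemPZp p (a (n * p) - a n))
    {q : Polynomial ℤ} (hq : IsIntegral (Polynomial ℤ) (intPolyToPS q * f)) :
    ∃ B : ℕ, ∀ p : ℕ, p.Prime → B ≤ p → ∀ m,
      Polynomial.C (Polynomial.C ((p : ℤ) ^ (m / p))) ∣
        connNum q (minpoly (Polynomial ℤ) (intPolyToPS q * f)) m %ₘ
          minpoly (Polynomial ℤ) (intPolyToPS q * f) := by
  set w := intPolyToPS q * f with hw
  set P := minpoly (Polynomial ℤ) w with hPdef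
  have hPm : P.Monic := minpoly.monic hq
  obtain ⟨B₁, hB₁⟩ := hb
  obtain ⟨B₂, hB₂⟩ := exists_forall_eq_zero_of_eval₂_toZMod hq
  obtain ⟨A, hA0, hA⟩ := (eisensteinSubring_isFixClosed).mem_of_isAlgebraicPS halg
  refine ⟨B₁ + B₂ + A + 1, fun p hp hpB m => ?_⟩
  have : Fact p.Prime := ⟨hp⟩
  obtain ⟨F, hF⟩ := exists_padicInt_lift (fun n => DenBound.memZp hp hA hA0 (by omega) n)
  set φ := (Polynomial.coeToPowerSeries.ringHom (R := ℤ_[p])).comp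
    (Polynomial.mapRingHom (Int.castRingHom ℤ_[p])) with hφ
  have hφw : (map PadicInt.Coe.ringHom).comp φ = (map (algebraMap ℚ ℚ_[p])).comp intPolyToPS := by
    rw [intPolyToPS_eq]
    apply Polynomial.ringHom_ext'
    · exact RingHom.ext_int _ _
    · simp [hφ]
  set W := φ q * F with hW
  have hWw : map PadicInt.Coe.ringHom W = map (algebraMap ℚ ℚ_[p]) w := by
    rw [hW, hw, map_mul, map_mul, hF]
    congr 1
    exact RingHom.congr_fun hφw q
  have hPW : P.eval₂ φ W = 0 := by
    apply map_padicInt_injective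
    rw [Polynomial.hom_eval₂, map_zero, hWw, hφw, ← Polynomial.hom_eval₂]
    have : P.eval₂ intPolyToPS w = 0 := minpoly.aeval _ _
    rw [this, map_zero]
  have hFb : ∀ n, 1 ≤ n → (p : ℤ_[p]) ∣ coeff (n * p) (X * F) - coeff n (X * F) := by
    have hc : ∀ n, 1 ≤ n → ((coeff n (X * F) : ℤ_[p]) : ℚ_[p]) = a n := by
      intro n hn
      obtain ⟨n, rfl⟩ := Nat.exists_eq_succ_of_ne_zero (by omega : n ≠ 0)
      have h1 := congrArg (coeff n) hF
      rw [coeff_map, coeff_map, hf, coeff_mk] at h1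
      rw [Nat.succ_eq_add_one, coeff_succ_X_mul]
      exact h1
    intro n hn
    obtain ⟨y, hy, hya⟩ := hB₁ p hp (by omega) n hn
    obtain ⟨z, hz⟩ := hy.exists_padicInt
    refine ⟨z, ?_⟩
    apply Subtype.val_injective
    have h2 := congrArg (fun x : ℚ => (x : ℚ_[p])) hya
    push_cast at h2
    rw [PadicInt.coe_sub, hc _ hn, hc _ (Nat.mul_pos hn hp.pos), PadicInt.coe_mul, hz, h2]
    rfl
  obtain ⟨V, hV⟩ := PadicInt.conn_iterate_dvd hFb m
  have hδ : ∀ r, derivative ℤ_[p] (φ r) = φ (Polynomial.derivative r) := by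
    intro r
    rw [hφ, RingHom.comp_apply, RingHom.comp_apply, Polynomial.coeToPowerSeries.ringHom_apply,
      Polynomial.coeToPowerSeries.ringHom_apply, derivative_coe, Polynomial.coe_mapRingHom,
      Polynomial.derivative_map]
  have h1 := connNum_eval₂ (f := F) (derivative ℤ_[p]) φ hδ hPW rfl m
  refine C_C_pow_dvd_of_eval₂ (δ := P.natDegree) (W := W)
    (fun S hS hS0 => hB₂ p (by omega) W hWw S hS hS0) (m / p) _ ?_
    ((φ q * (Polynomial.derivative P).eval₂ φ W ^ 2) ^ m * V) ?_
  · rw [← Polynomial.degree_eq_natDegree hPm.ne_zero]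
    exact Polynomial.degree_modByMonic_lt _ hPm
  · rw [Polynomial.modByMonic_eq_sub_mul_div, Polynomial.eval₂_sub, Polynomial.eval₂_mul,
      hPW, zero_mul, sub_zero, ← h1, mul_left_comm, ← hV]
    rfl

/-- The product of the prime powers `p ^ ⌊m / p⌋` over the primes `B ≤ p ≤ m`. -/
def primeFloorProd (B m : ℕ) : ℕ := ∏ p ∈ (Finset.Icc B m).filter Nat.Prime, p ^ (m / p)

theorem C_C_primeFloorProd_dvd {B m : ℕ} {S : Polynomial (Polynomial ℤ)}
    (h : ∀ p : ℕ, p.Prime → B ≤ p → Polynomial.C (Polynomial.C ((p : ℤ) ^ (m / p))) ∣ S) :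
    Polynomial.C (Polynomial.C (primeFloorProd B m : ℤ)) ∣ S := by
  rw [Polynomial.C_dvd_iff_dvd_coeff]
  intro i
  rw [Polynomial.C_dvd_iff_dvd_coeff]
  intro j
  rw [primeFloorProd, Nat.cast_prod]
  refine Finset.prod_dvd_of_coprime ?_ fun p hp => ?_
  · intro p hp r hr hne
    simp only [Finset.coe_filter, Set.mem_ofPred_eq] at hp hr
    simp only [Function.onFun, Nat.cast_pow]
    exact IsCoprime.pow (Nat.isCoprime_iff_coprime.2 ((Nat.coprime_primes hp.2 hr.2).2 hne))
  · simp only [Finset.mem_filter, Finset.mem_Icc] at hp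
    have := h p hp.2 hp.1.1
    rw [Polynomial.C_dvd_iff_dvd_coeff] at this
    have := this i
    rw [Polynomial.C_dvd_iff_dvd_coeff] at this
    simpa using this j

end Divisibility

section FactorialQuotient

open Nat

theorem primeFloorProd_pos (B m : ℕ) : 0 < primeFloorProd B m :=
  Finset.prod_pos fun _ hp => pow_pos (Finset.mem_filter.1 hp).2.pos _

theorem factorization_primeFloorProd {B m p : ℕ} (hp : p.Prime) :
    (primeFloorProd B m).factorization p = if B ≤ p then m / p else 0 := by
  rw [primeFloorProd, Nat.factorization_prod_apply
    fun q hq => (pow_pos (Finset.mem_filter.1 hq).2.pos _).ne']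
  have h1 : ∀ q ∈ (Finset.Icc B m).filter Nat.Prime, (q ^ (m / q)).factorization p =
      if q = p then m / p else 0 := by
    intro q hq
    rw [(Finset.mem_filter.1 hq).2.factorization_pow, Finsupp.single_apply]
    split_ifs with h
    · rw [h]
    · rfl
  rw [Finset.sum_congr rfl h1, Finset.sum_ite_eq']
  simp only [Finset.mem_filter, Finset.mem_Icc, hp, and_true]
  by_cases h : p ≤ m
  · simp [h]
  · simp [h, Nat.div_eq_of_lt (not_le.1 h)]

theorem factorization_factorial_eq_div_add {m p : ℕ} (hp : p.Prime) :
    (m !).factorization p = m / p + ((m / p)!).factorization p := by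
  have : Fact p.Prime := ⟨hp⟩
  rw [Nat.factorization_def _ hp, Nat.factorization_def _ hp]
  conv_lhs => rw [← Nat.div_add_mod m p]
  rw [padicValNat_factorial_mul_add _ (Nat.mod_lt _ hp.pos), padicValNat_factorial_mul, add_comm]

theorem primeFloorProd_dvd_factorial (B m : ℕ) : primeFloorProd B m ∣ m ! := by
  rw [← Nat.factorization_prime_le_iff_dvd (primeFloorProd_pos B m).ne' (factorial_ne_zero m)]
  intro p hp
  rw [factorization_primeFloorProd hp, factorization_factorial_eq_div_add hp]
  split_ifs
  · exact Nat.le_add_right _ _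
  · exact Nat.zero_le _

/-- The quotient of `m!` by the product of the prime powers `p ^ ⌊m / p⌋` for `B ≤ p`. -/
def factorialQuot (B m : ℕ) : ℕ := m ! / primeFloorProd B m

theorem factorialQuot_mul (B m : ℕ) : factorialQuot B m * primeFloorProd B m = m ! :=
  Nat.div_mul_cancel (primeFloorProd_dvd_factorial B m)

theorem factorialQuot_pos (B m : ℕ) : 0 < factorialQuot B m :=
  Nat.div_pos (Nat.le_of_dvd (factorial_pos m) (primeFloorProd_dvd_factorial B m))
    (primeFloorProd_pos B m)

theorem factorialQuot_zero (B : ℕ) : factorialQuot B 0 = 1 := by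
  have := factorialQuot_mul B 0
  rw [factorial_zero] at this
  exact Nat.eq_one_of_mul_eq_one_right this

theorem factorization_factorialQuot {B m p : ℕ} (hp : p.Prime) :
    (factorialQuot B m).factorization p = ((if B ≤ p then m / p else m)!).factorization p := by
  have h := congrArg (fun x => x.factorization p) (factorialQuot_mul B m)
  simp only [Nat.factorization_mul (factorialQuot_pos B m).ne' (primeFloorProd_pos B m).ne',
    Finsupp.add_apply, factorization_primeFloorProd hp] at h
  split_ifs at h ⊢ with hB
  · have := factorization_factorial_eq_div_add (m := m) hp
    omega
  · omega

theorem factorialQuot_mul_dvd (B k l : ℕ) :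
    factorialQuot B k * factorialQuot B l ∣ factorialQuot B (k + l) := by
  rw [← Nat.factorization_prime_le_iff_dvd
    (mul_pos (factorialQuot_pos B k) (factorialQuot_pos B l)).ne' (factorialQuot_pos B _).ne']
  intro p hp
  rw [Nat.factorization_mul (factorialQuot_pos B k).ne' (factorialQuot_pos B l).ne',
    Finsupp.add_apply, factorization_factorialQuot hp, factorization_factorialQuot hp,
    factorization_factorialQuot hp, ← Finsupp.add_apply,
    ← Nat.factorization_mul (factorial_ne_zero _) (factorial_ne_zero _)]
  refine (Nat.factorization_prime_le_iff_dvd (mul_ne_zero (factorial_ne_zero _)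
    (factorial_ne_zero _)) (factorial_ne_zero _)).2
    ((factorial_mul_factorial_dvd_factorial_add _ _).trans (factorial_dvd_factorial ?_)) p hp
  split_ifs
  · exact Nat.div_add_div_le_add_div
  · exact le_rfl

theorem factorization_factorialQuot_le {B m p : ℕ} (hp : p.Prime) :
    ((factorialQuot B m).factorization p : ℝ) ≤ 2 * (B + 1) ^ 2 * m / p ^ 2 := by
  have : Fact p.Prime := ⟨hp⟩
  have hp2 : (2 : ℝ) ≤ p := by exact_mod_cast hp.two_le
  have h1 : ∀ n : ℕ, ((n !).factorization p : ℝ) ≤ 2 * n / p := by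
    intro n
    rw [Nat.factorization_def _ hp]
    have h2 : (p - 1) * padicValNat p (n !) ≤ n := by
      rw [sub_one_mul_padicValNat_factorial]; exact Nat.sub_le _ _
    have h3 : ((p : ℝ) - 1) * padicValNat p (n !) ≤ n := by
      have := (Nat.cast_le (α := ℝ)).2 h2
      rwa [Nat.cast_mul, Nat.cast_sub hp.one_le, Nat.cast_one] at this
    rw [le_div_iff₀ (by linarith)]
    have h4 : (0 : ℝ) ≤ padicValNat p (n !) := Nat.cast_nonneg _
    nlinarith
  rw [factorization_factorialQuot hp]
  refine (h1 _).trans ?_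
  rw [div_le_div_iff₀ (by linarith) (by positivity)]
  split_ifs with hB
  · have h5 : ((m / p : ℕ) : ℝ) * p ≤ m := by exact_mod_cast Nat.div_mul_le_self m p
    have h6 : (m : ℝ) ≤ (B + 1) ^ 2 * m :=
      le_mul_of_one_le_left (Nat.cast_nonneg _) (by nlinarith [Nat.cast_nonneg (α := ℝ) B])
    nlinarith
  · have hB' : (p : ℝ) ≤ B + 1 := by exact_mod_cast (by omega : p ≤ B + 1)
    have h7 : (p : ℝ) ^ 2 ≤ (B + 1) ^ 2 := by gcongr
    have h8 : (1 : ℝ) ≤ p := by linarith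
    have h9 : (m : ℝ) * p ^ 2 ≤ (m : ℝ) * (B + 1) ^ 2 := by gcongr
    calc 2 * (m : ℝ) * p ^ 2 ≤ 2 * (B + 1) ^ 2 * m := by linarith
      _ ≤ _ := le_mul_of_one_le_right (by positivity) h8

theorem exists_factorialQuot_le (B : ℕ) : ∃ C : ℝ, 1 ≤ C ∧
    ∀ m, (factorialQuot B m : ℝ) ≤ C ^ m := by
  have hs : Summable fun n : ℕ => 4 * ((B : ℝ) + 1) ^ 2 * (1 / (n : ℝ) ^ (3 / 2 : ℝ)) :=
    (Real.summable_one_div_nat_rpow.2 (by norm_num)).mul_left _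
  set c := ∑' n : ℕ, 4 * ((B : ℝ) + 1) ^ 2 * (1 / (n : ℝ) ^ (3 / 2 : ℝ)) with hc
  have hc0 : 0 ≤ c := tsum_nonneg fun n => by positivity
  refine ⟨Real.exp c, Real.one_le_exp hc0, fun m => ?_⟩
  have hpos : (0 : ℝ) < factorialQuot B m := by exact_mod_cast factorialQuot_pos B m
  rw [← Real.exp_nat_mul, ← Real.log_le_iff_le_exp hpos]
  have hfac := Nat.prod_factorization_pow_eq_self (factorialQuot_pos B m).ne'
  rw [← hfac, Finsupp.prod, Nat.cast_prod, Real.log_prod (fun p hp => ?_)]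
  · have h1 : ∀ p ∈ (factorialQuot B m).factorization.support,
        Real.log ((p ^ (factorialQuot B m).factorization p : ℕ) : ℝ) ≤
          m * (4 * ((B : ℝ) + 1) ^ 2 * (1 / (p : ℝ) ^ (3 / 2 : ℝ))) := by
      intro p hp
      have hp' : p.Prime := Nat.prime_of_mem_primeFactors hp
      have hp0 : (0 : ℝ) < p := by exact_mod_cast hp'.pos
      have hlog : Real.log p ≤ 2 * (p : ℝ) ^ (1 / 2 : ℝ) := by
        have := Real.log_le_rpow_div hp0.le (show (0 : ℝ) < 1 / 2 by norm_num)
        linarith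
      rw [Nat.cast_pow, Real.log_pow]
      calc _ ≤ (2 * (B + 1) ^ 2 * m / p ^ 2) * (2 * (p : ℝ) ^ (1 / 2 : ℝ)) := by
            refine mul_le_mul (factorization_factorialQuot_le hp') hlog
              (Real.log_nonneg (by exact_mod_cast hp'.one_le)) (by positivity)
        _ = _ := by
            have : (p : ℝ) ^ 2 = (p : ℝ) ^ (1 / 2 : ℝ) * (p : ℝ) ^ (3 / 2 : ℝ) := by
              rw [← Real.rpow_add hp0]; norm_num
            rw [this]
            field_simp
            ring
    refine (Finset.sum_le_sum h1).trans ?_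
    rw [← Finset.mul_sum]
    exact mul_le_mul_of_nonneg_left (hs.sum_le_tsum _ fun n _ => by positivity) (Nat.cast_nonneg _)
  · have := (Nat.prime_of_mem_primeFactors hp).pos
    positivity

end FactorialQuotient

section IntegralValues

open Polynomial

variable {L : Type*} [Field L]

/-- Evaluation of integral bivariate polynomials at a point. -/
noncomputable def evalPoint (t θ : L) : ℤ[X][X] →+* L :=
  Polynomial.eval₂RingHom (Polynomial.eval₂RingHom (Int.castRingHom L) t) θ

theorem evalPoint_apply (t θ : L) (S : ℤ[X][X]) :
    evalPoint t θ S = S.eval₂ (Polynomial.eval₂RingHom (Int.castRingHom L) t) θ := rfl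

theorem isIntegral_pow_mul_eval₂ {A : Type*} [CommRing A] (ψ : A →+* L) {e k l : ℕ} {θ : L}
    (hθ : IsIntegral ℤ ((e : L) * θ)) (S : A[X]) (hS : S.natDegree ≤ k)
    (h : ∀ i, IsIntegral ℤ ((e : L) ^ l * ψ (S.coeff i))) :
    IsIntegral ℤ ((e : L) ^ (k + l) * S.eval₂ ψ θ) := by
  rw [Polynomial.eval₂_eq_sum_range' ψ (Nat.lt_succ_of_le hS), Finset.mul_sum]
  refine IsIntegral.sum _ fun i hi => ?_
  have hi' : i ≤ k := Nat.le_of_lt_succ (Finset.mem_range.1 hi)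
  have : (e : L) ^ (k + l) * (ψ (S.coeff i) * θ ^ i) =
      (e : L) ^ (k - i) * (((e : L) ^ l * ψ (S.coeff i)) * ((e : L) * θ) ^ i) := by
    obtain ⟨j, rfl⟩ := Nat.exists_eq_add_of_le hi'
    rw [Nat.add_sub_cancel_left]
    ring
  rw [this]
  have he : IsIntegral ℤ (e : L) := by exact_mod_cast isIntegral_algebraMap (x := (e : ℤ))
  exact (he.pow _).mul ((h i).mul (hθ.pow i))

theorem isIntegral_pow_mul_evalPoint {e k : ℕ} {t θ : L} (ht : IsIntegral ℤ ((e : L) * t))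
    (hθ : IsIntegral ℤ ((e : L) * θ)) {S : ℤ[X][X]} (hS : BidegreeLE k S) :
    IsIntegral ℤ ((e : L) ^ (k + (k + 0)) * evalPoint t θ S) := by
  refine isIntegral_pow_mul_eval₂ _ hθ S hS.1 fun i => ?_
  refine isIntegral_pow_mul_eval₂ _ ht _ (hS.2 i) fun j => ?_
  rw [pow_zero, one_mul]
  exact isIntegral_algebraMap (x := (S.coeff i).coeff j)

theorem coprime_primeFloorProd {e B : ℕ} (he : 0 < e) (hB : e < B) (m : ℕ) :
    Nat.Coprime e (primeFloorProd B m) := by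
  refine Nat.Coprime.prod_right fun p hp => ?_
  obtain ⟨h1, h2⟩ := Finset.mem_filter.1 hp
  refine Nat.Coprime.pow_right _ ((Nat.coprime_comm.1 ((Nat.Prime.coprime_iff_not_dvd h2).2
    fun hd => ?_)))
  have := Nat.le_of_dvd he hd
  have := (Finset.mem_Icc.1 h1).1
  omega

theorem IsIntegral.of_coprime_nat {x : L} {k l : ℕ} (h : Nat.Coprime k l)
    (hk : IsIntegral ℤ ((k : L) * x)) (hl : IsIntegral ℤ ((l : L) * x)) : IsIntegral ℤ x := by
  obtain ⟨u, v, huv⟩ := Nat.isCoprime_iff_coprime.2 h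
  have : x = (u : L) * ((k : L) * x) + (v : L) * ((l : L) * x) := by
    have h1 : ((u * k + v * l : ℤ) : L) = 1 := by rw [huv]; simp
    push_cast at h1
    linear_combination -x * h1
  rw [this]
  exact ((isIntegral_algebraMap (x := u)).mul hk).add ((isIntegral_algebraMap (x := v)).mul hl)

theorem exists_nat_mul_isIntegral [NumberField L] {ι : Type*} [Finite ι] (x : ι → L) :
    ∃ e : ℕ, 0 < e ∧ ∀ i, IsIntegral ℤ ((e : L) * x i) := by
  have := Fintype.ofFinite ι
  have h1 : ∀ i, ∃ e : ℕ, 0 < e ∧ IsIntegral ℤ ((e : L) * x i) := by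
    intro i
    have h2 : Algebra.IsAlgebraic ℤ ℚ := IsLocalization.isAlgebraic ℚ (nonZeroDivisors ℤ)
    have h3 : Algebra.IsAlgebraic ℤ L := Algebra.IsAlgebraic.trans ℤ ℚ L
    obtain ⟨y, hy, hxy⟩ := (h3.isAlgebraic (x i)).exists_integral_multiple
    refine ⟨y.natAbs, Int.natAbs_pos.2 hy, ?_⟩
    rw [zsmul_eq_mul] at hxy
    have h4 : ((y.natAbs : ℕ) : L) = ((|y| : ℤ) : L) := by rw [← Int.natCast_natAbs]; simp
    rw [h4]
    rcases abs_choice y with h | h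
    · rwa [h]
    · rw [h, Int.cast_neg, neg_mul]
      exact hxy.neg
  choose e he hex using h1
  refine ⟨∏ i, e i, Finset.prod_pos fun i _ => he i, fun i => ?_⟩
  obtain ⟨c, hc⟩ := Finset.dvd_prod_of_mem e (Finset.mem_univ i)
  rw [hc, Nat.cast_mul, mul_comm (e i : L), mul_assoc]
  exact (by exact_mod_cast isIntegral_algebraMap (x := (c : ℤ)) : IsIntegral ℤ (c : L)).mul (hex i)

theorem exists_denominators [NumberField L] {a : ℤ[X]} {P : ℤ[X][X]}
    {ι : Type*} [Finite ι] (t θ : ι → L) (hθ : ∀ i, evalPoint (t i) (θ i) P = 0)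
    (hdiv : ∃ B : ℕ, ∀ p : ℕ, p.Prime → B ≤ p → ∀ m,
      Polynomial.C (Polynomial.C ((p : ℤ) ^ (m / p))) ∣ connNum a P m %ₘ P) :
    ∃ d : ℕ → ℕ, (∀ m, 0 < d m) ∧ d 0 = 1 ∧ (∀ k l, d k * d l ∣ d (k + l)) ∧
      (∃ A : ℝ, 1 ≤ A ∧ ∀ m, (d m : ℝ) ≤ A ^ m) ∧
      ∀ i m, IsIntegral ℤ ((d m : L) * (evalPoint (t i) (θ i) (connNum a P m) /
        ((Nat.factorial m : L) * evalPoint (t i) (θ i) (Polynomial.C a * Polynomial.derivative P ^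
        2) ^ m))) := by
  have := Fintype.ofFinite ι
  obtain ⟨e₁, he₁, h₁⟩ := exists_nat_mul_isIntegral t
  obtain ⟨e₂, he₂, h₂⟩ := exists_nat_mul_isIntegral θ
  obtain ⟨e₃, he₃, h₃⟩ := exists_nat_mul_isIntegral
    fun i => (evalPoint (t i) (θ i) (Polynomial.C a * Polynomial.derivative P ^ 2))⁻¹
  have hnat : ∀ n : ℕ, IsIntegral ℤ (n : L) := fun n => by
    exact_mod_cast isIntegral_algebraMap (x := (n : ℤ))
  set e := e₁ * e₂ * e₃ with he
  have he0 : 0 < e := by positivity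
  replace h₁ : ∀ i, IsIntegral ℤ ((e : L) * t i) := fun i => by
    have : (e : L) * t i = (e₂ * e₃ : ℕ) * ((e₁ : L) * t i) := by rw [he]; push_cast; ring
    rw [this]; exact (hnat _).mul (h₁ i)
  replace h₂ : ∀ i, IsIntegral ℤ ((e : L) * θ i) := fun i => by
    have : (e : L) * θ i = (e₁ * e₃ : ℕ) * ((e₂ : L) * θ i) := by rw [he]; push_cast; ring
    rw [this]; exact (hnat _).mul (h₂ i)
  replace h₃ : ∀ i, IsIntegral ℤ ((e : L) *
      (evalPoint (t i) (θ i) (Polynomial.C a * Polynomial.derivative P ^ 2))⁻¹) := fun i => by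
    have : (e : L) * (evalPoint (t i) (θ i) (Polynomial.C a * Polynomial.derivative P ^ 2))⁻¹ =
        (e₁ * e₂ : ℕ) *
      ((e₃ : L) * (evalPoint (t i) (θ i) (Polynomial.C a * Polynomial.derivative P ^ 2))⁻¹) := by
        rw [he]; push_cast; ring
    rw [this]; exact (hnat _).mul (h₃ i)
  obtain ⟨B₀, hB₀⟩ := hdiv
  set B := max B₀ (e + 1) with hB
  obtain ⟨k, hk⟩ := exists_bidegreeLE_connNum a P
  have key : ∀ i m, IsIntegral ℤ ((e : L) ^ (k * m + (k * m + 0)) *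
      (evalPoint (t i) (θ i) (connNum a P m) / (primeFloorProd B m : L))) := by
    intro i m
    have hD0 : (primeFloorProd B m : L) ≠ 0 := by exact_mod_cast (primeFloorProd_pos B m).ne'
    obtain ⟨R, hR⟩ := C_C_primeFloorProd_dvd (B := B) (m := m) (S := connNum a P m %ₘ P)
      fun p hp hpB => hB₀ p hp ((le_max_left _ _).trans hpB) m
    have hev : evalPoint (t i) (θ i) (connNum a P m) =
        (primeFloorProd B m : L) * evalPoint (t i) (θ i) R := by
      have h4 := congrArg (evalPoint (t i) (θ i)) hR
      rw [modByMonic_eq_sub_mul_div, map_sub, map_mul, map_mul, hθ, zero_mul, sub_zero] at h4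
      rw [h4]
      simp [evalPoint_apply]
    obtain ⟨N, hN⟩ := BidegreeLE.exists_bidegreeLE R
    have h5 : evalPoint (t i) (θ i) (connNum a P m) / (primeFloorProd B m : L) =
        evalPoint (t i) (θ i) R := by rw [hev, mul_div_cancel_left₀ _ hD0]
    refine IsIntegral.of_coprime_nat (k := e ^ (N + (N + 0))) (l := primeFloorProd B m)
      ((coprime_primeFloorProd he0 (by omega) m).pow_left _) ?_ ?_
    · rw [h5, mul_left_comm, Nat.cast_pow]
      refine IsIntegral.mul (by exact_mod_cast hnat _)
        (isIntegral_pow_mul_evalPoint (h₁ i) (h₂ i) hN)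
    · rw [mul_left_comm, mul_div_cancel₀ _ hD0]
      exact isIntegral_pow_mul_evalPoint (h₁ i) (h₂ i) (hk m)
  refine ⟨fun m => e ^ ((2 * k + 1) * m) * factorialQuot B m, fun m => ?_, ?_, fun l m => ?_, ?_,
    fun i m => ?_⟩
  · have := factorialQuot_pos B m
    positivity
  · simp [factorialQuot_zero]
  · have := mul_dvd_mul_left (e ^ ((2 * k + 1) * (l + m))) (factorialQuot_mul_dvd B l m)
    have h4 : e ^ ((2 * k + 1) * l) * factorialQuot B l *
        (e ^ ((2 * k + 1) * m) * factorialQuot B m) =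
        e ^ ((2 * k + 1) * (l + m)) * (factorialQuot B l * factorialQuot B m) := by
      rw [mul_add, pow_add]; ac_rfl
    exact h4 ▸ this
  · obtain ⟨A, hA1, hA⟩ := exists_factorialQuot_le B
    have he1 : (1 : ℝ) ≤ (e : ℝ) ^ (2 * k + 1) := one_le_pow₀ (by exact_mod_cast he0)
    refine ⟨(e : ℝ) ^ (2 * k + 1) * A, one_le_mul_of_one_le_of_one_le he1 hA1, fun m => ?_⟩
    rw [mul_pow, ← pow_mul]
    push_cast
    exact mul_le_mul_of_nonneg_left (hA m) (by positivity)
  · have hD0 : (primeFloorProd B m : L) ≠ 0 := by exact_mod_cast (primeFloorProd_pos B m).ne'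
    have hQ0 : (factorialQuot B m : L) ≠ 0 := by exact_mod_cast (factorialQuot_pos B m).ne'
    have h6 : (Nat.factorial m : L) = (factorialQuot B m : L) * (primeFloorProd B m : L) := by
      exact_mod_cast (factorialQuot_mul B m).symm
    have h7 : ((e ^ ((2 * k + 1) * m) * factorialQuot B m : ℕ) : L) *
        (evalPoint (t i) (θ i) (connNum a P m) /
          ((Nat.factorial m : L) * evalPoint (t i) (θ i) (Polynomial.C a * Polynomial.derivative P
          ^ 2) ^ m)) =
        ((e : L) ^ (k * m + (k * m + 0)) *
          (evalPoint (t i) (θ i) (connNum a P m) / (primeFloorProd B m : L))) *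
        ((e : L) * (evalPoint (t i) (θ i) (Polynomial.C a * Polynomial.derivative P ^ 2))⁻¹) ^
          m := by
      rw [h6]
      push_cast
      rw [div_eq_mul_inv, mul_inv, mul_inv, mul_pow, inv_pow, div_eq_mul_inv]
      have : (2 * k + 1) * m = (k * m + (k * m + 0)) + m := by ring
      rw [this, pow_add]
      field_simp
    rw [h7]
    exact (key i m).mul ((h₃ i).pow m)

end IntegralValues

section AnalyticPreliminaries

open Filter Topology Asymptotics

/-- A Schwarz-type bound for the leading coefficient of a bounded function vanishing to order
`M` at the centre of a disc. -/
theorem norm_le_of_tendsto_div_pow {γ : ℂ → ℂ} {ρ K : ℝ} {l : ℂ} {M : ℕ} (hρ : 0 < ρ)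
    (hd : DifferentiableOn ℂ γ (Metric.ball 0 ρ)) (hK : ∀ z ∈ Metric.ball (0 : ℂ) ρ, ‖γ z‖ ≤ K)
    (h : Tendsto (fun z => γ z / z ^ M) (𝓝[≠] 0) (𝓝 l)) : ‖l‖ ≤ K / ρ ^ M := by
  have h0 : (0 : ℂ) ∈ Metric.ball (0 : ℂ) ρ := Metric.mem_ball_self hρ
  have hc : ContinuousAt γ 0 :=
    (hd.differentiableAt (Metric.ball_mem_nhds _ hρ)).continuousAt
  rcases M with _ | M
  · simp only [pow_zero, div_one] at h ⊢
    rw [tendsto_nhds_unique h (hc.tendsto.mono_left nhdsWithin_le_nhds)]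
    exact hK 0 h0
  have hbig : γ =O[𝓝[≠] 0] fun z => z ^ (M + 1) := by
    have h1 := (h.isBigO_one ℂ).mul (isBigO_refl (fun z : ℂ => z ^ (M + 1)) (𝓝[≠] 0))
    refine (h1.congr' ?_ ?_)
    · filter_upwards [self_mem_nhdsWithin] with z hz
      exact div_mul_cancel₀ _ (pow_ne_zero _ hz)
    · filter_upwards with z
      simp
  have hγ0 : γ 0 = 0 := by
    have h1 : Tendsto γ (𝓝[≠] 0) (𝓝 0) := by
      refine hbig.trans_tendsto ?_
      have : Tendsto (fun z : ℂ => z ^ (M + 1)) (𝓝 0) (𝓝 (0 ^ (M + 1))) :=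
        (continuous_pow (M + 1)).tendsto 0
      rw [zero_pow (Nat.succ_ne_zero M)] at this
      exact this.mono_left nhdsWithin_le_nhds
    exact tendsto_nhds_unique (hc.tendsto.mono_left nhdsWithin_le_nhds) h1
  have hlit : (fun z => γ z - γ 0) =o[𝓝 0] fun z => ‖z - 0‖ ^ M := by
    have h1 : γ =O[𝓝 0] fun z => z ^ (M + 1) := by
      have h2 : 𝓝 (0 : ℂ) = 𝓝[≠] 0 ⊔ pure 0 := by
        rw [sup_comm, pure_sup_nhdsNE]
      rw [h2, isBigO_sup]
      refine ⟨hbig, ?_⟩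
      rw [isBigO_pure]
      exact fun _ => hγ0
    simp only [hγ0, sub_zero]
    refine h1.trans_isLittleO ?_
    have h3 : (fun z : ℂ => z ^ (M + 1)) =o[𝓝 0] fun z : ℂ => z ^ M := by
      simpa using isLittleO_pow_pow (𝕜 := ℂ) (Nat.lt_succ_self M)
    refine (h3.norm_right).congr_right fun z => by rw [norm_pow]
  have hmaps : Set.MapsTo γ (Metric.ball 0 ρ) (Metric.closedBall (γ 0) K) := by
    intro z hz
    rw [hγ0, mem_closedBall_zero_iff]
    exact hK z hz
  refine le_of_tendsto h.norm ?_
  have hmem : ∀ᶠ z in 𝓝[≠] (0 : ℂ), z ∈ Metric.ball (0 : ℂ) ρ :=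
    nhdsWithin_le_nhds (Metric.ball_mem_nhds _ hρ)
  filter_upwards [hmem, self_mem_nhdsWithin] with z hz hz0
  have h4 := Complex.dist_le_mul_div_pow_of_mapsTo_ball_of_isLittleO hd hmaps hlit hz
  rw [hγ0, dist_zero_right, dist_zero_right, div_pow] at h4
  have h5 : 0 < ‖z‖ ^ (M + 1) := pow_pos (norm_pos_iff.2 hz0) _
  rw [norm_div, norm_pow, div_le_iff₀ h5]
  calc ‖γ z‖ ≤ _ := h4
    _ = _ := by ring

/-- The implicit function theorem for an equation `G (z, t) = 0` in two complex variables. -/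
theorem exists_implicit_function {G : ℂ × ℂ → ℂ} {z₀ t₀ c : ℂ} (hG : ContDiffAt ℂ 1 G (z₀, t₀))
    (h0 : G (z₀, t₀) = 0) (hc : HasDerivAt (fun t => G (z₀, t)) c t₀) (hc0 : c ≠ 0) :
    ∃ φ : ℂ → ℂ, φ z₀ = t₀ ∧ ∀ᶠ z in 𝓝 z₀, DifferentiableAt ℂ φ z ∧ G (z, φ z) = 0 := by
  have h1 : fderiv ℂ G (z₀, t₀) ∘L .inr ℂ ℂ ℂ =
      (ContinuousLinearEquiv.unitsEquivAut ℂ (Units.mk0 c hc0) : ℂ →L[ℂ] ℂ) := by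
    ext
    have h2 : HasFDerivAt (fun t : ℂ => ((z₀, t) : ℂ × ℂ)) (ContinuousLinearMap.inr ℂ ℂ ℂ) t₀ :=
      hasFDerivAt_prodMk_right z₀ t₀
    have h3 := ((hG.differentiableAt one_ne_zero).hasFDerivAt.comp t₀ h2).hasDerivAt
    have h4 := h3.unique hc
    simpa using h4
  have hi : (fderiv ℂ G (z₀, t₀) ∘L .inr ℂ ℂ ℂ).IsInvertible := ⟨_, h1.symm⟩
  refine ⟨hG.implicitFunction one_ne_zero hi, hG.implicitFunction_apply_self one_ne_zero hi, ?_⟩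
  have h5 := (hG.contDiffAt_implicitFunction one_ne_zero hi).eventually (by simp)
  filter_upwards [h5, hG.eventually_apply_implicitFunction one_ne_zero hi] with z hz hz'
  exact ⟨hz.differentiableAt one_ne_zero, by rw [hz', h0]⟩

end AnalyticPreliminaries

section DeterminantDegree

open scoped Polynomial

variable {A n : Type*} [CommRing A] [Fintype n] [DecidableEq n]

theorem Matrix.natDegree_det_le {M : Matrix n n A[X]} {N : n → ℕ}
    (h : ∀ i j, (M i j).natDegree ≤ N i) : M.det.natDegree ≤ ∑ i, N i := by
  rw [Matrix.det_apply]
  refine Polynomial.natDegree_sum_le_of_forall_le _ _ fun σ _ => ?_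
  have h1 : (∏ i, M (σ i) i).natDegree ≤ ∑ i, N i := by
    refine (Polynomial.natDegree_prod_le _ _).trans ?_
    rw [← Equiv.sum_comp σ N]
    exact Finset.sum_le_sum fun i _ => h _ _
  rcases Int.units_eq_one_or (Equiv.Perm.sign σ) with hs | hs
  · rwa [hs, one_smul]
  · rwa [hs, Units.neg_smul, one_smul, Polynomial.natDegree_neg]

theorem Matrix.coeff_det_of_natDegree_le {M : Matrix n n A[X]} {N : ℕ}
    (h : ∀ i j, (M i j).natDegree ≤ N) :
    M.det.coeff (Fintype.card n * N) = (M.map fun q => q.coeff N).det := by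
  rw [Matrix.det_apply, Matrix.det_apply, Polynomial.finsetSum_coeff]
  refine Finset.sum_congr rfl fun σ _ => ?_
  have h1 := Polynomial.coeff_prod_of_natDegree_le (s := Finset.univ)
    (fun i => M (σ i) i) N fun i _ => h _ _
  rw [Finset.card_univ] at h1
  rw [Polynomial.coeff_smul, h1]
  rfl

theorem Matrix.natDegree_adjugate_le {M : Matrix n n A[X]} {N : ℕ}
    (h : ∀ i j, (M i j).natDegree ≤ N) (i j : n) :
    (M.adjugate i j).natDegree + N ≤ Fintype.card n * N := by
  rw [Matrix.adjugate_apply]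
  have h1 : ∀ k l, ((M.updateRow j (Pi.single i 1)) k l).natDegree ≤
      Function.update (fun _ => N) j 0 k := by
    intro k l
    by_cases hk : k = j
    · subst hk
      rw [Matrix.updateRow_self, Function.update_self, Pi.single_apply]
      split_ifs <;> simp
    · rw [Matrix.updateRow_ne hk, Function.update_of_ne hk]
      exact h k l
  have h2 := Matrix.natDegree_det_le h1
  have h3 : ∑ k, Function.update (fun _ => N) j 0 k + N = Fintype.card n * N := by
    have h4 := Finset.sum_update_of_mem (Finset.mem_univ j) (fun _ : n => N) 0
    rw [h4, zero_add]
    have h5 := Finset.sum_sdiff (Finset.subset_univ {j}) (f := fun _ : n => N)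
    rw [Finset.sum_singleton] at h5
    rw [h5]; simp
  omega

end DeterminantDegree

section MultiplicationMatrix

open scoped Polynomial

variable {K : Type*} [CommRing K] {δ : ℕ}

/-- The matrix of multiplication by `w ^ i` on polynomials in `w` modulo `P`. -/
noncomputable def mulMat (δ : ℕ) (P : K[X][X]) (i : ℕ) : Matrix (Fin δ) (Fin δ) K[X] :=
  fun r c => ((Polynomial.X ^ (i + c) : K[X][X]) %ₘ P).coeff r

theorem sum_pow_mul_eval_mulMat {P : K[X][X]} (hP : P.Monic) (hδ : P.natDegree = δ) {t w : K}
    (hw : P.eval₂ (Polynomial.evalRingHom t) w = 0) (i : ℕ) (c : Fin δ) :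
    ∑ r : Fin δ, w ^ (r : ℕ) * (mulMat δ P i r c).eval t = w ^ (i + c : ℕ) := by
  nontriviality K
  have h1 : ((Polynomial.X ^ (i + c : ℕ) : K[X][X]) %ₘ P).natDegree < δ := by
    have := Polynomial.natDegree_modByMonic_lt (Polynomial.X ^ (i + c : ℕ) : K[X][X]) hP
      (by rintro rfl; rw [Polynomial.natDegree_one] at hδ; subst hδ; exact c.elim0)
    rwa [hδ] at this
  have h2 : ((Polynomial.X ^ (i + c : ℕ) : K[X][X]) %ₘ P).eval₂ (Polynomial.evalRingHom t) w =
      w ^ (i + c : ℕ) := by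
    rw [Polynomial.modByMonic_eq_sub_mul_div, Polynomial.eval₂_sub, Polynomial.eval₂_mul, hw,
      zero_mul, sub_zero, Polynomial.eval₂_X_pow]
  rw [← h2, Polynomial.eval₂_eq_sum_range' _ h1, ← Fin.sum_univ_eq_sum_range
    fun r => Polynomial.evalRingHom t (((Polynomial.X ^ (i + c : ℕ) : K[X][X]) %ₘ P).coeff r)
      * w ^ r]
  exact Finset.sum_congr rfl fun r _ => mul_comm _ _

theorem vandermonde_mul_mulMat {P : K[X][X]} (hP : P.Monic) (hδ : P.natDegree = δ) {t : K}
    {w : Fin δ → K} (hw : ∀ κ, P.eval₂ (Polynomial.evalRingHom t) (w κ) = 0) (i : ℕ) :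
    Matrix.vandermonde w * (mulMat δ P i).map (Polynomial.eval t) =
      Matrix.diagonal (fun κ => w κ ^ i) * Matrix.vandermonde w := by
  ext κ c
  rw [Matrix.mul_apply, Matrix.diagonal_mul]
  simp only [Matrix.vandermonde_apply, Matrix.map_apply]
  rw [sum_pow_mul_eval_mulMat hP hδ (hw κ), pow_add]

end MultiplicationMatrix

section NormPolynomial

open scoped Polynomial

variable {K : Type*} [CommRing K] {δ : ℕ} {Λ : Type*} [Fintype Λ]

/-- The value at `(t, w)` of the bivariate polynomial with coefficients `u` and exponents
`eT`, `eW`. -/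
def formVal {A : Type*} [CommRing A] (eT eW : Λ → ℕ) (u : Λ → A) (t w : A) : A :=
  ∑ μ, u μ * t ^ eT μ * w ^ eW μ

/-- The matrix of multiplication by `d Π + a ∑ u T ^ eT w ^ eW` modulo `P`. -/
noncomputable def normMat (δ : ℕ) (P : K[X][X]) (a Q : K[X]) (eT eW : Λ → ℕ)
    {A : Type*} [CommRing A] [Algebra K A] (d : A) (u : Λ → A) : Matrix (Fin δ) (Fin δ) A[X] :=
  (Polynomial.C d * Q.map (algebraMap K A)) • (1 : Matrix (Fin δ) (Fin δ) A[X]) +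
    ∑ μ, (Polynomial.C (u μ) * Polynomial.X ^ eT μ * a.map (algebraMap K A)) •
      (mulMat δ P (eW μ)).map (Polynomial.map (algebraMap K A))

theorem normMat_map (P : K[X][X]) (a Q : K[X]) (eT eW : Λ → ℕ)
    {A B : Type*} [CommRing A] [Algebra K A] [CommRing B] [Algebra K B] (f : A →ₐ[K] B)
    (d : A) (u : Λ → A) :
    (normMat δ P a Q eT eW d u).map (Polynomial.map (f : A →+* B)) =
      normMat δ P a Q eT eW (f d) (fun μ => f (u μ)) := by
  have hf : (f : A →+* B).comp (algebraMap K A) = algebraMap K B := f.comp_algebraMap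
  ext1 r c
  simp only [normMat, Matrix.map_apply, Matrix.add_apply, Matrix.smul_apply, Matrix.sum_apply,
    smul_eq_mul, Polynomial.map_add, Polynomial.map_mul, Polynomial.map_sum, Polynomial.map_C,
    Polynomial.map_pow, Polynomial.map_X, Polynomial.map_map, hf, Matrix.one_apply, RingHom.coe_coe]
  split_ifs <;> simp

theorem det_normMat_map (P : K[X][X]) (a Q : K[X]) (eT eW : Λ → ℕ)
    {A B : Type*} [CommRing A] [Algebra K A] [CommRing B] [Algebra K B] (f : A →ₐ[K] B)
    (d : A) (u : Λ → A) :
    (normMat δ P a Q eT eW d u).det.map (f : A →+* B) =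
      (normMat δ P a Q eT eW (f d) (fun μ => f (u μ))).det := by
  rw [← normMat_map, ← Polynomial.coe_mapRingHom, RingHom.map_det]
  rfl

/-- The numerical condition which makes the norm polynomial of large degree dominated by `Q`. -/
def DegreeBound (δ : ℕ) (P : K[X][X]) (a : K[X]) (eT eW : Λ → ℕ) (N : ℕ) : Prop :=
  ∀ μ i r c, i ≤ eW μ + 1 → eT μ + a.natDegree + (mulMat δ P i r c).natDegree + 2 ≤ N

section Degree

variable {P : K[X][X]} {a Q : K[X]} {eT eW : Λ → ℕ} {N : ℕ} {A : Type*} [CommRing A] [Algebra K A]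

theorem normMat_eq_add (d : A) (u : Λ → A) (hN : DegreeBound δ P a eT eW N) :
    ∃ L : Matrix (Fin δ) (Fin δ) A[X], (∀ r c, (L r c).natDegree ≤ N - 1 ∧ (L r c).coeff N = 0) ∧
      normMat δ P a Q eT eW d u =
        (Polynomial.C d * Q.map (algebraMap K A)) • (1 : Matrix (Fin δ) (Fin δ) A[X]) + L := by
  refine ⟨_, fun r c => ?_, rfl⟩
  have h1 : ((∑ μ, (Polynomial.C (u μ) * Polynomial.X ^ eT μ * a.map (algebraMap K A)) •
      (mulMat δ P (eW μ)).map (Polynomial.map (algebraMap K A))) r c).natDegree ≤ N - 2 := by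
    rw [Matrix.sum_apply]
    refine Polynomial.natDegree_sum_le_of_forall_le _ _ fun μ _ => ?_
    rw [Matrix.smul_apply, smul_eq_mul, Matrix.map_apply]
    have h2 := hN μ (eW μ) r c (Nat.le_succ _)
    have h3 : (a.map (algebraMap K A)).natDegree ≤ a.natDegree := Polynomial.natDegree_map_le
    have h4 : ((mulMat δ P (eW μ) r c).map (algebraMap K A)).natDegree ≤
      (mulMat δ P (eW μ) r c).natDegree := Polynomial.natDegree_map_le
    have h5 : (Polynomial.C (u μ) * Polynomial.X ^ eT μ : A[X]).natDegree ≤ eT μ :=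
      Polynomial.natDegree_C_mul_X_pow_le _ _
    refine Polynomial.natDegree_mul_le.trans ((add_le_add
      (Polynomial.natDegree_mul_le.trans (add_le_add h5 h3)) h4).trans (by omega))
  refine ⟨h1.trans (by omega), ?_⟩
  by_cases hΛ : IsEmpty Λ
  · simp
  · rw [not_isEmpty_iff] at hΛ
    obtain ⟨μ⟩ := hΛ
    have := hN μ 0 r c (by omega)
    exact Polynomial.coeff_eq_zero_of_natDegree_lt (by omega)

theorem natDegree_normMat_le (d : A) (u : Λ → A) (hN : DegreeBound δ P a eT eW N)
    (hQ : Q.natDegree ≤ N) (r c : Fin δ) : (normMat δ P a Q eT eW d u r c).natDegree ≤ N := by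
  obtain ⟨L, hL, h⟩ := normMat_eq_add (Q := Q) d u hN
  rw [h, Matrix.add_apply, Matrix.smul_apply, smul_eq_mul]
  refine (Polynomial.natDegree_add_le _ _).trans (max_le ?_ ((hL r c).1.trans (by omega)))
  have h1 : (1 : Matrix (Fin δ) (Fin δ) A[X]) r c = Polynomial.C (if r = c then 1 else 0) := by
    rw [Matrix.one_apply]; split_ifs <;> simp
  rw [h1]
  refine (Polynomial.natDegree_mul_C_le _ _).trans ((Polynomial.natDegree_C_mul_le _ _).trans
    (Polynomial.natDegree_map_le.trans hQ))

theorem natDegree_det_normMat_le (d : A) (u : Λ → A) (hN : DegreeBound δ P a eT eW N)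
    (hQ : Q.natDegree ≤ N) : (normMat δ P a Q eT eW d u).det.natDegree ≤ δ * N := by
  have := Matrix.natDegree_det_le (M := normMat δ P a Q eT eW d u) (N := fun _ => N)
    fun r c => natDegree_normMat_le d u hN hQ r c
  simpa using this

theorem coeff_det_normMat (d : A) (u : Λ → A) (hN : DegreeBound δ P a eT eW N)
    (hQ : Q.natDegree ≤ N) (hQ1 : Q.coeff N = 1) :
    (normMat δ P a Q eT eW d u).det.coeff (δ * N) = d ^ δ := by
  have := Matrix.coeff_det_of_natDegree_le (M := normMat δ P a Q eT eW d u) (N := N)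
    fun r c => natDegree_normMat_le d u hN hQ r c
  rw [Fintype.card_fin] at this
  rw [this]
  have h1 : ((normMat δ P a Q eT eW d u).map fun q => q.coeff N) =
      d • (1 : Matrix (Fin δ) (Fin δ) A) := by
    obtain ⟨L, hL, h⟩ := normMat_eq_add (Q := Q) d u hN
    ext r c
    rw [h, Matrix.map_apply, Matrix.add_apply, Polynomial.coeff_add, (hL r c).2, add_zero,
      Matrix.smul_apply, Matrix.smul_apply, smul_eq_mul, smul_eq_mul, Matrix.one_apply,
      Matrix.one_apply]
    split_ifs <;> simp [hQ1]
  rw [h1, Matrix.det_smul, Matrix.det_one, Fintype.card_fin, mul_one]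

end Degree

end NormPolynomial

section NormEval

open scoped Polynomial

variable {K : Type*} [Field K] {δ : ℕ} {Λ : Type*} [Fintype Λ] {P : K[X][X]} {a Q : K[X]}
  {eT eW : Λ → ℕ} {N : ℕ} {t : K} {w : Fin δ → K}

/-- The value at `(t, w)` of `d Q + a ∑ u T ^ eT w ^ eW`. -/
noncomputable def curveFun (a Q : K[X]) (eT eW : Λ → ℕ) (d : K) (u : Λ → K) (t w : K) : K :=
  d * Q.eval t + a.eval t * formVal eT eW u t w

theorem vandermonde_mul_normMat (hP : P.Monic) (hδ : P.natDegree = δ)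
    (hw : ∀ κ, P.eval₂ (Polynomial.evalRingHom t) (w κ) = 0) (d : K) (u : Λ → K) :
    Matrix.vandermonde w * (normMat δ P a Q eT eW d u).map (Polynomial.eval t) =
      Matrix.diagonal (fun κ => curveFun a Q eT eW d u t (w κ)) * Matrix.vandermonde w := by
  have h1 : (normMat δ P a Q eT eW d u).map (Polynomial.eval t) =
      (d * Q.eval t) • (1 : Matrix (Fin δ) (Fin δ) K) +
      ∑ μ, (u μ * t ^ eT μ * a.eval t) • (mulMat δ P (eW μ)).map (Polynomial.eval t) := by
    ext r c
    simp only [normMat, Matrix.map_apply, Matrix.add_apply, Matrix.smul_apply, Matrix.sum_apply,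
      smul_eq_mul, Polynomial.eval_add, Polynomial.eval_mul, Polynomial.eval_finsetSum,
      Polynomial.eval_C, Polynomial.eval_pow, Polynomial.eval_X, Algebra.algebraMap_self,
      Polynomial.map_id, Matrix.one_apply]
    split_ifs <;> simp
  rw [h1, Matrix.mul_add, Matrix.mul_sum]
  simp only [Matrix.mul_smul, Matrix.mul_one, vandermonde_mul_mulMat hP hδ hw]
  ext κ c
  simp only [Matrix.add_apply, Matrix.smul_apply, Matrix.sum_apply, Matrix.diagonal_mul,
    smul_eq_mul, curveFun, formVal, add_mul, Finset.mul_sum, Finset.sum_mul]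
  congr 1
  exact Finset.sum_congr rfl fun μ _ => by ring

theorem det_vandermonde_ne_zero (hinj : Function.Injective w) : (Matrix.vandermonde w).det ≠ 0 :=
  Matrix.det_vandermonde_ne_zero_iff.2 hinj

theorem eval_det_normMat (hP : P.Monic) (hδ : P.natDegree = δ)
    (hw : ∀ κ, P.eval₂ (Polynomial.evalRingHom t) (w κ) = 0) (hinj : Function.Injective w)
    (d : K) (u : Λ → K) :
    (normMat δ P a Q eT eW d u).det.eval t = ∏ κ, curveFun a Q eT eW d u t (w κ) := by
  have h1 := congrArg Matrix.det (vandermonde_mul_normMat (a := a) (Q := Q) (eT := eT) (eW := eW)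
    hP hδ hw d u)
  rw [Matrix.det_mul, Matrix.det_mul, Matrix.det_diagonal, mul_comm] at h1
  have h2 := mul_right_cancel₀ (det_vandermonde_ne_zero hinj) h1
  rw [← h2, ← Polynomial.coe_evalRingHom, RingHom.map_det]
  rfl

/-- The numerator polynomial in Abel's theorem for the form `w · v dt`. -/
noncomputable def abelNum (δ : ℕ) (P : K[X][X]) (a Q : K[X]) (eT eW : Λ → ℕ) (d : K)
    (u v : Λ → K) : K[X] :=
  ((normMat δ P a Q eT eW d u).adjugate *
    ∑ μ, (Polynomial.C (v μ) * Polynomial.X ^ eT μ) • mulMat δ P (eW μ + 1)).trace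

theorem natDegree_abelNum_le (hN : DegreeBound δ P a eT eW N) (hQ : Q.natDegree ≤ N) (d : K)
    (u v : Λ → K) (hδN : 2 ≤ δ * N) :
    (abelNum δ P a Q eT eW d u v).natDegree + 2 ≤ δ * N := by
  suffices (abelNum δ P a Q eT eW d u v).natDegree ≤ δ * N - 2 by omega
  rw [abelNum, Matrix.trace]
  refine Polynomial.natDegree_sum_le_of_forall_le _ _ fun r _ => ?_
  rw [Matrix.diag_apply, Matrix.mul_apply]
  refine Polynomial.natDegree_sum_le_of_forall_le _ _ fun c _ => ?_
  rw [Matrix.sum_apply, Finset.mul_sum]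
  refine Polynomial.natDegree_sum_le_of_forall_le _ _ fun μ _ => ?_
  rw [Matrix.smul_apply, smul_eq_mul]
  have h1 := Matrix.natDegree_adjugate_le (M := normMat δ P a Q eT eW d u)
    (natDegree_normMat_le d u hN hQ) r c
  rw [Fintype.card_fin] at h1
  have h2 := hN μ (eW μ + 1) c r le_rfl
  refine Polynomial.natDegree_mul_le.trans ((add_le_add le_rfl
    (Polynomial.natDegree_mul_le.trans (add_le_add
      (Polynomial.natDegree_C_mul_X_pow_le _ _) le_rfl))).trans (by omega))

theorem eval_abelNum (hP : P.Monic) (hδ : P.natDegree = δ)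
    (hw : ∀ κ, P.eval₂ (Polynomial.evalRingHom t) (w κ) = 0) (hinj : Function.Injective w)
    (d : K) (u v : Λ → K) :
    (abelNum δ P a Q eT eW d u v).eval t = ∑ κ, (∏ κ' ∈ Finset.univ.erase κ,
      curveFun a Q eT eW d u t (w κ')) * (w κ * formVal eT eW v t (w κ)) := by
  set V := Matrix.vandermonde w with hV
  have hVu : IsUnit V.det := (det_vandermonde_ne_zero hinj).isUnit
  set H := (normMat δ P a Q eT eW d u).map (Polynomial.eval t) with hH
  set G := ∑ μ, (v μ * t ^ eT μ) • (mulMat δ P (eW μ + 1)).map (Polynomial.eval t) with hG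
  set DH := Matrix.diagonal (fun κ => curveFun a Q eT eW d u t (w κ)) with hDH
  set DG := Matrix.diagonal (fun κ => w κ * formVal eT eW v t (w κ)) with hDG
  have h1 : V * H = DH * V := vandermonde_mul_normMat hP hδ hw d u
  have h2 : V * G = DG * V := by
    rw [hG, Matrix.mul_sum]
    simp only [Matrix.mul_smul, hV, vandermonde_mul_mulMat hP hδ hw]
    ext κ c
    simp only [hDG, Matrix.smul_apply, Matrix.sum_apply, Matrix.diagonal_mul, smul_eq_mul,
      formVal, Finset.mul_sum, Finset.sum_mul]
    exact Finset.sum_congr rfl fun μ _ => by ring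
  have h3 : H = V⁻¹ * DH * V := by
    rw [Matrix.mul_assoc, ← h1, ← Matrix.mul_assoc, Matrix.nonsing_inv_mul _ hVu, Matrix.one_mul]
  have h4 : G = V⁻¹ * DG * V := by
    rw [Matrix.mul_assoc, ← h2, ← Matrix.mul_assoc, Matrix.nonsing_inv_mul _ hVu, Matrix.one_mul]
  have h5 : H.adjugate = V.adjugate * (DH.adjugate * V⁻¹.adjugate) := by
    rw [h3, Matrix.adjugate_mul_distrib, Matrix.adjugate_mul_distrib]
  have h6 : (H.adjugate * G).trace = (DH.adjugate * DG).trace := by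
    have h7 : H.adjugate * G =
        V.adjugate * (DH.adjugate * ((V⁻¹.adjugate * V⁻¹) * (DG * V))) := by
      rw [h5, h4]
      simp only [Matrix.mul_assoc]
    rw [h7, Matrix.adjugate_mul, Matrix.smul_mul, Matrix.one_mul, Matrix.trace_mul_comm,
      Matrix.mul_smul, Matrix.smul_mul, ← Matrix.mul_assoc, Matrix.mul_assoc _ V,
      Matrix.mul_adjugate, Matrix.mul_smul, smul_smul, Matrix.mul_one, Matrix.det_nonsing_inv,
      Ring.inverse_mul_cancel _ hVu, one_smul]
  have h8 : (abelNum δ P a Q eT eW d u v).eval t = (H.adjugate * G).trace := by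
    have h9 : (normMat δ P a Q eT eW d u).adjugate.map (Polynomial.eval t) = H.adjugate := by
      have := RingHom.map_adjugate (Polynomial.evalRingHom t) (normMat δ P a Q eT eW d u)
      exact this
    rw [← h9]
    simp only [abelNum, Matrix.trace, Matrix.diag_apply, Matrix.mul_apply, hG,
      Polynomial.eval_finsetSum, Polynomial.eval_mul, Matrix.sum_apply, Matrix.smul_apply,
      Matrix.map_apply, smul_eq_mul, Polynomial.eval_C, Polynomial.eval_pow, Polynomial.eval_X]
  rw [h8, h6, hDH, hDG, Matrix.adjugate_diagonal, Matrix.diagonal_mul_diagonal,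
    Matrix.trace_diagonal]

end NormEval

section AbelSum

open scoped Polynomial

variable {K : Type*} [Field K] {δ : ℕ} {Λ : Type*} [Fintype Λ] {P : K[X][X]} {a Q : K[X]}
  {eT eW : Λ → ℕ} {N : ℕ} {Z : Type*} [Fintype Z]

theorem det_normMat_eq_prod (hP : P.Monic) (hδ : P.natDegree = δ)
    (hN : DegreeBound δ P a eT eW N) (hQ : Q.natDegree ≤ N) (hQ1 : Q.coeff N = 1) {d : K}
    {u : Λ → K} {z : Z → K} (hz : Function.Injective z)
    (hZ : Fintype.card Z = δ * N) {W : Z → Fin δ → K}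
    (hW : ∀ i κ, P.eval₂ (Polynomial.evalRingHom (z i)) (W i κ) = 0)
    (hinj : ∀ i, Function.Injective (W i)) {κ : Z → Fin δ}
    (h0 : ∀ i, curveFun a Q eT eW d u (z i) (W i (κ i)) = 0) :
    (normMat δ P a Q eT eW d u).det =
      Polynomial.C (d ^ δ) * ∏ i, (Polynomial.X - Polynomial.C (z i)) := by
  classical
  have h1 : (∏ i, (Polynomial.X - Polynomial.C (z i))).natDegree = δ * N := by
    rw [Polynomial.natDegree_finsetProd_X_sub_C_eq_card, Finset.card_univ, hZ]
  have hm : (∏ i, (Polynomial.X - Polynomial.C (z i))).Monic :=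
    Polynomial.monic_prod_of_monic _ _ fun i _ => Polynomial.monic_X_sub_C _
  refine Polynomial.eq_of_degree_sub_lt_of_eval_finset_eq (Finset.univ.image z) ?_ ?_
  · rw [Finset.card_image_of_injective _ hz, Finset.card_univ, hZ]
    rw [Polynomial.degree_lt_iff_coeff_zero]
    intro m hm'
    rw [Polynomial.coeff_sub, Polynomial.coeff_C_mul]
    rcases hm'.eq_or_lt with h | h
    · rw [← h, coeff_det_normMat d u hN hQ hQ1]
      have : (∏ i, (Polynomial.X - Polynomial.C (z i))).coeff (δ * N) = 1 := by
        rw [← h1]; exact hm.coeff_natDegree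
      rw [this, mul_one, sub_self]
    · rw [Polynomial.coeff_eq_zero_of_natDegree_lt
        ((natDegree_det_normMat_le d u hN hQ).trans_lt h),
        Polynomial.coeff_eq_zero_of_natDegree_lt (by rw [h1]; exact h), mul_zero, sub_zero]
  · intro x hx
    obtain ⟨i, -, rfl⟩ := Finset.mem_image.1 hx
    rw [eval_det_normMat hP hδ (hW i) (hinj i), Finset.prod_eq_zero (Finset.mem_univ (κ i)) (h0 i),
      Polynomial.eval_mul, Polynomial.eval_prod,
      Finset.prod_eq_zero (Finset.mem_univ i) (by simp), mul_zero]

theorem abel_sum_eq_zero [DecidableEq Z] (hP : P.Monic) (hδ : P.natDegree = δ)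
    (hN : DegreeBound δ P a eT eW N) (hQ : Q.natDegree ≤ N) (hQ1 : Q.coeff N = 1) {d : K}
    (hd : d ≠ 0) {u : Λ → K} (v : Λ → K) {z : Z → K} (hz : Function.Injective z)
    (hZ : Fintype.card Z = δ * N) (hδN : 2 ≤ δ * N) {W : Z → Fin δ → K}
    (hW : ∀ i κ, P.eval₂ (Polynomial.evalRingHom (z i)) (W i κ) = 0)
    (hinj : ∀ i, Function.Injective (W i)) {κ : Z → Fin δ}
    (h0 : ∀ i, curveFun a Q eT eW d u (z i) (W i (κ i)) = 0) {F' : Z → K}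
    (hF' : ∀ i, (Polynomial.derivative (normMat δ P a Q eT eW d u).det).eval (z i) =
      F' i * ∏ κ' ∈ Finset.univ.erase (κ i), curveFun a Q eT eW d u (z i) (W i κ')) :
    (∀ i, F' i ≠ 0) ∧
    ∑ i, W i (κ i) * formVal eT eW v (z i) (W i (κ i)) / F' i = 0 := by
  have h1 := det_normMat_eq_prod hP hδ hN hQ hQ1 hz hZ hW hinj h0
  have h2 : ∀ i, (Polynomial.derivative (normMat δ P a Q eT eW d u).det).eval (z i) =
      d ^ δ * ∏ j ∈ Finset.univ.erase i, (z i - z j) := by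
    intro i
    have := Lagrange.eval_nodal_derivative_eval_node_eq (v := z) (Finset.mem_univ i)
    rw [Lagrange.nodal, Lagrange.eval_nodal] at this
    rw [h1, Polynomial.derivative_C_mul, Polynomial.eval_mul, Polynomial.eval_C, this]
  have h3 : ∀ i, d ^ δ * ∏ j ∈ Finset.univ.erase i, (z i - z j) ≠ 0 := fun i =>
    mul_ne_zero (pow_ne_zero _ hd) (Finset.prod_ne_zero_iff.2 fun j hj =>
      sub_ne_zero.2 (hz.ne (Finset.ne_of_mem_erase hj).symm))
  have h4 : ∀ i, F' i * ∏ κ' ∈ Finset.univ.erase (κ i), curveFun a Q eT eW d u (z i) (W i κ') ≠ 0 :=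
    fun i => by rw [← hF', h2]; exact h3 i
  refine ⟨fun i => left_ne_zero_of_mul (h4 i), ?_⟩
  have h5 := natDegree_abelNum_le hN hQ d u v hδN
  have h6 := Lagrange.coeff_eq_sum (s := Finset.univ) (v := z) hz.injOn
    (P := abelNum δ P a Q eT eW d u v) (by
      rw [Finset.card_univ, hZ]
      exact Polynomial.degree_le_natDegree.trans_lt (by exact_mod_cast (by omega)))
  rw [Finset.card_univ, hZ, Polynomial.coeff_eq_zero_of_natDegree_lt (by omega)] at h6
  have h7 : ∀ i, W i (κ i) * formVal eT eW v (z i) (W i (κ i)) / F' i = (d ^ δ)⁻¹ *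
      ((abelNum δ P a Q eT eW d u v).eval (z i) / ∏ j ∈ Finset.univ.erase i, (z i - z j)) := by
    intro i
    have h8 : (abelNum δ P a Q eT eW d u v).eval (z i) =
        (∏ κ' ∈ Finset.univ.erase (κ i), curveFun a Q eT eW d u (z i) (W i κ')) *
          (W i (κ i) * formVal eT eW v (z i) (W i (κ i))) := by
      rw [eval_abelNum hP hδ (hW i) (hinj i)]
      refine Finset.sum_eq_single (κ i) (fun k _ hk => ?_) (fun h => (h (Finset.mem_univ _)).elim)
      rw [Finset.prod_eq_zero (Finset.mem_erase.2 ⟨hk.symm, Finset.mem_univ _⟩) (h0 i), zero_mul]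
    have h9 := (hF' i).symm.trans (h2 i)
    have h10 := right_ne_zero_of_mul (h3 i)
    rw [h8, inv_mul_eq_div, div_div, div_eq_div_iff (left_ne_zero_of_mul (h4 i))
      (mul_ne_zero h10 (pow_ne_zero _ hd))]
    linear_combination (-(W i (κ i) * formVal eT eW v (z i) (W i (κ i)))) * h9
  rw [Finset.sum_congr rfl fun i _ => h7 i, ← Finset.mul_sum, ← h6, mul_zero]

end AbelSum

section Interpolation

open scoped Polynomial

variable {K : Type*} [Field K] {δ : ℕ} {J : Type*} [Fintype J]

theorem eq_zero_of_formVal_eq_zero (e : J ≃ Fin (Fintype.card J)) {t : J → K}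
    (ht : Function.Injective t) {w : J × Fin δ → K}
    (hw : ∀ j, Function.Injective fun κ => w (j, κ)) {u : J × Fin δ → K}
    (h : ∀ i, formVal (fun μ : J × Fin δ => (e μ.1 : ℕ)) (fun μ => (μ.2 : ℕ)) u (t i.1) (w i) = 0) :
    u = 0 := by
  have h1 : ∀ j κ, ∑ i, u (i, κ) * t j ^ (e i : ℕ) = 0 := by
    intro j
    have h2 : (fun κ => ∑ i, u (i, κ) * t j ^ (e i : ℕ)) = 0 := by
      refine Matrix.eq_zero_of_forall_index_sum_mul_pow_eq_zero (hw j) fun κ => ?_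
      rw [← h (j, κ), formVal, Fintype.sum_prod_type_right]
      refine Finset.sum_congr rfl fun κ' _ => ?_
      rw [Finset.sum_mul]
    exact fun κ => congrFun h2 κ
  ext ⟨i, κ⟩
  have h3 : (fun k => u (e.symm k, κ)) = 0 := by
    refine Matrix.eq_zero_of_forall_index_sum_mul_pow_eq_zero (ht.comp e.symm.injective) fun k => ?_
    rw [← h1 (e.symm k) κ, ← Equiv.sum_comp e.symm]
    simp
  have := congrFun h3 (e i)
  simpa using this

/-- The matrix of the interpolation problem for `formVal`. -/
def interpMat {A Λ : Type*} [CommRing A] (eT eW : Λ → ℕ) (s W : Λ → A) : Matrix Λ Λ A :=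
  fun i μ => s i ^ eT μ * W i ^ eW μ

theorem interpMat_mulVec {A Λ : Type*} [CommRing A] [Fintype Λ] (eT eW : Λ → ℕ) (s W u : Λ → A)
    (i : Λ) : (interpMat eT eW s W).mulVec u i = formVal eT eW u (s i) (W i) := by
  rw [Matrix.mulVec, dotProduct, formVal]
  exact Finset.sum_congr rfl fun μ _ => by rw [interpMat]; ring

theorem det_interpMat_ne_zero [DecidableEq J] (e : J ≃ Fin (Fintype.card J)) {t : J → K}
    (ht : Function.Injective t) {w : J × Fin δ → K}
    (hw : ∀ j, Function.Injective fun κ => w (j, κ)) :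
    (interpMat (fun μ : J × Fin δ => (e μ.1 : ℕ)) (fun μ => (μ.2 : ℕ)) (fun μ => t μ.1) w).det
      ≠ 0 := by
  intro h0
  obtain ⟨u, hu, h⟩ := Matrix.exists_mulVec_eq_zero_iff.2 h0
  refine hu (eq_zero_of_formVal_eq_zero e ht hw fun i => ?_)
  rw [← interpMat_mulVec _ _ (fun μ => t μ.1) w, h]
  rfl

/-- Every bivariate polynomial of suitable bidegree is a `formVal`. -/
theorem formVal_coeff (e : J ≃ Fin (Fintype.card J)) (q : Fin δ → K[X])
    (hq : ∀ κ, (q κ).natDegree < Fintype.card J) (t w : K) :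
    formVal (fun μ : J × Fin δ => (e μ.1 : ℕ)) (fun μ => (μ.2 : ℕ))
      (fun μ => (q μ.2).coeff (e μ.1)) t w = ∑ κ, (q κ).eval t * w ^ (κ : ℕ) := by
  rw [formVal, Fintype.sum_prod_type_right]
  refine Finset.sum_congr rfl fun κ _ => ?_
  rw [Polynomial.eval_eq_sum_range' (hq κ), ← Fin.sum_univ_eq_sum_range
    (fun i => (q κ).coeff i * t ^ i), ← Equiv.sum_comp e, Finset.sum_mul]

end Interpolation

section UniversalInterpolation

open scoped Polynomial

variable {K : Type*} [Field K] {Λ : Type*} [Fintype Λ] [DecidableEq Λ]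

/-- The matrix of the universal interpolation problem `d Q + a ∑ u T ^ eT w ^ eW = 0` at points
`(s, W)`, whose coordinates are the two families of variables. -/
noncomputable def univMat (a : K[X]) (eT eW : Λ → ℕ) :
    Matrix Λ Λ (MvPolynomial (Λ ⊕ Λ) K) :=
  Matrix.diagonal (fun i => Polynomial.aeval (MvPolynomial.X (Sum.inl i)) a) *
    interpMat eT eW (fun i => MvPolynomial.X (Sum.inl i)) (fun i => MvPolynomial.X (Sum.inr i))

/-- The leading coefficient in the universal interpolation problem. -/
noncomputable def univDet (a : K[X]) (eT eW : Λ → ℕ) : MvPolynomial (Λ ⊕ Λ) K :=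
  (univMat a eT eW).det

/-- The remaining coefficients in the universal interpolation problem. -/
noncomputable def univCoeff (a Q : K[X]) (eT eW : Λ → ℕ) : Λ → MvPolynomial (Λ ⊕ Λ) K :=
  (univMat a eT eW).adjugate.mulVec
    fun i => -Polynomial.aeval (MvPolynomial.X (Sum.inl i)) Q

/-- The coefficients of the norm of the universal interpolant, divided by the product of
the `T - s`. -/
noncomputable def univResidual (δ : ℕ) (P : K[X][X]) (a Q : K[X]) (eT eW : Λ → ℕ) (m : ℕ) :
    MvPolynomial (Λ ⊕ Λ) K :=
  ((normMat δ P a Q eT eW (univDet a eT eW) (univCoeff a Q eT eW)).det /ₘ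
    ∏ i, (Polynomial.X - Polynomial.C (MvPolynomial.X (Sum.inl i)))).coeff m

variable {a Q : K[X]} {eT eW : Λ → ℕ}

theorem aeval_univDet (s W : Λ → K) :
    MvPolynomial.aeval (Sum.elim s W) (univDet a eT eW) =
      (∏ i, a.eval (s i)) * (interpMat eT eW s W).det := by
  rw [univDet, univMat, Matrix.det_mul, Matrix.det_diagonal, map_mul, map_prod]
  congr 1
  · refine Finset.prod_congr rfl fun i _ => ?_
    rw [← Polynomial.aeval_algHom_apply, MvPolynomial.aeval_X, Sum.elim_inl,
      Polynomial.coe_aeval_eq_eval]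
  · rw [AlgHom.map_det]
    congr 1
    ext i μ
    simp [interpMat]

theorem univCoeff_spec (i : Λ) :
    univDet a eT eW * Polynomial.aeval (MvPolynomial.X (Sum.inl i)) Q +
      Polynomial.aeval (MvPolynomial.X (Sum.inl i)) a * formVal eT eW (univCoeff a Q eT eW)
        (MvPolynomial.X (Sum.inl i)) (MvPolynomial.X (Sum.inr i)) = 0 := by
  have h1 : (univMat a eT eW).mulVec (univCoeff a Q eT eW) =
      univDet a eT eW • fun i => -Polynomial.aeval (MvPolynomial.X (Sum.inl i)) Q := by
    rw [univCoeff, Matrix.mulVec_mulVec, Matrix.mul_adjugate, Matrix.smul_mulVec,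
      Matrix.one_mulVec, univDet]
  have h2 := congrFun h1 i
  rw [univMat, ← Matrix.mulVec_mulVec, Matrix.mulVec_diagonal, interpMat_mulVec] at h2
  rw [h2, Pi.smul_apply, smul_eq_mul]
  ring

theorem curveFun_univCoeff (s W : Λ → K) (i : Λ) :
    curveFun a Q eT eW (MvPolynomial.aeval (Sum.elim s W) (univDet a eT eW))
      (fun μ => MvPolynomial.aeval (Sum.elim s W) (univCoeff a Q eT eW μ)) (s i) (W i) = 0 := by
  have h1 := congrArg (MvPolynomial.aeval (Sum.elim s W)) (univCoeff_spec (a := a) (Q := Q)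
    (eT := eT) (eW := eW) i)
  simp only [map_add, map_mul, map_zero, ← Polynomial.aeval_algHom_apply, MvPolynomial.aeval_X,
    Sum.elim_inl, Polynomial.coe_aeval_eq_eval, formVal, map_sum, map_pow, Sum.elim_inr] at h1
  rw [curveFun, formVal]
  exact h1

theorem aeval_univResidual {δ : ℕ} (P : K[X][X]) (s W : Λ → K) (m : ℕ) :
    MvPolynomial.aeval (Sum.elim s W) (univResidual δ P a Q eT eW m) =
      ((normMat δ P a Q eT eW (MvPolynomial.aeval (Sum.elim s W) (univDet a eT eW))
        (fun μ => MvPolynomial.aeval (Sum.elim s W) (univCoeff a Q eT eW μ))).det /ₘ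
        ∏ i, (Polynomial.X - Polynomial.C (s i))).coeff m := by
  have hm : (∏ i : Λ, (Polynomial.X - Polynomial.C
      (MvPolynomial.X (Sum.inl i) : MvPolynomial (Λ ⊕ Λ) K))).Monic :=
    Polynomial.monic_prod_of_monic _ _ fun i _ => Polynomial.monic_X_sub_C _
  rw [univResidual, ← det_normMat_map]
  have h1 : ∏ i, (Polynomial.X - Polynomial.C (s i)) = (∏ i : Λ, (Polynomial.X - Polynomial.C
      (MvPolynomial.X (Sum.inl i) : MvPolynomial (Λ ⊕ Λ) K))).map
      ((MvPolynomial.aeval (Sum.elim s W) : MvPolynomial (Λ ⊕ Λ) K →ₐ[K] K) :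
        MvPolynomial (Λ ⊕ Λ) K →+* K) := by
    rw [Polynomial.map_prod]
    refine Finset.prod_congr rfl fun i _ => ?_
    simp
  rw [h1, ← Polynomial.map_divByMonic _ hm, Polynomial.coeff_map]
  rfl

theorem univCoeff_eq_zero {s W : Λ → K} (h : ∀ i, Q.eval (s i) = 0) (μ : Λ) :
    MvPolynomial.aeval (Sum.elim s W) (univCoeff a Q eT eW μ) = 0 := by
  rw [univCoeff, Matrix.mulVec, dotProduct, map_sum]
  refine Finset.sum_eq_zero fun i _ => ?_
  rw [map_mul, map_neg, ← Polynomial.aeval_algHom_apply, MvPolynomial.aeval_X, Sum.elim_inl,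
    Polynomial.coe_aeval_eq_eval, h, neg_zero, mul_zero]

end UniversalInterpolation

section AbelConstancy

open scoped Polynomial Topology
open Filter

variable {δ : ℕ} {Λ : Type*} [Fintype Λ] {P : ℂ[X][X]} {a Q : ℂ[X]} {eT eW : Λ → ℕ} {N : ℕ}
  {Z : Type*} [Fintype Z]

/-- `curveFun` along a branch as a linear combination of functions of the first coordinate. -/
theorem curveFun_eq (d : ℂ) (u : Λ → ℂ) (t w : ℂ) :
    curveFun a Q eT eW d u t w =
      d * Q.eval t + ∑ μ, u μ * (a.eval t * t ^ eT μ * w ^ eW μ) := by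
  rw [curveFun, formVal, Finset.mul_sum]
  congr 1
  exact Finset.sum_congr rfl fun μ _ => by ring

theorem differentiableAt_branchMonomial {Λ : Type*} {eT eW : Λ → ℕ} {ω : ℂ → ℂ} {t : ℂ}
    (hω : DifferentiableAt ℂ ω t) (μ : Λ) :
    DifferentiableAt ℂ (fun t => a.eval t * t ^ eT μ * ω t ^ eW μ) t :=
  (a.differentiableAt.mul (differentiableAt_id.pow _)).mul (hω.pow _)

theorem hasDerivAt_curveFun_branch {ω : ℂ → ℂ} {t : ℂ} (hω : DifferentiableAt ℂ ω t) (d : ℂ)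
    (u : Λ → ℂ) :
    HasDerivAt (fun t => curveFun a Q eT eW d u t (ω t))
      (deriv (fun t => curveFun a Q eT eW d u t (ω t)) t) t := by
  refine DifferentiableAt.hasDerivAt ?_
  simp only [curveFun_eq]
  exact ((Q.differentiableAt).const_mul d).add (DifferentiableAt.fun_sum fun μ _ =>
    (differentiableAt_branchMonomial hω μ).const_mul _)

theorem hasDerivAt_curveFun_comp {ω d z : ℂ → ℂ} {u : Λ → ℂ → ℂ} {d' z' ζ : ℂ} {u' : Λ → ℂ}
    (hd : HasDerivAt d d' ζ) (hu : ∀ μ, HasDerivAt (u μ) (u' μ) ζ) (hz : HasDerivAt z z' ζ)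
    (hω : DifferentiableAt ℂ ω (z ζ)) :
    HasDerivAt (fun ζ => curveFun a Q eT eW (d ζ) (fun μ => u μ ζ) (z ζ) (ω (z ζ)))
      (curveFun a Q eT eW d' u' (z ζ) (ω (z ζ)) +
        deriv (fun t => curveFun a Q eT eW (d ζ) (fun μ => u μ ζ) t (ω t)) (z ζ) * z') ζ := by
  have hB := fun μ => (differentiableAt_branchMonomial (a := a) (eT := eT) (eW := eW) hω
      μ).hasDerivAt
  have hQ := Q.hasDerivAt (z ζ)
  have h1 : deriv (fun t => curveFun a Q eT eW (d ζ) (fun μ => u μ ζ) t (ω t)) (z ζ) =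
      d ζ * (Polynomial.derivative Q).eval (z ζ) + ∑ μ, u μ ζ *
        deriv (fun t => a.eval t * t ^ eT μ * ω t ^ eW μ) (z ζ) := by
    refine HasDerivAt.deriv ?_
    simp only [curveFun_eq]
    exact (hQ.const_mul _).add (HasDerivAt.fun_sum fun μ _ => (hB μ).const_mul _)
  have h2 := (hd.mul (hQ.comp ζ hz)).add (HasDerivAt.fun_sum (u := Finset.univ)
    fun μ _ => (hu μ).mul ((hB μ).comp ζ hz))
  rw [h1]
  simp only [curveFun_eq]
  refine HasDerivAt.congr_deriv (f := fun ζ => d ζ * Q.eval (z ζ) + ∑ μ, u μ ζ *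
    (a.eval (z ζ) * z ζ ^ eT μ * ω (z ζ) ^ eW μ)) h2 ?_
  simp only [Function.comp, Finset.sum_add_distrib, add_mul, Finset.sum_mul, mul_assoc]
  ring

theorem derivative_det_normMat_eval (hP : P.Monic) (hδ : P.natDegree = δ)
    {d : ℂ} {u : Λ → ℂ}
    {z : ℂ} {W : Fin δ → ℂ → ℂ} (hd : ∀ κ, DifferentiableAt ℂ (W κ) z)
    (hW : ∀ᶠ t in 𝓝 z, ∀ κ, P.eval₂ (Polynomial.evalRingHom t) (W κ t) = 0)
    (hinj : ∀ᶠ t in 𝓝 z, Function.Injective fun κ => W κ t) {κ : Fin δ}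
    (h0 : curveFun a Q eT eW d u z (W κ z) = 0) :
    (Polynomial.derivative (normMat δ P a Q eT eW d u).det).eval z =
      deriv (fun t => curveFun a Q eT eW d u t (W κ t)) z *
        ∏ κ' ∈ Finset.univ.erase κ, curveFun a Q eT eW d u z (W κ' z) := by
  have h1 : (fun t => (normMat δ P a Q eT eW d u).det.eval t) =ᶠ[𝓝 z]
      fun t => ∏ κ', curveFun a Q eT eW d u t (W κ' t) := by
    filter_upwards [hW, hinj] with t h1 h2
    exact eval_det_normMat hP hδ h1 h2 d u
  have h2 := HasDerivAt.fun_finsetProd (u := Finset.univ) fun κ' _ =>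
    hasDerivAt_curveFun_branch (a := a) (Q := Q) (eT := eT) (eW := eW) (hd κ') d u
  have h3 := h2.congr_of_eventuallyEq h1
  generalize (normMat δ P a Q eT eW d u).det = D at h3 ⊢
  have h3 := (D.hasDerivAt z).unique h3
  rw [h3, Finset.sum_eq_single κ]
  · rw [smul_eq_mul, mul_comm]
  · intro κ' _ hκ'
    rw [Finset.prod_eq_zero (Finset.mem_erase.2 ⟨hκ'.symm, Finset.mem_univ _⟩) h0, zero_smul]
  · exact fun h => absurd (Finset.mem_univ _) h

theorem sum_logDeriv_eq_zero [DecidableEq Z] (hP : P.Monic) (hδ : P.natDegree = δ)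
    (hN : DegreeBound δ P a eT eW N) (hQ : Q.natDegree ≤ N) (hQ1 : Q.coeff N = 1)
    (hδN : 2 ≤ δ * N) (hZ : Fintype.card Z = δ * N) {κ : Z → Fin δ}
    {W : Z → Fin δ → ℂ → ℂ} {ζ : ℂ} {d : ℂ → ℂ} {u : Λ → ℂ → ℂ} {z : Z → ℂ → ℂ} {d' : ℂ}
    {u' : Λ → ℂ} {z' : Z → ℂ}
    (hd : HasDerivAt d d' ζ) (hu : ∀ μ, HasDerivAt (u μ) (u' μ) ζ)
    (hz : ∀ r, HasDerivAt (z r) (z' r) ζ) (hd0 : d ζ ≠ 0)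
    (hWd : ∀ r κ, DifferentiableAt ℂ (W r κ) (z r ζ))
    (hW : ∀ r, ∀ᶠ t in 𝓝 (z r ζ), ∀ κ, P.eval₂ (Polynomial.evalRingHom t) (W r κ t) = 0)
    (hinj : ∀ r, ∀ᶠ t in 𝓝 (z r ζ), Function.Injective fun κ => W r κ t)
    (h0 : ∀ r, ∀ᶠ ζ in 𝓝 ζ,
      curveFun a Q eT eW (d ζ) (fun μ => u μ ζ) (z r ζ) (W r (κ r) (z r ζ)) = 0)
    (ha : ∀ r, a.eval (z r ζ) ≠ 0) (hzi : Function.Injective fun r => z r ζ) :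
    ∑ r, W r (κ r) (z r ζ) / a.eval (z r ζ) * z' r = 0 := by
  classical
  have h0' := fun r => (h0 r).self_of_nhds
  obtain ⟨hF, hsum⟩ := abel_sum_eq_zero hP hδ hN hQ hQ1 hd0 (u := fun μ => u μ ζ)
    (fun μ => u' μ - d' / d ζ * u μ ζ)
    hzi hZ hδN (W := fun r κ => W r κ (z r ζ)) (fun r => (hW r).self_of_nhds)
    (fun r => (hinj r).self_of_nhds) h0'
    (F' := fun r => deriv (fun t => curveFun a Q eT eW (d ζ) (fun μ => u μ ζ) t (W r (κ r) t))
      (z r ζ))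
    (fun r => derivative_det_normMat_eval hP hδ (hWd r) (hW r) (hinj r) (h0' r))
  rw [← neg_eq_zero, ← Finset.sum_neg_distrib, ← hsum]
  refine Finset.sum_congr rfl fun r _ => ?_
  have h1 := hasDerivAt_curveFun_comp (a := a) (Q := Q) (eT := eT) (eW := eW) hd hu (hz r)
    (hWd r (κ r))
  have h2 := h1.unique ((hasDerivAt_const ζ (0 : ℂ)).congr_of_eventuallyEq (h0 r))
  have hFr := hF r
  have har := ha r
  have h3 := h0' r
  set F' := deriv (fun t => curveFun a Q eT eW (d ζ) (fun μ => u μ ζ) t (W r (κ r) t)) (z r ζ)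
  have h4 : formVal eT eW (fun μ => u' μ - d' / d ζ * u μ ζ) (z r ζ) (W r (κ r) (z r ζ)) =
      formVal eT eW u' (z r ζ) (W r (κ r) (z r ζ)) -
        d' / d ζ * formVal eT eW (fun μ => u μ ζ) (z r ζ) (W r (κ r) (z r ζ)) := by
    simp only [formVal, Finset.mul_sum, ← Finset.sum_sub_distrib]
    exact Finset.sum_congr rfl fun μ _ => by ring
  rw [h4]
  rw [curveFun] at h2 h3
  field_simp
  linear_combination (-W r (κ r) (z r ζ) * d ζ) * h2 + W r (κ r) (z r ζ) * d' * h3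

theorem eventually_const_of_deriv_eq_zero {E : ℂ → ℂ} {z₀ : ℂ}
    (hd : ∀ᶠ z in 𝓝 z₀, DifferentiableAt ℂ E z) (h : ∀ᶠ z in 𝓝[≠] z₀, deriv E z = 0) :
    ∀ᶠ z in 𝓝 z₀, E z = E z₀ := by
  have han : AnalyticAt ℂ E z₀ := Complex.analyticAt_iff_eventually_differentiableAt.2 hd
  have h1 := (han.deriv.frequently_zero_iff_eventually_zero).1 h.frequently
  obtain ⟨r, hr, hball⟩ := Metric.eventually_nhds_iff_ball.1 (h1.and hd)
  filter_upwards [Metric.ball_mem_nhds z₀ hr] with z hz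
  exact (Metric.isOpen_ball.is_const_of_deriv_eq_zero (convex_ball z₀ r).isPreconnected
    (fun x hx => (hball x hx).2.differentiableWithinAt) (fun x hx => (hball x hx).1) hz
    (Metric.mem_ball_self hr))

theorem prod_eventually_const (hP : P.Monic) (hδ : P.natDegree = δ)
    (hN : DegreeBound δ P a eT eW N) (hQ : Q.natDegree ≤ N) (hQ1 : Q.coeff N = 1)
    (hδN : 2 ≤ δ * N) (hZ : Fintype.card Z = δ * N) {κ : Z → Fin δ}
    {W : Z → Fin δ → ℂ → ℂ} {y : Z → ℂ → ℂ} {ζ₀ : ℂ} {d : ℂ → ℂ} {u : Λ → ℂ → ℂ} {z : Z → ℂ → ℂ}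
    (hd : ∀ᶠ ζ in 𝓝 ζ₀, DifferentiableAt ℂ d ζ)
    (hu : ∀ μ, ∀ᶠ ζ in 𝓝 ζ₀, DifferentiableAt ℂ (u μ) ζ)
    (hz : ∀ r, ∀ᶠ ζ in 𝓝 ζ₀, DifferentiableAt ℂ (z r) ζ) (hd0 : d ζ₀ ≠ 0)
    (hWd : ∀ r, ∀ᶠ t in 𝓝 (z r ζ₀), ∀ κ, DifferentiableAt ℂ (W r κ) t)
    (hW : ∀ r, ∀ᶠ t in 𝓝 (z r ζ₀), ∀ κ, P.eval₂ (Polynomial.evalRingHom t) (W r κ t) = 0)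
    (hinj : ∀ r, ∀ᶠ t in 𝓝 (z r ζ₀), Function.Injective fun κ => W r κ t)
    (ha : ∀ r, ∀ᶠ t in 𝓝 (z r ζ₀), a.eval t ≠ 0)
    (hy : ∀ r, ∀ᶠ t in 𝓝 (z r ζ₀), HasDerivAt (y r) (W r (κ r) t / a.eval t * y r t) t)
    (h0 : ∀ r, ∀ᶠ ζ in 𝓝 ζ₀,
      curveFun a Q eT eW (d ζ) (fun μ => u μ ζ) (z r ζ) (W r (κ r) (z r ζ)) = 0)
    (hzi : ∀ᶠ ζ in 𝓝[≠] ζ₀, Function.Injective fun r => z r ζ) :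
    ∀ᶠ ζ in 𝓝 ζ₀, ∏ r, y r (z r ζ) = ∏ r, y r (z r ζ₀) := by
  classical
  have hzc : ∀ r, ContinuousAt (z r) ζ₀ := fun r => (hz r).self_of_nhds.continuousAt
  have pull : ∀ {p : Z → ℂ → Prop}, (∀ r, ∀ᶠ t in 𝓝 (z r ζ₀), p r t) →
      ∀ᶠ ζ in 𝓝 ζ₀, ∀ r, p r (z r ζ) := fun h =>
    eventually_all.2 fun r => (hzc r).eventually (h r)
  have hyz : ∀ᶠ ζ in 𝓝 ζ₀, HasDerivAt (fun ζ => ∏ r, y r (z r ζ))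
      (∑ r, (∏ r' ∈ Finset.univ.erase r, y r' (z r' ζ)) •
        (W r (κ r) (z r ζ) / a.eval (z r ζ) * y r (z r ζ) * deriv (z r) ζ)) ζ := by
    filter_upwards [pull hy, eventually_all.2 hz] with ζ h1 h2
    exact HasDerivAt.fun_finsetProd fun r _ => (h1 r).comp ζ (h2 r).hasDerivAt
  refine eventually_const_of_deriv_eq_zero (E := fun ζ => ∏ r, y r (z r ζ))
    (hyz.mono fun ζ h => h.differentiableAt) ?_
  have hd1 : ∀ᶠ ζ in 𝓝 ζ₀, d ζ ≠ 0 := hd.self_of_nhds.continuousAt.eventually_ne hd0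
  filter_upwards [nhdsWithin_le_nhds hyz, nhdsWithin_le_nhds hd, nhdsWithin_le_nhds hd1,
    nhdsWithin_le_nhds (eventually_all.2 hz), nhdsWithin_le_nhds (eventually_all.2 hu),
    nhdsWithin_le_nhds (pull hWd),
    nhdsWithin_le_nhds (pull fun r => (hW r).eventually_nhds),
    nhdsWithin_le_nhds (pull fun r => (hinj r).eventually_nhds),
    nhdsWithin_le_nhds (pull ha), nhdsWithin_le_nhds (eventually_all.2 fun r => (h0
    r).eventually_nhds),
    hzi] with ζ h1 h2 h3 h4 h5 h6 h7 h8 h9 h10 h11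
  rw [h1.deriv]
  have := sum_logDeriv_eq_zero hP hδ hN hQ hQ1 hδN hZ h2.hasDerivAt (fun μ => (h5 μ).hasDerivAt)
    (fun r => (h4 r).hasDerivAt) h3 h6 h7 h8 h10 h9 h11
  rw [← mul_zero (∏ r, y r (z r ζ)), ← this, Finset.mul_sum]
  refine Finset.sum_congr rfl fun r _ => ?_
  rw [← Finset.mul_prod_erase _ _ (Finset.mem_univ r), smul_eq_mul]
  ring

end AbelConstancy

section Deformation

open scoped Polynomial Topology
open Filter Metric

/-- The analytic branches `w j κ` of a plane curve `P(t, w) = 0` over discs around points `τ j`,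
together with solutions `y j κ` of `y' = (w / a) y`. -/
structure BranchData (ε δ : ℕ) where
  a : ℂ[X]
  P : ℂ[X][X]
  τ : Fin ε → ℂ
  R : ℝ
  w : Fin ε → Fin δ → ℂ → ℂ
  y : Fin ε → Fin δ → ℂ → ℂ
  monic : P.Monic
  natDegree_eq : P.natDegree = δ
  degree_le : ∀ i r c, i ≤ δ → a.natDegree + (mulMat δ P i r c).natDegree + 2 ≤ ε
  δ_pos : 0 < δ
  τ_injective : Function.Injective τ
  R_pos : 0 < R
  disjoint_ball : ∀ i j, i ≠ j → Disjoint (ball (τ i) R) (ball (τ j) R)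
  differentiableAt_w : ∀ j κ, ∀ t ∈ ball (τ j) R, DifferentiableAt ℂ (w j κ) t
  root : ∀ j, ∀ t ∈ ball (τ j) R, ∀ κ, P.eval₂ (Polynomial.evalRingHom t) (w j κ t) = 0
  w_injective : ∀ j, ∀ t ∈ ball (τ j) R, Function.Injective fun κ => w j κ t
  a_ne_zero : ∀ j, ∀ t ∈ ball (τ j) R, a.eval t ≠ 0
  y_ne_zero : ∀ j κ, ∀ t ∈ ball (τ j) R, y j κ t ≠ 0
  hasDerivAt_y : ∀ j κ, ∀ t ∈ ball (τ j) R,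
    HasDerivAt (y j κ) (w j κ t / a.eval t * y j κ t) t
  nodal_ne_zero : ∀ j, ∀ t ∈ ball (τ j) R,
    (Polynomial.derivative (∏ i, (Polynomial.X - Polynomial.C (τ i)))).eval t ≠ 0

namespace BranchData

variable {ε δ : ℕ} (D : BranchData ε δ)

/-- The polynomial vanishing at the base points. -/
noncomputable def nodal : ℂ[X] := ∏ i, (Polynomial.X - Polynomial.C (D.τ i))

theorem nodal_monic : D.nodal.Monic :=
  Polynomial.monic_prod_of_monic _ _ fun _ _ => Polynomial.monic_X_sub_C _

theorem natDegree_nodal : D.nodal.natDegree = ε := by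
  rw [nodal, Polynomial.natDegree_finsetProd_X_sub_C_eq_card, Finset.card_univ, Fintype.card_fin]

theorem nodal_eval_τ (j : Fin ε) : D.nodal.eval (D.τ j) = 0 := by
  rw [nodal, Polynomial.eval_prod]
  exact Finset.prod_eq_zero (Finset.mem_univ j) (by simp)

theorem two_le_ε (D : BranchData ε δ) : 2 ≤ ε := by
  have := D.degree_le 0 ⟨0, D.δ_pos⟩ ⟨0, D.δ_pos⟩ (Nat.zero_le _)
  omega

/-- The form `∑ x t ^ i w ^ j`. -/
def xForm (x : Fin ε × Fin δ → ℂ) (t w : ℂ) : ℂ :=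
  formVal (fun μ : Fin ε × Fin δ => (μ.1 : ℕ)) (fun μ => (μ.2 : ℕ)) x t w

/-- The tangent vector at `t` on the branch `(j, κ)` associated with a form. -/
noncomputable def speed (x : Fin ε × Fin δ → ℂ) (j : Fin ε) (κ : Fin δ) (t : ℂ) : ℂ :=
  -(D.a.eval t * xForm x t (D.w j κ t)) / (Polynomial.derivative D.nodal).eval t

/-- Auxiliary points on the curve at which the zeros of a function are prescribed. -/
structure Nodes (n : ℕ) where
  η : Option (Fin n) → ℂ
  T : Option (Fin n) → Fin ε → ℂ
  η_injective : Function.Injective η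
  η_none : η none = 0
  T_none : ∀ j, T none j = D.τ j
  T_mem : ∀ o j, T o j ∈ ball (D.τ j) (D.R / 4)
  nodal_T : ∀ o j, D.nodal.eval (T o j) = η o

theorem exists_nodes (n : ℕ) : Nonempty (D.Nodes n) := by
  have h1 : ∀ j, (fun t => D.nodal.eval t) '' ball (D.τ j) (D.R / 4) ∈ 𝓝 (0 : ℂ) := by
    intro j
    have h2 := (D.nodal.hasStrictDerivAt (D.τ j)).map_nhds_eq
      (D.nodal_ne_zero j _ (mem_ball_self D.R_pos))
    rw [← D.nodal_eval_τ j, ← h2]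
    exact image_mem_map (ball_mem_nhds _ (by linarith [D.R_pos]))
  have h3 : (⋂ j, (fun t => D.nodal.eval t) '' ball (D.τ j) (D.R / 4)) ∈ 𝓝 (0 : ℂ) :=
    iInter_mem.2 h1
  have h4 := (infinite_of_mem_nhds _ h3).sdiff (Set.finite_singleton (0 : ℂ))
  obtain ⟨s, hs, hcard⟩ := h4.exists_subset_card_eq n
  let f : Fin n ≃ s := (Fintype.equivFinOfCardEq (by simpa using hcard)).symm
  have hf : ∀ o : Fin n, ((f o : ℂ) ∈ ⋂ j, (fun t => D.nodal.eval t) '' ball (D.τ j) (D.R / 4)) ∧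
      (f o : ℂ) ≠ 0 := fun o => by
    have := hs (f o).2
    exact ⟨this.1, fun h => this.2 h⟩
  have hf' : ∀ (o : Fin n) j, ∃ t ∈ ball (D.τ j) (D.R / 4), D.nodal.eval t = f o := fun o j =>
    Set.mem_iInter.1 (hf o).1 j
  choose T hT hT' using hf'
  refine ⟨⟨fun o => o.elim 0 fun o => (f o : ℂ), fun o => o.elim D.τ T, ?_, rfl, fun _ => rfl,
    ?_, ?_⟩⟩
  · rintro (_ | o) (_ | o') h
    · rfl
    · exact absurd h.symm (hf o').2
    · exact absurd h (hf o).2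
    · exact congrArg some (f.injective (Subtype.ext h))
  · rintro (_ | o) j
    · exact mem_ball_self (by linarith [D.R_pos])
    · exact hT o j
  · rintro (_ | o) j
    · exact D.nodal_eval_τ j
    · exact hT' o j

namespace Nodes

variable {D} {n : ℕ} (S : D.Nodes n)

theorem T_mem' (o j) : S.T o j ∈ ball (D.τ j) D.R :=
  ball_subset_ball (by linarith [D.R_pos]) (S.T_mem o j)

theorem T_injective : Function.Injective fun i : Option (Fin n) × Fin ε => S.T i.1 i.2 := by
  rintro ⟨o, j⟩ ⟨o', j'⟩ (h : S.T o j = S.T o' j')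
  have h1 : o = o' := S.η_injective (by rw [← S.nodal_T o j, h, S.nodal_T])
  by_cases h2 : j = j'
  · rw [h1, h2]
  · exact absurd (S.T_mem' o' j') (Set.disjoint_left.1 (D.disjoint_ball j j' h2)
      (h ▸ S.T_mem' o j))

/-- The polynomial vanishing at all nodes. -/
noncomputable def Q : ℂ[X] := (∏ o, (Polynomial.X - Polynomial.C (S.η o))).comp D.nodal

theorem natDegree_Q : S.Q.natDegree = (n + 1) * ε := by
  rw [Q, Polynomial.natDegree_comp, D.natDegree_nodal,
    Polynomial.natDegree_finsetProd_X_sub_C_eq_card, Finset.card_univ, Fintype.card_option,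
    Fintype.card_fin]

theorem coeff_Q : S.Q.coeff ((n + 1) * ε) = 1 := by
  have h : S.Q.Monic := by
    refine Polynomial.Monic.comp (Polynomial.monic_prod_of_monic _ _ fun i _ =>
      Polynomial.monic_X_sub_C _) D.nodal_monic ?_
    rw [D.natDegree_nodal]
    have := D.two_le_ε
    omega
  rw [← S.natDegree_Q]
  exact h

theorem eval_Q (o j) : S.Q.eval (S.T o j) = 0 := by
  rw [Q, Polynomial.eval_comp, S.nodal_T, Polynomial.eval_prod]
  exact Finset.prod_eq_zero (Finset.mem_univ o) (by simp)

theorem eval_derivative_prod (o) : (Polynomial.derivative (∏ o, (Polynomial.X -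
    Polynomial.C (S.η o)))).eval (S.η o) = ∏ o' ∈ Finset.univ.erase o, (S.η o - S.η o') := by
  have := Lagrange.eval_nodal_derivative_eval_node_eq (v := S.η) (Finset.mem_univ o)
  rwa [Lagrange.nodal, Lagrange.eval_nodal] at this

theorem eval_derivative_Q (o j) : (Polynomial.derivative S.Q).eval (S.T o j) =
    (∏ o' ∈ Finset.univ.erase o, (S.η o - S.η o')) *
      (Polynomial.derivative D.nodal).eval (S.T o j) := by
  rw [Q, Polynomial.derivative_comp, Polynomial.eval_mul, Polynomial.eval_comp, S.nodal_T,
    S.eval_derivative_prod, mul_comm]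

theorem eval_derivative_Q_ne_zero (o j) : (Polynomial.derivative S.Q).eval (S.T o j) ≠ 0 := by
  rw [S.eval_derivative_Q]
  refine mul_ne_zero (Finset.prod_ne_zero_iff.2 fun o' ho' => ?_) (D.nodal_ne_zero j _ (S.T_mem' o
    j))
  exact sub_ne_zero.2 fun h => (Finset.mem_erase.1 ho').1 (S.η_injective h).symm

/-- The exponents of `t` in the interpolating functions. -/
noncomputable def eT (μ : (Fin n × Fin ε) × Fin δ) : ℕ := Fintype.equivFin (Fin n × Fin ε) μ.1

/-- The exponents of `w` in the interpolating functions. -/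
def eW (μ : (Fin n × Fin ε) × Fin δ) : ℕ := μ.2

theorem degreeBound : DegreeBound δ D.P D.a (eT (n := n) (ε := ε) (δ := δ)) eW ((n + 1) * ε) := by
  intro μ i r c hi
  have h1 := D.degree_le i r c (hi.trans μ.2.2)
  have h2 : eT μ < n * ε := by
    refine (Fintype.equivFin (Fin n × Fin ε) μ.1).2.trans_eq ?_
    rw [Fintype.card_prod, Fintype.card_fin, Fintype.card_fin]
  have h3 : (n + 1) * ε = n * ε + ε := by ring
  omega

/-- The prescribed zeros. -/
noncomputable def s (x : Fin ε × Fin δ → ℂ) (l : (Fin n × Fin ε) × Fin δ) (ζ : ℂ) : ℂ :=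
  S.T (some l.1.1) l.1.2 + ζ * D.speed x l.1.2 l.2 (S.T (some l.1.1) l.1.2)

/-- The values at `ζ` of a polynomial in the coordinates of the prescribed zeros. -/
noncomputable def val (x : Fin ε × Fin δ → ℂ)
    (p : MvPolynomial (((Fin n × Fin ε) × Fin δ) ⊕ ((Fin n × Fin ε) × Fin δ)) ℂ) (ζ : ℂ) : ℂ :=
  MvPolynomial.aeval (Sum.elim (fun l => S.s x l ζ) fun l => D.w l.1.2 l.2 (S.s x l ζ)) p

variable (x : Fin ε × Fin δ → ℂ)

theorem hasDerivAt_s (l) (ζ : ℂ) :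
    HasDerivAt (S.s x l) (D.speed x l.1.2 l.2 (S.T (some l.1.1) l.1.2)) ζ := by
  have := ((hasDerivAt_id ζ).mul_const
    (D.speed x l.1.2 l.2 (S.T (some l.1.1) l.1.2))).const_add (S.T (some l.1.1) l.1.2)
  simp only [id, one_mul] at this
  exact this

theorem s_zero (l) : S.s x l 0 = S.T (some l.1.1) l.1.2 := by simp [s]

theorem analyticAt_s (l) (ζ : ℂ) : AnalyticAt ℂ (S.s x l) ζ :=
  Complex.analyticAt_iff_eventually_differentiableAt.2
    (Eventually.of_forall fun ζ => (S.hasDerivAt_s x l ζ).differentiableAt)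

theorem analyticAt_w (D : BranchData ε δ) (j κ) {t : ℂ} (ht : t ∈ ball (D.τ j) D.R) :
    AnalyticAt ℂ (D.w j κ) t :=
  Complex.analyticAt_iff_eventually_differentiableAt.2 <| by
    filter_upwards [isOpen_ball.mem_nhds ht] with t ht using D.differentiableAt_w j κ t ht

theorem analyticAt_val {ζ : ℂ} (h : ∀ l, S.s x l ζ ∈ ball (D.τ l.1.2) D.R) (p) :
    AnalyticAt ℂ (S.val x p) ζ := by
  have h1 : ∀ i, AnalyticAt ℂ (fun ζ =>
      Sum.elim (fun l => S.s x l ζ) (fun l => D.w l.1.2 l.2 (S.s x l ζ)) i) ζ := by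
    rintro (l | l)
    · exact S.analyticAt_s x l ζ
    · exact (analyticAt_w D l.1.2 l.2 (h l)).comp (S.analyticAt_s x l ζ)
  exact AnalyticAt.aeval_mvPolynomial h1 p

/-- The leading coefficient of the interpolating function. -/
noncomputable def d : ℂ → ℂ := S.val x (univDet D.a eT eW)

/-- The remaining coefficients of the interpolating function. -/
noncomputable def u (μ : (Fin n × Fin ε) × Fin δ) : ℂ → ℂ := S.val x (univCoeff D.a S.Q eT eW μ)

/-- The coefficients of the norm of the interpolating function. -/
noncomputable def res (m : ℕ) : ℂ → ℂ := S.val x (univResidual δ D.P D.a S.Q eT eW m)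

theorem s_zero_mem (l) : S.s x l 0 ∈ ball (D.τ l.1.2) D.R := by
  rw [S.s_zero]; exact S.T_mem' _ _

theorem d_zero : S.d x 0 = (∏ l : (Fin n × Fin ε) × Fin δ, D.a.eval (S.T (some l.1.1) l.1.2)) *
    (interpMat eT eW (fun l : (Fin n × Fin ε) × Fin δ => S.T (some l.1.1) l.1.2)
      (fun l => D.w l.1.2 l.2 (S.T (some l.1.1) l.1.2))).det := by
  rw [d, val, aeval_univDet]
  simp only [S.s_zero]

theorem d_zero_ne_zero : S.d x 0 ≠ 0 := by
  rw [S.d_zero]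
  refine mul_ne_zero (Finset.prod_ne_zero_iff.2 fun l _ => D.a_ne_zero l.1.2 _ (S.T_mem' _ _)) ?_
  refine det_interpMat_ne_zero (J := Fin n × Fin ε) (δ := δ) (Fintype.equivFin _)
    (t := fun j => S.T (some j.1) j.2)
    (w := fun l => D.w l.1.2 l.2 (S.T (some l.1.1) l.1.2)) ?_ fun j => ?_
  · intro j j' h
    have := S.T_injective (a₁ := (some j.1, j.2)) (a₂ := (some j'.1, j'.2)) h
    simp only [Prod.mk.injEq, Option.some.injEq] at this
    exact Prod.ext this.1 this.2
  · exact D.w_injective j.2 _ (S.T_mem' (some j.1) j.2)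

theorem u_zero (μ) : S.u x μ 0 = 0 := by
  rw [u, val]
  refine univCoeff_eq_zero (fun l => ?_) μ
  rw [S.s_zero, S.eval_Q]

theorem curveFun_s (l) (ζ : ℂ) : curveFun D.a S.Q eT eW (S.d x ζ) (fun μ => S.u x μ ζ) (S.s x l ζ)
    (D.w l.1.2 l.2 (S.s x l ζ)) = 0 :=
  curveFun_univCoeff (fun l => S.s x l ζ) (fun l => D.w l.1.2 l.2 (S.s x l ζ)) l

end Nodes

end BranchData

end Deformation

section Deformation

open scoped Polynomial Topology
open Filter Metric

namespace BranchData.Nodes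

variable {ε δ : ℕ} {D : BranchData ε δ} {n : ℕ} (S : D.Nodes n) (x : Fin ε × Fin δ → ℂ)

theorem analyticAt_d_zero : AnalyticAt ℂ (S.d x) 0 := S.analyticAt_val x (S.s_zero_mem x) _

theorem analyticAt_u_zero (μ) : AnalyticAt ℂ (S.u x μ) 0 := S.analyticAt_val x (S.s_zero_mem x) _

theorem hasDerivAt_curveFun_zero {ω : ℂ → ℂ} (t : ℂ) :
    HasDerivAt (fun t => curveFun D.a S.Q eT eW (S.d x 0) (fun μ => S.u x μ 0) t (ω t))
      (S.d x 0 * (Polynomial.derivative S.Q).eval t) t := by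
  simp only [S.u_zero, curveFun_eq, zero_mul, Finset.sum_const_zero, add_zero]
  exact (S.Q.hasDerivAt t).const_mul _

theorem exists_residual (i : Fin ε × Fin δ) : ∃ c : ℂ → ℂ, c 0 = D.τ i.1 ∧
    ∀ᶠ ζ in 𝓝 (0 : ℂ), DifferentiableAt ℂ c ζ ∧
      curveFun D.a S.Q eT eW (S.d x ζ) (fun μ => S.u x μ ζ) (c ζ) (D.w i.1 i.2 (c ζ)) = 0 := by
  refine exists_implicit_function (G := fun q : ℂ × ℂ => curveFun D.a S.Q eT eW (S.d x q.1)
    (fun μ => S.u x μ q.1) q.2 (D.w i.1 i.2 q.2)) (z₀ := 0) (t₀ := D.τ i.1) ?_ ?_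
    (S.hasDerivAt_curveFun_zero x (D.τ i.1)) ?_
  · have hw : ContDiffAt ℂ 1 (D.w i.1 i.2) (D.τ i.1) :=
      (analyticAt_w D i.1 i.2 (mem_ball_self D.R_pos)).contDiffAt
    have h1 : ∀ p : ℂ[X], ContDiffAt ℂ 1 (fun q : ℂ × ℂ => p.eval q.2) (0, D.τ i.1) := fun p =>
      p.differentiable.contDiff.contDiffAt.comp (0, D.τ i.1) contDiffAt_snd
    simp only [curveFun_eq]
    refine ContDiffAt.add (ContDiffAt.mul ?_ (h1 _)) (ContDiffAt.sum fun μ _ =>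
      ContDiffAt.mul ?_ (ContDiffAt.mul (ContDiffAt.mul (h1 _) (contDiffAt_snd.pow _)) ?_))
    · exact (S.analyticAt_d_zero x).contDiffAt.comp (0, D.τ i.1) contDiffAt_fst
    · exact (S.analyticAt_u_zero x μ).contDiffAt.comp (0, D.τ i.1) contDiffAt_fst
    · exact (hw.comp (0, D.τ i.1) contDiffAt_snd).pow _
  · simp only [S.u_zero, curveFun_eq, zero_mul, Finset.sum_const_zero, add_zero]
    rw [← S.T_none, S.eval_Q, mul_zero]
  · rw [← S.T_none]
    exact mul_ne_zero (S.d_zero_ne_zero x) (S.eval_derivative_Q_ne_zero _ _)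

/-- The derivative at `0` of a zero of the interpolating function. -/
theorem formVal_deriv_u_add (o) (j) (κ) {z : ℂ → ℂ} (hz0 : z 0 = S.T o j) {z' : ℂ}
    (hz : HasDerivAt z z' 0)
    (h : ∀ᶠ ζ in 𝓝 (0 : ℂ), curveFun D.a S.Q eT eW (S.d x ζ) (fun μ => S.u x μ ζ) (z ζ)
      (D.w j κ (z ζ)) = 0) :
    D.a.eval (S.T o j) * formVal eT eW (fun μ => deriv (S.u x μ) 0) (S.T o j) (D.w j κ (S.T o j)) +
      S.d x 0 * ((∏ o' ∈ Finset.univ.erase o, (S.η o - S.η o')) *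
        (Polynomial.derivative D.nodal).eval (S.T o j)) * z' = 0 := by
  have h1 := hasDerivAt_curveFun_comp (a := D.a) (Q := S.Q) (eT := eT) (eW := eW) (ω := D.w j κ)
    (S.analyticAt_d_zero x).differentiableAt.hasDerivAt
    (fun μ => (S.analyticAt_u_zero x μ).differentiableAt.hasDerivAt) hz
    (hz0 ▸ D.differentiableAt_w j κ _ (S.T_mem' o j))
  have h2 := h1.unique ((hasDerivAt_const (0 : ℂ) (0 : ℂ)).congr_of_eventuallyEq h)
  rw [(S.hasDerivAt_curveFun_zero x (z 0)).deriv, hz0, S.eval_derivative_Q, curveFun, S.eval_Q,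
    mul_zero, zero_add] at h2
  exact h2

/-- The polynomial of degree less than `n` interpolating the derivative of `∏ (X - η)` at the
nonzero nodes. -/
noncomputable def interp : ℂ[X] :=
  Polynomial.derivative (∏ o, (Polynomial.X - Polynomial.C (S.η o))) -
    Polynomial.C ((n : ℂ) + 1) * ∏ o : Fin n, (Polynomial.X - Polynomial.C (S.η (some o)))

theorem natDegree_interp_lt (hn : 0 < n) : S.interp.natDegree < n := by
  have h1 : (∏ o, (Polynomial.X - Polynomial.C (S.η o))).natDegree = n + 1 := by
    rw [Polynomial.natDegree_finsetProd_X_sub_C_eq_card, Finset.card_univ, Fintype.card_option,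
      Fintype.card_fin]
  have h2 : (∏ o : Fin n, (Polynomial.X - Polynomial.C (S.η (some o)))).natDegree = n := by
    rw [Polynomial.natDegree_finsetProd_X_sub_C_eq_card, Finset.card_univ, Fintype.card_fin]
  have h3 : (∏ o, (Polynomial.X - Polynomial.C (S.η o))).Monic :=
    Polynomial.monic_prod_of_monic _ _ fun _ _ => Polynomial.monic_X_sub_C _
  have h4 : (∏ o : Fin n, (Polynomial.X - Polynomial.C (S.η (some o)))).Monic :=
    Polynomial.monic_prod_of_monic _ _ fun _ _ => Polynomial.monic_X_sub_C _
  have h5 : S.interp.natDegree ≤ n := by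
    refine (Polynomial.natDegree_sub_le _ _).trans (max_le ?_ ?_)
    · exact (Polynomial.natDegree_derivative_le _).trans (by omega)
    · exact (Polynomial.natDegree_C_mul_le _ _).trans h2.le
  have h6 : S.interp.coeff n = 0 := by
    rw [interp, Polynomial.coeff_sub, Polynomial.coeff_derivative, Polynomial.coeff_C_mul]
    have h7 := h3.coeff_natDegree
    have h8 := h4.coeff_natDegree
    rw [h1] at h7
    rw [h2] at h8
    rw [h7, h8]
    ring
  refine lt_of_le_of_ne h5 fun h => ?_
  have h9 : S.interp.leadingCoeff = 0 := by rw [Polynomial.leadingCoeff, h, h6]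
  rw [Polynomial.leadingCoeff_eq_zero.1 h9, Polynomial.natDegree_zero] at h
  omega

theorem interp_eval_some (o : Fin n) : S.interp.eval (S.η (some o)) =
    ∏ o' ∈ Finset.univ.erase (some o), (S.η (some o) - S.η o') := by
  rw [interp, Polynomial.eval_sub, S.eval_derivative_prod, Polynomial.eval_mul,
    Polynomial.eval_prod Finset.univ, Finset.prod_eq_zero (Finset.mem_univ o) (by simp), mul_zero,
    sub_zero]

theorem interp_eval_zero : S.interp.eval 0 =
    -n * ∏ o' ∈ Finset.univ.erase none, (S.η none - S.η o') := by
  have h1 := S.eval_derivative_prod none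
  have h2 : ∏ o' ∈ Finset.univ.erase none, (S.η none - S.η o') = ∏ o : Fin n, (-S.η (some o)) := by
    have := Finset.mul_prod_erase Finset.univ (fun o' => if o' = none then 1 else S.η none - S.η o')
      (Finset.mem_univ none)
    rw [Fintype.prod_option, if_pos rfl, one_mul, one_mul] at this
    rw [Finset.prod_congr rfl fun o' ho' => (if_neg (Finset.mem_erase.1 ho').1).symm, this]
    exact Finset.prod_congr rfl fun o _ => by simp [S.η_none]
  rw [S.η_none] at h1
  rw [interp, Polynomial.eval_sub, h1, Polynomial.eval_mul, Polynomial.eval_prod, ← S.η_none, h2]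
  simp only [S.η_none, Polynomial.eval_sub, Polynomial.eval_X, Polynomial.eval_C, zero_sub]
  ring

theorem exists_form (hn : 0 < n) : ∃ v : (Fin n × Fin ε) × Fin δ → ℂ, ∀ t w : ℂ,
    formVal eT eW v t w = S.interp.eval (D.nodal.eval t) * xForm x t w := by
  refine ⟨fun μ => (S.interp.comp D.nodal * ∑ i : Fin ε, Polynomial.C (x (i, μ.2)) *
    Polynomial.X ^ (i : ℕ)).coeff (Fintype.equivFin (Fin n × Fin ε) μ.1), fun t w => ?_⟩
  have h1 := formVal_coeff (Fintype.equivFin (Fin n × Fin ε)) (fun κ : Fin δ =>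
    S.interp.comp D.nodal * ∑ i : Fin ε, Polynomial.C (x (i, κ)) * Polynomial.X ^ (i : ℕ))
    (fun κ => ?_) t w
  · refine h1.trans ?_
    rw [xForm, formVal, Fintype.sum_prod_type_right, Finset.mul_sum]
    refine Finset.sum_congr rfl fun κ _ => ?_
    rw [Polynomial.eval_mul, Polynomial.eval_comp, Polynomial.eval_finsetSum, mul_assoc,
      Finset.sum_mul]
    simp
  · rw [Fintype.card_prod, Fintype.card_fin, Fintype.card_fin]
    refine (Polynomial.natDegree_mul_le).trans_lt ?_
    rw [Polynomial.natDegree_comp, D.natDegree_nodal]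
    have h2 : (∑ i : Fin ε, Polynomial.C (x (i, κ)) * Polynomial.X ^ (i : ℕ)).natDegree ≤ ε - 1 :=
      Polynomial.natDegree_sum_le_of_forall_le _ _ fun i _ =>
        (Polynomial.natDegree_C_mul_X_pow_le _ _).trans (by omega)
    have h3 := S.natDegree_interp_lt hn
    have h4 : (S.interp.natDegree + 1) * ε ≤ n * ε := Nat.mul_le_mul_right _ h3
    have := D.two_le_ε
    have h5 : (S.interp.natDegree + 1) * ε = S.interp.natDegree * ε + ε := by ring
    omega

theorem formVal_deriv_u (hn : 0 < n) (t w : ℂ) :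
    formVal eT eW (fun μ => deriv (S.u x μ) 0) t w =
      S.d x 0 * (S.interp.eval (D.nodal.eval t) * xForm x t w) := by
  obtain ⟨v, hv⟩ := S.exists_form x hn
  have h1 : (fun μ => deriv (S.u x μ) 0 - S.d x 0 * v μ) = 0 := by
    refine eq_zero_of_formVal_eq_zero (J := Fin n × Fin ε) (δ := δ) (Fintype.equivFin _)
      (t := fun j => S.T (some j.1) j.2)
      (w := fun l => D.w l.1.2 l.2 (S.T (some l.1.1) l.1.2)) ?_ (fun j => ?_) fun l => ?_
    · intro j j' h
      have := S.T_injective (a₁ := (some j.1, j.2)) (a₂ := (some j'.1, j'.2)) h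
      simp only [Prod.mk.injEq, Option.some.injEq] at this
      exact Prod.ext this.1 this.2
    · exact D.w_injective j.2 _ (S.T_mem' (some j.1) j.2)
    · have h2 := S.formVal_deriv_u_add x (some l.1.1) l.1.2 l.2 (S.s_zero x l) (S.hasDerivAt_s x l
        0)
        (Eventually.of_forall fun ζ => S.curveFun_s x l ζ)
      have h3 := hv (S.T (some l.1.1) l.1.2) (D.w l.1.2 l.2 (S.T (some l.1.1) l.1.2))
      rw [S.nodal_T, S.interp_eval_some] at h3
      have h4 := D.a_ne_zero l.1.2 _ (S.T_mem' (some l.1.1) l.1.2)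
      have h5 := D.nodal_ne_zero l.1.2 _ (S.T_mem' (some l.1.1) l.1.2)
      change (Polynomial.derivative D.nodal).eval _ ≠ 0 at h5
      rw [BranchData.speed] at h2
      have h6 : formVal eT eW (fun μ => deriv (S.u x μ) 0 - S.d x 0 * v μ)
          (S.T (some l.1.1) l.1.2) (D.w l.1.2 l.2 (S.T (some l.1.1) l.1.2)) =
          formVal eT eW (fun μ => deriv (S.u x μ) 0)
          (S.T (some l.1.1) l.1.2) (D.w l.1.2 l.2 (S.T (some l.1.1) l.1.2)) - S.d x 0 *
          formVal eT eW v (S.T (some l.1.1) l.1.2) (D.w l.1.2 l.2 (S.T (some l.1.1) l.1.2)) := by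
        simp only [formVal, Finset.mul_sum, ← Finset.sum_sub_distrib]
        exact Finset.sum_congr rfl fun μ _ => by ring
      refine h6.trans ?_
      rw [h3]
      refine mul_left_cancel₀ h4 ?_
      field_simp at h2
      linear_combination h2
  rw [← hv, formVal, formVal, Finset.mul_sum]
  refine Finset.sum_congr rfl fun μ _ => ?_
  have := congrFun h1 μ
  simp only [Pi.zero_apply] at this
  linear_combination (t ^ eT μ * w ^ eW μ) * this

theorem hasDerivAt_residual (hn : 0 < n) (i : Fin ε × Fin δ) {c : ℂ → ℂ} (hc0 : c 0 = D.τ i.1)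
    (hc : ∀ᶠ ζ in 𝓝 (0 : ℂ), DifferentiableAt ℂ c ζ ∧
      curveFun D.a S.Q eT eW (S.d x ζ) (fun μ => S.u x μ ζ) (c ζ) (D.w i.1 i.2 (c ζ)) = 0) :
    HasDerivAt c (-n * D.speed x i.1 i.2 (D.τ i.1)) 0 := by
  have h1 := hc.self_of_nhds.1.hasDerivAt
  have h2 := S.formVal_deriv_u_add x none i.1 i.2 (hc0.trans (S.T_none _).symm) h1
    (hc.mono fun ζ h => h.2)
  rw [S.formVal_deriv_u x hn, S.nodal_T, S.η_none, S.interp_eval_zero, S.η_none] at h2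
  have h3 := S.eval_derivative_Q_ne_zero none i.1
  rw [S.eval_derivative_Q, S.η_none] at h3
  have h4 := S.d_zero_ne_zero x
  rw [BranchData.speed, ← S.T_none]
  refine h1.congr_deriv ?_
  have h5 := left_ne_zero_of_mul h3
  have h6 := right_ne_zero_of_mul h3
  field_simp
  refine mul_left_cancel₀ (mul_ne_zero h4 h5) ?_
  linear_combination h2

end BranchData.Nodes

end Deformation

section Deformation

open scoped Polynomial Topology
open Filter Metric

theorem HasDerivAt.eventually_ne_of_ne {f g : ℂ → ℂ} {f' g' z₀ : ℂ} (hf : HasDerivAt f f' z₀)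
    (hg : HasDerivAt g g' z₀) (h : f z₀ ≠ g z₀ ∨ f' ≠ g') : ∀ᶠ z in 𝓝[≠] z₀, f z ≠ g z := by
  rcases h with h | h
  · refine nhdsWithin_le_nhds ?_
    filter_upwards [(hf.continuousAt.sub hg.continuousAt).eventually_ne (sub_ne_zero.2 h)] with z hz
    exact sub_ne_zero.1 hz
  · filter_upwards [(hf.sub hg).eventually_ne (sub_ne_zero.2 h) (c := 0)] with z hz
    exact sub_ne_zero.1 hz

namespace BranchData.Nodes

variable {ε δ : ℕ} {D : BranchData ε δ} {n : ℕ} (S : D.Nodes n) (x : Fin ε × Fin δ → ℂ)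

theorem prod_eq_mul {M : Type*} [CommMonoid M]
    (f : Option (Fin n) → Fin ε → Fin δ → M) :
    ∏ r : (Option (Fin n) × Fin ε) × Fin δ, f r.1.1 r.1.2 r.2 =
      (∏ i : Fin ε × Fin δ, f none i.1 i.2) *
        ∏ l : (Fin n × Fin ε) × Fin δ, f (some l.1.1) l.1.2 l.2 := by
  simp only [Fintype.prod_prod_type, Fintype.prod_option]

theorem exists_deformation (hn : 0 < n)
    (hgen : ∀ o j, Function.Injective fun κ => xForm x (S.T o j) (D.w j κ (S.T o j))) :
    ∃ c : Fin ε × Fin δ → ℂ → ℂ,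
      (∀ i, c i 0 = D.τ i.1 ∧ HasDerivAt (c i) (-n * D.speed x i.1 i.2 (D.τ i.1)) 0) ∧
      ∀ᶠ ζ in 𝓝[≠] (0 : ℂ),
        (∀ m, S.res x m ζ =
          S.d x ζ ^ δ * (∏ i, (Polynomial.X - Polynomial.C (c i ζ))).coeff m) ∧
        (∏ i, D.y i.1 i.2 (c i ζ)) * ∏ l : (Fin n × Fin ε) × Fin δ, D.y l.1.2 l.2 (S.s x l ζ) =
          (∏ i : Fin ε × Fin δ, D.y i.1 i.2 (D.τ i.1)) *
            ∏ l : (Fin n × Fin ε) × Fin δ, D.y l.1.2 l.2 (S.T (some l.1.1) l.1.2) := by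
  choose c hc0 hc using S.exists_residual x
  have hcd := fun i => S.hasDerivAt_residual x hn i (hc0 i) (hc i)
  refine ⟨c, fun i => ⟨hc0 i, hcd i⟩, ?_⟩
  set zz : Option (Fin n) → Fin ε → Fin δ → ℂ → ℂ := fun o j κ ζ =>
    o.elim (c (j, κ) ζ) fun o => S.s x ((o, j), κ) ζ with hzz
  have hzz0 : ∀ o j κ, zz o j κ 0 = S.T o j := by
    rintro (_ | o) j κ
    · exact (hc0 (j, κ)).trans (S.T_none j).symm
    · exact S.s_zero x ((o, j), κ)
  have hzzd : ∀ o j κ, HasDerivAt (zz o j κ)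
      ((o.elim (-n : ℂ) fun _ => 1) * D.speed x j κ (S.T o j)) 0 := by
    rintro (_ | o) j κ
    · rw [S.T_none]; exact hcd (j, κ)
    · exact (S.hasDerivAt_s x ((o, j), κ) 0).congr_deriv (one_mul _).symm
  have hinj : ∀ᶠ ζ in 𝓝[≠] (0 : ℂ), Function.Injective
      fun r : (Option (Fin n) × Fin ε) × Fin δ => zz r.1.1 r.1.2 r.2 ζ := by
    have h1 : ∀ r r' : (Option (Fin n) × Fin ε) × Fin δ, r ≠ r' →
        ∀ᶠ ζ in 𝓝[≠] (0 : ℂ), zz r.1.1 r.1.2 r.2 ζ ≠ zz r'.1.1 r'.1.2 r'.2 ζ := by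
      rintro ⟨⟨o, j⟩, κ⟩ ⟨⟨o', j'⟩, κ'⟩ hne
      refine (hzzd o j κ).eventually_ne_of_ne (hzzd o' j' κ') ?_
      by_cases hT : (o, j) = (o', j')
      · right
        obtain ⟨rfl, rfl⟩ := Prod.mk.inj hT
        have hκ : κ ≠ κ' := fun h => hne (by rw [h])
        intro h
        have h2 : (o.elim (-n : ℂ) fun _ => 1) ≠ 0 := by
          cases o
          · exact neg_ne_zero.2 (Nat.cast_ne_zero.2 hn.ne')
          · exact one_ne_zero
        have h3 := mul_left_cancel₀ h2 h
        have h4 : (Polynomial.derivative D.nodal).eval (S.T o j) ≠ 0 :=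
          D.nodal_ne_zero j _ (S.T_mem' o j)
        rw [BranchData.speed, BranchData.speed, div_left_inj' h4, neg_inj] at h3
        exact hκ (hgen o j (mul_left_cancel₀ (D.a_ne_zero j _ (S.T_mem' o j)) h3))
      · left
        change zz o j κ 0 ≠ zz o' j' κ' 0
        rw [hzz0, hzz0]
        exact fun h => hT (S.T_injective h)
    have h2 : ∀ᶠ ζ in 𝓝[≠] (0 : ℂ), ∀ r r' : (Option (Fin n) × Fin ε) × Fin δ, r ≠ r' →
        zz r.1.1 r.1.2 r.2 ζ ≠ zz r'.1.1 r'.1.2 r'.2 ζ :=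
      eventually_all.2 fun r => eventually_all.2 fun r' => eventually_imp_distrib_left.2 (h1 r r')
    filter_upwards [h2] with ζ hζ r r' h
    by_contra hne
    exact hζ r r' hne h
  have hball : ∀ o j, ∀ᶠ t in 𝓝 (S.T o j), t ∈ ball (D.τ j) D.R := fun o j =>
    isOpen_ball.mem_nhds (S.T_mem' o j)
  have hcard : Fintype.card ((Option (Fin n) × Fin ε) × Fin δ) = δ * ((n + 1) * ε) := by
    simp only [Fintype.card_prod, Fintype.card_option, Fintype.card_fin]
    ring
  have hδN : 2 ≤ δ * ((n + 1) * ε) := by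
    have := D.two_le_ε
    have := D.δ_pos
    nlinarith [Nat.zero_le (n * ε)]
  have h0 : ∀ r : (Option (Fin n) × Fin ε) × Fin δ, ∀ᶠ ζ in 𝓝 (0 : ℂ),
      curveFun D.a S.Q eT eW (S.d x ζ) (fun μ => S.u x μ ζ) (zz r.1.1 r.1.2 r.2 ζ)
        (D.w r.1.2 r.2 (zz r.1.1 r.1.2 r.2 ζ)) = 0 := by
    rintro ⟨⟨_ | o, j⟩, κ⟩
    · exact (hc (j, κ)).mono fun ζ h => h.2
    · exact Eventually.of_forall fun ζ => S.curveFun_s x ((o, j), κ) ζ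
  have hzd : ∀ r : (Option (Fin n) × Fin ε) × Fin δ, ∀ᶠ ζ in 𝓝 (0 : ℂ),
      DifferentiableAt ℂ (zz r.1.1 r.1.2 r.2) ζ := by
    rintro ⟨⟨_ | o, j⟩, κ⟩
    · exact (hc (j, κ)).mono fun ζ h => h.1
    · exact Eventually.of_forall fun ζ => (S.hasDerivAt_s x ((o, j), κ) ζ).differentiableAt
  have hE := prod_eventually_const (Z := (Option (Fin n) × Fin ε) × Fin δ) D.monic D.natDegree_eq
    degreeBound S.natDegree_Q.le S.coeff_Q hδN hcard (κ := fun r => r.2)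
    (W := fun r => D.w r.1.2) (y := fun r => D.y r.1.2 r.2) (ζ₀ := 0) (d := S.d x) (u := S.u x)
    (z := fun r => zz r.1.1 r.1.2 r.2)
    (Complex.analyticAt_iff_eventually_differentiableAt.1 (S.analyticAt_d_zero x))
    (fun μ => Complex.analyticAt_iff_eventually_differentiableAt.1 (S.analyticAt_u_zero x μ))
    hzd (S.d_zero_ne_zero x)
    (fun r => by
      rw [hzz0]
      exact (hball _ _).mono fun t ht κ => D.differentiableAt_w _ κ t ht)
    (fun r => by rw [hzz0]; exact (hball _ _).mono fun t ht => D.root _ t ht)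
    (fun r => by rw [hzz0]; exact (hball _ _).mono fun t ht => D.w_injective _ t ht)
    (fun r => by rw [hzz0]; exact (hball _ _).mono fun t ht => D.a_ne_zero _ t ht)
    (fun r => by rw [hzz0]; exact (hball _ _).mono fun t ht => D.hasDerivAt_y _ _ t ht)
    h0 hinj
  have hzball : ∀ᶠ ζ in 𝓝 (0 : ℂ), ∀ r : (Option (Fin n) × Fin ε) × Fin δ,
      zz r.1.1 r.1.2 r.2 ζ ∈ ball (D.τ r.1.2) D.R :=
    eventually_all.2 fun r => (hzzd _ _ _).continuousAt.eventually (by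
      rw [hzz0]; exact hball _ _)
  filter_upwards [hinj, nhdsWithin_le_nhds hE, nhdsWithin_le_nhds hzball,
    nhdsWithin_le_nhds (eventually_all.2 h0)] with ζ h1 h2 h3 h4
  constructor
  · intro m
    have h5 := det_normMat_eq_prod (κ := fun r : (Option (Fin n) × Fin ε) × Fin δ => r.2)
      D.monic D.natDegree_eq degreeBound S.natDegree_Q.le S.coeff_Q
      h1 hcard (fun r => D.root r.1.2 _ (h3 r)) (fun r => D.w_injective r.1.2 _ (h3 r)) h4
    rw [res, val, aeval_univResidual]
    change ((normMat δ D.P D.a S.Q eT eW (S.d x ζ) (fun μ => S.u x μ ζ)).det /ₘ _).coeff m = _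
    rw [h5, prod_eq_mul fun o j κ => Polynomial.X - Polynomial.C (zz o j κ ζ), mul_comm (∏ i, _),
      mul_left_comm]
    refine Eq.trans ?_ (Polynomial.coeff_C_mul _)
    congr 1
    exact Polynomial.mul_divByMonic_cancel_left _
      (Polynomial.monic_prod_of_monic _ _ fun l _ => Polynomial.monic_X_sub_C (S.s x l ζ))
  · simp only [hzz0] at h2
    rw [prod_eq_mul fun o j κ => D.y j κ (zz o j κ ζ),
      prod_eq_mul fun o j κ => D.y j κ (S.T o j)] at h2
    simp only [S.T_none] at h2
    exact h2

end BranchData.Nodes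

end Deformation

section AuxForm

/-- A polynomial in `Y` and in the non-leading coefficients of `∏ (X - c i)`. -/
noncomputable def auxForm {A ι : Type*} [CommRing A] [Fintype ι] {k g m : ℕ}
    (p : Fin k → (Fin g → Fin m) → A) (c : ι → A) (Y : A) : A :=
  ∑ b, ∑ α, p b α * (∏ l, (∏ i, (Polynomial.X - Polynomial.C (c i))).coeff l ^ (α l : ℕ)) *
    Y ^ (b : ℕ)

end AuxForm

section Growth

open scoped Polynomial Topology
open Filter Metric

namespace BranchData

variable {ε δ : ℕ} (D : BranchData ε δ)

theorem xForm_add (x y : Fin ε × Fin δ → ℂ) (t w : ℂ) :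
    xForm (x + y) t w = xForm x t w + xForm y t w := by
  simp only [xForm, formVal, Pi.add_apply, add_mul, Finset.sum_add_distrib]

theorem xForm_smul (c : ℂ) (x : Fin ε × Fin δ → ℂ) (t w : ℂ) :
    xForm (c • x) t w = c * xForm x t w := by
  simp only [xForm, formVal, Pi.smul_apply, smul_eq_mul, Finset.mul_sum, mul_assoc]

theorem eq_zero_of_xForm_eq_zero {x : Fin ε × Fin δ → ℂ}
    (h : ∀ j κ, xForm x (D.τ j) (D.w j κ (D.τ j)) = 0) : x = 0 :=
  eq_zero_of_formVal_eq_zero (finCongr (Fintype.card_fin ε).symm) D.τ_injective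
    (w := fun i => D.w i.1 i.2 (D.τ i.1)) (fun j => D.w_injective j _ (mem_ball_self D.R_pos))
    fun i => h i.1 i.2

/-- The linear map sending a form to its tangent vectors at the base points. -/
noncomputable def speedMap : (Fin ε × Fin δ → ℂ) →ₗ[ℂ] (Fin ε × Fin δ → ℂ) where
  toFun x i := D.speed x i.1 i.2 (D.τ i.1)
  map_add' x y := by
    ext i
    simp only [speed, xForm_add, Pi.add_apply]
    ring
  map_smul' c x := by
    ext i
    simp only [speed, xForm_smul, Pi.smul_apply, smul_eq_mul, RingHom.id_apply]
    ring

theorem speedMap_injective : Function.Injective D.speedMap := by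
  refine (injective_iff_map_eq_zero _).2 fun x hx => D.eq_zero_of_xForm_eq_zero fun j κ => ?_
  have h1 : D.speed x j κ (D.τ j) = 0 := congrFun hx (j, κ)
  have h2 := D.nodal_ne_zero j _ (mem_ball_self D.R_pos)
  change (Polynomial.derivative D.nodal).eval _ ≠ 0 at h2
  rw [speed, div_eq_zero_iff, neg_eq_zero, mul_eq_zero] at h1
  rcases h1 with (h1 | h1) | h1
  · exact absurd h1 (D.a_ne_zero j _ (mem_ball_self D.R_pos))
  · exact h1
  · exact absurd h1 h2

/-- The inverse of `speedMap`. -/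
noncomputable def speedInv : (Fin ε × Fin δ → ℂ) →ₗ[ℂ] (Fin ε × Fin δ → ℂ) :=
  (LinearEquiv.ofInjectiveEndo D.speedMap D.speedMap_injective).symm

theorem speedMap_speedInv (x) : D.speedMap (D.speedInv x) = x :=
  (LinearEquiv.ofInjectiveEndo D.speedMap D.speedMap_injective).apply_symm_apply x

theorem speedInv_speedMap (x) : D.speedInv (D.speedMap x) = x :=
  (LinearEquiv.ofInjectiveEndo D.speedMap D.speedMap_injective).symm_apply_apply x

theorem continuousOn_speed (j : Fin ε) (κ : Fin δ) :
    ContinuousOn (fun q : (Fin ε × Fin δ → ℂ) × ℂ => D.speed (D.speedInv q.1) j κ q.2)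
      (Set.univ ×ˢ ball (D.τ j) D.R) := by
  have hw : ContinuousOn (fun q : (Fin ε × Fin δ → ℂ) × ℂ => D.w j κ q.2)
      (Set.univ ×ˢ ball (D.τ j) D.R) := by
    refine ContinuousOn.comp (t := ball (D.τ j) D.R) (g := D.w j κ)
      (fun t ht => (D.differentiableAt_w j κ t ht).continuousAt.continuousWithinAt)
      continuous_snd.continuousOn fun q hq => hq.2
  have hx : ∀ i, Continuous fun q : (Fin ε × Fin δ → ℂ) × ℂ => D.speedInv q.1 i := fun i =>
    (continuous_apply i).comp (D.speedInv.continuous_of_finiteDimensional.comp continuous_fst)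
  refine ContinuousOn.div (ContinuousOn.neg (ContinuousOn.mul ?_ ?_)) ?_ fun q hq =>
    D.nodal_ne_zero j _ hq.2
  · exact (D.a.continuous.comp continuous_snd).continuousOn
  · refine continuousOn_finsetSum _ fun i _ => ContinuousOn.mul (ContinuousOn.mul
      (hx i).continuousOn (continuous_snd.pow _).continuousOn) (hw.pow _)
  · exact ((Polynomial.derivative D.nodal).continuous.comp continuous_snd).continuousOn

theorem exists_speed_le : ∃ E : ℝ, 0 < E ∧ ∀ x : Fin ε × Fin δ → ℂ, ‖x‖ ≤ 2 → ∀ j κ,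
    ∀ t ∈ closedBall (D.τ j) (D.R / 4), ‖D.speed (D.speedInv x) j κ t‖ ≤ E := by
  have h1 : ∀ i : Fin ε × Fin δ, ∃ E : ℝ, ∀ q ∈ closedBall (0 : Fin ε × Fin δ → ℂ) 2 ×ˢ
      closedBall (D.τ i.1) (D.R / 4), ‖D.speed (D.speedInv q.1) i.1 i.2 q.2‖ ≤ E := fun i =>
    ((isCompact_closedBall _ _).prod (isCompact_closedBall _ _)).exists_bound_of_continuousOn
      ((D.continuousOn_speed i.1 i.2).mono (Set.prod_mono (Set.subset_univ _)
        (closedBall_subset_ball (by linarith [D.R_pos]))))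
  choose E hE using h1
  refine ⟨∑ i, |E i| + 1, by positivity, fun x hx j κ t ht => ?_⟩
  refine (hE (j, κ) (x, t) ⟨by simpa using hx, ht⟩).trans ((le_abs_self _).trans ?_)
  exact (Finset.single_le_sum (f := fun i => |E i|) (fun i _ => abs_nonneg _)
    (Finset.mem_univ (j, κ))).trans (by simp)

theorem exists_injective_xForm : ∃ x : Fin ε × Fin δ → ℂ, ∀ j, ∀ t ∈ ball (D.τ j) D.R,
    Function.Injective fun κ => xForm x t (D.w j κ t) := by
  by_cases hδ : 1 < δ
  · have hε := D.two_le_ε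
    refine ⟨Pi.single (⟨0, by omega⟩, ⟨1, hδ⟩) 1, fun j t ht => ?_⟩
    convert D.w_injective j t ht using 2 with κ
    rw [xForm, formVal, Finset.sum_eq_single (⟨0, by omega⟩, ⟨1, hδ⟩)]
    · simp
    · intro μ _ hμ
      rw [Pi.single_eq_of_ne hμ, zero_mul, zero_mul]
    · exact fun h => absurd (Finset.mem_univ _) h
  · refine ⟨0, fun j t ht κ κ' _ => Fin.ext ?_⟩
    have := κ.2
    have := κ'.2
    omega

namespace Nodes

variable {D} {n : ℕ} (S : D.Nodes n)

theorem d_zero_eq (x x') : S.d x 0 = S.d x' 0 := by rw [S.d_zero, S.d_zero]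

theorem eventually_generic (x : Fin ε × Fin δ → ℂ) {x₁ : Fin ε × Fin δ → ℂ}
    (hx₁ : ∀ j, ∀ t ∈ ball (D.τ j) D.R, Function.Injective fun κ => xForm x₁ t (D.w j κ t)) :
    ∀ᶠ ν in 𝓝[≠] (0 : ℂ), ∀ o j, Function.Injective fun κ =>
      xForm (x + ν • x₁) (S.T o j) (D.w j κ (S.T o j)) := by
  have h1 : ∀ o j, ∀ κ κ' : Fin δ, κ ≠ κ' → ∀ᶠ ν in 𝓝[≠] (0 : ℂ),
      xForm (x + ν • x₁) (S.T o j) (D.w j κ (S.T o j)) ≠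
        xForm (x + ν • x₁) (S.T o j) (D.w j κ' (S.T o j)) := by
    intro o j κ κ' hκ
    have h2 : ∀ κ, HasDerivAt (fun ν : ℂ => xForm (x + ν • x₁) (S.T o j) (D.w j κ (S.T o j)))
        (xForm x₁ (S.T o j) (D.w j κ (S.T o j))) 0 := fun κ => by
      simp only [xForm_add, xForm_smul]
      have := ((hasDerivAt_id (0 : ℂ)).mul_const
        (xForm x₁ (S.T o j) (D.w j κ (S.T o j)))).const_add (xForm x (S.T o j) (D.w j κ (S.T o j)))
      simp only [id, one_mul] at this
      exact this
    exact (h2 κ).eventually_ne_of_ne (h2 κ') (Or.inr fun h => hκ (hx₁ j _ (S.T_mem' o j) h))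
  have h2 : ∀ᶠ ν in 𝓝[≠] (0 : ℂ), ∀ o j, ∀ κ κ' : Fin δ, κ ≠ κ' →
      xForm (x + ν • x₁) (S.T o j) (D.w j κ (S.T o j)) ≠
        xForm (x + ν • x₁) (S.T o j) (D.w j κ' (S.T o j)) :=
    eventually_all.2 fun o => eventually_all.2 fun j => eventually_all.2 fun κ =>
      eventually_all.2 fun κ' => eventually_imp_distrib_left.2 (h1 o j κ κ')
  filter_upwards [h2] with ν hν o j κ κ' h
  by_contra hne
  exact hν o j κ κ' hne h

/-- The compact set in which the prescribed zeros move. -/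
def region : Set ((Fin n × Fin ε) × Fin δ → ℂ) :=
  Set.univ.pi fun l => closedBall (S.T (some l.1.1) l.1.2) (D.R / 4)

theorem isCompact_region : IsCompact S.region :=
  isCompact_univ_pi fun _ => isCompact_closedBall _ _

theorem mem_ball_of_mem_region {s} (hs : s ∈ S.region) (l) : s l ∈ ball (D.τ l.1.2) D.R := by
  have h1 := hs l (Set.mem_univ l)
  have h2 := S.T_mem (some l.1.1) l.1.2
  rw [mem_closedBall] at h1
  rw [mem_ball] at h2 ⊢
  have := dist_triangle (s l) (S.T (some l.1.1) l.1.2) (D.τ l.1.2)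
  linarith [D.R_pos]

theorem continuousOn_coord {F : Fin ε → Fin δ → ℂ → ℂ}
    (hF : ∀ j κ, ∀ t ∈ ball (D.τ j) D.R, ContinuousAt (F j κ) t) (l : (Fin n × Fin ε) × Fin δ) :
    ContinuousOn (fun s => F l.1.2 l.2 (s l)) S.region := fun s hs =>
  (ContinuousAt.comp (f := fun s : (Fin n × Fin ε) × Fin δ → ℂ => s l) (g := F l.1.2 l.2)
    (hF l.1.2 l.2 (s l) (S.mem_ball_of_mem_region hs l))
    (continuous_apply l).continuousAt).continuousWithinAt

theorem exists_aeval_le (p : MvPolynomial (((Fin n × Fin ε) × Fin δ) ⊕ ((Fin n × Fin ε) × Fin δ))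
    ℂ) :
    ∃ B : ℝ, 1 ≤ B ∧ ∀ s ∈ S.region,
      ‖MvPolynomial.aeval (Sum.elim s fun l => D.w l.1.2 l.2 (s l)) p‖ ≤ B := by
  obtain ⟨B, hB⟩ := S.isCompact_region.exists_bound_of_continuousOn
    (f := fun s => MvPolynomial.aeval (Sum.elim s fun l => D.w l.1.2 l.2 (s l)) p) <| by
    have h1 : ContinuousOn (fun s : (Fin n × Fin ε) × Fin δ → ℂ =>
        Sum.elim s fun l => D.w l.1.2 l.2 (s l)) S.region := by
      refine continuousOn_pi.2 ?_
      rintro (l | l)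
      · exact (continuous_apply l).continuousOn
      · exact S.continuousOn_coord
          (fun j κ t ht => (D.differentiableAt_w j κ t ht).continuousAt) l
    have h2 := (MvPolynomial.continuous_eval p).comp_continuousOn h1
    refine h2.congr fun s _ => ?_
    rw [Function.comp_apply, MvPolynomial.aeval_eq_eval]
  exact ⟨max B 1, le_max_right _ _, fun s hs => (hB s hs).trans (le_max_left _ _)⟩

theorem exists_prod_y_le (E : ℂ) : ∃ B : ℝ, 1 ≤ B ∧ ∀ s ∈ S.region,
    ‖E / ∏ l, D.y l.1.2 l.2 (s l)‖ ≤ B := by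
  obtain ⟨B, hB⟩ := S.isCompact_region.exists_bound_of_continuousOn
    (f := fun s => E / ∏ l, D.y l.1.2 l.2 (s l)) <| by
    refine continuousOn_const.div (continuousOn_finsetProd _ fun l _ => ?_) fun s hs => ?_
    · exact S.continuousOn_coord (fun j κ t ht => (D.hasDerivAt_y j κ t ht).continuousAt) l
    · exact Finset.prod_ne_zero_iff.2 fun l _ => D.y_ne_zero _ _ _ (S.mem_ball_of_mem_region hs l)
  exact ⟨max B 1, le_max_right _ _, fun s hs => (hB s hs).trans (le_max_left _ _)⟩

end Nodes

end BranchData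

end Growth

section GrowthEstimate

open scoped Polynomial Topology
open Filter Metric Asymptotics

theorem tendsto_div_pow_of_isBigO {E : Type*} [NormedAddCommGroup E] [NormedSpace ℂ E]
    {F h : E → ℂ} {M : ℕ} {z : ℂ → E} {v : E} (hc : Continuous h)
    (hh : ∀ (c : ℂ) z, h (c • z) = c ^ M * h z)
    (hF : (fun z => F z - h z) =O[𝓝 0] fun z => ‖z‖ ^ (M + 1)) (hz : HasDerivAt z v 0)
    (hz0 : z 0 = 0) : Tendsto (fun ζ => F (z ζ) / ζ ^ M) (𝓝[≠] 0) (𝓝 (h v)) := by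
  have h1 : Tendsto (fun ζ => ζ⁻¹ • z ζ) (𝓝[≠] 0) (𝓝 v) := by
    simpa [slope_fun_def, hz0] using hz.tendsto_slope
  have h2 : Tendsto (fun ζ => h (ζ⁻¹ • z ζ)) (𝓝[≠] 0) (𝓝 (h v)) := (hc.tendsto v).comp h1
  have hz' : Tendsto z (𝓝 0) (𝓝 0) := by simpa [hz0] using hz.continuousAt.tendsto
  have h3 : (fun ζ => F (z ζ) - h (z ζ)) =O[𝓝[≠] 0] fun ζ : ℂ => ζ ^ (M + 1) := by
    have h4 : (fun ζ => z ζ) =O[𝓝 0] fun ζ : ℂ => ζ := by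
      simpa [hz0] using hz.differentiableAt.isBigO_sub
    refine ((hF.comp_tendsto hz').trans ?_).mono nhdsWithin_le_nhds
    exact (h4.norm_left.pow (M + 1))
  have h5 : Tendsto (fun ζ => (F (z ζ) - h (z ζ)) / ζ ^ M) (𝓝[≠] 0) (𝓝 0) := by
    have h6 : (fun ζ => (F (z ζ) - h (z ζ)) / ζ ^ M) =O[𝓝[≠] 0] fun ζ : ℂ => ζ := by
      have h7 := h3.mul (isBigO_refl (fun ζ : ℂ => (ζ ^ M)⁻¹) (𝓝[≠] 0))
      refine (h7.congr' (Eventually.of_forall fun ζ => (div_eq_mul_inv _ _).symm) ?_)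
      filter_upwards [self_mem_nhdsWithin] with ζ hζ
      have : ζ ^ M ≠ 0 := pow_ne_zero _ hζ
      rw [pow_succ]
      field_simp
    exact h6.trans_tendsto (tendsto_id.mono_left nhdsWithin_le_nhds)
  have h6 := h2.add h5
  rw [add_zero] at h6
  refine h6.congr' ?_
  filter_upwards [self_mem_nhdsWithin] with ζ hζ
  have : ζ ^ M ≠ 0 := pow_ne_zero _ hζ
  rw [hh, inv_pow]
  field_simp
  ring

/-- The sum of the norms of a family of coefficients. -/
noncomputable def coeffSum {A : Type*} [Norm A] {k g m : ℕ}
    (p : Fin k → (Fin g → Fin m) → A) : ℝ := ∑ b, ∑ α, ‖p b α‖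

namespace BranchData.Nodes

variable {ε δ : ℕ} {D : BranchData ε δ} {n : ℕ} (S : D.Nodes n)

/-- A function interpolating the homogenised values of an auxiliary form. -/
noncomputable def auxVal {k g m : ℕ} (p : Fin k → (Fin g → Fin (m + 1)) → ℂ) (E : ℂ)
    (x : Fin ε × Fin δ → ℂ) (ζ : ℂ) : ℂ :=
  ∑ b, ∑ α, p b α * (∏ l : Fin g, (S.res x l ζ ^ (α l : ℕ) * (S.d x ζ ^ δ) ^ (m - α l))) *
    (E / ∏ l, D.y l.1.2 l.2 (S.s x l ζ)) ^ (b : ℕ)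

theorem norm_auxVal_le {k g m : ℕ} (p : Fin k → (Fin g → Fin (m + 1)) → ℂ) {E : ℂ}
    {x : Fin ε × Fin δ → ℂ} {ζ : ℂ} {B₀ B₁ : ℝ} (hres : ∀ l : Fin g, ‖S.res x l ζ‖ ≤ B₀)
    (hd : ‖S.d x ζ ^ δ‖ ≤ B₀) (hB₁ : 1 ≤ B₁)
    (hy : ‖E / ∏ l, D.y l.1.2 l.2 (S.s x l ζ)‖ ≤ B₁) :
    ‖S.auxVal p E x ζ‖ ≤ B₀ ^ (g * m) * B₁ ^ k * coeffSum p := by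
  have hB₀ : 0 ≤ B₀ := (norm_nonneg _).trans hd
  rw [coeffSum, Finset.mul_sum]
  refine (norm_sum_le _ _).trans (Finset.sum_le_sum fun b _ => ?_)
  rw [Finset.mul_sum]
  refine (norm_sum_le _ _).trans (Finset.sum_le_sum fun α _ => ?_)
  rw [norm_mul, norm_mul, norm_prod, norm_pow, mul_comm (_ * _) ‖p b α‖, mul_assoc]
  refine mul_le_mul_of_nonneg_left (mul_le_mul ?_ ?_ (by positivity) (by positivity))
    (norm_nonneg _)
  · have h1 : ∀ l : Fin g, ‖S.res x l ζ ^ (α l : ℕ) * (S.d x ζ ^ δ) ^ (m - α l)‖ ≤ B₀ ^ m := by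
      intro l
      have h2 : m = α l + (m - α l) := by have := (α l).2; omega
      conv_rhs => rw [h2, pow_add]
      rw [norm_mul, norm_pow, norm_pow _ (m - α l)]
      gcongr
      exact hres l
    refine (Finset.prod_le_prod (fun l _ => norm_nonneg _) fun l _ => h1 l).trans ?_
    rw [Finset.prod_const, Finset.card_univ, Fintype.card_fin, ← pow_mul, mul_comm]
  · exact (pow_le_pow_left₀ (norm_nonneg _) hy _).trans (pow_le_pow_right₀ hB₁ b.2.le)

theorem differentiableAt_auxVal {k g m : ℕ} (p : Fin k → (Fin g → Fin (m + 1)) → ℂ) (E : ℂ)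
    {x : Fin ε × Fin δ → ℂ} {ζ : ℂ} (h : ∀ l, S.s x l ζ ∈ ball (D.τ l.1.2) D.R) :
    DifferentiableAt ℂ (S.auxVal p E x) ζ := by
  have hr : ∀ l, DifferentiableAt ℂ (S.res x l) ζ := fun l => (S.analyticAt_val x h
      _).differentiableAt
  have hd : DifferentiableAt ℂ (S.d x) ζ := (S.analyticAt_val x h _).differentiableAt
  have hy : ∀ l : (Fin n × Fin ε) × Fin δ,
      DifferentiableAt ℂ (fun ζ => D.y l.1.2 l.2 (S.s x l ζ)) ζ := fun l =>
    DifferentiableAt.comp ζ (D.hasDerivAt_y l.1.2 l.2 _ (h l)).differentiableAt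
      (S.hasDerivAt_s x l ζ).differentiableAt
  unfold auxVal
  refine DifferentiableAt.fun_sum fun b _ => DifferentiableAt.fun_sum fun α _ =>
    DifferentiableAt.fun_mul (DifferentiableAt.fun_mul (differentiableAt_const _) ?_)
      (DifferentiableAt.fun_pow ?_ _)
  · refine DifferentiableAt.fun_finsetProd fun l _ => ?_
    exact ((hr l).fun_pow _).fun_mul ((hd.fun_pow _).fun_pow _)
  · refine DifferentiableAt.fun_div (differentiableAt_const _) (DifferentiableAt.fun_finsetProd
      fun l _ => hy l) ?_
    exact Finset.prod_ne_zero_iff.2 fun l _ => D.y_ne_zero _ _ _ (h l)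

theorem auxVal_eq {k g m : ℕ} (p : Fin k → (Fin g → Fin (m + 1)) → ℂ) {E : ℂ}
    {x : Fin ε × Fin δ → ℂ} {ζ : ℂ} {c : Fin ε × Fin δ → ℂ} {Y : ℂ}
    (hres : ∀ l, S.res x l ζ =
      S.d x ζ ^ δ * (∏ i, (Polynomial.X - Polynomial.C (c i))).coeff l)
    (hy : E / ∏ l, D.y l.1.2 l.2 (S.s x l ζ) = Y) :
    S.auxVal p E x ζ = (S.d x ζ ^ δ) ^ (g * m) * auxForm p c Y := by
  rw [auxVal, auxForm, Finset.mul_sum]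
  refine Finset.sum_congr rfl fun b _ => ?_
  rw [Finset.mul_sum]
  refine Finset.sum_congr rfl fun α _ => ?_
  have h1 : ∀ l : Fin g, S.res x l ζ ^ (α l : ℕ) * (S.d x ζ ^ δ) ^ (m - α l) =
      (S.d x ζ ^ δ) ^ m * (∏ i, (Polynomial.X - Polynomial.C (c i))).coeff l ^ (α l : ℕ) := by
    intro l
    have h2 : (α l : ℕ) + (m - α l) = m := by have := (α l).2; omega
    have h3 := pow_add (S.d x ζ ^ δ) (α l) (m - α l)
    rw [h2] at h3
    rw [hres, mul_pow, h3]
    ring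
  rw [hy, Finset.prod_congr rfl fun l _ => h1 l, Finset.prod_mul_distrib, Finset.prod_const,
    Finset.card_univ, Fintype.card_fin, ← pow_mul _ m g, mul_comm m g]
  ring

theorem s_mem_region {x : Fin ε × Fin δ → ℂ} {E : ℝ} (hE : 0 < E)
    (hx : ∀ j κ, ∀ t ∈ closedBall (D.τ j) (D.R / 4), ‖D.speed x j κ t‖ ≤ E) {ζ : ℂ}
    (hζ : ζ ∈ ball (0 : ℂ) (D.R / (4 * E))) : (fun l => S.s x l ζ) ∈ S.region := by
  intro l _
  have h1 := hx l.1.2 l.2 (S.T (some l.1.1) l.1.2) (ball_subset_closedBall (S.T_mem _ _))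
  rw [mem_ball_zero_iff] at hζ
  rw [mem_closedBall, dist_eq_norm, show S.s x l ζ - S.T (some l.1.1) l.1.2 = ζ * D.speed x l.1.2
    l.2 _ from
    add_sub_cancel_left _ _, norm_mul]
  calc _ ≤ D.R / (4 * E) * E := mul_le_mul hζ.le h1 (norm_nonneg _) (by have := D.R_pos; positivity)
    _ = D.R / 4 := by field_simp

theorem tendsto_auxVal {k g m M : ℕ} (hn : 0 < n) (p : Fin k → (Fin g → Fin (m + 1)) → ℂ)
    {h : (Fin ε × Fin δ → ℂ) → ℂ} (hc : Continuous h)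
    (hh : ∀ (c : ℂ) z, h (c • z) = c ^ M * h z)
    (hF : (fun z : Fin ε × Fin δ → ℂ => auxForm p (fun i => D.τ i.1 + z i)
      (∏ i, D.y i.1 i.2 (D.τ i.1 + z i)) - h z) =O[𝓝 0] fun z => ‖z‖ ^ (M + 1))
    {x : Fin ε × Fin δ → ℂ}
    (hgen : ∀ o j, Function.Injective fun κ => xForm x (S.T o j) (D.w j κ (S.T o j))) :
    Tendsto (fun ζ => S.auxVal p ((∏ i : Fin ε × Fin δ, D.y i.1 i.2 (D.τ i.1)) *
      ∏ l : (Fin n × Fin ε) × Fin δ, D.y l.1.2 l.2 (S.T (some l.1.1) l.1.2)) x ζ / ζ ^ M) (𝓝[≠] 0)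
      (𝓝 ((S.d x 0 ^ δ) ^ (g * m) * ((-n : ℂ) ^ M * h (D.speedMap x)))) := by
  obtain ⟨c, hc0, hcd⟩ := S.exists_deformation x hn hgen
  have hd : ContinuousAt (S.d x) 0 := (S.analyticAt_val x (S.s_zero_mem x) _).continuousAt
  have hy : ∀ᶠ ζ in 𝓝 (0 : ℂ), ∀ l, S.s x l ζ ∈ ball (D.τ l.1.2) D.R :=
    eventually_all.2 fun l => (S.hasDerivAt_s x l 0).continuousAt.eventually_mem
      (isOpen_ball.mem_nhds (S.s_zero_mem x l))
  have hz : HasDerivAt (fun ζ i => c i ζ - D.τ i.1) ((-n : ℂ) • D.speedMap x) 0 :=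
    hasDerivAt_pi.2 fun i => ((hc0 i).2.sub_const _)
  have h1 := tendsto_div_pow_of_isBigO hc hh hF hz (funext fun i => sub_eq_zero.2 (hc0 i).1)
  rw [hh] at h1
  refine ((((hd.tendsto.mono_left nhdsWithin_le_nhds).pow δ).pow (g * m)).mul h1).congr' ?_
  filter_upwards [hcd, nhdsWithin_le_nhds hy] with ζ hζ hyζ
  simp only [add_sub_cancel]
  rw [S.auxVal_eq p hζ.1 (Y := ∏ i, D.y i.1 i.2 (c i ζ)), mul_div_assoc]
  rw [← hζ.2, mul_div_cancel_right₀]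
  exact Finset.prod_ne_zero_iff.2 fun l _ => D.y_ne_zero _ _ _ (hyζ l)

end BranchData.Nodes

/-- The key growth estimate: the leading form of an auxiliary function vanishing at the base
points to order `M` is bounded by a quantity decaying like `(n ρ) ^ (-M)` for all `n`. -/
theorem BranchData.exists_growth {ε δ : ℕ} (D : BranchData ε δ) :
    ∃ ρ : ℝ, 0 < ρ ∧ ∀ n : ℕ, 0 < n → ∃ B : ℝ, 1 ≤ B ∧ ∀ (k m M : ℕ)
      (p : Fin k → (Fin (ε * δ) → Fin (m + 1)) → ℂ) (h : (Fin ε × Fin δ → ℂ) → ℂ),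
      Continuous h → (∀ (c : ℂ) z, h (c • z) = c ^ M * h z) →
      ((fun z : Fin ε × Fin δ → ℂ => auxForm p (fun i => D.τ i.1 + z i)
        (∏ i, D.y i.1 i.2 (D.τ i.1 + z i)) - h z) =O[𝓝 0] fun z => ‖z‖ ^ (M + 1)) →
      ∀ x, ‖x‖ ≤ 1 → ‖h x‖ * (n * ρ) ^ M ≤ B ^ (m + k) * coeffSum p := by
  obtain ⟨E, hE, hspeed⟩ := D.exists_speed_le
  have hρ : 0 < D.R / (4 * E) := by have := D.R_pos; positivity
  refine ⟨D.R / (4 * E), hρ, fun n hn => ?_⟩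
  obtain ⟨S⟩ := D.exists_nodes n
  set E₀ := (∏ i : Fin ε × Fin δ, D.y i.1 i.2 (D.τ i.1)) *
    ∏ l : (Fin n × Fin ε) × Fin δ, D.y l.1.2 l.2 (S.T (some l.1.1) l.1.2)
  obtain ⟨B₁, hB₁, hy⟩ := S.exists_prod_y_le E₀
  choose Br hBr hr using fun l : Fin (ε * δ) =>
    S.exists_aeval_le (univResidual δ D.P D.a S.Q Nodes.eT Nodes.eW l)
  obtain ⟨Bd, hBd, hd⟩ := S.exists_aeval_le (univDet D.a Nodes.eT Nodes.eW)
  set B₀ := Bd ^ δ + ∑ l, Br l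
  have hBrpos : 0 ≤ ∑ l, Br l := Finset.sum_nonneg fun l _ => zero_le_one.trans (hBr l)
  have hB₀pos : 0 ≤ B₀ := by positivity
  have hB₀d : Bd ^ δ ≤ B₀ := le_add_of_nonneg_right hBrpos
  have hB₀r : ∀ l, Br l ≤ B₀ := fun l =>
    (Finset.single_le_sum (f := Br) (fun l _ => zero_le_one.trans (hBr l))
      (Finset.mem_univ l)).trans (le_add_of_nonneg_left (by positivity))
  set d₀ := ‖S.d 0 0 ^ δ‖
  have hd₀ : 0 < d₀ := norm_pos_iff.2 (pow_ne_zero _ (S.d_zero_ne_zero 0))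
  set B₂ := max 1 ((B₀ / d₀) ^ (ε * δ))
  have hB₂ : 1 ≤ B₂ := le_max_left _ _
  refine ⟨B₂ * B₁, one_le_mul_of_one_le_of_one_le hB₂ hB₁,
    fun k m M p h hc hh hF x hx => ?_⟩
  have hp : 0 ≤ coeffSum p :=
    Finset.sum_nonneg fun b _ => Finset.sum_nonneg fun α _ => norm_nonneg _
  have key : ∀ x : Fin ε × Fin δ → ℂ, ‖x‖ ≤ 2 → (∀ o j, Function.Injective fun κ =>
      xForm (D.speedInv x) (S.T o j) (D.w j κ (S.T o j))) →
      ‖h x‖ * (n * (D.R / (4 * E))) ^ M ≤ (B₂ * B₁) ^ (m + k) * coeffSum p := by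
    intro x hx hgen
    have hreg : ∀ ζ ∈ ball (0 : ℂ) (D.R / (4 * E)), (fun l => S.s (D.speedInv x) l ζ) ∈ S.region :=
      fun ζ hζ => S.s_mem_region hE (hspeed x hx) hζ
    have h1 := norm_le_of_tendsto_div_pow hρ
      (γ := S.auxVal p E₀ (D.speedInv x)) (K := B₀ ^ (ε * δ * m) * B₁ ^ k * coeffSum p)
      (fun ζ hζ => (S.differentiableAt_auxVal p E₀
        (S.mem_ball_of_mem_region (hreg ζ hζ))).differentiableWithinAt)
      (fun ζ hζ => S.norm_auxVal_le p (fun l => (hr l _ (hreg ζ hζ)).trans (hB₀r l))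
        (by rw [norm_pow]
            exact (pow_le_pow_left₀ (norm_nonneg _) (hd _ (hreg ζ hζ)) δ).trans hB₀d) hB₁
        (hy _ (hreg ζ hζ)))
      (S.tendsto_auxVal hn p hc hh hF hgen)
    rw [D.speedMap_speedInv, norm_mul, norm_mul, norm_pow, norm_pow _ M, norm_neg,
      Complex.norm_natCast, S.d_zero_eq _ 0, le_div_iff₀ (by positivity)] at h1
    have h2 : B₀ ^ (ε * δ * m) = d₀ ^ (ε * δ * m) * ((B₀ / d₀) ^ (ε * δ)) ^ m := by
      rw [← pow_mul, ← mul_pow, mul_div_cancel₀ _ hd₀.ne']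
    have h3 : d₀ ^ (ε * δ * m) * (‖h x‖ * (n * (D.R / (4 * E))) ^ M) ≤
        d₀ ^ (ε * δ * m) * (((B₀ / d₀) ^ (ε * δ)) ^ m * B₁ ^ k * coeffSum p) := by
      calc _ = d₀ ^ (ε * δ * m) * (n ^ M * ‖h x‖) * (D.R / (4 * E)) ^ M := by rw [mul_pow]; ring
        _ ≤ _ := h1
        _ = _ := by rw [h2]; ring
    refine (le_of_mul_le_mul_left h3 (by positivity)).trans ?_
    refine mul_le_mul_of_nonneg_right ?_ hp
    rw [mul_pow]
    refine mul_le_mul ?_ (pow_le_pow_right₀ hB₁ (by omega)) (by positivity) (by positivity)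
    exact (pow_le_pow_left₀ (by positivity) (le_max_right _ _) m).trans
      (pow_le_pow_right₀ hB₂ (by omega))
  obtain ⟨x₁, hx₁⟩ := D.exists_injective_xForm
  have hcont : Continuous fun ν : ℂ => x + ν • D.speedMap x₁ := by fun_prop
  have h1 : ∀ᶠ ν in 𝓝[≠] (0 : ℂ), ‖h (x + ν • D.speedMap x₁)‖ * (n * (D.R / (4 * E))) ^ M ≤
      (B₂ * B₁) ^ (m + k) * coeffSum p := by
    have h2 : ∀ᶠ ν in 𝓝 (0 : ℂ), ‖x + ν • D.speedMap x₁‖ < 2 := by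
      refine hcont.norm.continuousAt.eventually_lt continuousAt_const ?_
      rw [zero_smul, add_zero]
      linarith
    filter_upwards [nhdsWithin_le_nhds h2, S.eventually_generic (D.speedInv x) hx₁] with ν hν hgen
    refine key _ hν.le ?_
    rwa [map_add, map_smul, D.speedInv_speedMap]
  have h2 : Tendsto (fun ν : ℂ => ‖h (x + ν • D.speedMap x₁)‖ * (n * (D.R / (4 * E))) ^ M)
      (𝓝[≠] 0) (𝓝 (‖h x‖ * (n * (D.R / (4 * E))) ^ M)) := by
    have h3 : Continuous fun ν : ℂ => ‖h (x + ν • D.speedMap x₁)‖ * (n * (D.R / (4 * E))) ^ M :=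
      (hc.comp hcont).norm.mul continuous_const
    have h4 := h3.tendsto 0
    rw [zero_smul, add_zero] at h4
    exact h4.mono_left nhdsWithin_le_nhds
  exact le_of_tendsto h2 h1

end GrowthEstimate

section WeightedNorm

open scoped ENNReal NNReal
open Finset.HasAntidiagonal (antidiagonal)

namespace MvPowerSeries

variable {ι : Type*}

/-- The weighted `ℓ¹` norm of a power series. -/
noncomputable def wnorm (r : ℝ≥0) (F : MvPowerSeries ι ℂ) : ℝ≥0∞ :=
  ∑' β, ‖coeff β F‖ₑ * (r : ℝ≥0∞) ^ β.degree

variable {r : ℝ≥0}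

theorem enorm_coeff_mul_le (β : ι →₀ ℕ) (F : MvPowerSeries ι ℂ) :
    ‖coeff β F‖ₑ * (r : ℝ≥0∞) ^ β.degree ≤ wnorm r F := ENNReal.le_tsum β

theorem wnorm_add_le (F G : MvPowerSeries ι ℂ) : wnorm r (F + G) ≤ wnorm r F + wnorm r G := by
  rw [wnorm, wnorm, wnorm, ← ENNReal.tsum_add]
  refine ENNReal.tsum_le_tsum fun β => ?_
  rw [map_add, ← add_mul]
  gcongr
  exact enorm_add_le _ _

theorem wnorm_mul_le (F G : MvPowerSeries ι ℂ) : wnorm r (F * G) ≤ wnorm r F * wnorm r G := by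
  classical
  calc wnorm r (F * G) ≤ ∑' β, ∑ x ∈ antidiagonal β, (‖coeff x.1 F‖ₑ * (r : ℝ≥0∞) ^ x.1.degree) *
        (‖coeff x.2 G‖ₑ * (r : ℝ≥0∞) ^ x.2.degree) := by
        refine ENNReal.tsum_le_tsum fun β => ?_
        rw [coeff_mul]
        refine (mul_le_mul_left (enorm_sum_le _ _) _).trans_eq ?_
        rw [Finset.sum_mul]
        refine Finset.sum_congr rfl fun x hx => ?_
        rw [← Finset.HasAntidiagonal.mem_antidiagonal.1 hx, map_add, pow_add, enorm_mul]
        ring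
    _ = ∑' x : (ι →₀ ℕ) × (ι →₀ ℕ), (‖coeff x.1 F‖ₑ * (r : ℝ≥0∞) ^ x.1.degree) *
        (‖coeff x.2 G‖ₑ * (r : ℝ≥0∞) ^ x.2.degree) := by
        rw [← Finset.HasAntidiagonal.sigmaAntidiagonalEquivProd.tsum_eq, ENNReal.tsum_sigma']
        refine tsum_congr fun β => ?_
        rw [tsum_fintype, ← Finset.sum_finset_coe]
        rfl
    _ = wnorm r F * wnorm r G := by
        rw [ENNReal.tsum_prod']
        simp only [ENNReal.tsum_mul_left, ENNReal.tsum_mul_right]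
        rfl

theorem wnorm_C_le (c : ℂ) : wnorm r (C c : MvPowerSeries ι ℂ) ≤ ‖c‖ₑ := by
  classical
  rw [wnorm, tsum_eq_single 0]
  · simp
  · intro β hβ
    rw [coeff_C, if_neg hβ]
    simp

theorem wnorm_neg (F : MvPowerSeries ι ℂ) : wnorm r (-F) = wnorm r F := by
  simp [wnorm]

variable (ι r) in
/-- The ring of power series with finite weighted norm. -/
noncomputable def convSubring : Subring (MvPowerSeries ι ℂ) where
  carrier := {F | wnorm r F ≠ ∞}
  mul_mem' hF hG := ne_top_of_le_ne_top (ENNReal.mul_ne_top hF hG) (wnorm_mul_le _ _)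
  one_mem' := ne_top_of_le_ne_top (by simp) (wnorm_C_le (1 : ℂ))
  add_mem' hF hG := ne_top_of_le_ne_top (ENNReal.add_ne_top.2 ⟨hF, hG⟩) (wnorm_add_le _ _)
  zero_mem' := by simp [wnorm]
  neg_mem' h := by rwa [Set.mem_ofPred_eq, wnorm_neg]

theorem mem_convSubring {F : MvPowerSeries ι ℂ} : F ∈ convSubring ι r ↔ wnorm r F ≠ ∞ := Iff.rfl

theorem C_mem_convSubring (c : ℂ) : (C c : MvPowerSeries ι ℂ) ∈ convSubring ι r :=
  ne_top_of_le_ne_top (by simp) (wnorm_C_le c)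

theorem summable_of_mem_convSubring {F : MvPowerSeries ι ℂ} (hF : F ∈ convSubring ι r) :
    Summable fun β => ‖coeff β F‖ * (r : ℝ) ^ β.degree := by
  have h1 : ∑' β, ‖coeff β F‖ₑ * (r : ℝ≥0∞) ^ β.degree ≠ ∞ := hF
  refine (ENNReal.summable_toReal h1).congr fun β => ?_
  simp

open Classical in
/-- The univariate power series with coefficients `c` in the variable `i`. -/
noncomputable def uniSeries {A : Type*} [Zero A] (i : ι) (c : ℕ → A) : MvPowerSeries ι A :=
  fun β => if β = Finsupp.single i (β i) then c (β i) else 0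

theorem coeff_uniSeries_single {A : Type*} [Semiring A] (i : ι) (c : ℕ → A) (m : ℕ) :
    coeff (Finsupp.single i m) (uniSeries i c) = c m := by
  rw [coeff_apply, uniSeries, Finsupp.single_eq_same, if_pos rfl]

theorem coeff_uniSeries_of_notMem {A : Type*} [Semiring A] (i : ι) (c : ℕ → A) {β : ι →₀ ℕ}
    (h : β ∉ Set.range (Finsupp.single i : ℕ → ι →₀ ℕ)) : coeff β (uniSeries i c) = 0 :=
  if_neg fun h' => h ⟨β i, h'.symm⟩

theorem map_uniSeries {A B : Type*} [Semiring A] [Semiring B] (σ : A →+* B) (i : ι) (c : ℕ → A) :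
    map σ (uniSeries i c) = uniSeries i fun m => σ (c m) := by
  ext β
  rw [coeff_map]
  by_cases h : β ∈ Set.range (Finsupp.single i : ℕ → ι →₀ ℕ)
  · obtain ⟨m, rfl⟩ := h
    simp only [coeff_uniSeries_single]
  · rw [coeff_uniSeries_of_notMem _ _ h, coeff_uniSeries_of_notMem _ _ h, map_zero]

theorem uniSeries_mem_convSubring (i : ι) {c : ℕ → ℂ}
    (hc : Summable fun m => ‖c m‖ * (r : ℝ) ^ m) : uniSeries i c ∈ convSubring ι r := by
  rw [mem_convSubring, wnorm, ← (Finsupp.single_injective i).tsum_eq]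
  · have h1 : ∀ m : ℕ, ‖coeff (Finsupp.single i m) (uniSeries i c)‖ₑ *
        (r : ℝ≥0∞) ^ (Finsupp.single i m).degree = ENNReal.ofReal (‖c m‖ * (r : ℝ) ^ m) := by
      intro m
      rw [coeff_uniSeries_single, Finsupp.degree_single, ENNReal.ofReal_mul (norm_nonneg _),
        ENNReal.ofReal_pow r.coe_nonneg, ofReal_norm, ENNReal.ofReal_coe_nnreal]
    simp only [h1]
    rw [← ENNReal.ofReal_tsum_of_nonneg (fun m => by positivity) hc]
    exact ENNReal.ofReal_ne_top
  · intro β hβ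
    by_contra h
    exact hβ (by simp only [coeff_uniSeries_of_notMem i c h, enorm_zero, zero_mul])

theorem X_eq_uniSeries {A : Type*} [Semiring A] (i : ι) :
    (X i : MvPowerSeries ι A) = uniSeries i (Pi.single 1 1) := by
  classical
  ext β
  by_cases h : β ∈ Set.range (Finsupp.single i : ℕ → ι →₀ ℕ)
  · obtain ⟨m, rfl⟩ := h
    rw [coeff_uniSeries_single, coeff_X, Pi.single_apply]
    exact if_congr (Finsupp.single_injective i).eq_iff rfl rfl
  · rw [coeff_uniSeries_of_notMem _ _ h, coeff_X, if_neg]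
    rintro rfl
    exact h ⟨1, rfl⟩

theorem X_mem_convSubring (i : ι) : (X i : MvPowerSeries ι ℂ) ∈ convSubring ι r := by
  rw [X_eq_uniSeries]
  refine uniSeries_mem_convSubring i (summable_of_hasFiniteSupport ((Set.finite_singleton 1).subset
    ?_))
  intro m hm
  by_contra h
  exact hm (by simp [Pi.single_eq_of_ne h])

section Eval

variable [Fintype ι] {z : ι → ℂ}

theorem norm_prod_pow_le (hz : ∀ i, ‖z i‖ ≤ r) (β : ι →₀ ℕ) :
    ‖∏ i, z i ^ β i‖ ≤ (r : ℝ) ^ β.degree := by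
  rw [norm_prod, Finsupp.degree_eq_sum, ← Finset.prod_pow_eq_pow_sum]
  refine Finset.prod_le_prod (fun i _ => norm_nonneg _) fun i _ => ?_
  rw [norm_pow]
  exact pow_le_pow_left₀ (norm_nonneg _) (hz i) _

theorem summable_eval {F : MvPowerSeries ι ℂ} (hF : F ∈ convSubring ι r) (hz : ∀ i, ‖z i‖ ≤ r) :
    Summable fun β => ‖coeff β F * ∏ i, z i ^ β i‖ := by
  refine (summable_of_mem_convSubring hF).of_nonneg_of_le (fun _ => norm_nonneg _) fun β => ?_
  rw [norm_mul]
  exact mul_le_mul_of_nonneg_left (norm_prod_pow_le hz β) (norm_nonneg _)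

theorem tsum_eval_mul {F G : MvPowerSeries ι ℂ} (hF : F ∈ convSubring ι r)
    (hG : G ∈ convSubring ι r) (hz : ∀ i, ‖z i‖ ≤ r) :
    ∑' β, coeff β (F * G) * ∏ i, z i ^ β i =
      (∑' β, coeff β F * ∏ i, z i ^ β i) * ∑' β, coeff β G * ∏ i, z i ^ β i := by
  classical
  have key : ∀ f g : (ι →₀ ℕ) → ℂ, (Summable fun β => ‖f β‖) → (Summable fun β => ‖g β‖) →
      (∑' β, f β) * ∑' β, g β = ∑' β, ∑ x ∈ antidiagonal β, f x.1 * g x.2 := fun f g hf hg =>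
    hf.of_norm.tsum_mul_tsum_eq_tsum_sum_antidiagonal hg.of_norm
      (summable_mul_of_summable_norm hf hg)
  rw [key _ _ (summable_eval hF hz) (summable_eval hG hz)]
  refine tsum_congr fun β => ?_
  rw [coeff_mul, Finset.sum_mul]
  refine Finset.sum_congr rfl fun x hx => ?_
  have h1 : ∀ i, z i ^ β i = z i ^ x.1 i * z i ^ x.2 i := fun i => by
    rw [← pow_add, ← Finsupp.add_apply, Finset.HasAntidiagonal.mem_antidiagonal.1 hx]
  rw [Finset.prod_congr rfl fun i _ => h1 i, Finset.prod_mul_distrib]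
  ring

theorem tsum_eval_add {F G : MvPowerSeries ι ℂ} (hF : F ∈ convSubring ι r)
    (hG : G ∈ convSubring ι r) (hz : ∀ i, ‖z i‖ ≤ r) :
    ∑' β, coeff β (F + G) * ∏ i, z i ^ β i =
      (∑' β, coeff β F * ∏ i, z i ^ β i) + ∑' β, coeff β G * ∏ i, z i ^ β i := by
  rw [← (summable_eval hF hz).of_norm.tsum_add (summable_eval hG hz).of_norm]
  simp only [map_add, add_mul]

theorem tsum_eval_C (z : ι → ℂ) (c : ℂ) :
    ∑' β, coeff β (C c : MvPowerSeries ι ℂ) * ∏ i, z i ^ β i = c := by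
  classical
  rw [tsum_eq_single 0]
  · simp
  · intro β hβ
    rw [coeff_C, if_neg hβ, zero_mul]

/-- Evaluation of an absolutely convergent power series. -/
noncomputable def evalConv (hz : ∀ i, ‖z i‖ ≤ r) : convSubring ι r →+* ℂ where
  toFun F := ∑' β, coeff β F.1 * ∏ i, z i ^ β i
  map_one' := tsum_eval_C z 1
  map_zero' := by
    have := tsum_eval_C z 0
    rwa [map_zero] at this
  map_add' F G := tsum_eval_add F.2 G.2 hz
  map_mul' F G := tsum_eval_mul F.2 G.2 hz

theorem evalConv_apply (hz : ∀ i, ‖z i‖ ≤ r) (F : convSubring ι r) :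
    evalConv hz F = ∑' β, coeff β F.1 * ∏ i, z i ^ β i := rfl

theorem evalConv_C (hz : ∀ i, ‖z i‖ ≤ r) (c : ℂ) :
    evalConv hz ⟨C c, C_mem_convSubring c⟩ = c := tsum_eval_C z c

theorem evalConv_uniSeries (hz : ∀ i, ‖z i‖ ≤ r) (i : ι) {c : ℕ → ℂ}
    (hc : uniSeries i c ∈ convSubring ι r) :
    evalConv hz ⟨uniSeries i c, hc⟩ = ∑' m, c m * z i ^ m := by
  classical
  rw [evalConv_apply, ← (Finsupp.single_injective i).tsum_eq]
  · refine tsum_congr fun m => ?_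
    rw [coeff_uniSeries_single, Finset.prod_eq_single i]
    · simp
    · intro j _ hj
      rw [Finsupp.single_eq_of_ne hj, pow_zero]
    · exact fun h => absurd (Finset.mem_univ i) h
  · intro β hβ
    by_contra h
    exact hβ (by simp only [coeff_uniSeries_of_notMem i c h, zero_mul])

theorem evalConv_X (hz : ∀ i, ‖z i‖ ≤ r) (i : ι) :
    evalConv hz ⟨X i, X_mem_convSubring i⟩ = z i := by
  have h1 : (⟨X i, X_mem_convSubring i⟩ : convSubring ι r) = ⟨uniSeries i (Pi.single 1 1),
    X_eq_uniSeries (A := ℂ) i ▸ X_mem_convSubring i⟩ := Subtype.ext (X_eq_uniSeries i)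
  rw [h1, evalConv_uniSeries, tsum_eq_single 1]
  · simp
  · intro m hm
    rw [Pi.single_eq_of_ne hm, zero_mul]

end Eval

end MvPowerSeries

end WeightedNorm

section LeadingForm

open scoped ENNReal NNReal Topology
open Filter Asymptotics

theorem map_auxForm {A B ι : Type*} [CommRing A] [CommRing B] [Fintype ι] {k g m : ℕ}
    (φ : A →+* B) (p : Fin k → (Fin g → Fin m) → A) (c : ι → A) (Y : A) :
    φ (auxForm p c Y) = auxForm (fun b α => φ (p b α)) (fun i => φ (c i)) (φ Y) := by
  have h1 : ∀ l, φ ((∏ i, (Polynomial.X - Polynomial.C (c i))).coeff l) =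
      (∏ i, (Polynomial.X - Polynomial.C (φ (c i)))).coeff l := by
    intro l
    rw [← Polynomial.coeff_map, Polynomial.map_prod]
    simp
  simp only [auxForm, map_sum, map_mul, map_pow, map_prod, h1]

/-- Orthogonality of characters: coefficients of a form are averages of its values. -/
theorem exists_norm_coeff_le_of_form {ι : Type*} [Fintype ι] (s : Finset (ι →₀ ℕ))
    (c : (ι →₀ ℕ) → ℂ) {β : ι →₀ ℕ} (hβ : β ∈ s) {K : ℝ}
    (h : ∀ z : ι → ℂ, (∀ i, ‖z i‖ ≤ 1) → ‖∑ γ ∈ s, c γ * ∏ i, z i ^ γ i‖ ≤ K) : ‖c β‖ ≤ K := by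
  classical
  obtain ⟨N, hN0, hN⟩ : ∃ N : ℕ, N ≠ 0 ∧ ∀ γ ∈ s, ∀ i, γ i < N := by
    refine ⟨s.sup (fun γ => γ.degree) + 1, by omega, fun γ hγ i => ?_⟩
    have := Finset.le_sup (f := fun γ : ι →₀ ℕ => γ.degree) hγ
    have := Finsupp.le_degree i γ
    omega
  set ω := Complex.exp (2 * Real.pi * Complex.I / N)
  have hω : IsPrimitiveRoot ω N := Complex.isPrimitiveRoot_exp N hN0
  have hω1 : ‖ω‖ = 1 := hω.norm'_eq_one hN0
  have hsum : ∀ γ ∈ s, ∑ u : ι → Fin N, (∏ i, (ω ^ (u i : ℕ)) ^ γ i) *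
      (∏ i, (ω ^ (u i : ℕ)) ^ (N - β i)) = if γ = β then (N : ℂ) ^ Fintype.card ι else 0 := by
    intro γ hγ
    have h1 : ∀ i, ∑ u : Fin N, (ω ^ (u : ℕ)) ^ (γ i + (N - β i)) =
        if γ i = β i then (N : ℂ) else 0 := by
      intro i
      have h2 := hN γ hγ i
      have h3 := hN β hβ i
      have h4 : ∀ u : Fin N, (ω ^ (u : ℕ)) ^ (γ i + (N - β i)) =
          (ω ^ (γ i + (N - β i))) ^ (u : ℕ) := fun u => by rw [← pow_mul, ← pow_mul, mul_comm]
      simp only [h4]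
      rw [Fin.sum_univ_eq_sum_range fun u => (ω ^ (γ i + (N - β i))) ^ u]
      split_ifs with h5
      · rw [h5, show β i + (N - β i) = N by omega, hω.pow_eq_one]
        simp
      · have h6 : ω ^ (γ i + (N - β i)) ≠ 1 := by
          rw [Ne, hω.pow_eq_one_iff_dvd]
          rintro ⟨q, hq⟩
          rcases lt_trichotomy q 1 with hq1 | hq1 | hq1
          · obtain rfl : q = 0 := by omega
            omega
          · subst hq1
            omega
          · have : N * 2 ≤ N * q := Nat.mul_le_mul_left _ hq1
            omega
        have h7 := mul_neg_geom_sum (ω ^ (γ i + (N - β i))) N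
        rw [← pow_mul, mul_comm _ N, pow_mul, hω.pow_eq_one, one_pow, sub_self] at h7
        exact (mul_eq_zero.1 h7).resolve_left (sub_ne_zero.2 h6.symm)
    have h2 : ∀ u : ι → Fin N, (∏ i, (ω ^ (u i : ℕ)) ^ γ i) *
        (∏ i, (ω ^ (u i : ℕ)) ^ (N - β i)) = ∏ i, (ω ^ (u i : ℕ)) ^ (γ i + (N - β i)) := fun u => by
      rw [← Finset.prod_mul_distrib]
      exact Finset.prod_congr rfl fun i _ => (pow_add _ _ _).symm
    simp only [h2]
    rw [← Fintype.prod_sum fun i (u : Fin N) => (ω ^ (u : ℕ)) ^ (γ i + (N - β i)),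
      Finset.prod_congr rfl fun i _ => h1 i]
    split_ifs with h3
    · simp [h3]
    · obtain ⟨i, hi⟩ := Finsupp.ne_iff.1 h3
      exact Finset.prod_eq_zero (Finset.mem_univ i) (if_neg hi)
  have h1 : ∑ u : ι → Fin N, (∑ γ ∈ s, c γ * ∏ i, (ω ^ (u i : ℕ)) ^ γ i) *
      (∏ i, (ω ^ (u i : ℕ)) ^ (N - β i)) = c β * (N : ℂ) ^ Fintype.card ι := by
    simp only [Finset.sum_mul, mul_assoc]
    rw [Finset.sum_comm]
    simp only [← Finset.mul_sum]
    rw [Finset.sum_congr rfl fun γ hγ => by rw [hsum γ hγ]]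
    simp [hβ]
  have h2 := norm_sum_le Finset.univ fun u : ι → Fin N =>
    (∑ γ ∈ s, c γ * ∏ i, (ω ^ (u i : ℕ)) ^ γ i) * (∏ i, (ω ^ (u i : ℕ)) ^ (N - β i))
  rw [h1] at h2
  have h3 : ∀ u : ι → Fin N, ‖(∑ γ ∈ s, c γ * ∏ i, (ω ^ (u i : ℕ)) ^ γ i) *
      (∏ i, (ω ^ (u i : ℕ)) ^ (N - β i))‖ ≤ K := by
    intro u
    rw [norm_mul, norm_prod]
    simp only [norm_pow, hω1, one_pow, Finset.prod_const_one, mul_one]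
    exact h (fun i => ω ^ (u i : ℕ)) fun i => by rw [norm_pow, hω1, one_pow]
  have h4 := h2.trans (Finset.sum_le_sum fun u _ => h3 u)
  rw [Finset.sum_const, Finset.card_univ, Fintype.card_fun, Fintype.card_fin, nsmul_eq_mul,
    norm_mul, norm_pow, Complex.norm_natCast, Nat.cast_pow, mul_comm] at h4
  exact le_of_mul_le_mul_left h4 (by positivity)

namespace MvPowerSeries

variable {ι : Type*} [Fintype ι] {r : ℝ≥0}

open Classical in
/-- The homogeneous part of degree `M` of a power series, as a function. -/
noncomputable def formFun (F : MvPowerSeries ι ℂ) (M : ℕ) (z : ι → ℂ) : ℂ :=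
  ∑ β ∈ Finset.finsuppAntidiag Finset.univ M, coeff β F * ∏ i, z i ^ β i

theorem mem_finsuppAntidiag_univ [DecidableEq ι] {M : ℕ} {β : ι →₀ ℕ} :
    β ∈ Finset.finsuppAntidiag Finset.univ M ↔ β.degree = M := by
  rw [Finset.mem_finsuppAntidiag, Finsupp.degree_eq_sum]
  simp

theorem continuous_formFun (F : MvPowerSeries ι ℂ) (M : ℕ) : Continuous (formFun F M) := by
  unfold formFun
  fun_prop

theorem formFun_smul (F : MvPowerSeries ι ℂ) (M : ℕ) (c : ℂ) (z : ι → ℂ) :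
    formFun F M (c • z) = c ^ M * formFun F M z := by
  classical
  rw [formFun, formFun, Finset.mul_sum]
  refine Finset.sum_congr rfl fun β hβ => ?_
  simp only [Pi.smul_apply, smul_eq_mul, mul_pow, Finset.prod_mul_distrib,
    Finset.prod_pow_eq_pow_sum]
  rw [← Finsupp.degree_eq_sum, mem_finsuppAntidiag_univ.1 hβ]
  ring

theorem isBigO_eval_sub_formFun {F : MvPowerSeries ι ℂ} (hr : 0 < r) (hF : F ∈ convSubring ι r)
    {M : ℕ} (hM : ∀ β : ι →₀ ℕ, β.degree < M → coeff β F = 0) :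
    (fun z : ι → ℂ => (∑' β, coeff β F * ∏ i, z i ^ β i) - formFun F M z) =O[𝓝 0]
      fun z => ‖z‖ ^ (M + 1) := by
  classical
  have hs := summable_of_mem_convSubring hF
  refine IsBigO.of_bound ((∑' β, ‖coeff β F‖ * (r : ℝ) ^ β.degree) / (r : ℝ) ^ (M + 1)) ?_
  filter_upwards [Metric.ball_mem_nhds (0 : ι → ℂ) (NNReal.coe_pos.2 hr)] with z hz
  rw [mem_ball_zero_iff] at hz
  have hz' : ∀ i, ‖z i‖ ≤ r := fun i => (norm_le_pi_norm z i).trans hz.le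
  have hsum := (summable_eval hF hz').of_norm
  have hsup : ∀ β ∉ (↑(Finset.finsuppAntidiag (Finset.univ : Finset ι) M) : Set (ι →₀ ℕ)),
      M < β.degree ∨ coeff β F = 0 := fun β hβ => by
    rw [Finset.mem_coe, mem_finsuppAntidiag_univ] at hβ
    rcases lt_or_gt_of_ne hβ with h | h
    · exact Or.inr (hM β h)
    · exact Or.inl h
  rw [formFun, ← hsum.sum_add_tsum_compl (s := Finset.finsuppAntidiag Finset.univ M),
    add_sub_cancel_left, norm_pow, norm_norm]
  have hb : ∀ β : ↑(↑(Finset.finsuppAntidiag (Finset.univ : Finset ι) M) : Set (ι →₀ ℕ))ᶜ,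
      ‖coeff β.1 F * ∏ i, z i ^ β.1 i‖ ≤
        (‖coeff β.1 F‖ * (r : ℝ) ^ β.1.degree) * ((‖z‖ / r) ^ (M + 1)) := by
    rintro ⟨β, hβ⟩
    rcases hsup β hβ with h | h
    · rw [norm_mul, mul_assoc]
      refine mul_le_mul_of_nonneg_left ?_ (norm_nonneg _)
      have hr' : (0 : ℝ) < r := hr
      calc ‖∏ i, z i ^ β i‖ ≤ ‖z‖ ^ β.degree :=
            norm_prod_pow_le (r := ‖z‖₊) (fun i => norm_le_pi_norm z i) β
        _ = (r : ℝ) ^ β.degree * (‖z‖ / r) ^ β.degree := by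
            rw [← mul_pow, mul_div_cancel₀ _ hr'.ne']
        _ ≤ _ := by
            refine mul_le_mul_of_nonneg_left ?_ (by positivity)
            exact pow_le_pow_of_le_one (by positivity) ((div_le_one hr').2 hz.le) h
    · simp [h]
  have hs' := (hs.subtype (↑(Finset.finsuppAntidiag (Finset.univ : Finset ι) M) : Set (ι →₀ ℕ))ᶜ)
  refine (tsum_of_norm_bounded (hs'.mul_right _).hasSum hb).trans ?_
  rw [tsum_mul_right]
  calc _ ≤ (∑' β, ‖coeff β F‖ * (r : ℝ) ^ β.degree) * (‖z‖ / r) ^ (M + 1) := by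
        refine mul_le_mul_of_nonneg_right ?_ (by positivity)
        exact hs.tsum_subtype_le _ _ fun β => by positivity
    _ = _ := by rw [div_pow]; ring

end MvPowerSeries

end LeadingForm

section AuxSeries

open scoped ENNReal NNReal Topology
open Filter Asymptotics
open MvPowerSeries (uniSeries convSubring wnorm)

section Algebraic

variable {A ι : Type*} [CommRing A] [Fintype ι]

/-- The expansion at `t` of the coefficients of `∏ (X - c i)`. -/
noncomputable def elemSeries (t : ι → A) (l : ℕ) : MvPowerSeries ι A :=
  (∏ i, (Polynomial.X - Polynomial.C (MvPowerSeries.C (t i) + MvPowerSeries.X i))).coeff l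

/-- The monomials in `elemSeries` and in the product of the series `Y i`. -/
noncomputable def auxMon (t : ι → A) (Y : ι → ℕ → A) {g : ℕ} (α : Fin g → ℕ) (b : ℕ) :
    MvPowerSeries ι A :=
  (∏ l : Fin g, elemSeries t l ^ α l) * (∏ i, uniSeries i (Y i)) ^ b

/-- The power series expansion at `t` of an auxiliary form. -/
noncomputable def auxSeries (t : ι → A) (Y : ι → ℕ → A) {k g m : ℕ}
    (p : Fin k → (Fin g → Fin m) → A) : MvPowerSeries ι A :=
  auxForm (fun b α => MvPowerSeries.C (p b α))
    (fun i => MvPowerSeries.C (t i) + MvPowerSeries.X i) (∏ i, uniSeries i (Y i))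

theorem coeff_auxSeries (t : ι → A) (Y : ι → ℕ → A) {k g m : ℕ}
    (p : Fin k → (Fin g → Fin m) → A) (β : ι →₀ ℕ) :
    MvPowerSeries.coeff β (auxSeries t Y p) =
      ∑ b, ∑ α, p b α * MvPowerSeries.coeff β (auxMon t Y (fun l => (α l : ℕ)) b) := by
  simp only [auxSeries, auxForm, map_sum, mul_assoc, MvPowerSeries.coeff_C_mul]
  rfl

theorem map_auxMon {B : Type*} [CommRing B] (σ : A →+* B) (t : ι → A) (Y : ι → ℕ → A) {g : ℕ}
    (α : Fin g → ℕ) (b : ℕ) : MvPowerSeries.map σ (auxMon t Y α b) =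
      auxMon (fun i => σ (t i)) (fun i m => σ (Y i m)) α b := by
  have h1 : ∀ l, MvPowerSeries.map σ (elemSeries t l) = elemSeries (fun i => σ (t i)) l := by
    intro l
    rw [elemSeries, ← Polynomial.coeff_map, Polynomial.map_prod]
    simp [elemSeries]
  simp only [auxMon, map_mul, map_prod, map_pow, h1, MvPowerSeries.map_uniSeries]

theorem coeff_map_auxSeries {B : Type*} [CommRing B] (σ : A →+* B) (t : ι → A) (Y : ι → ℕ → A)
    {k g m : ℕ} (p : Fin k → (Fin g → Fin m) → A) (β : ι →₀ ℕ) :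
    MvPowerSeries.coeff β (auxSeries (fun i => σ (t i)) (fun i m => σ (Y i m))
      fun b α => σ (p b α)) = σ (MvPowerSeries.coeff β (auxSeries t Y p)) := by
  simp only [coeff_auxSeries, map_sum, map_mul, ← map_auxMon, MvPowerSeries.coeff_map]

end Algebraic

section Analytic

variable {ι : Type*} [Fintype ι] {r : ℝ≥0} {t : ι → ℂ} {Y : ι → ℕ → ℂ}

/-- The element `t i + X i` of the ring of convergent series. -/
noncomputable def coordConv (r : ℝ≥0) (t : ι → ℂ) (i : ι) : convSubring ι r :=
  ⟨MvPowerSeries.C (t i), MvPowerSeries.C_mem_convSubring _⟩ +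
    ⟨MvPowerSeries.X i, MvPowerSeries.X_mem_convSubring i⟩

/-- The series `∏ Y i` as an element of the ring of convergent series. -/
noncomputable def prodConv (hY : ∀ i, Summable fun m => ‖Y i m‖ * (r : ℝ) ^ m) : convSubring ι r :=
  ∏ i, ⟨uniSeries i (Y i), MvPowerSeries.uniSeries_mem_convSubring i (hY i)⟩

theorem elemSeries_mem_convSubring (t : ι → ℂ) (l : ℕ) : elemSeries t l ∈ convSubring ι r := by
  have h1 : elemSeries t l = (convSubring ι r).subtype
      ((∏ i, (Polynomial.X - Polynomial.C (coordConv r t i))).coeff l) := by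
    rw [elemSeries, ← Polynomial.coeff_map, Polynomial.map_prod]
    simp [coordConv]
  rw [h1]
  exact Subtype.property _

theorem prod_uniSeries_mem_convSubring (hY : ∀ i, Summable fun m => ‖Y i m‖ * (r : ℝ) ^ m) :
    ∏ i, uniSeries i (Y i) ∈ convSubring ι r :=
  prod_mem fun i _ => MvPowerSeries.uniSeries_mem_convSubring i (hY i)

theorem auxSeries_eq_coe (hY : ∀ i, Summable fun m => ‖Y i m‖ * (r : ℝ) ^ m) {k g m : ℕ}
    (p : Fin k → (Fin g → Fin m) → ℂ) : (convSubring ι r).subtype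
      (auxForm (fun b α => ⟨MvPowerSeries.C (p b α), MvPowerSeries.C_mem_convSubring _⟩)
        (coordConv r t) (prodConv hY)) = auxSeries t Y p := by
  rw [map_auxForm, auxSeries]
  congr 1
  rw [prodConv, map_prod]
  rfl

theorem auxSeries_mem_convSubring (hY : ∀ i, Summable fun m => ‖Y i m‖ * (r : ℝ) ^ m) {k g m : ℕ}
    (p : Fin k → (Fin g → Fin m) → ℂ) : auxSeries t Y p ∈ convSubring ι r := by
  rw [← auxSeries_eq_coe hY p]
  exact Subtype.property _

theorem tsum_auxSeries (hY : ∀ i, Summable fun m => ‖Y i m‖ * (r : ℝ) ^ m) {k g m : ℕ}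
    (p : Fin k → (Fin g → Fin m) → ℂ) {z : ι → ℂ} (hz : ∀ i, ‖z i‖ ≤ r) :
    ∑' β, MvPowerSeries.coeff β (auxSeries t Y p) * ∏ i, z i ^ β i =
      auxForm p (fun i => t i + z i) (∏ i, ∑' m, Y i m * z i ^ m) := by
  rw [← auxSeries_eq_coe hY p]
  change MvPowerSeries.evalConv hz _ = _
  rw [map_auxForm]
  congr 1
  · funext b α
    exact MvPowerSeries.evalConv_C hz _
  · funext i
    rw [coordConv, map_add, MvPowerSeries.evalConv_C, MvPowerSeries.evalConv_X]
  · rw [prodConv, map_prod]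
    exact Finset.prod_congr rfl fun i _ => MvPowerSeries.evalConv_uniSeries hz i _

theorem exists_norm_coeff_auxMon_le (hr : 0 < r)
    (hY : ∀ i, Summable fun m => ‖Y i m‖ * (r : ℝ) ^ m) (g : ℕ) :
    ∃ C : ℝ, 1 ≤ C ∧ ∀ (α : Fin g → ℕ) (b : ℕ) (β : ι →₀ ℕ),
      ‖MvPowerSeries.coeff β (auxMon t Y α b)‖ ≤ C ^ (∑ l, α l + b + β.degree) := by
  set N : ℝ≥0∞ := 1 + ∑ l : Fin g, wnorm r (elemSeries t l) + wnorm r (∏ i, uniSeries i (Y i))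
  have hN : N ≠ ∞ := by
    simp only [N, ne_eq, ENNReal.add_eq_top, ENNReal.one_ne_top, ENNReal.sum_eq_top, not_or,
      not_exists, not_and, not_false_eq_true, true_and]
    exact ⟨fun l _ => elemSeries_mem_convSubring t l, prod_uniSeries_mem_convSubring hY⟩
  have hN1 : 1 ≤ N := le_add_right (le_add_right le_rfl)
  have he : ∀ l : Fin g, wnorm r (elemSeries t l) ≤ N := fun l =>
    le_add_right (le_add_left (Finset.single_le_sum (f := fun l : Fin g => wnorm r (elemSeries t l))
      (fun _ _ => bot_le) (Finset.mem_univ l)))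
  have hy : wnorm r (∏ i, uniSeries i (Y i)) ≤ N := le_add_left le_rfl
  have h1 : wnorm r (1 : MvPowerSeries ι ℂ) ≤ 1 := by
    simpa using MvPowerSeries.wnorm_C_le (ι := ι) (r := r) (1 : ℂ)
  have hpow : ∀ (F : MvPowerSeries ι ℂ) (n : ℕ), wnorm r (F ^ n) ≤ wnorm r F ^ n := by
    intro F n
    induction n with
    | zero => simpa using h1
    | succ n ih =>
      rw [pow_succ, pow_succ]
      exact (MvPowerSeries.wnorm_mul_le _ _).trans (mul_le_mul_left ih _)
  have hprod : ∀ (s : Finset (Fin g)) (α : Fin g → ℕ),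
      wnorm r (∏ l ∈ s, elemSeries t l ^ α l) ≤ N ^ ∑ l ∈ s, α l := by
    classical
    intro s α
    induction s using Finset.induction_on with
    | empty => simpa using h1
    | insert a s ha ih =>
      rw [Finset.prod_insert ha, Finset.sum_insert ha, pow_add]
      exact (MvPowerSeries.wnorm_mul_le _ _).trans (mul_le_mul' ((hpow _ _).trans
        (pow_le_pow_left' (he a) _)) ih)
  have hr' : (0 : ℝ) < r := hr
  refine ⟨max N.toReal (r : ℝ)⁻¹, le_max_of_le_left ?_, fun α b β => ?_⟩
  · rw [← ENNReal.toReal_one]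
    exact ENNReal.toReal_mono hN hN1
  have h2 : wnorm r (auxMon t Y α b) ≤ N ^ (∑ l, α l + b) := by
    rw [pow_add]
    exact (MvPowerSeries.wnorm_mul_le _ _).trans (mul_le_mul' (hprod _ _) ((hpow _ _).trans
      (pow_le_pow_left' hy _)))
  have h3 := ENNReal.toReal_mono (ENNReal.pow_ne_top hN)
    ((MvPowerSeries.enorm_coeff_mul_le β (auxMon t Y α b)).trans h2)
  rw [ENNReal.toReal_mul, ENNReal.toReal_pow, ENNReal.toReal_pow, toReal_enorm,
    ENNReal.coe_toReal] at h3
  calc _ = ‖MvPowerSeries.coeff β (auxMon t Y α b)‖ * (r : ℝ) ^ β.degree *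
           (r : ℝ)⁻¹ ^ β.degree := by
        rw [mul_assoc, ← mul_pow, mul_inv_cancel₀ hr'.ne', one_pow, mul_one]
    _ ≤ N.toReal ^ (∑ l, α l + b) * (r : ℝ)⁻¹ ^ β.degree :=
        mul_le_mul_of_nonneg_right h3 (by positivity)
    _ ≤ _ := by
        rw [pow_add _ _ β.degree]
        gcongr
        · exact le_max_left _ _
        · exact le_max_right _ _

/-- The growth estimate for the first non-vanishing coefficients of an auxiliary series. -/
theorem BranchData.exists_growth_coeff {ε δ : ℕ} (D : BranchData ε δ) (hr : 0 < r)
    {Y : Fin ε × Fin δ → ℕ → ℂ} (hY : ∀ i, Summable fun m => ‖Y i m‖ * (r : ℝ) ^ m)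
    (hDY : ∀ i (z : ℂ), ‖z‖ ≤ r → D.y i.1 i.2 (D.τ i.1 + z) = ∑' m, Y i m * z ^ m) :
    ∃ ρ : ℝ, 0 < ρ ∧ ∀ n : ℕ, 0 < n → ∃ B : ℝ, 1 ≤ B ∧ ∀ (k m M : ℕ)
      (p : Fin k → (Fin (ε * δ) → Fin (m + 1)) → ℂ),
      (∀ β : Fin ε × Fin δ →₀ ℕ, β.degree < M →
        MvPowerSeries.coeff β (auxSeries (fun i => D.τ i.1) Y p) = 0) →
      ∀ β : Fin ε × Fin δ →₀ ℕ, β.degree = M →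
        ‖MvPowerSeries.coeff β (auxSeries (fun i => D.τ i.1) Y p)‖ * (n * ρ) ^ M ≤
          B ^ (m + k) * coeffSum p := by
  classical
  obtain ⟨ρ, hρ, hn⟩ := D.exists_growth
  refine ⟨ρ, hρ, fun n hn0 => ?_⟩
  obtain ⟨B, hB, h⟩ := hn n hn0
  refine ⟨B, hB, fun k m M p hp β hβ => ?_⟩
  have hF := auxSeries_mem_convSubring (t := fun i : Fin ε × Fin δ => D.τ i.1) hY p
  have h1 := MvPowerSeries.isBigO_eval_sub_formFun hr hF hp
  have h2 := h k m M p _ (MvPowerSeries.continuous_formFun _ M) (MvPowerSeries.formFun_smul _ M)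
    (h1.congr' (by
      filter_upwards [Metric.ball_mem_nhds (0 : Fin ε × Fin δ → ℂ) (NNReal.coe_pos.2 hr)] with z hz
      rw [mem_ball_zero_iff] at hz
      have hz' : ∀ i, ‖z i‖ ≤ r := fun i => (norm_le_pi_norm z i).trans hz.le
      rw [tsum_auxSeries hY p hz', Finset.prod_congr rfl fun i _ => (hDY i (z i) (hz' i)).symm])
      EventuallyEq.rfl)
  have h3 : 0 < ((n : ℝ) * ρ) ^ M := by positivity
  have h4 : ∀ z : Fin ε × Fin δ → ℂ, (∀ i, ‖z i‖ ≤ 1) →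
      ‖MvPowerSeries.formFun (auxSeries (fun i => D.τ i.1) Y p) M z‖ ≤
        B ^ (m + k) * coeffSum p / (n * ρ) ^ M := fun z hz =>
    (le_div_iff₀ h3).2 (h2 z ((pi_norm_le_iff_of_nonneg zero_le_one).2 hz))
  rw [← le_div_iff₀ h3]
  exact exists_norm_coeff_le_of_form _ _
    ((@MvPowerSeries.mem_finsuppAntidiag_univ _ _ (Classical.decEq _) _ _).2 hβ) h4

end Analytic

section Integral

variable {A : Type*} [CommRing A] {ι : Type*}

/-- The ring of power series whose coefficients of degree `n` have denominator `d n`. -/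
def intSubring (A ι : Type*) [CommRing A] (d : ℕ → ℕ) (h0 : d 0 = 1)
    (hd : ∀ k l, d k * d l ∣ d (k + l)) : Subring (MvPowerSeries ι A) where
  carrier := {F | ∀ β : ι →₀ ℕ, IsIntegral ℤ ((d β.degree : A) * MvPowerSeries.coeff β F)}
  mul_mem' {F G} hF hG β := by
    classical
    rw [MvPowerSeries.coeff_mul, Finset.mul_sum]
    refine IsIntegral.sum _ fun x hx => ?_
    obtain ⟨q, hq⟩ := hd x.1.degree x.2.degree
    rw [← Finset.HasAntidiagonal.mem_antidiagonal.1 hx, map_add, hq]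
    convert ((hF x.1).mul (hG x.2)).mul (isIntegral_natCast q) using 1
    push_cast
    ring
  one_mem' β := by
    classical
    rw [MvPowerSeries.coeff_one]
    split_ifs with h
    · subst h
      simpa [h0] using isIntegral_one
    · simpa using isIntegral_zero
  add_mem' {F G} hF hG β := by
    rw [map_add, mul_add]
    exact (hF β).add (hG β)
  zero_mem' β := by simpa using isIntegral_zero
  neg_mem' {F} hF β := by
    rw [map_neg, mul_neg]
    exact (hF β).neg

variable {d : ℕ → ℕ} {h0 : d 0 = 1} {hd : ∀ k l, d k * d l ∣ d (k + l)}

theorem C_mem_intSubring {c : A} (hc : IsIntegral ℤ c) :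
    (MvPowerSeries.C c : MvPowerSeries ι A) ∈ intSubring A ι d h0 hd := by
  classical
  intro β
  rw [MvPowerSeries.coeff_C]
  split_ifs with h
  · subst h
    simpa [h0] using hc
  · simpa using isIntegral_zero

theorem uniSeries_mem_intSubring (i : ι) {c : ℕ → A}
    (hc : ∀ m, IsIntegral ℤ ((d m : A) * c m)) :
    uniSeries i c ∈ intSubring A ι d h0 hd := by
  intro β
  by_cases h : β ∈ Set.range (Finsupp.single i : ℕ → ι →₀ ℕ)
  · obtain ⟨m, rfl⟩ := h
    rw [MvPowerSeries.coeff_uniSeries_single, Finsupp.degree_single]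
    exact hc m
  · rw [MvPowerSeries.coeff_uniSeries_of_notMem _ _ h]
    simpa using isIntegral_zero

theorem X_mem_intSubring (i : ι) :
    (MvPowerSeries.X i : MvPowerSeries ι A) ∈ intSubring A ι d h0 hd := by
  rw [MvPowerSeries.X_eq_uniSeries]
  refine uniSeries_mem_intSubring i fun m => (isIntegral_natCast _).mul ?_
  rcases eq_or_ne m 1 with rfl | h
  · simpa using isIntegral_one
  · simpa [Pi.single_eq_of_ne h] using isIntegral_zero

theorem mul_elemSeries_mem_intSubring [Fintype ι] {t : ι → A} {e : ℕ}
    (he : ∀ i, IsIntegral ℤ ((e : A) * t i)) (l : ℕ) :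
    MvPowerSeries.C ((e : A) ^ Fintype.card ι) * elemSeries t l ∈ intSubring A ι d h0 hd := by
  let E : intSubring A ι d h0 hd := ⟨MvPowerSeries.C (e : A), C_mem_intSubring (isIntegral_natCast
      e)⟩
  let T : ι → intSubring A ι d h0 hd := fun i =>
    ⟨MvPowerSeries.C ((e : A) * t i), C_mem_intSubring (he i)⟩ + E * ⟨MvPowerSeries.X i,
    X_mem_intSubring i⟩
  have h1 : MvPowerSeries.C ((e : A) ^ Fintype.card ι) * elemSeries t l =
      (intSubring A ι d h0 hd).subtype
        ((∏ i, (Polynomial.C E * Polynomial.X - Polynomial.C (T i))).coeff l) := by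
    rw [elemSeries, ← Polynomial.coeff_C_mul, ← Polynomial.coeff_map, Polynomial.map_prod, map_pow,
      map_pow, ← Finset.card_univ, ← Finset.prod_const, ← Finset.prod_mul_distrib]
    congr 1
    refine Finset.prod_congr rfl fun i _ => ?_
    have h2 : (intSubring A ι d h0 hd).subtype (T i) = MvPowerSeries.C (e : A) *
        (MvPowerSeries.C (t i) + MvPowerSeries.X i) := by
      rw [mul_add, ← map_mul]
      rfl
    rw [Polynomial.map_sub, Polynomial.map_mul, Polynomial.map_C, Polynomial.map_C,
      Polynomial.map_X, h2, map_mul]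
    exact mul_sub _ _ _
  rw [h1]
  exact Subtype.property _

theorem isIntegral_coeff_auxMon [Fintype ι] {t : ι → A} {Y : ι → ℕ → A} {e : ℕ}
    (he : ∀ i, IsIntegral ℤ ((e : A) * t i)) (hY : ∀ i m, IsIntegral ℤ ((d m : A) * Y i m))
    (h0 : d 0 = 1) (hd : ∀ k l, d k * d l ∣ d (k + l))
    {g m : ℕ} {α : Fin g → ℕ} (hα : ∀ l, α l ≤ m) (b : ℕ) (β : ι →₀ ℕ) :
    IsIntegral ℤ ((d β.degree : A) * ((e : A) ^ (Fintype.card ι * (g * m)) *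
      MvPowerSeries.coeff β (auxMon t Y α b))) := by
  have h1 : MvPowerSeries.C ((e : A) ^ (Fintype.card ι * (g * m))) * auxMon t Y α b ∈
      intSubring A ι d h0 hd := by
    have h2 : MvPowerSeries.C ((e : A) ^ (Fintype.card ι * (g * m))) * auxMon t Y α b =
        (∏ l : Fin g, (MvPowerSeries.C (((e : A) ^ Fintype.card ι) ^ (m - α l)) *
          (MvPowerSeries.C ((e : A) ^ Fintype.card ι) * elemSeries t l) ^ α l)) *
            (∏ i, uniSeries i (Y i)) ^ b := by
      have h3 : ∀ l : Fin g, MvPowerSeries.C (((e : A) ^ Fintype.card ι) ^ (m - α l)) *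
          (MvPowerSeries.C ((e : A) ^ Fintype.card ι) * elemSeries t l) ^ α l =
          MvPowerSeries.C (((e : A) ^ Fintype.card ι) ^ m) * elemSeries t l ^ α l := by
        intro l
        rw [mul_pow, ← map_pow, ← mul_assoc, ← map_mul, ← pow_add, Nat.sub_add_cancel (hα l)]
      rw [Finset.prod_congr rfl fun l _ => h3 l, Finset.prod_mul_distrib, Finset.prod_const,
        Finset.card_univ, Fintype.card_fin, ← map_pow, ← pow_mul, ← pow_mul, auxMon, mul_assoc,
        mul_comm m g]
    rw [h2]
    refine mul_mem (prod_mem fun l _ => mul_mem (C_mem_intSubring ?_)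
      (pow_mem (mul_elemSeries_mem_intSubring he l) _)) (pow_mem (prod_mem fun i _ =>
        uniSeries_mem_intSubring i (hY i)) _)
    exact ((isIntegral_natCast e).pow _).pow _
  have h2 := h1 β
  rwa [MvPowerSeries.coeff_C_mul] at h2

end Integral

end AuxSeries

section Siegel

open NumberField

theorem exists_house_bound (L : Type*) [Field L] [NumberField L] : ∃ c : ℝ, ∀ (α β : Type)
    [Fintype α] [Fintype β] (a : Matrix α β (𝓞 L)), a ≠ 0 → 0 < Fintype.card α →
    Fintype.card β = 2 * Fintype.card α → ∀ A : ℝ,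
    (∀ k l, house (algebraMap (𝓞 L) L (a k l)) ≤ A) →
    ∃ ξ : β → 𝓞 L, ξ ≠ 0 ∧ a.mulVec ξ = 0 ∧
      ∀ l, house (ξ l : L) ≤ c * (c * Fintype.card β * A) ^ (1 : ℝ) := by
  classical
  refine ⟨?_, fun α β _ _ a ha hα hβ A hA => ?_⟩
  rotate_left
  · have h1 : Fintype.card α < Fintype.card β := by omega
    have h2 : ((Fintype.card α : ℕ) : ℝ) / ((Fintype.card β : ℕ) - (Fintype.card α : ℕ)) = 1 := by
      rw [hβ, div_eq_one_iff_eq]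
      · push_cast
        ring
      · push_cast
        have : (0 : ℝ) < Fintype.card α := by exact_mod_cast hα
        linarith
    have h3 := NumberField.house.exists_ne_zero_int_vec_house_le L a ha hα h1 rfl hA rfl
    rw [h2] at h3
    exact h3

theorem house_le_of_forall_norm_le {L : Type*} [Field L] [NumberField L] {x : L} {A : ℝ}
    (h : ∀ σ : L →+* ℂ, ‖σ x‖ ≤ A) : house x ≤ A := by
  obtain ⟨σ⟩ : Nonempty (L →+* ℂ) := inferInstance
  exact (pi_norm_le_iff_of_nonneg ((norm_nonneg _).trans (h σ))).2 h

/-- Siegel's lemma for twice as many unknowns as equations. -/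
theorem exists_siegel_solution (L : Type*) [Field L] [NumberField L] : ∃ c : ℝ, 1 ≤ c ∧
    ∀ (α β : Type) [Fintype α] [Fintype β] (a : α → β → L), 0 < Fintype.card α →
    Fintype.card β = 2 * Fintype.card α → (∀ k l, IsIntegral ℤ (a k l)) → ∀ A : ℝ, 1 ≤ A →
    (∀ k l (σ : L →+* ℂ), ‖σ (a k l)‖ ≤ A) →
    ∃ ξ : β → L, ξ ≠ 0 ∧ (∀ l, IsIntegral ℤ (ξ l)) ∧ (∀ k, ∑ l, a k l * ξ l = 0) ∧
      ∀ l (σ : L →+* ℂ), ‖σ (ξ l)‖ ≤ c * Fintype.card β * A := by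
  obtain ⟨c, hc⟩ := exists_house_bound L
  refine ⟨max 1 (c * c), le_max_left _ _, fun α β _ _ a hα hβ ha A hA1 hA => ?_⟩
  have hβ0 : 0 < Fintype.card β := by omega
  have hβ1 : (1 : ℝ) ≤ Fintype.card β := by exact_mod_cast hβ0
  let a' : Matrix α β (𝓞 L) := fun k l => ⟨a k l, ha k l⟩
  by_cases h0 : a' = 0
  · have h1 : ∀ k l, a k l = 0 := fun k l => congrArg Subtype.val (congrFun (congrFun h0 k) l)
    have : Nonempty β := Fintype.card_pos_iff.1 hβ0
    refine ⟨1, one_ne_zero, fun l => isIntegral_one, fun k => by simp [h1], fun l σ => ?_⟩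
    rw [Pi.one_apply, map_one, norm_one]
    exact one_le_mul_of_one_le_of_one_le (one_le_mul_of_one_le_of_one_le (le_max_left _ _) hβ1) hA1
  · obtain ⟨ξ, h1, h2, h3⟩ := hc α β a' h0 hα hβ A fun k l =>
      house_le_of_forall_norm_le fun σ => hA k l σ
    refine ⟨fun l => (ξ l : L), fun h => h1 ?_, fun l => (ξ l).2, fun k => ?_, fun l σ => ?_⟩
    · funext l
      exact Subtype.ext (congrFun h l)
    · have := congrArg (algebraMap (𝓞 L) L) (congrFun h2 k)
      simp only [Matrix.mulVec, dotProduct, map_sum, map_mul, Pi.zero_apply, map_zero] at this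
      exact this
    · refine (norm_embedding_le_house _ σ).trans ((h3 l).trans ?_)
      rw [Real.rpow_one, ← mul_assoc, ← mul_assoc]
      gcongr
      exact le_max_right _ _

end Siegel

section Growth

open scoped NNReal

variable {L : Type*} [Field L] [NumberField L]

theorem exists_uniform_growth {ε δ : ℕ} {r : ℝ≥0} (hr : 0 < r) {t : Fin ε × Fin δ → L}
    {Y : Fin ε × Fin δ → ℕ → L} (D : (L →+* ℂ) → BranchData ε δ)
    (hτ : ∀ σ i, (D σ).τ i.1 = σ (t i))
    (hY : ∀ σ : L →+* ℂ, ∀ i, Summable fun m => ‖σ (Y i m)‖ * (r : ℝ) ^ m)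
    (hDY : ∀ σ i (z : ℂ), ‖z‖ ≤ r →
      (D σ).y i.1 i.2 (σ (t i) + z) = ∑' m, σ (Y i m) * z ^ m) :
    ∃ ρ : ℝ, 0 < ρ ∧ ∀ n : ℕ, 0 < n → ∃ B : ℝ, 1 ≤ B ∧ ∀ (k m M : ℕ)
      (p : Fin k → (Fin (ε * δ) → Fin (m + 1)) → L),
      (∀ β : Fin ε × Fin δ →₀ ℕ, β.degree < M → MvPowerSeries.coeff β (auxSeries t Y p) = 0) →
      ∀ β : Fin ε × Fin δ →₀ ℕ, β.degree = M → ∀ σ : L →+* ℂ,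
        ‖σ (MvPowerSeries.coeff β (auxSeries t Y p))‖ * (n * ρ) ^ M ≤
          B ^ (m + k) * coeffSum fun b α => σ (p b α) := by
  have hne : Nonempty (L →+* ℂ) := inferInstance
  have h1 : ∀ σ : L →+* ℂ, ∃ ρ : ℝ, 0 < ρ ∧ ∀ n : ℕ, 0 < n → ∃ B : ℝ, 1 ≤ B ∧ ∀ (k m M : ℕ)
      (p : Fin k → (Fin (ε * δ) → Fin (m + 1)) → L),
      (∀ β : Fin ε × Fin δ →₀ ℕ, β.degree < M → MvPowerSeries.coeff β (auxSeries t Y p) = 0) →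
      ∀ β : Fin ε × Fin δ →₀ ℕ, β.degree = M →
        ‖σ (MvPowerSeries.coeff β (auxSeries t Y p))‖ * (n * ρ) ^ M ≤
          B ^ (m + k) * coeffSum fun b α => σ (p b α) := by
    intro σ
    have hτ' : (fun i : Fin ε × Fin δ => (D σ).τ i.1) = fun i => σ (t i) := funext (hτ σ)
    obtain ⟨ρ, hρ, h⟩ := (D σ).exists_growth_coeff hr (hY σ)
      (fun i z hz => by rw [hτ]; exact hDY σ i z hz)
    refine ⟨ρ, hρ, fun n hn => ?_⟩
    obtain ⟨B, hB, h⟩ := h n hn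
    refine ⟨B, hB, fun k m M p hp β hβ => ?_⟩
    rw [hτ'] at h
    have := h k m M (fun b α => σ (p b α))
      (fun β hβ => by rw [coeff_map_auxSeries, hp β hβ, map_zero]) β hβ
    rwa [coeff_map_auxSeries] at this
  choose ρ hρ h using h1
  obtain ⟨σ₀, hσ₀⟩ := Finite.exists_min ρ
  refine ⟨ρ σ₀, hρ σ₀, fun n hn => ?_⟩
  choose B hB h using fun σ => h σ n hn
  obtain ⟨σ₁, hσ₁⟩ := Finite.exists_max B
  refine ⟨B σ₁, hB σ₁, fun k m M p hp β hβ σ => ?_⟩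
  have h2 := h σ k m M p hp β hβ
  have h3 : 0 ≤ coeffSum fun b α => σ (p b α) :=
    Finset.sum_nonneg fun b _ => Finset.sum_nonneg fun α _ => norm_nonneg _
  have h4 := hρ σ₀
  have h5 := hB σ
  calc _ ≤ ‖σ (MvPowerSeries.coeff β (auxSeries t Y p))‖ * (n * ρ σ) ^ M := by
        gcongr
        exact hσ₀ σ
    _ ≤ _ := h2
    _ ≤ _ := by
        gcongr
        exact hσ₁ σ

end Growth

section Main

open scoped NNReal
open Filter

theorem exists_siegel_parameters (g : ℕ) {Q c : ℝ} (hQ : 1 ≤ Q) (hc : 0 ≤ c) : ∃ K m : ℕ, 0 < K ∧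
    Q ^ (m + 2 * K ^ g) * (c * (2 * ((K * (m + 1) : ℕ) : ℝ) ^ g) ^ 2) < 2 ^ (K * (m + 1)) := by
  obtain ⟨K, hK⟩ := pow_unbounded_of_one_lt (2 * Q) one_lt_two
  have hK0 : 0 < K := by
    rcases Nat.eq_zero_or_pos K with rfl | h
    · norm_num at hK
      linarith
    · exact h
  set c₀ := Q ^ (2 * K ^ g) * (c * 4 * (K : ℝ) ^ (2 * g))
  have hc₀ : 0 ≤ c₀ := by positivity
  have h1 := (tendsto_pow_const_div_const_pow_of_one_lt (2 * g) (one_lt_two (α := ℝ))).const_mul c₀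
  rw [mul_zero] at h1
  obtain ⟨m, hm⟩ := (((tendsto_add_atTop_iff_nat 1).2 h1).eventually_lt_const zero_lt_one).exists
  rw [← mul_div_assoc, div_lt_one (by positivity)] at hm
  refine ⟨K, m, hK0, ?_⟩
  calc _ = Q ^ m * (c₀ * ((m + 1 : ℕ) : ℝ) ^ (2 * g)) := by
        simp only [c₀]
        rw [Nat.cast_mul, mul_pow, pow_add]
        ring
    _ < Q ^ m * 2 ^ (m + 1) := by gcongr
    _ ≤ Q ^ (m + 1) * 2 ^ (m + 1) := by
        exact mul_le_mul_of_nonneg_right (pow_le_pow_right₀ hQ m.le_succ) (by positivity)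
    _ = (2 * Q) ^ (m + 1) := by rw [← mul_pow, mul_comm]
    _ ≤ (2 ^ K) ^ (m + 1) := by gcongr
    _ = _ := by rw [pow_mul]

variable {L : Type*} [Field L] [NumberField L]

theorem exists_uniform_norm_coeff_auxMon_le {ι : Type*} [Fintype ι] {r : ℝ≥0} (hr : 0 < r)
    {t : ι → L} {Y : ι → ℕ → L}
    (hY : ∀ σ : L →+* ℂ, ∀ i, Summable fun m => ‖σ (Y i m)‖ * (r : ℝ) ^ m) (g : ℕ) :
    ∃ C : ℝ, 1 ≤ C ∧ ∀ (σ : L →+* ℂ) (α : Fin g → ℕ) (b : ℕ) (β : ι →₀ ℕ),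
      ‖σ (MvPowerSeries.coeff β (auxMon t Y α b))‖ ≤ C ^ (∑ l, α l + b + β.degree) := by
  have hne : Nonempty (L →+* ℂ) := inferInstance
  choose C hC h using fun σ : L →+* ℂ =>
    exists_norm_coeff_auxMon_le (t := fun i => σ (t i)) hr (hY σ) g
  obtain ⟨σ₁, hσ₁⟩ := Finite.exists_max C
  refine ⟨C σ₁, hC σ₁, fun σ α b β => ?_⟩
  rw [← MvPowerSeries.coeff_map, map_auxMon]
  have := hC σ
  exact (h σ α b β).trans (pow_le_pow_left₀ (by linarith) (hσ₁ σ) _)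

/-- Coefficients of the auxiliary series produced by Siegel's lemma. -/
theorem exists_auxSeries_coeff_eq_zero {ε δ : ℕ} {r : ℝ≥0} (hr : 0 < r) {t : Fin ε × Fin δ → L}
    {Y : Fin ε × Fin δ → ℕ → L}
    (hY : ∀ σ : L →+* ℂ, ∀ i, Summable fun m => ‖σ (Y i m)‖ * (r : ℝ) ^ m)
    {d : ℕ → ℕ} (h0 : d 0 = 1) (hd : ∀ k l, d k * d l ∣ d (k + l)) (hd0 : ∀ m, 0 < d m)
    {A : ℝ} (hA1 : 1 ≤ A) (hA : ∀ m, (d m : ℝ) ≤ A ^ m)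
    (hdY : ∀ i m, IsIntegral ℤ ((d m : L) * Y i m)) {e : ℕ} (he0 : 0 < e)
    (he : ∀ i, IsIntegral ℤ ((e : L) * t i)) :
    ∃ c H : ℝ, 0 ≤ c ∧ 1 ≤ H ∧ ∀ K m : ℕ, 0 < K →
      ∃ p : Fin (2 * K ^ (ε * δ)) → (Fin (ε * δ) → Fin (m + 1)) → L, p ≠ 0 ∧
        (∀ b α, IsIntegral ℤ (p b α)) ∧
        (∀ β : Fin ε × Fin δ →₀ ℕ, β.degree < K * (m + 1) →
          MvPowerSeries.coeff β (auxSeries t Y p) = 0) ∧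
        ∀ σ : L →+* ℂ, coeffSum (fun b α => σ (p b α)) ≤
          c * (2 * ((K * (m + 1) : ℕ) : ℝ) ^ (ε * δ)) ^ 2 *
            H ^ (ε * δ * (K * (m + 1)) + m + 2 * K ^ (ε * δ)) := by
  classical
  set g := ε * δ with hg
  obtain ⟨c, hc, hS⟩ := exists_siegel_solution L
  obtain ⟨C, hC, hCb⟩ := exists_uniform_norm_coeff_auxMon_le hr (t := t) hY g
  have he1 : (1 : ℝ) ≤ e := by exact_mod_cast he0
  have hgι : Fintype.card (Fin ε × Fin δ) = g := by simp [hg]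
  set H : ℝ := A * (e : ℝ) ^ (g * g) * C ^ (g + 1)
  have hH : 1 ≤ H := one_le_mul_of_one_le_of_one_le (one_le_mul_of_one_le_of_one_le hA1
    (one_le_pow₀ he1)) (one_le_pow₀ hC)
  refine ⟨c, H, by linarith, hH, fun K m hK => ?_⟩
  set M := K * (m + 1) with hM
  have hM0 : 0 < M := by positivity
  let toF : (Fin ε × Fin δ → Fin M) → (Fin ε × Fin δ →₀ ℕ) := fun β =>
    Finsupp.equivFunOnFinite.symm fun i => (β i : ℕ)
  have hdeg : ∀ β, (toF β).degree ≤ g * M := by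
    intro β
    rw [Finsupp.degree_eq_sum, ← hgι, ← Finset.card_univ, ← smul_eq_mul]
    exact Finset.sum_le_card_nsmul _ _ _ fun i _ => (β i).2.le
  obtain ⟨ξ, hξ0, hξi, hξ, hξb⟩ := hS (Fin ε × Fin δ → Fin M)
    (Fin (2 * K ^ g) × (Fin g → Fin (m + 1)))
    (fun β x => (d (toF β).degree : L) * ((e : L) ^ (Fintype.card (Fin ε × Fin δ) * (g * m)) *
      MvPowerSeries.coeff (toF β) (auxMon t Y (fun l => (x.2 l : ℕ)) x.1)))
    (by
      have : Nonempty (Fin M) := ⟨⟨0, hM0⟩⟩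
      exact Fintype.card_pos)
    (by
      rw [Fintype.card_prod, Fintype.card_fun, Fintype.card_fun, hgι, Fintype.card_fin,
        Fintype.card_fin, Fintype.card_fin, Fintype.card_fin, hM, mul_pow, mul_assoc])
    (fun β x => isIntegral_coeff_auxMon he hdY h0 hd (fun l => Nat.lt_succ_iff.1 (x.2 l).2) _ _)
    (H ^ (g * M + m + 2 * K ^ g)) (one_le_pow₀ hH)
    (fun β x σ => by
      rw [map_mul, map_mul, map_pow, map_natCast, map_natCast, norm_mul, norm_mul, norm_pow,
        Complex.norm_natCast, Complex.norm_natCast, hgι]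
      have h1 : ∑ l, (x.2 l : ℕ) ≤ g * m := by
        calc _ ≤ Finset.univ.card • m :=
              Finset.sum_le_card_nsmul _ _ _ fun l _ => Nat.lt_succ_iff.1 (x.2 l).2
          _ = _ := by simp
      have h2 : ∑ l, (x.2 l : ℕ) + x.1 + (toF β).degree ≤ (g + 1) * (g * M + m + 2 * K ^ g) := by
        have h3 := x.1.2
        have h4 := hdeg β
        nlinarith [Nat.zero_le (g * (g * M)), Nat.zero_le (g * (2 * K ^ g))]
      calc _ ≤ A ^ (g * M + m + 2 * K ^ g) * ((e : ℝ) ^ (g * g * (g * M + m + 2 * K ^ g)) *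
            C ^ ((g + 1) * (g * M + m + 2 * K ^ g))) := by
            gcongr ?_ * (?_ * ?_)
            · refine (hA _).trans (pow_le_pow_right₀ hA1 ?_)
              have := hdeg β
              omega
            · refine pow_le_pow_right₀ he1 ?_
              rw [← mul_assoc]
              exact Nat.mul_le_mul_left _ (by omega)
            · exact (hCb σ _ _ _).trans (pow_le_pow_right₀ hC h2)
        _ = _ := by
            simp only [H]
            rw [mul_pow, mul_pow, ← pow_mul, ← pow_mul, mul_assoc (A ^ _)])
  have hcard : (Fintype.card (Fin (2 * K ^ g) × (Fin g → Fin (m + 1))) : ℝ) = 2 * (M : ℝ) ^ g := by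
    rw [Fintype.card_prod, Fintype.card_fun, Fintype.card_fin, Fintype.card_fin, Fintype.card_fin,
      hM]
    push_cast
    rw [mul_pow, mul_assoc]
  refine ⟨fun b α => ξ (b, α), fun h => hξ0 ?_, fun b α => hξi _, fun β hβ => ?_, fun σ => ?_⟩
  · funext x
    exact congrFun (congrFun h x.1) x.2
  · have h1 : ∀ i, β i < M := fun i => (Finsupp.le_degree i β).trans_lt hβ
    have h2 : toF (fun i => ⟨β i, h1 i⟩) = β := by
      ext i
      rfl
    have h3 := hξ fun i => ⟨β i, h1 i⟩
    simp only [h2] at h3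
    have h4 : (d β.degree : L) * (e : L) ^ (Fintype.card (Fin ε × Fin δ) * (g * m)) ≠ 0 :=
      mul_ne_zero (Nat.cast_ne_zero.2 (hd0 _).ne') (pow_ne_zero _ (Nat.cast_ne_zero.2 he0.ne'))
    refine (mul_eq_zero.1 ?_).resolve_left h4
    rw [← h3, coeff_auxSeries, ← Finset.univ_product_univ, Finset.sum_product, Finset.mul_sum]
    refine Finset.sum_congr rfl fun b _ => ?_
    rw [Finset.mul_sum]
    exact Finset.sum_congr rfl fun α _ => by ring
  · have h1 : coeffSum (fun b α => σ (ξ (b, α))) =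
        ∑ x : Fin (2 * K ^ g) × (Fin g → Fin (m + 1)), ‖σ (ξ x)‖ := by
      rw [← Finset.univ_product_univ, Finset.sum_product]
      rfl
    rw [h1]
    refine (Finset.sum_le_sum fun x _ => hξb x σ).trans (le_of_eq ?_)
    rw [Finset.sum_const, Finset.card_univ, nsmul_eq_mul, hcard]
    ring

/-- The arithmetic part of the algebraicity criterion: integrality, house bounds and growth force
the auxiliary series produced by Siegel's lemma to vanish identically. -/
theorem exists_auxSeries_eq_zero {ε δ : ℕ} {r : ℝ≥0} (hr : 0 < r) {t : Fin ε × Fin δ → L}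
    {Y : Fin ε × Fin δ → ℕ → L} (D : (L →+* ℂ) → BranchData ε δ)
    (hτ : ∀ σ i, (D σ).τ i.1 = σ (t i))
    (hY : ∀ σ : L →+* ℂ, ∀ i, Summable fun m => ‖σ (Y i m)‖ * (r : ℝ) ^ m)
    (hDY : ∀ σ i (z : ℂ), ‖z‖ ≤ r →
      (D σ).y i.1 i.2 (σ (t i) + z) = ∑' m, σ (Y i m) * z ^ m)
    {d : ℕ → ℕ} (hd0 : ∀ m, 0 < d m) (h0 : d 0 = 1) (hd : ∀ k l, d k * d l ∣ d (k + l))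
    {A : ℝ} (hA1 : 1 ≤ A) (hA : ∀ m, (d m : ℝ) ≤ A ^ m)
    (hdY : ∀ i m, IsIntegral ℤ ((d m : L) * Y i m)) :
    ∃ (k m : ℕ) (p : Fin k → (Fin (ε * δ) → Fin (m + 1)) → L), p ≠ 0 ∧ auxSeries t Y p = 0 := by
  set g := ε * δ with hg
  obtain ⟨e, he0, he⟩ := exists_nat_mul_isIntegral t
  have he1 : (1 : ℝ) ≤ e := by exact_mod_cast he0
  obtain ⟨c, H, hc, hH, hS⟩ :=
    exists_auxSeries_coeff_eq_zero hr hY h0 hd hd0 hA1 hA hdY he0 he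
  obtain ⟨ρ, hρ, hG⟩ := exists_uniform_growth hr D hτ hY hDY
  obtain ⟨n, hn⟩ := exists_nat_gt (2 * A * H ^ g / ρ)
  rw [div_lt_iff₀ hρ] at hn
  have hn1 : 0 < 2 * A * H ^ g := by positivity
  have hn0 : 0 < n := by
    rcases Nat.eq_zero_or_pos n with rfl | h
    · rw [Nat.cast_zero, zero_mul] at hn
      linarith
    · exact h
  obtain ⟨B, hB, hG⟩ := hG n hn0
  have hQ : 1 ≤ (e : ℝ) ^ (g * g) * B * H := one_le_mul_of_one_le_of_one_le
    (one_le_mul_of_one_le_of_one_le (one_le_pow₀ he1) hB) hH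
  obtain ⟨K, m, hK, hKm⟩ := exists_siegel_parameters g hQ hc
  obtain ⟨p, hp0, hpi, hpM, hpσ⟩ := hS K m hK
  refine ⟨_, m, p, hp0, ?_⟩
  by_contra hne
  set M := K * (m + 1)
  have hex : ∃ N, ∃ β : Fin ε × Fin δ →₀ ℕ, β.degree = N ∧
      MvPowerSeries.coeff β (auxSeries t Y p) ≠ 0 := by
    by_contra! h
    exact hne (MvPowerSeries.ext fun β => by simpa using h _ β rfl)
  classical
  obtain ⟨β, hβ, hβ0⟩ := Nat.find_spec hex
  set N := Nat.find hex
  have hMN : M ≤ N := by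
    by_contra! h
    exact hβ0 (hpM β (hβ.trans_lt h))
  have hlow : ∀ γ : Fin ε × Fin δ →₀ ℕ, γ.degree < N →
      MvPowerSeries.coeff γ (auxSeries t Y p) = 0 := fun γ hγ => by
    by_contra h
    exact Nat.find_min hex hγ ⟨γ, rfl, h⟩
  set ξ := MvPowerSeries.coeff β (auxSeries t Y p) with hξ
  set u : L := (d N : L) * (e : L) ^ (g * (g * m)) with hu
  have hu0 : u ≠ 0 :=
    mul_ne_zero (Nat.cast_ne_zero.2 (hd0 _).ne') (pow_ne_zero _ (Nat.cast_ne_zero.2 he0.ne'))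
  have hI : IsIntegral ℤ (u * ξ) := by
    rw [hξ, coeff_auxSeries, Finset.mul_sum]
    refine IsIntegral.sum _ fun b _ => ?_
    rw [Finset.mul_sum]
    refine IsIntegral.sum _ fun α _ => ?_
    have h1 := isIntegral_coeff_auxMon he hdY h0 hd (α := fun l => (α l : ℕ)) (m := m)
      (fun l => Nat.lt_succ_iff.1 (α l).2) b β
    rw [hβ, show Fintype.card (Fin ε × Fin δ) = g by simp [hg]] at h1
    convert (hpi b α).mul h1 using 1
    rw [hu]
    ring
  obtain ⟨σ, hσ⟩ := NumberField.exists_conjugate_one_le_norm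
    (α := (⟨u * ξ, hI⟩ : NumberField.RingOfIntegers L))
    (fun h => mul_ne_zero hu0 hβ0 (congrArg Subtype.val h))
  have hσ' : 1 ≤ (d N : ℝ) * (e : ℝ) ^ (g * (g * m)) * ‖σ ξ‖ := by
    refine hσ.trans (le_of_eq ?_)
    change ‖σ (u * ξ)‖ = _
    rw [map_mul, hu, map_mul, map_pow, map_natCast, map_natCast, norm_mul, norm_mul, norm_pow,
      Complex.norm_natCast, Complex.norm_natCast]
  have hgrow := hG _ m N p hlow β hβ σ
  set k := 2 * K ^ g with hk
  set q := 2 * (M : ℝ) ^ g with hq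
  have hlt : B ^ (m + k) * (c * q ^ 2 * H ^ (g * M + m + k)) * (e : ℝ) ^ (g * (g * m)) <
      (2 * H ^ g) ^ M := by
    calc _ ≤ H ^ (g * M) * (((e : ℝ) ^ (g * g) * B * H) ^ (m + k) * (c * q ^ 2)) := by
          have h1 : (e : ℝ) ^ (g * (g * m)) ≤ ((e : ℝ) ^ (g * g)) ^ (m + k) := by
            rw [← pow_mul, ← mul_assoc]
            exact pow_le_pow_right₀ he1 (Nat.mul_le_mul_left _ (by omega))
          calc _ ≤ B ^ (m + k) * (c * q ^ 2 * H ^ (g * M + m + k)) *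
                ((e : ℝ) ^ (g * g)) ^ (m + k) := by gcongr
            _ = _ := by
              rw [mul_pow, mul_pow, add_assoc, pow_add H]
              ring
      _ < H ^ (g * M) * 2 ^ M := by gcongr
      _ = _ := by rw [mul_pow, ← pow_mul, mul_comm]
  have hle : (2 * H ^ g) ^ M * A ^ N ≤ (n * ρ) ^ N := by
    have h1 : 1 ≤ 2 * H ^ g := one_le_mul_of_one_le_of_one_le one_le_two (one_le_pow₀ hH)
    calc _ ≤ (2 * H ^ g) ^ N * A ^ N := by gcongr
      _ = (2 * A * H ^ g) ^ N := by rw [← mul_pow]; ring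
      _ ≤ _ := by gcongr
  have hAN : 0 < A ^ N := by positivity
  have h1 : (n * ρ) ^ N ≤ A ^ N * (e : ℝ) ^ (g * (g * m)) *
      (B ^ (m + k) * (c * q ^ 2 * H ^ (g * M + m + k))) := by
    calc (n * ρ) ^ N ≤ (d N : ℝ) * (e : ℝ) ^ (g * (g * m)) * ‖σ ξ‖ * (n * ρ) ^ N :=
          le_mul_of_one_le_left (by positivity) hσ'
      _ = (d N : ℝ) * (e : ℝ) ^ (g * (g * m)) * (‖σ ξ‖ * (n * ρ) ^ N) := by ring
      _ ≤ (d N : ℝ) * (e : ℝ) ^ (g * (g * m)) * (B ^ (m + k) * (c * q ^ 2 *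
            H ^ (g * M + m + k))) := by
          exact mul_le_mul_of_nonneg_left (hgrow.trans (mul_le_mul_of_nonneg_left (hpσ σ)
            (by positivity))) (by positivity)
      _ ≤ _ := by
          gcongr
          exact hA N
  have h2 := hle.trans h1
  have h3 : A ^ N * (B ^ (m + k) * (c * q ^ 2 * H ^ (g * M + m + k)) * (e : ℝ) ^ (g * (g * m))) <
      A ^ N * (2 * H ^ g) ^ M := mul_lt_mul_of_pos_left hlt hAN
  linarith

end Main

section Branches

open scoped Polynomial Topology
open Filter Metric

/-- The derivative along a curve of a polynomial in two variables. -/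
theorem hasDerivAt_evalPoint (S : ℤ[X][X]) {w : ℂ → ℂ} {w' t : ℂ} (hw : HasDerivAt w w' t) :
    HasDerivAt (fun s => evalPoint s (w s) S)
      (evalPoint t (w t) S.baseDeriv + evalPoint t (w t) (Polynomial.derivative S) * w') t := by
  have hX : ∀ q : ℤ[X], HasDerivAt (fun s : ℂ => q.eval₂ (Int.castRingHom ℂ) s)
      ((Polynomial.derivative q).eval₂ (Int.castRingHom ℂ) t) t := by
    intro q
    have := (q.map (Int.castRingHom ℂ)).hasDerivAt t
    rw [Polynomial.derivative_map, Polynomial.eval_map] at this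
    simpa only [Polynomial.eval_map] using this
  induction S using Polynomial.induction_on' with
  | add S T hS hT =>
    simp only [map_add, Polynomial.baseDeriv_add]
    exact (hS.fun_add hT).congr_deriv (by ring)
  | monomial n c =>
    rw [Polynomial.baseDeriv_monomial, Polynomial.derivative_monomial]
    simp only [evalPoint_apply, Polynomial.eval₂_monomial, Polynomial.coe_eval₂RingHom,
      Polynomial.eval₂_mul, Polynomial.eval₂_natCast]
    exact ((hX c).fun_mul (hw.fun_pow n)).congr_deriv (by ring)

/-- The rational function on the curve giving the `m`-th iterate of the connection. -/
noncomputable def connFun (a : ℤ[X]) (P : ℤ[X][X]) (w : ℂ → ℂ) (m : ℕ) (t : ℂ) : ℂ :=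
  evalPoint t (w t) (connNum a P m) /
    evalPoint t (w t) (Polynomial.C a * Polynomial.derivative P ^ 2) ^ m

theorem hasDerivAt_connFun_mul {a : ℤ[X]} {P : ℤ[X][X]} {w y : ℂ → ℂ} {t : ℂ}
    (hw : DifferentiableAt ℂ w t) (hP : ∀ᶠ s in 𝓝 t, evalPoint s (w s) P = 0)
    (ha : a.eval₂ (Int.castRingHom ℂ) t ≠ 0)
    (hP' : evalPoint t (w t) (Polynomial.derivative P) ≠ 0)
    (hy : HasDerivAt y (w t / a.eval₂ (Int.castRingHom ℂ) t * y t) t) (m : ℕ) :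
    HasDerivAt (fun s => connFun a P w m s * y s) (connFun a P w (m + 1) t * y t) t := by
  obtain ⟨w', hw'⟩ : ∃ w', HasDerivAt w w' t := ⟨_, hw.hasDerivAt⟩
  have h0 := (hasDerivAt_evalPoint P hw').unique
    ((hasDerivAt_const t (0 : ℂ)).congr_of_eventuallyEq hP)
  have htan : ∀ S : ℤ[X][X], evalPoint t (w t) (Polynomial.tangentDeriv P S) =
      evalPoint t (w t) (Polynomial.derivative P) * (evalPoint t (w t) S.baseDeriv +
        evalPoint t (w t) (Polynomial.derivative S) * w') := by
    intro S
    rw [Polynomial.tangentDeriv, map_sub, map_mul, map_mul]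
    linear_combination (-evalPoint t (w t) (Polynomial.derivative S)) * h0
  set S := connNum a P m with hS
  have hC : ∀ q : ℤ[X], evalPoint t (w t) (Polynomial.C q) = q.eval₂ (Int.castRingHom ℂ) t := by
    intro q
    rw [evalPoint_apply, Polynomial.eval₂_C]
    rfl
  set U : ℤ[X][X] := Polynomial.C a * Polynomial.derivative P ^ 2 with hU
  have hU0 : evalPoint t (w t) U ≠ 0 := by
    rw [hU, map_mul, map_pow, hC]
    exact mul_ne_zero ha (pow_ne_zero _ hP')
  have hUd : evalPoint t (w t) U.baseDeriv + evalPoint t (w t) (Polynomial.derivative U) * w' =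
      evalPoint t (w t) (Polynomial.C (Polynomial.derivative a) * Polynomial.derivative P ^ 2 +
        2 * Polynomial.C a * Polynomial.tangentDeriv P (Polynomial.derivative P)) := by
    refine (hasDerivAt_evalPoint U hw').unique ?_
    have h1 : HasDerivAt (fun s => evalPoint s (w s) (Polynomial.C a))
        (evalPoint t (w t) (Polynomial.C (Polynomial.derivative a))) t := by
      refine (hasDerivAt_evalPoint (Polynomial.C a) hw').congr_deriv ?_
      rw [← Polynomial.monomial_zero_left, Polynomial.baseDeriv_monomial]
      simp
    have h2 := h1.fun_mul ((hasDerivAt_evalPoint (Polynomial.derivative P) hw').fun_pow 2)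
    simp only [hU, map_mul, map_pow, map_add]
    refine h2.congr_deriv ?_
    rw [htan, map_ofNat]
    ring
  have h3 := ((hasDerivAt_evalPoint S hw').fun_div ((hasDerivAt_evalPoint U hw').fun_pow m)
    (pow_ne_zero m hU0)).fun_mul hy
  refine h3.congr_deriv ?_
  rw [hUd, connFun, connNum, ← hS, ← hU]
  simp only [map_add, map_sub, map_mul, map_pow, htan S, map_natCast, map_ofNat, hC]
  have hX : evalPoint t (w t) (Polynomial.X : ℤ[X][X]) = w t := by
    rw [evalPoint_apply, Polynomial.eval₂_X]
  have hUe : evalPoint t (w t) U =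
      a.eval₂ (Int.castRingHom ℂ) t * evalPoint t (w t) (Polynomial.derivative P) ^ 2 := by
    rw [hU, map_mul, map_pow, hC]
  rw [hX, hUe]
  set p := evalPoint t (w t) (Polynomial.derivative P)
  set α := a.eval₂ (Int.castRingHom ℂ) t
  cases m with
  | zero =>
    simp only [Nat.cast_zero, pow_zero, zero_mul, mul_zero, sub_zero]
    field_simp
    ring
  | succ m =>
    simp only [Nat.add_sub_cancel]
    field_simp
    ring

/-- The Taylor coefficients of a solution along a branch. -/
theorem hasSum_connNum {a : ℤ[X]} {P : ℤ[X][X]} {w y : ℂ → ℂ} {τ : ℂ} {R : ℝ}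
    (hw : ∀ t ∈ ball τ R, DifferentiableAt ℂ w t)
    (hP : ∀ t ∈ ball τ R, evalPoint t (w t) P = 0)
    (ha : ∀ t ∈ ball τ R, a.eval₂ (Int.castRingHom ℂ) t ≠ 0)
    (hP' : ∀ t ∈ ball τ R, evalPoint t (w t) (Polynomial.derivative P) ≠ 0)
    (hy : ∀ t ∈ ball τ R, HasDerivAt y (w t / a.eval₂ (Int.castRingHom ℂ) t * y t) t)
    (hy1 : y τ = 1) {z : ℂ} (hz : ‖z‖ < R) :
    HasSum (fun m => evalPoint τ (w τ) (connNum a P m) / ((Nat.factorial m : ℂ) *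
      evalPoint τ (w τ) (Polynomial.C a * Polynomial.derivative P ^ 2) ^ m) * z ^ m)
      (y (τ + z)) := by
  have hR : 0 < R := (norm_nonneg _).trans_lt hz
  have h1 : ∀ m, ∀ t ∈ ball τ R, iteratedDeriv m y t = connFun a P w m t * y t := by
    intro m
    induction m with
    | zero =>
      intro t _
      simp [connFun, connNum]
    | succ m ih =>
      intro t ht
      have hball : ∀ᶠ s in 𝓝 t, s ∈ ball τ R := isOpen_ball.mem_nhds ht
      rw [iteratedDeriv_succ, Filter.EventuallyEq.deriv_eq (hball.mono fun s hs => ih s hs)]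
      exact (hasDerivAt_connFun_mul (hw t ht) (hball.mono fun s hs => hP s hs) (ha t ht)
        (hP' t ht) (hy t ht) m).deriv
  have h2 := Complex.hasSum_taylorSeries_on_ball (f := y) (c := τ) (r := R.toNNReal)
    (z := τ + z) (fun t ht => (hy t (by
      rwa [Real.coe_toNNReal _ hR.le] at ht)).differentiableAt.differentiableWithinAt)
    (by simpa [Real.coe_toNNReal _ hR.le] using hz)
  refine (funext fun m => ?_ : (fun m => _) = _) ▸ h2
  rw [h1 m τ (mem_ball_self hR), hy1, connFun, add_sub_cancel_left, smul_eq_mul, smul_eq_mul]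
  field_simp

/-- The solution of a first order linear differential equation near a point. -/
theorem exists_local_solution {F : ℂ → ℂ} {τ : ℂ} (hF : ∀ᶠ t in 𝓝 τ, DifferentiableAt ℂ F t) :
    ∃ y : ℂ → ℂ, y τ = 1 ∧ ∀ᶠ t in 𝓝 τ, y t ≠ 0 ∧ HasDerivAt y (F t * y t) t := by
  obtain ⟨R, hR, h⟩ := Metric.eventually_nhds_iff_ball.1 hF
  have h1 : DifferentiableOn ℂ F (ball τ R) := fun t ht => (h t ht).differentiableWithinAt
  obtain ⟨G, hG0, hG⟩ := h1.isExactOn_ball.with_val_at τ 0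
  refine ⟨fun t => Complex.exp (G t), by simp [hG0], ?_⟩
  filter_upwards [ball_mem_nhds τ hR] with t ht
  refine ⟨Complex.exp_ne_zero _, ?_⟩
  rw [mul_comm]
  exact (hG t ht).cexp

theorem exists_branch {a : ℤ[X]} {P : ℤ[X][X]} {τ θ : ℂ} (hP : evalPoint τ θ P = 0)
    (hP' : evalPoint τ θ (Polynomial.derivative P) ≠ 0)
    (ha : a.eval₂ (Int.castRingHom ℂ) τ ≠ 0) :
    ∃ w y : ℂ → ℂ, w τ = θ ∧ y τ = 1 ∧ ∀ᶠ t in 𝓝 τ, DifferentiableAt ℂ w t ∧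
      evalPoint t (w t) P = 0 ∧ a.eval₂ (Int.castRingHom ℂ) t ≠ 0 ∧
      evalPoint t (w t) (Polynomial.derivative P) ≠ 0 ∧ y t ≠ 0 ∧
      HasDerivAt y (w t / a.eval₂ (Int.castRingHom ℂ) t * y t) t := by
  have hG : ContDiff ℂ 1 fun x : ℂ × ℂ => evalPoint x.1 x.2 P := by
    have h1 : ∀ x : ℂ × ℂ, evalPoint x.1 x.2 P = ∑ i ∈ Finset.range (P.natDegree + 1),
        (∑ j ∈ Finset.range ((P.coeff i).natDegree + 1), ((P.coeff i).coeff j : ℂ) * x.1 ^ j) *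
          x.2 ^ i := by
      intro x
      rw [evalPoint_apply, Polynomial.eval₂_eq_sum_range]
      refine Finset.sum_congr rfl fun i _ => ?_
      rw [Polynomial.coe_eval₂RingHom, Polynomial.eval₂_eq_sum_range]
      rfl
    simp only [h1]
    fun_prop
  obtain ⟨w, hw0, hw⟩ := exists_implicit_function (G := fun x => evalPoint x.1 x.2 P)
    (c := evalPoint τ θ (Polynomial.derivative P)) hG.contDiffAt hP (by
      have h1 : ∀ (S : ℤ[X][X]) (s : ℂ), evalPoint τ s S =
          (S.map (Polynomial.eval₂RingHom (Int.castRingHom ℂ) τ)).eval s := fun S s => by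
        rw [Polynomial.eval_map, evalPoint_apply]
      simp only [h1]
      rw [← Polynomial.derivative_map]
      exact Polynomial.hasDerivAt _ _) hP'
  have hd := hw.mono fun t ht => ht.1
  have had : ∀ t, DifferentiableAt ℂ (fun t : ℂ => a.eval₂ (Int.castRingHom ℂ) t) t := by
    intro t
    simp only [← Polynomial.eval_map]
    exact Polynomial.differentiable _ _
  have ha' : ∀ᶠ t in 𝓝 τ, a.eval₂ (Int.castRingHom ℂ) t ≠ 0 :=
    (had τ).continuousAt.eventually_ne ha
  have hP'' : ∀ᶠ t in 𝓝 τ, evalPoint t (w t) (Polynomial.derivative P) ≠ 0 := by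
    have h1 := (hasDerivAt_evalPoint (Polynomial.derivative P)
      hd.self_of_nhds.hasDerivAt).continuousAt
    exact h1.eventually_ne (by rwa [hw0])
  obtain ⟨y, hy1, hy⟩ := exists_local_solution
    (F := fun t => w t / a.eval₂ (Int.castRingHom ℂ) t) (τ := τ) (by
      filter_upwards [hd, ha'] with t h1 h2
      exact h1.fun_div (had t) h2)
  refine ⟨w, y, hw0, hy1, ?_⟩
  filter_upwards [hw, ha', hP'', hy] with t h1 h2 h3 h4
  exact ⟨h1.1, h1.2, h2, h3, h4.1, h4.2⟩

end Branches

section BranchConstruction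

open scoped Polynomial Topology NNReal
open Filter Metric

theorem eventually_forall_mem_ball {x : ℂ} {p : ℂ → Prop} (h : ∀ᶠ t in 𝓝 x, p t) :
    ∀ᶠ R : ℝ in 𝓝[>] 0, ∀ t ∈ ball x R, p t := by
  obtain ⟨R, hR, h⟩ := Metric.eventually_nhds_iff_ball.1 h
  filter_upwards [Ioo_mem_nhdsGT hR] with s hs t ht
  exact h t (ball_subset_ball hs.2.le ht)

theorem eventually_disjoint_ball {x y : ℂ} (h : x ≠ y) :
    ∀ᶠ R : ℝ in 𝓝[>] 0, Disjoint (ball x R) (ball y R) := by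
  filter_upwards [Ioo_mem_nhdsGT (half_pos (dist_pos.2 h))] with s hs
  exact ball_disjoint_ball (by linarith [hs.2])

theorem eval₂_evalRingHom_map (S : ℤ[X][X]) (t θ : ℂ) :
    (S.map (Polynomial.mapRingHom (Int.castRingHom ℂ))).eval₂ (Polynomial.evalRingHom t) θ =
      evalPoint t θ S := by
  rw [Polynomial.eval₂_map, evalPoint_apply]
  congr 1
  ext <;> simp

theorem exists_branchData {a : ℤ[X]} {P : ℤ[X][X]} {ε δ : ℕ} (hm : P.Monic)
    (hδ : P.natDegree = δ) (hδ0 : 0 < δ)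
    (hε : ∀ i r c, i ≤ δ → (a.map (Int.castRingHom ℂ)).natDegree +
      (mulMat δ (P.map (Polynomial.mapRingHom (Int.castRingHom ℂ))) i r c).natDegree + 2 ≤ ε)
    {τ : Fin ε → ℂ} (hτ : Function.Injective τ) {θ : Fin ε × Fin δ → ℂ}
    (hP : ∀ i : Fin ε × Fin δ, evalPoint (τ i.1) (θ i) P = 0)
    (hP' : ∀ i, evalPoint (τ i.1) (θ i) (Polynomial.derivative P) ≠ 0)
    (hθ : ∀ j, Function.Injective fun κ => θ (j, κ))
    (ha : ∀ j, a.eval₂ (Int.castRingHom ℂ) (τ j) ≠ 0) :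
    ∃ D : BranchData ε δ, D.a = a.map (Int.castRingHom ℂ) ∧
      D.P = P.map (Polynomial.mapRingHom (Int.castRingHom ℂ)) ∧ D.τ = τ ∧
      (∀ i : Fin ε × Fin δ, D.w i.1 i.2 (τ i.1) = θ i) ∧ (∀ i : Fin ε × Fin δ, D.y i.1 i.2 (τ
      i.1) = 1) ∧
      ∀ i : Fin ε × Fin δ, ∀ t ∈ ball (τ i.1) D.R,
        evalPoint t (D.w i.1 i.2 t) (Polynomial.derivative P) ≠ 0 := by
  choose w y hw hy h using fun i => exists_branch (hP i) (hP' i) (ha i.1)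
  have h1 : ∀ᶠ R : ℝ in 𝓝[>] 0, ∀ i : Fin ε × Fin δ, ∀ t ∈ ball (τ i.1) R, _ :=
    eventually_all.2 fun i => eventually_forall_mem_ball (h i)
  have h2 : ∀ᶠ R : ℝ in 𝓝[>] 0, ∀ i j, i ≠ j → Disjoint (ball (τ i) R) (ball (τ j) R) := by
    refine eventually_all.2 fun i => eventually_all.2 fun j => ?_
    by_cases hij : i = j
    · exact Eventually.of_forall fun R h => (h hij).elim
    · filter_upwards [eventually_disjoint_ball (hτ.ne hij)] with R hR _ using hR
  have h3 : ∀ᶠ R : ℝ in 𝓝[>] 0, ∀ j κ κ', ∀ t ∈ ball (τ j) R,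
      w (j, κ) t = w (j, κ') t → κ = κ' := by
    refine eventually_all.2 fun j => eventually_all.2 fun κ => eventually_all.2 fun κ' => ?_
    by_cases hκ : κ = κ'
    · exact Eventually.of_forall fun R t _ _ => hκ
    · have hne : ∀ᶠ t in 𝓝 (τ j), w (j, κ) t - w (j, κ') t ≠ 0 :=
        ((h (j, κ)).self_of_nhds.1.continuousAt.sub
          (h (j, κ')).self_of_nhds.1.continuousAt).eventually_ne (by
            simp only [Pi.sub_apply, hw]
            exact sub_ne_zero.2 ((hθ j).ne hκ))
      filter_upwards [eventually_forall_mem_ball hne] with R hR t ht h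
      exact (hR t ht (sub_eq_zero.2 h)).elim
  have h4 : ∀ᶠ R : ℝ in 𝓝[>] 0, ∀ j, ∀ t ∈ ball (τ j) R,
      (Polynomial.derivative (∏ i, (Polynomial.X - Polynomial.C (τ i)))).eval t ≠ 0 := by
    refine eventually_all.2 fun j => eventually_forall_mem_ball ?_
    refine (Polynomial.continuous _).continuousAt.eventually_ne ?_
    have hs : (∏ i, (Polynomial.X - Polynomial.C (τ i))).Separable :=
      Polynomial.separable_prod_X_sub_C_iff.2 hτ
    have := hs.aeval_derivative_ne_zero (x := τ j) (by
      rw [Polynomial.coe_aeval_eq_eval, Polynomial.eval_prod]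
      exact Finset.prod_eq_zero (Finset.mem_univ j) (by simp))
    rwa [Polynomial.coe_aeval_eq_eval] at this
  obtain ⟨R, h1, h2, h3, h4, hR⟩ := (h1.and <| h2.and <| h3.and <| h4.and
    self_mem_nhdsWithin).exists
  refine ⟨{
    a := a.map (Int.castRingHom ℂ)
    P := P.map (Polynomial.mapRingHom (Int.castRingHom ℂ))
    τ := τ
    R := R
    w := fun j κ => w (j, κ)
    y := fun j κ => y (j, κ)
    monic := hm.map _
    natDegree_eq := by rw [hm.natDegree_map, hδ]
    degree_le := hε
    δ_pos := hδ0
    τ_injective := hτ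
    R_pos := hR
    disjoint_ball := h2
    differentiableAt_w := fun j κ t ht => (h1 (j, κ) t ht).1
    root := fun j t ht κ => by
      rw [eval₂_evalRingHom_map]
      exact (h1 (j, κ) t ht).2.1
    w_injective := fun j t ht κ κ' h => h3 j κ κ' t ht h
    a_ne_zero := fun j t ht => by
      rw [Polynomial.eval_map]
      exact (h1 (j, ⟨0, hδ0⟩) t ht).2.2.1
    y_ne_zero := fun j κ t ht => (h1 (j, κ) t ht).2.2.2.2.1
    hasDerivAt_y := fun j κ t ht => by
      rw [Polynomial.eval_map]
      exact (h1 (j, κ) t ht).2.2.2.2.2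
    nodal_ne_zero := h4 }, rfl, rfl, rfl, fun i => hw i, fun i => hy i,
    fun i t ht => (h1 i t ht).2.2.2.1⟩

theorem Polynomial.exists_finite_splits {K : Type} [Field K] (G : K[X]) :
    ∃ (L : Type) (_ : Field L) (_ : Algebra K L),
      FiniteDimensional K L ∧ (G.map (algebraMap K L)).Splits :=
  ⟨G.SplittingField, inferInstance, inferInstance, inferInstance,
    Polynomial.SplittingField.splits G⟩

theorem exists_numberField_roots {ι : Type*} [Fintype ι] {δ : ℕ} {Q : ι → ℚ[X]}
    (hm : ∀ j, (Q j).Monic) (hδ : ∀ j, (Q j).natDegree = δ) (hs : ∀ j, (Q j).Separable) :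
    ∃ (L : Type) (_ : Field L) (_ : NumberField L) (θ : ι → Fin δ → L),
      (∀ j, Function.Injective (θ j)) ∧
        ∀ j κ, (Q j).eval₂ (Rat.castHom L) (θ j κ) = 0 := by
  obtain ⟨L, _, alg, hfd, hL⟩ := (∏ j, Q j).exists_finite_splits
  have hc : CharZero L := algebraRat.charZero L
  obtain rfl : alg = DivisionRing.toRatAlgebra := Subsingleton.elim _ _
  have hsp : ∀ j, ((Q j).map (algebraMap ℚ L)).Splits := fun j =>
    hL.of_dvd (Polynomial.map_ne_zero (Polynomial.monic_prod_of_monic _ _ fun j _ => hm j).ne_zero)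
      (Polynomial.map_dvd _ (Finset.dvd_prod_of_mem _ (Finset.mem_univ j)))
  have hcard : ∀ j, Fintype.card ((Q j).rootSet L) = δ := fun j => by
    rw [Polynomial.card_rootSet_eq_natDegree (hs j) (hsp j), hδ]
  refine ⟨L, inferInstance, ⟨⟩,
    fun j κ => ((Fintype.equivFinOfCardEq (hcard j)).symm κ : L),
    fun j => Subtype.val_injective.comp (Equiv.injective _), fun j κ => ?_⟩
  exact (Polynomial.mem_rootSet.1 ((Fintype.equivFinOfCardEq (hcard j)).symm κ).2).2

theorem map_evalPoint {L M : Type*} [Field L] [Field M] (σ : L →+* M) (t θ : L) (S : ℤ[X][X]) :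
    σ (evalPoint t θ S) = evalPoint (σ t) (σ θ) S := by
  rw [evalPoint_apply, evalPoint_apply, Polynomial.hom_eval₂]
  congr 1
  ext <;> simp

theorem evalPoint_C {L : Type*} [Field L] (t θ : L) (a : ℤ[X]) :
    evalPoint t θ (Polynomial.C a) = a.eval₂ (Int.castRingHom L) t := by
  rw [evalPoint_apply, Polynomial.eval₂_C, Polynomial.coe_eval₂RingHom]

/-- Base points close to the origin at which a polynomial does not vanish. -/
theorem exists_basePoints {d : ℤ[X]} (hd : d ≠ 0) (ε : ℕ) {ρ : ℝ} (hρ : 0 < ρ) :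
    ∃ τ : Fin ε → ℚ, Function.Injective τ ∧ (∀ j, 0 < τ j ∧ (τ j : ℝ) < ρ) ∧
      ∀ j, d.eval₂ (Int.castRingHom ℚ) (τ j) ≠ 0 := by
  have hdQ : d.map (Int.castRingHom ℚ) ≠ 0 :=
    (Polynomial.map_ne_zero_iff Int.cast_injective).2 hd
  have hfin : ((d.map (Int.castRingHom ℚ)).rootSet ℚ).Finite := Polynomial.rootSet_finite _ _
  obtain ⟨c, hc0, hc⟩ := exists_rat_btwn hρ
  have hinf : (Set.Ioo (0 : ℚ) c \ (d.map (Int.castRingHom ℚ)).rootSet ℚ).Infinite :=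
    (Set.Ioo_infinite (by exact_mod_cast hc0)).sdiff hfin
  have := hinf.to_subtype
  let e := Infinite.natEmbedding ↥(Set.Ioo (0 : ℚ) c \ (d.map (Int.castRingHom ℚ)).rootSet ℚ)
  refine ⟨fun j => (e j : ℚ), fun i j h => Fin.ext (e.injective (Subtype.ext h)), fun j => ?_,
    fun j h => (e j).2.2 ?_⟩
  · exact ⟨(e j).2.1.1, lt_trans (by exact_mod_cast (e j).2.1.2) hc⟩
  · exact Polynomial.mem_rootSet.2 ⟨hdQ, by
      rwa [Polynomial.coe_aeval_eq_eval, Polynomial.eval_map]⟩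

end BranchConstruction

section BranchRelation

open scoped Polynomial Topology NNReal
open Filter Metric

/-- If the iterates of the connection `y' = (w / a) y` on the curve `P(t, w) = 0` are divisible by
the expected power of almost all primes, then the product of the solutions along the branches is
algebraic in the base points. -/
theorem exists_auxForm_eq_zero {a : ℤ[X]} {P U V : ℤ[X][X]} {d : ℤ[X]} {δ : ℕ} (hm : P.Monic)
    (hδ : P.natDegree = δ) (hδ0 : 0 < δ) (ha : a ≠ 0) (hd : d ≠ 0)
    (hbez : U * P + V * Polynomial.derivative P = Polynomial.C d)
    (hdiv : ∃ B : ℕ, ∀ p : ℕ, p.Prime → B ≤ p → ∀ m,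
      Polynomial.C (Polynomial.C ((p : ℤ) ^ (m / p))) ∣ connNum a P m %ₘ P)
    {ρ : ℝ} (hρ : 0 < ρ) :
    ∃ (ε : ℕ) (D : BranchData ε δ) (r : ℝ≥0) (k m : ℕ)
      (p : Fin k → (Fin (ε * δ) → Fin (m + 1)) → ℂ),
      0 < r ∧ (r : ℝ) < D.R ∧ D.a = a.map (Int.castRingHom ℂ) ∧
      D.P = P.map (Polynomial.mapRingHom (Int.castRingHom ℂ)) ∧ (∀ j, ‖D.τ j‖ < ρ) ∧ p ≠ 0 ∧
      ∀ z : Fin ε × Fin δ → ℂ, (∀ i, ‖z i‖ ≤ r) →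
        auxForm p (fun i => D.τ i.1 + z i) (∏ i, D.y i.1 i.2 (D.τ i.1 + z i)) = 0 := by
  obtain ⟨ε, hε⟩ : ∃ ε : ℕ, ∀ i r c, i ≤ δ → (a.map (Int.castRingHom ℂ)).natDegree +
      (mulMat δ (P.map (Polynomial.mapRingHom (Int.castRingHom ℂ))) i r c).natDegree + 2 ≤ ε := by
    refine ⟨(a.map (Int.castRingHom ℂ)).natDegree + (∑ i ∈ Finset.range (δ + 1), ∑ r, ∑ c,
      (mulMat δ (P.map (Polynomial.mapRingHom (Int.castRingHom ℂ))) i r c).natDegree) + 2,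
      fun i r c hi => ?_⟩
    gcongr
    refine le_trans ?_ (Finset.single_le_sum (fun _ _ => Nat.zero_le _)
      (Finset.mem_range.2 (Nat.lt_succ_of_le hi)))
    refine le_trans ?_ (Finset.single_le_sum (fun _ _ => Nat.zero_le _) (Finset.mem_univ r))
    exact Finset.single_le_sum (f := fun c => (mulMat δ (P.map (Polynomial.mapRingHom
      (Int.castRingHom ℂ))) i r c).natDegree) (fun _ _ => Nat.zero_le _) (Finset.mem_univ c)
  obtain ⟨τ, hτ, hτρ, hτd⟩ := exists_basePoints (mul_ne_zero ha hd) ε hρ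
  have hda : ∀ j, d.eval₂ (Int.castRingHom ℚ) (τ j) ≠ 0 ∧
      a.eval₂ (Int.castRingHom ℚ) (τ j) ≠ 0 := fun j => by
    have := hτd j
    rw [Polynomial.eval₂_mul] at this
    exact ⟨right_ne_zero_of_mul this, left_ne_zero_of_mul this⟩
  let φ : ∀ j, ℤ[X] →+* ℚ := fun j => Polynomial.eval₂RingHom (Int.castRingHom ℚ) (τ j)
  obtain ⟨L, _, _, θ, hθi, hθ⟩ := exists_numberField_roots (Q := fun j => P.map (φ j)) (δ := δ)
    (fun j => hm.map _) (fun j => by rw [hm.natDegree_map, hδ]) (fun j => by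
      have h0 : φ j d ≠ 0 := (hda j).1
      refine ⟨Polynomial.C (φ j d)⁻¹ * U.map (φ j), Polynomial.C (φ j d)⁻¹ * V.map (φ j), ?_⟩
      have := congrArg (Polynomial.map (φ j)) hbez
      rw [Polynomial.map_add, Polynomial.map_mul, Polynomial.map_mul, Polynomial.map_C,
        ← Polynomial.derivative_map] at this
      rw [mul_assoc, mul_assoc, ← mul_add, this, ← Polynomial.C_mul, inv_mul_cancel₀ h0,
        Polynomial.C_1])
  have hφ : ∀ j, (Rat.castHom L).comp (φ j) =
      Polynomial.eval₂RingHom (Int.castRingHom L) (τ j : L) := fun j => by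
    ext <;> simp [φ]
  set t : Fin ε × Fin δ → L := fun i => (τ i.1 : L) with ht
  set Θ : Fin ε × Fin δ → L := fun i => θ i.1 i.2 with hΘ
  have hP : ∀ i, evalPoint (t i) (Θ i) P = 0 := fun i => by
    have := hθ i.1 i.2
    rw [Polynomial.eval₂_map, hφ] at this
    exact this
  have hcast : ∀ (q : ℤ[X]) j, q.eval₂ (Int.castRingHom L) (τ j : L) =
      ((q.eval₂ (Int.castRingHom ℚ) (τ j) : ℚ) : L) := fun q j =>
    (RingHom.congr_fun (hφ j) q).symm
  have hd' : ∀ i, evalPoint (t i) (Θ i) (Polynomial.C d) ≠ 0 := fun i => by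
    rw [evalPoint_C, hcast]
    exact_mod_cast (hda i.1).1
  have ha' : ∀ i, evalPoint (t i) (Θ i) (Polynomial.C a) ≠ 0 := fun i => by
    rw [evalPoint_C, hcast]
    exact_mod_cast (hda i.1).2
  have hP' : ∀ i, evalPoint (t i) (Θ i) (Polynomial.derivative P) ≠ 0 := fun i h => hd' i (by
    rw [← hbez, map_add, map_mul, map_mul, h, hP, mul_zero, mul_zero, add_zero])
  have hD : ∀ σ : L →+* ℂ, ∃ D : BranchData ε δ, D.a = a.map (Int.castRingHom ℂ) ∧
      D.P = P.map (Polynomial.mapRingHom (Int.castRingHom ℂ)) ∧ (D.τ = fun j => (τ j : ℂ)) ∧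
      (∀ i : Fin ε × Fin δ, D.w i.1 i.2 (σ (t i)) = σ (Θ i)) ∧
      (∀ i : Fin ε × Fin δ, D.y i.1 i.2 (σ (t i)) = 1) ∧
      ∀ i : Fin ε × Fin δ, ∀ s ∈ ball (σ (t i)) D.R,
        evalPoint s (D.w i.1 i.2 s) (Polynomial.derivative P) ≠ 0 := fun σ => by
    have hσ : ∀ i, σ (t i) = (τ i.1 : ℂ) := fun i => map_ratCast σ _
    simp only [hσ]
    refine exists_branchData hm hδ hδ0 hε (Rat.cast_injective.comp hτ) (θ := fun i => σ (Θ i))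
      (fun i => ?_) (fun i => ?_) (fun j => σ.injective.comp (hθi j)) fun j => ?_
    · rw [Function.comp_apply, ← hσ, ← map_evalPoint, hP, map_zero]
    · rw [Function.comp_apply, ← hσ, ← map_evalPoint]
      exact (map_ne_zero σ).2 (hP' i)
    · rw [Function.comp_apply, ← hσ (j, ⟨0, hδ0⟩), ← evalPoint_C _ (σ (Θ (j, ⟨0, hδ0⟩))),
        ← map_evalPoint]
      exact (map_ne_zero σ).2 (ha' _)
  choose D hDa hDP hDτ hDw hDy hDP' using hD
  have hσ : ∀ (σ : L →+* ℂ) (i : Fin ε × Fin δ), (D σ).τ i.1 = σ (t i) := fun σ i => by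
    rw [hDτ, ht, map_ratCast]
  obtain ⟨r, hr0, hr⟩ : ∃ r : ℝ≥0, 0 < r ∧ ∀ σ, (r : ℝ) < (D σ).R := by
    have h1 : ∀ᶠ r : ℝ in 𝓝[>] 0, ∀ σ, r < (D σ).R := eventually_all.2 fun σ => by
      filter_upwards [Ioo_mem_nhdsGT (D σ).R_pos] with r hr using hr.2
    obtain ⟨r, hr, hr0⟩ := (h1.and self_mem_nhdsWithin).exists
    exact ⟨⟨r, hr0.le⟩, hr0, hr⟩
  obtain ⟨den, hden, hden0, hdenm, ⟨A, hA1, hA⟩, hI⟩ := exists_denominators t Θ hP hdiv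
  set Y : Fin ε × Fin δ → ℕ → L := fun i m => evalPoint (t i) (Θ i) (connNum a P m) /
    ((Nat.factorial m : L) *
      evalPoint (t i) (Θ i) (Polynomial.C a * Polynomial.derivative P ^ 2) ^ m) with hYdef
  have hsum : ∀ (σ : L →+* ℂ) i (z : ℂ), ‖z‖ ≤ r →
      HasSum (fun m => σ (Y i m) * z ^ m) ((D σ).y i.1 i.2 (σ (t i) + z)) := fun σ i z hz => by
    have h1 := hasSum_connNum (a := a) (P := P) (w := (D σ).w i.1 i.2) (y := (D σ).y i.1 i.2)
      (τ := σ (t i)) (R := (D σ).R) (z := z)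
      (fun s hs => (D σ).differentiableAt_w _ _ s (by rwa [hσ]))
      (fun s hs => by
        rw [← eval₂_evalRingHom_map, ← hDP σ]
        exact (D σ).root _ s (by rwa [hσ]) _)
      (fun s hs => by
        rw [← Polynomial.eval_map, ← hDa σ]
        exact (D σ).a_ne_zero i.1 s (by rwa [hσ]))
      (hDP' σ i)
      (fun s hs => by
        rw [← Polynomial.eval_map, ← hDa σ]
        exact (D σ).hasDerivAt_y _ _ s (by rwa [hσ]))
      (hDy σ i) (hz.trans_lt (hr σ))
    simp only [hDw σ i, ← map_evalPoint, ← map_pow, ← map_natCast σ, ← map_mul, ← map_div₀] at h1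
    simpa only [hYdef, ← map_pow] using h1
  have hYs : ∀ (σ : L →+* ℂ) i, Summable fun m => ‖σ (Y i m)‖ * (r : ℝ) ^ m := fun σ i => by
    have h1 := (hsum σ i ((r : ℝ) : ℂ) (by simp)).summable.norm
    simpa only [norm_mul, norm_pow, Complex.norm_real, Real.norm_eq_abs, NNReal.abs_eq] using h1
  obtain ⟨k, m, p, hp0, hp⟩ := exists_auxSeries_eq_zero hr0 D hσ hYs
    (fun σ i z hz => (hsum σ i z hz).tsum_eq.symm) hden hden0 hdenm hA1 hA hI
  let σ : L →+* ℂ := Classical.arbitrary _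
  refine ⟨ε, D σ, r, k, m, fun b α => σ (p b α), hr0, hr σ, hDa σ, hDP σ, fun j => ?_,
    fun h => hp0 ?_, fun z hz => ?_⟩
  · rw [hDτ]
    have : ‖((τ j : ℚ) : ℂ)‖ = (τ j : ℝ) := by
      rw [Complex.norm_ratCast, abs_of_pos (by exact_mod_cast (hτρ j).1)]
    rw [this]
    exact (hτρ j).2
  · ext b α
    exact (map_eq_zero σ).1 (congrFun (congrFun h b) α)
  · have h1 := tsum_auxSeries (t := fun i => σ (t i)) (hYs σ) (fun b α => σ (p b α)) hz
    simp only [coeff_map_auxSeries, hp, map_zero, zero_mul, tsum_zero] at h1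
    have h2 : ∀ i, (D σ).y i.1 i.2 ((D σ).τ i.1 + z i) = ∑' m, σ (Y i m) * z i ^ m := fun i => by
      rw [hσ]
      exact (hsum σ i (z i) (hz i)).tsum_eq.symm
    simp only [h2]
    simp only [hσ]
    exact h1.symm

end BranchRelation

section Specialization

open scoped Polynomial Topology NNReal
open Filter Metric

/-- A polynomial in the non-leading coefficients of `∏ (X - c i)`. -/
noncomputable def symmForm {A ι : Type*} [CommRing A] [Fintype ι] {g m : ℕ}
    (q : (Fin g → Fin m) → A) (c : ι → A) : A :=
  ∑ α, q α * ∏ l, (∏ i, (Polynomial.X - Polynomial.C (c i))).coeff l ^ (α l : ℕ)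

theorem auxForm_eq_sum_symmForm {A ι : Type*} [CommRing A] [Fintype ι] {k g m : ℕ}
    (p : Fin k → (Fin g → Fin m) → A) (c : ι → A) (Y : A) :
    auxForm p c Y = ∑ b, symmForm (p b) c * Y ^ (b : ℕ) := by
  simp only [auxForm, symmForm, Finset.sum_mul]

theorem map_symmForm {A B ι : Type*} [CommRing A] [CommRing B] [Fintype ι] {g m : ℕ}
    (φ : A →+* B) (q : (Fin g → Fin m) → A) (c : ι → A) :
    φ (symmForm q c) = symmForm (fun α => φ (q α)) fun i => φ (c i) := by
  simp only [symmForm, map_sum, map_mul, map_prod, map_pow, ← Polynomial.coeff_map,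
    Polynomial.map_prod, Polynomial.map_sub, Polynomial.map_X, Polynomial.map_C]

theorem Multiset.exists_map_univ_eq {α ι : Type*} [Fintype ι] {s : Multiset α}
    (hs : s.card = Fintype.card ι) : ∃ c : ι → α, Finset.univ.val.map c = s := by
  classical
  let e : ι ≃ s.ToType := Fintype.equivOfCardEq (by rw [Multiset.card_coe, hs])
  refine ⟨fun i => (e i : α), ?_⟩
  have h1 : (Finset.univ : Finset ι).val.map e = (Finset.univ : Finset s.ToType).val := by
    rw [← Finset.map_univ_equiv e]
    rfl
  have h2 := Multiset.map_univ_coe s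
  rw [← h1, Multiset.map_map] at h2
  exact h2

theorem exists_coeff_prod_X_sub_C_eq {ι : Type*} [Fintype ι] {g : ℕ} (hg : g = Fintype.card ι)
    (u : Fin g → ℂ) :
    ∃ c : ι → ℂ, ∀ l : Fin g, (∏ i, (Polynomial.X - Polynomial.C (c i))).coeff l = u l := by
  set G : ℂ[X] := Polynomial.X ^ g + ∑ l, Polynomial.C (u l) * Polynomial.X ^ (l : ℕ) with hG
  have hlt : (∑ l, Polynomial.C (u l) * Polynomial.X ^ (l : ℕ) : ℂ[X]).degree < (g : ℕ) :=
    (Polynomial.degree_sum_le _ _).trans_lt ((Finset.sup_lt_iff (WithBot.bot_lt_coe g)).2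
      fun l _ => (Polynomial.degree_C_mul_X_pow_le _ _).trans_lt (Nat.cast_lt.2 l.2))
  have hm : G.Monic := Polynomial.monic_X_pow_add hlt
  have hdeg : G.natDegree = g := Polynomial.natDegree_eq_of_degree_eq_some (by
    rw [hG, Polynomial.degree_add_eq_left_of_degree_lt (by rwa [Polynomial.degree_X_pow]),
      Polynomial.degree_X_pow])
  have hsp : G.Splits := IsAlgClosed.splits G
  obtain ⟨c, hc⟩ := Multiset.exists_map_univ_eq (ι := ι) (s := G.roots) (by
    rw [← hsp.natDegree_eq_card_roots, hdeg, hg])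
  refine ⟨c, fun l => ?_⟩
  have h1 : (∏ i, (Polynomial.X - Polynomial.C (c i))) = G := by
    rw [hsp.eq_prod_roots_of_monic hm, ← hc, Multiset.map_map]
    rfl
  rw [h1, hG, Polynomial.coeff_add, Polynomial.coeff_X_pow, if_neg l.2.ne, zero_add,
    Polynomial.finsetSum_coeff]
  simp only [Polynomial.coeff_C_mul, Polynomial.coeff_X_pow, Fin.val_inj]
  simp

theorem exists_symmForm_ne_zero {ι : Type*} [Fintype ι] {g m : ℕ} (hg : g = Fintype.card ι)
    {q : (Fin g → Fin m) → ℂ} (hq : q ≠ 0) : ∃ c : ι → ℂ, symmForm q c ≠ 0 := by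
  by_contra! h
  set F : MvPolynomial (Fin g) ℂ :=
    ∑ α, MvPolynomial.monomial (Finsupp.equivFunOnFinite.symm fun l => (α l : ℕ)) (q α) with hF
  have hF0 : F = 0 := MvPolynomial.funext fun u => by
    obtain ⟨c, hc⟩ := exists_coeff_prod_X_sub_C_eq hg u
    have := h c
    simp only [symmForm, hc] at this
    rw [map_zero, ← this, hF, map_sum]
    refine Finset.sum_congr rfl fun α _ => ?_
    rw [MvPolynomial.eval_monomial, Finsupp.prod_fintype _ _ fun _ => pow_zero _]
    rfl
  refine hq (funext fun α => ?_)
  have h1 := congrArg (MvPolynomial.coeff (Finsupp.equivFunOnFinite.symm fun l => (α l : ℕ))) hF0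
  rw [hF, MvPolynomial.coeff_sum, Finset.sum_eq_single α] at h1
  · simpa using h1
  · intro β _ hβ
    rw [MvPolynomial.coeff_monomial, if_neg]
    intro h2
    refine hβ (funext fun l => Fin.ext ?_)
    exact congrFun (Finsupp.equivFunOnFinite.symm.injective h2) l
  · simp

theorem exists_symmForm_ne_zero_near {ι : Type*} [Fintype ι] {g m : ℕ} (hg : g = Fintype.card ι)
    {q : (Fin g → Fin m) → ℂ} (hq : q ≠ 0) {r : ℝ} (hr : 0 < r) :
    ∀ c₀ : ι → ℂ, ∃ z : ι → ℂ, (∀ i, ‖z i‖ ≤ r) ∧ symmForm q (fun i => c₀ i + z i) ≠ 0 := by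
  intro c₀
  obtain ⟨c, hc⟩ := exists_symmForm_ne_zero hg hq
  set G : ℂ[X] := symmForm (fun α => Polynomial.C (q α)) fun i =>
    Polynomial.C (c₀ i) + Polynomial.X * Polynomial.C (c i - c₀ i) with hG
  have heval : ∀ s : ℂ, G.eval s = symmForm q fun i => c₀ i + s * (c i - c₀ i) := fun s => by
    rw [hG, ← Polynomial.coe_evalRingHom, map_symmForm]
    simp
  have hG0 : G ≠ 0 := fun h => hc (by
    have := heval 1
    simpa [h] using this.symm)
  have hsmall : ∀ᶠ s : ℂ in 𝓝 0, ∀ i, ‖s * (c i - c₀ i)‖ ≤ r := eventually_all.2 fun i => by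
    have h1 : Tendsto (fun s : ℂ => ‖s * (c i - c₀ i)‖) (𝓝 0) (𝓝 0) := by
      have : Continuous fun s : ℂ => ‖s * (c i - c₀ i)‖ := by fun_prop
      simpa using this.tendsto 0
    exact h1.eventually_le_const hr
  have hinf : {s : ℂ | ∀ i, ‖s * (c i - c₀ i)‖ ≤ r}.Infinite := infinite_of_mem_nhds 0 hsmall
  obtain ⟨s, hs, hs'⟩ := (hinf.sdiff G.roots.toFinset.finite_toSet).nonempty
  refine ⟨fun i => s * (c i - c₀ i), hs, fun h => hs' ?_⟩
  rw [← heval] at h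
  simpa [hG0] using h

theorem exists_relation_of_auxForm_eq_zero {ι : Type*} [Fintype ι] [DecidableEq ι] {k g m : ℕ}
    (hg : g = Fintype.card ι) {p : Fin k → (Fin g → Fin m) → ℂ} (hp : p ≠ 0) {r : ℝ} (hr : 0 < r)
    {τ : ι → ℂ} {y : ι → ℂ → ℂ} (hy : ∀ i z, ‖z‖ ≤ r → y i (τ i + z) ≠ 0)
    (h : ∀ z : ι → ℂ, (∀ i, ‖z i‖ ≤ r) →
      auxForm p (fun i => τ i + z i) (∏ i, y i (τ i + z i)) = 0) (i₀ : ι) :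
    ∃ (Q : Fin k → ℂ[X]) (K : ℂ), Q ≠ 0 ∧ K ≠ 0 ∧ ∀ z : ℂ, ‖z‖ ≤ r →
      ∑ b, (Q b).eval (τ i₀ + z) * (K * y i₀ (τ i₀ + z)) ^ (b : ℕ) = 0 := by
  obtain ⟨b, hb⟩ := Function.ne_iff.1 hp
  obtain ⟨z, hz, hzb⟩ := exists_symmForm_ne_zero_near hg hb hr τ
  have hup : ∀ t : ℂ, (fun i => Polynomial.eval t (Function.update
      (fun i => Polynomial.C (τ i + z i)) i₀ Polynomial.X i)) =
      Function.update (fun i => τ i + z i) i₀ t := fun t => by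
    ext i
    rcases eq_or_ne i i₀ with rfl | hi
    · simp
    · simp [hi]
  have heval : ∀ b (t : ℂ), (symmForm (fun α => Polynomial.C (p b α)) (Function.update
      (fun i => Polynomial.C (τ i + z i)) i₀ Polynomial.X)).eval t =
      symmForm (p b) (Function.update (fun i => τ i + z i) i₀ t) := fun b t => by
    rw [← Polynomial.coe_evalRingHom, map_symmForm]
    simp only [Polynomial.coe_evalRingHom, Polynomial.eval_C, hup]
  refine ⟨fun b => symmForm (fun α => Polynomial.C (p b α)) (Function.update
    (fun i => Polynomial.C (τ i + z i)) i₀ Polynomial.X),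
    ∏ i ∈ Finset.univ.erase i₀, y i (τ i + z i), fun h0 => hzb ?_,
    Finset.prod_ne_zero_iff.2 fun i _ => hy i _ (hz i), fun s hs => ?_⟩
  · have h1 := heval b (τ i₀ + z i₀)
    rw [congrFun h0 b, Pi.zero_apply, Polynomial.eval_zero,
      Function.update_eq_self i₀ fun i => τ i + z i] at h1
    exact h1.symm
  · have h1 := h (Function.update z i₀ s) fun i => by
      rcases eq_or_ne i i₀ with rfl | hi
      · simpa using hs
      · simpa [hi] using hz i
    rw [auxForm_eq_sum_symmForm] at h1
    rw [← h1]
    have h2 : (fun i => τ i + Function.update z i₀ s i) =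
        Function.update (fun i => τ i + z i) i₀ (τ i₀ + s) := by
      ext i
      rcases eq_or_ne i i₀ with rfl | hi
      · simp
      · simp [hi]
    have h3 : ∏ i, y i (τ i + Function.update z i₀ s i) =
        (∏ i ∈ Finset.univ.erase i₀, y i (τ i + z i)) * y i₀ (τ i₀ + s) := by
      rw [← Finset.prod_erase_mul _ _ (Finset.mem_univ i₀), Function.update_self]
      congr 1
      refine Finset.prod_congr rfl fun i hi => ?_
      rw [Function.update_of_ne (Finset.ne_of_mem_erase hi)]
    rw [h2, h3]
    simp only [heval]

end Specialization

section Convergent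

open scoped Polynomial Topology NNReal
open Filter Metric

variable {r : ℝ≥0}

theorem uniSeries_unit {A : Type*} [Semiring A] (F : A⟦X⟧) :
    MvPowerSeries.uniSeries () (fun n => PowerSeries.coeff n F) = F := by
  ext n
  exact MvPowerSeries.coeff_uniSeries_single () _ n

/-- Power series over `ℂ` converging absolutely on the closed disc of radius `r`. -/
noncomputable def PowerSeries.discSubring (r : ℝ≥0) : Subring ℂ⟦X⟧ :=
  MvPowerSeries.convSubring Unit r

theorem PowerSeries.mem_discSubring_of_summable {F : ℂ⟦X⟧}
    (hF : Summable fun n => ‖coeff n F‖ * (r : ℝ) ^ n) : F ∈ discSubring r := by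
  rw [← uniSeries_unit F]
  exact MvPowerSeries.uniSeries_mem_convSubring () hF

theorem PowerSeries.summable_of_mem_discSubring {F : ℂ⟦X⟧} (hF : F ∈ discSubring r) :
    Summable fun n => ‖coeff n F‖ * (r : ℝ) ^ n := by
  have h1 := (MvPowerSeries.summable_of_mem_convSubring hF).comp_injective
    (Finsupp.single_injective ())
  simp only [Function.comp_def, Finsupp.degree_single] at h1
  exact h1

/-- The value at a point of the disc of an absolutely convergent power series. -/
noncomputable def PowerSeries.discEval {z : ℂ} (hz : ‖z‖ ≤ r) : discSubring r →+* ℂ :=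
  MvPowerSeries.evalConv (ι := Unit) (z := fun _ => z) fun _ => hz

theorem PowerSeries.discEval_apply {z : ℂ} (hz : ‖z‖ ≤ r) (F : discSubring r) :
    discEval hz F = ∑' n, coeff n F.1 * z ^ n := by
  have h1 : F = ⟨MvPowerSeries.uniSeries () fun n => coeff n F.1,
    (uniSeries_unit F.1).symm ▸ F.2⟩ := Subtype.ext (uniSeries_unit F.1).symm
  conv_lhs => rw [h1]
  exact MvPowerSeries.evalConv_uniSeries (fun _ => hz) () _

theorem PowerSeries.hasSum_discEval {z : ℂ} (hz : ‖z‖ ≤ r) (F : discSubring r) :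
    HasSum (fun n => coeff n F.1 * z ^ n) (discEval hz F) := by
  rw [discEval_apply]
  refine Summable.hasSum (Summable.of_norm ?_)
  refine (summable_of_mem_discSubring F.2).of_nonneg_of_le (fun _ => norm_nonneg _) fun n => ?_
  rw [norm_mul, norm_pow]
  gcongr

theorem PowerSeries.coe_mem_discSubring (q : ℂ[X]) : (q : ℂ⟦X⟧) ∈ discSubring r := by
  refine mem_discSubring_of_summable (summable_of_hasFiniteSupport ?_)
  refine q.support.finite_toSet.subset fun n hn => ?_
  rw [Function.mem_support, Polynomial.coeff_coe] at hn
  exact Polynomial.mem_support_iff.2 fun h => hn (by rw [h, norm_zero, zero_mul])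

theorem PowerSeries.discEval_coe {z : ℂ} (hz : ‖z‖ ≤ r) (q : ℂ[X]) :
    discEval hz ⟨q, coe_mem_discSubring q⟩ = q.eval z := by
  rw [discEval_apply, tsum_eq_sum (s := q.support), Polynomial.eval_eq_sum, Polynomial.sum]
  · simp only [Polynomial.coeff_coe]
  · intro n hn
    rw [Polynomial.coeff_coe, Polynomial.notMem_support_iff.1 hn, zero_mul]

theorem PowerSeries.hasFPowerSeriesAt_of_hasSum {F : ℂ⟦X⟧} {g : ℂ → ℂ} (hr : 0 < r)
    (h : ∀ z : ℂ, ‖z‖ < r → HasSum (fun n => coeff n F * z ^ n) (g z)) :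
    HasFPowerSeriesAt g (FormalMultilinearSeries.ofScalars ℂ fun n => coeff n F) 0 := by
  rw [hasFPowerSeriesAt_iff]
  filter_upwards [ball_mem_nhds (0 : ℂ) (NNReal.coe_pos.2 hr)] with z hz
  have := h z (mem_ball_zero_iff.1 hz)
  simpa only [FormalMultilinearSeries.coeff_ofScalars, smul_eq_mul, mul_comm, zero_add] using this

theorem PowerSeries.eq_zero_of_discEval_eq_zero (hr : 0 < r) (F : discSubring r)
    (h : ∀ z (hz : ‖z‖ ≤ r), ‖z‖ < r → discEval hz F = 0) : F = 0 := by
  have h1 : HasFPowerSeriesAt (0 : ℂ → ℂ) _ 0 :=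
    hasFPowerSeriesAt_of_hasSum (F := F.1) hr fun z hz => by
      have h1 := hasSum_discEval hz.le F
      rwa [h z hz.le hz] at h1
  have h2 := h1.eq_zero
  ext n
  have h3 := congrArg (fun p => p.coeff n) h2
  simp only [FormalMultilinearSeries.coeff_ofScalars] at h3
  rw [h3]
  rfl

theorem PowerSeries.hasDerivAt_tsum {F : ℂ⟦X⟧} (hr : 0 < r) (hF : F ∈ discSubring r)
    (hF' : PowerSeries.derivative ℂ F ∈ discSubring r) {z : ℂ} (hz : ‖z‖ < r) :
    HasDerivAt (fun s => ∑' n, coeff n F * s ^ n)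
      (∑' n, coeff n (PowerSeries.derivative ℂ F) * z ^ n) z := by
  have hs := summable_of_mem_discSubring hF'
  have hcoe : ∀ n, coeff n (PowerSeries.derivative ℂ F) = coeff (n + 1) F * ((n + 1 : ℕ) : ℂ) := by
    intro n
    rw [PowerSeries.coeff_derivative, Nat.cast_add_one]
  have hu : Summable fun n => ‖coeff n F * (n : ℂ)‖ * (r : ℝ) ^ (n - 1) := by
    rw [← summable_nat_add_iff 1]
    simpa only [hcoe, Nat.add_sub_cancel] using hs
  have h1 := hasDerivAt_tsum_of_isPreconnected (g := fun n s => coeff n F * s ^ n)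
    (g' := fun n s => coeff n F * ((n : ℂ) * s ^ (n - 1))) hu (isOpen_ball (α := ℂ) (x := 0) (ε :=
    r))
    (convex_ball _ _).isPreconnected (fun n s _ => (hasDerivAt_pow n s).const_mul _)
    (fun n s hs => by
      rw [← mul_assoc, norm_mul _ (s ^ _), norm_pow]
      have := (mem_ball_zero_iff.1 hs).le
      gcongr)
    (mem_ball_self (NNReal.coe_pos.2 hr))
    (hasSum_discEval (r := r) (z := 0) (by simp) ⟨F, hF⟩).summable (mem_ball_zero_iff.2 hz)
  refine h1.congr_deriv ?_
  have h2 : Summable fun n => coeff n F * ((n : ℂ) * z ^ (n - 1)) := by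
    refine Summable.of_norm (hu.of_nonneg_of_le (fun _ => norm_nonneg _) fun n => ?_)
    rw [← mul_assoc, norm_mul _ (z ^ _), norm_pow]
    gcongr
  rw [h2.tsum_eq_zero_add]
  simp only [hcoe, Nat.cast_zero, zero_mul, mul_zero, zero_add, Nat.add_sub_cancel, mul_assoc]

theorem PowerSeries.exists_mem_discSubring {F : ℚ⟦X⟧} (hF : F ∈ growthSubring) :
    ∃ r : ℝ≥0, 0 < r ∧ ∀ s ≤ r, PowerSeries.map (Rat.castHom ℂ) F ∈ discSubring s := by
  obtain ⟨r, hr, A, hA⟩ := mem_growthSubring.1 hF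
  refine ⟨⟨r, hr.le⟩, hr, fun s hs => mem_discSubring_of_summable ?_⟩
  have h1 : Summable fun n => |((coeff n F : ℚ) : ℝ)| * r ^ n :=
    summable_of_sum_range_le (c := A) (fun n => by positivity) fun n => hA n
  refine h1.of_nonneg_of_le (fun _ => by positivity) fun n => ?_
  rw [PowerSeries.coeff_map, eq_ratCast, Complex.norm_ratCast]
  exact mul_le_mul le_rfl (pow_le_pow_left₀ s.2 hs n) (by positivity) (by positivity)

end Convergent

section Convergent

open scoped Polynomial Topology NNReal
open Filter Metric

theorem PowerSeries.map_derivative {A B : Type*} [CommRing A] [CommRing B] (φ : A →+* B)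
    (F : A⟦X⟧) : PowerSeries.map φ (PowerSeries.derivative A F) =
      PowerSeries.derivative B (PowerSeries.map φ F) := by
  ext n
  simp [PowerSeries.coeff_derivative]

theorem map_intPolyToPS (q : ℤ[X]) : PowerSeries.map (Rat.castHom ℂ) (intPolyToPS q) =
    ((q.map (Int.castRingHom ℂ) : ℂ[X]) : ℂ⟦X⟧) := by
  rw [intPolyToPS_eq]
  ext n
  simp

/-- The complex analytic functions defined by a solution of `y' = f y` and by `f`. -/
theorem exists_convergent_solution {f y : ℚ⟦X⟧} (hf : f ∈ growthSubring)
    (hy : y ∈ growthSubring) (hyf : PowerSeries.derivative ℚ y = f * y) {q : ℤ[X]} {P : ℤ[X][X]}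
    (hP : P.eval₂ intPolyToPS (intPolyToPS q * f) = 0) :
    ∃ r : ℝ≥0, 0 < r ∧ ∃ hr : PowerSeries.map (Rat.castHom ℂ) y ∈ discSubring r, ∃ F Y : ℂ → ℂ,
      (∀ z (hz : ‖z‖ ≤ r), discEval hz ⟨_, hr⟩ = Y z) ∧
      ∀ z, ‖z‖ < r → ContinuousAt F z ∧ HasDerivAt Y (F z * Y z) z ∧
        evalPoint z (q.eval₂ (Int.castRingHom ℂ) z * F z) P = 0 := by
  obtain ⟨r₁, hr₁, h₁⟩ := exists_mem_discSubring hf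
  obtain ⟨r₂, hr₂, h₂⟩ := exists_mem_discSubring hy
  set r := min r₁ r₂ with hr
  have hr0 : 0 < r := lt_min hr₁ hr₂
  have hfr := h₁ r (min_le_left _ _)
  have hyr := h₂ r (min_le_right _ _)
  have hd : PowerSeries.derivative ℂ (PowerSeries.map (Rat.castHom ℂ) y) =
      PowerSeries.map (Rat.castHom ℂ) f * PowerSeries.map (Rat.castHom ℂ) y := by
    rw [← PowerSeries.map_derivative, hyf, map_mul]
  refine ⟨r, hr0, hyr, fun z => ∑' n, coeff n (PowerSeries.map (Rat.castHom ℂ) f) * z ^ n,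
    fun z => ∑' n, coeff n (PowerSeries.map (Rat.castHom ℂ) y) * z ^ n,
    fun z hz => discEval_apply hz _, fun z hz => ⟨?_, ?_, ?_⟩⟩
  · have h1 : ContinuousOn (fun z : ℂ => ∑' n, coeff n (PowerSeries.map (Rat.castHom ℂ) f) * z ^ n)
        (ball 0 r) := by
      refine continuousOn_tsum (fun n => by fun_prop) (summable_of_mem_discSubring hfr)
        fun n s hs => ?_
      rw [norm_mul, norm_pow]
      have := (mem_ball_zero_iff.1 hs).le
      gcongr
    exact h1.continuousAt (isOpen_ball.mem_nhds (mem_ball_zero_iff.2 hz))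
  · refine (hasDerivAt_tsum hr0 hyr (hd ▸ mul_mem hfr hyr) hz).congr_deriv ?_
    rw [hd]
    have h1 := map_mul (discEval hz.le) ⟨_, hfr⟩ ⟨_, hyr⟩
    simp only [discEval_apply] at h1
    exact h1
  · have hcod : ∀ a : ℤ[X], (PowerSeries.map (Rat.castHom ℂ)).comp intPolyToPS a ∈
        discSubring r := fun a => by
      rw [RingHom.comp_apply, map_intPolyToPS]
      exact coe_mem_discSubring _
    let φ : ℤ[X] →+* discSubring r :=
      ((PowerSeries.map (Rat.castHom ℂ)).comp intPolyToPS).codRestrict _ hcod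
    have hφ : (discEval hz.le).comp φ = Polynomial.eval₂RingHom (Int.castRingHom ℂ) z := by
      ext a
      · simp
      · have : φ Polynomial.X = ⟨((Polynomial.X.map (Int.castRingHom ℂ) : ℂ[X]) : ℂ⟦X⟧),
          coe_mem_discSubring _⟩ := Subtype.ext (map_intPolyToPS _)
        rw [RingHom.comp_apply, this, discEval_coe]
        simp
    have h1 : P.eval₂ φ (φ q * ⟨_, hfr⟩) = 0 := by
      apply Subtype.val_injective
      change (discSubring r).subtype _ = 0
      rw [Polynomial.hom_eval₂, map_mul]
      have h2 := congrArg (PowerSeries.map (Rat.castHom ℂ)) hP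
      rw [Polynomial.hom_eval₂, map_zero, map_mul] at h2
      exact h2
    have h2 := congrArg (discEval hz.le) h1
    rw [Polynomial.hom_eval₂, map_zero, hφ, map_mul, ← RingHom.comp_apply, hφ, discEval_apply] at h2
    exact h2

end Convergent

section Descent

open scoped Polynomial Topology NNReal
open Filter Metric

/-- A power series over `ℚ` which is algebraic over `ℂ(t)` is algebraic over `ℚ(t)`. -/
theorem isAlgebraicPS_of_complex {y : ℚ⟦X⟧} {k : ℕ} {Q : Fin k → ℂ[X]} (hQ : Q ≠ 0)
    (h : ∑ b, (Q b : ℂ⟦X⟧) * PowerSeries.map (Rat.castHom ℂ) y ^ (b : ℕ) = 0) :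
    IsAlgebraicPS y := by
  obtain ⟨b₀, hb₀⟩ := Function.ne_iff.1 hQ
  obtain ⟨n₀, hn₀⟩ : ∃ n, (Q b₀).coeff n ≠ 0 := by
    by_contra! h
    exact hb₀ (Polynomial.ext fun n => by simp [h n])
  obtain ⟨φ, hφ⟩ := Module.Projective.exists_dual_ne_zero ℚ hn₀
  let R : Fin k → ℚ[X] := fun b =>
    ∑ n ∈ (Q b).support, Polynomial.monomial n (φ ((Q b).coeff n))
  have hR : ∀ b n, (R b).coeff n = φ ((Q b).coeff n) := fun b n => by
    simp only [R, Polynomial.finsetSum_coeff, Polynomial.coeff_monomial, Finset.sum_ite_eq',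
      Polynomial.mem_support_iff]
    split_ifs with h0
    · rfl
    · rw [not_not.1 h0, map_zero]
  clear_value R
  refine ⟨∑ b, Polynomial.C (R b) * Polynomial.X ^ (b : ℕ), fun h0 => hφ ?_, ?_⟩
  · have h1 := congrArg (Polynomial.coeff · (b₀ : ℕ)) h0
    simp only [Polynomial.finsetSum_coeff, Polynomial.coeff_C_mul, Polynomial.coeff_X_pow,
      Fin.val_inj, mul_ite, mul_one, mul_zero, Finset.sum_ite_eq, Finset.mem_univ, if_true,
      Polynomial.coeff_zero] at h1
    rw [← hR, h1, Polynomial.coeff_zero]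
  · ext N
    have h1 := congrArg (fun s : ℂ⟦X⟧ => φ (coeff N s)) h
    rw [map_sum (coeff N), map_sum φ, map_zero, map_zero] at h1
    rw [Polynomial.eval₂_finsetSum, map_sum (coeff N), map_zero (coeff N), ← h1]
    refine Finset.sum_congr rfl fun b _ => ?_
    rw [Polynomial.eval₂_mul, Polynomial.eval₂_C, Polynomial.eval₂_X_pow, ← map_pow,
      PowerSeries.coeff_mul, PowerSeries.coeff_mul, map_sum φ]
    refine Finset.sum_congr rfl fun x _ => ?_
    rw [Polynomial.coeToPowerSeries.ringHom_apply, Polynomial.coeff_coe, Polynomial.coeff_coe, hR,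
      coeff_map, Rat.coe_castHom, mul_comm ((Q b).coeff _), ← Rat.smul_def, map_smul, smul_eq_mul,
      mul_comm]

/-- Near a point of its disc, a convergent solution is proportional to a branch solution. -/
theorem exists_branch_eq {ε δ : ℕ} (D : BranchData ε δ) {a : ℤ[X]} {P : ℤ[X][X]}
    (hDa : D.a = a.map (Int.castRingHom ℂ))
    (hDP : D.P = P.map (Polynomial.mapRingHom (Int.castRingHom ℂ)))
    {F Y : ℂ → ℂ} {j : Fin ε} (h : ∀ᶠ z in 𝓝 (D.τ j), ContinuousAt F z ∧
      HasDerivAt Y (F z * Y z) z ∧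
      evalPoint z (a.eval₂ (Int.castRingHom ℂ) z * F z) P = 0) :
    ∃ κ, ∃ c : ℂ, ∀ᶠ z in 𝓝 (D.τ j), Y z = c * D.y j κ z := by
  set w : ℂ → ℂ := fun z => a.eval₂ (Int.castRingHom ℂ) z * F z with hw
  have hball : ∀ᶠ z in 𝓝 (D.τ j), z ∈ ball (D.τ j) D.R := ball_mem_nhds _ D.R_pos
  have hroot : ∀ᶠ z in 𝓝 (D.τ j), ∃ κ, w z = D.w j κ z := by
    filter_upwards [h, hball] with z hz hzb
    set G : ℂ[X] := D.P.map (Polynomial.evalRingHom z) with hG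
    have hm : G.Monic := D.monic.map _
    have hroots : Finset.univ.image (fun κ => D.w j κ z) = G.roots.toFinset := by
      refine Finset.eq_of_subset_of_card_le (fun x hx => ?_) ?_
      · obtain ⟨κ, -, rfl⟩ := Finset.mem_image.1 hx
        rw [Multiset.mem_toFinset, Polynomial.mem_roots hm.ne_zero, Polynomial.IsRoot, hG,
          Polynomial.eval_map]
        exact D.root j z hzb κ
      · rw [Finset.card_image_of_injective _ (D.w_injective j z hzb), Finset.card_univ,
          Fintype.card_fin, ← D.natDegree_eq, ← D.monic.natDegree_map (Polynomial.evalRingHom z)]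
        exact (Multiset.toFinset_card_le _).trans (Polynomial.card_roots' _)
    have hz' : w z ∈ G.roots.toFinset := by
      rw [Multiset.mem_toFinset, Polynomial.mem_roots hm.ne_zero, Polynomial.IsRoot, hG,
        Polynomial.eval_map, hDP, eval₂_evalRingHom_map]
      exact hz.2.2
    rw [← hroots] at hz'
    obtain ⟨κ, -, hκ⟩ := Finset.mem_image.1 hz'
    exact ⟨κ, hκ.symm⟩
  obtain ⟨κ, hκ⟩ := hroot.self_of_nhds
  have hwc : ContinuousAt w (D.τ j) := by
    refine ContinuousAt.mul ?_ h.self_of_nhds.1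
    simp only [← Polynomial.eval_map]
    exact (Polynomial.continuous _).continuousAt
  have heq : ∀ᶠ z in 𝓝 (D.τ j), w z = D.w j κ z := by
    have hne : ∀ᶠ z in 𝓝 (D.τ j), ∀ κ', κ' ≠ κ → w z - D.w j κ' z ≠ 0 := by
      refine eventually_all.2 fun κ' => ?_
      by_cases hκ' : κ' = κ
      · exact Eventually.of_forall fun z h => (h hκ').elim
      · have h1 : w (D.τ j) - D.w j κ' (D.τ j) ≠ 0 := by
          rw [hκ]
          exact sub_ne_zero.2 fun h =>
            hκ' (D.w_injective j _ (mem_ball_self D.R_pos) h).symm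
        filter_upwards [(hwc.sub (D.differentiableAt_w j κ' _
          (mem_ball_self D.R_pos)).continuousAt).eventually_ne h1] with z hz _ using hz
    filter_upwards [hroot, hne] with z hz hz'
    obtain ⟨κ', hκ''⟩ := hz
    rcases eq_or_ne κ' κ with rfl | hκ'
    · exact hκ''
    · exact (hz' κ' hκ' (sub_eq_zero.2 hκ'')).elim
  obtain ⟨R, hR, hR'⟩ := Metric.eventually_nhds_iff_ball.1 (h.and (hball.and heq))
  have hderiv : ∀ z ∈ ball (D.τ j) R, HasDerivAt (fun z => Y z / D.y j κ z) 0 z := fun z hz => by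
    obtain ⟨⟨-, hY, -⟩, hzb, hwz⟩ := hR' z hz
    have hy0 := D.y_ne_zero j κ z hzb
    have ha0 := D.a_ne_zero j z hzb
    refine (hY.fun_div (D.hasDerivAt_y j κ z hzb) hy0).congr_deriv ?_
    rw [← hwz, hw]
    simp only
    rw [← Polynomial.eval_map, ← hDa]
    field_simp
    ring
  refine ⟨κ, Y (D.τ j) / D.y j κ (D.τ j), ?_⟩
  filter_upwards [ball_mem_nhds _ hR] with z hz
  have h1 := isOpen_ball.is_const_of_deriv_eq_zero (convex_ball _ _).isPreconnected
    (fun z hz => (hderiv z hz).differentiableAt.differentiableWithinAt)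
    (fun z hz => (hderiv z hz).deriv) (mem_ball_self hR) hz
  rw [h1, div_mul_cancel₀ _ (D.y_ne_zero j κ z (hR' z hz).2.1)]

end Descent

section MainTheorem

open scoped Polynomial Topology NNReal
open Filter Metric

theorem MemNPZp.memPZp {n p : ℕ} {x : ℚ} (h : MemNPZp n p x) : MemPZp p x := by
  obtain ⟨y, hy, rfl⟩ := h
  refine ⟨n * y, fun h => hy ?_, by ring⟩
  have h1 := h.trans (Rat.mul_den_dvd n y)
  rwa [Rat.den_natCast, one_mul] at h1

/-- If `a_{np} - a_n ∈ p ℤ_(p)` for almost all primes `p`, then the solutions of `y' = f y` are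
algebraic. -/
theorem isAlgebraicPS_of_memPZp {a : ℕ → ℚ} {f y : ℚ⟦X⟧}
    (hf : f = PowerSeries.mk fun k => a (k + 1)) (halg : IsAlgebraicPS f)
    (hb : ∃ B : ℕ, ∀ p : ℕ, p.Prime → B ≤ p → ∀ n : ℕ, 1 ≤ n → MemPZp p (a (n * p) - a n))
    (hyf : PowerSeries.derivative ℚ y = f * y) : IsAlgebraicPS y := by
  rcases eq_or_ne y 0 with rfl | hy0
  · exact ⟨Polynomial.X, Polynomial.X_ne_zero, Polynomial.eval₂_X _ _⟩
  have hfg := growthSubring_isFixClosed.mem_of_isAlgebraicPS halg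
  obtain ⟨q, hq0, hq⟩ := halg.exists_isIntegral
  set P := minpoly ℤ[X] (intPolyToPS q * f) with hP
  have hPm : P.Monic := minpoly.monic hq
  have hP0 : P.eval₂ intPolyToPS (intPolyToPS q * f) = 0 := minpoly.aeval _ _
  obtain ⟨U, V, d, hd, hbez⟩ := hPm.exists_bezout (minpoly.irreducible hq)
  obtain ⟨r₀, hr₀, hyr, F, Y, hYe, hFY⟩ :=
    exists_convergent_solution hfg (mem_growthSubring_of_derivative hfg hyf) hyf hP0
  obtain ⟨ε, D, r, k, m, p, hr, hrR, hDa, hDP, hτ, hp, haux⟩ :=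
    exists_auxForm_eq_zero hPm rfl (minpoly.natDegree_pos hq) hq0 hd hbez
      (exists_dvd_connNum_modByMonic hf halg hb hq) (NNReal.coe_pos.2 hr₀)
  have hε := D.two_le_ε
  set j : Fin ε := ⟨0, by omega⟩ with hj
  have hτj : D.τ j ∈ ball (0 : ℂ) r₀ := mem_ball_zero_iff.2 (hτ j)
  have hball : ∀ᶠ z in 𝓝 (D.τ j), z ∈ ball (0 : ℂ) r₀ := isOpen_ball.mem_nhds hτj
  have hYd : AnalyticOnNhd ℂ Y (ball 0 r₀) := DifferentiableOn.analyticOnNhd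
    (fun z hz => (hFY z (mem_ball_zero_iff.1 hz)).2.1.differentiableAt.differentiableWithinAt)
    isOpen_ball
  obtain ⟨κ, c, hc⟩ := exists_branch_eq D hDa hDP
    (hball.mono fun z hz => hFY z (mem_ball_zero_iff.1 hz))
  have hc0 : c ≠ 0 := by
    rintro rfl
    have h1 := hYd.eqOn_zero_of_preconnected_of_eventuallyEq_zero
      (convex_ball _ _).isPreconnected hτj (hc.mono fun z hz => by simpa using hz)
    have h2 := eq_zero_of_discEval_eq_zero hr₀ ⟨_, hyr⟩ fun z hz hz' =>
      (hYe z hz).trans (h1 (mem_ball_zero_iff.2 hz'))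
    refine hy0 (PowerSeries.map_injective (Rat.castHom ℂ) Rat.cast_injective ?_)
    rw [map_zero]
    exact congrArg Subtype.val h2
  obtain ⟨Q, K, hQ, hK, hrel⟩ := exists_relation_of_auxForm_eq_zero
    (τ := fun i : Fin ε × Fin P.natDegree => D.τ i.1) (y := fun i => D.y i.1 i.2)
    (by simp) hp (NNReal.coe_pos.2 hr)
    (fun i z hz => D.y_ne_zero _ _ _ (by
      rw [mem_ball, dist_eq_norm, add_sub_cancel_left]
      exact hz.trans_lt hrR)) haux (j, κ)
  have hs : K * c⁻¹ ≠ 0 := mul_ne_zero hK (inv_ne_zero hc0)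
  set s := K * c⁻¹ with hsdef
  refine isAlgebraicPS_of_complex (Q := fun b => Polynomial.C (s ^ (b : ℕ)) * Q b) (fun h => hQ ?_)
    ?_
  · funext b
    exact (mul_eq_zero.1 (congrFun h b)).resolve_left
      (Polynomial.C_ne_zero.2 (pow_ne_zero _ hs))
  · have hnear : ∀ᶠ z in 𝓝 (D.τ j), ∑ b : Fin k, (Polynomial.C (s ^ (b : ℕ)) * Q b).eval z *
        Y z ^ (b : ℕ) = 0 := by
      filter_upwards [hc, ball_mem_nhds _ (NNReal.coe_pos.2 hr)] with z hz hzr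
      rw [mem_ball, dist_eq_norm] at hzr
      have h1 := hrel (z - D.τ j) hzr.le
      simp only [add_sub_cancel] at h1
      rw [← h1]
      refine Finset.sum_congr rfl fun b _ => ?_
      rw [hz, Polynomial.eval_mul, Polynomial.eval_C, mul_right_comm, ← mul_pow, mul_comm, hsdef]
      congr 2
      field_simp
    have han : AnalyticOnNhd ℂ (fun z => ∑ b : Fin k, (Polynomial.C (s ^ (b : ℕ)) * Q b).eval z *
        Y z ^ (b : ℕ)) (ball 0 r₀) :=
      Finset.analyticOnNhd_fun_sum _ fun b _ =>
        AnalyticOnNhd.mul ((AnalyticOnNhd.eval_polynomial _).mono (Set.subset_univ _))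
          (hYd.pow _)
    have hzero := han.eqOn_zero_of_preconnected_of_eventuallyEq_zero
      (convex_ball _ _).isPreconnected hτj hnear
    have h3 := eq_zero_of_discEval_eq_zero hr₀
      (∑ b : Fin k, ⟨_, coe_mem_discSubring (Polynomial.C (s ^ (b : ℕ)) * Q b)⟩ *
        ⟨_, hyr⟩ ^ (b : ℕ)) fun z hz hz' => by
      rw [map_sum]
      refine Eq.trans ?_ (hzero (mem_ball_zero_iff.2 hz'))
      refine Finset.sum_congr rfl fun b _ => ?_
      rw [map_mul, map_pow (discEval hz), hYe z hz, discEval_coe hz]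
    have h4 := congrArg (discSubring r₀).subtype h3
    rw [map_sum, map_zero] at h4
    exact h4

/-- **Main theorem.** Let `(a_n)_{n ≥ 1}` be rational numbers with
`f(t) = ∑_{n ≥ 1} a_n t^{n-1}` algebraic over `ℚ(t)`.  The following are equivalent:
(a) every power series solution `y ∈ ℚ[[t]]` of `y' = f y` is algebraic over `ℚ(t)`;
(b) for all but finitely many primes `p`, `a_{np} - a_n ∈ p ℤ_(p)` for all `n ≥ 1`;
(c) for all but finitely many primes `p`, `a_{np} - a_n ∈ n p ℤ_(p)` for all `n ≥ 1`. -/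
theorem algebraic_solutions_tfae
    (a : ℕ → ℚ) (f : PowerSeries ℚ)
    (hf : f = PowerSeries.mk fun k => a (k + 1))
    (halg : IsAlgebraicPS f) :
    ((∀ y : PowerSeries ℚ, PowerSeries.derivative ℚ y = f * y → IsAlgebraicPS y) ↔
      (∃ B : ℕ, ∀ p : ℕ, p.Prime → B ≤ p →
        ∀ n : ℕ, 1 ≤ n → MemPZp p (a (n * p) - a n))) ∧
    ((∃ B : ℕ, ∀ p : ℕ, p.Prime → B ≤ p →
        ∀ n : ℕ, 1 ≤ n → MemPZp p (a (n * p) - a n)) ↔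
      (∃ B : ℕ, ∀ p : ℕ, p.Prime → B ≤ p →
        ∀ n : ℕ, 1 ≤ n → MemNPZp n p (a (n * p) - a n))) := by
  have hcb : (∃ B : ℕ, ∀ p : ℕ, p.Prime → B ≤ p →
      ∀ n : ℕ, 1 ≤ n → MemNPZp n p (a (n * p) - a n)) →
      ∃ B : ℕ, ∀ p : ℕ, p.Prime → B ≤ p → ∀ n : ℕ, 1 ≤ n → MemPZp p (a (n * p) - a n) :=
    fun ⟨B, hB⟩ => ⟨B, fun p hp hpB n hn => (hB p hp hpB n hn).memPZp⟩
  have hba (hb : ∃ B : ℕ, ∀ p : ℕ, p.Prime → B ≤ p →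
      ∀ n : ℕ, 1 ≤ n → MemPZp p (a (n * p) - a n)) (y : PowerSeries ℚ)
      (hy : PowerSeries.derivative ℚ y = f * y) : IsAlgebraicPS y :=
    isAlgebraicPS_of_memPZp hf halg hb hy
  exact ⟨⟨fun h => hcb (gauss_of_algebraic hf halg h), hba⟩,
    fun hb => gauss_of_algebraic hf halg (hba hb), hcb⟩

end MainTheorem
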